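/- Let S be a boundaryless surface in which every circle is two-sided (this condition is equivalent to orientability for boundaryless surfaces). If S admits a circle decomposition, then S is homeomorphic to the torus Circle × Circle or to the open annulus Circle × ℝ. -/

import Mathlib

open Topology Set

/-- A circle in a topological space `X`: a subset homeomorphic to the unit circle. -/
def IsCircle {X : Type*} [TopologicalSpace X] (C : Set X) : Prop :=
  Nonempty (C ≃ₜ Circle)

/-- A circle decomposition of `X`: a set of pairwise disjoint circles whose union is `X`. -/
def IsCircleDecomposition {X : Type*} [TopologicalSpace X] (𝒞 : Set (Set X)) : Prop :=
  (∀ C ∈ 𝒞, IsCircle C) ∧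
  (∀ C ∈ 𝒞, ∀ D ∈ 𝒞, C ≠ D → Disjoint C D) ∧
  ⋃₀ 𝒞 = Set.univ

/-- A circle `C` in `S` is two-sided if there is an embedding of the annulus
`Circle × [-1,1]` into `S` carrying the middle circle onto `C`. -/
def IsTwoSided {S : Type*} [TopologicalSpace S] (C : Set S) : Prop :=
  ∃ h : Circle × Set.Icc (-1:ℝ) 1 → S, Topology.IsEmbedding h ∧
    h '' {p : Circle × Set.Icc (-1:ℝ) 1 | (p.2 : ℝ) = 0} = C

/-- A `𝒞`-annular neighborhood of a circle `C`: an embedded annulus whose middle circle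
is `C`, whose image is a neighborhood of `C`, and whose two boundary circles belong
to `𝒞`. -/
def HasAnnularNbhd {S : Type*} [TopologicalSpace S] (𝒞 : Set (Set S)) (C : Set S) : Prop :=
  ∃ h : Circle × Set.Icc (-1:ℝ) 1 → S, Topology.IsEmbedding h ∧
    h '' {p : Circle × Set.Icc (-1:ℝ) 1 | (p.2 : ℝ) = 0} = C ∧
    Set.range h ∈ nhdsSet C ∧
    h '' {p : Circle × Set.Icc (-1:ℝ) 1 | (p.2 : ℝ) = -1} ∈ 𝒞 ∧
    h '' {p : Circle × Set.Icc (-1:ℝ) 1 | (p.2 : ℝ) = 1} ∈ 𝒞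

/-- `f` admits a continuous logarithm on `U`. -/
def HasLogOn (U : Set ℂ) (f : ℂ → ℂ) : Prop :=
  ∃ g : ℂ → ℂ, ContinuousOn g U ∧ ∀ z ∈ U, Complex.exp (g z) = f z

namespace HasLogOn

lemma mono {U V : Set ℂ} {f : ℂ → ℂ} (h : HasLogOn U f) (hVU : V ⊆ U) : HasLogOn V f := by
  obtain ⟨g, hg, hgf⟩ := h
  exact ⟨g, hg.mono hVU, fun z hz => hgf z (hVU hz)⟩

lemma congr {U : Set ℂ} {f f' : ℂ → ℂ} (h : HasLogOn U f) (hf : ∀ z ∈ U, f' z = f z) :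
    HasLogOn U f' := by
  obtain ⟨g, hg, hgf⟩ := h
  exact ⟨g, hg, fun z hz => (hgf z hz).trans (hf z hz).symm⟩

lemma mul {U : Set ℂ} {f f' : ℂ → ℂ} (h : HasLogOn U f) (h' : HasLogOn U f') :
    HasLogOn U (fun z => f z * f' z) := by
  obtain ⟨g, hg, hgf⟩ := h
  obtain ⟨g', hg', hgf'⟩ := h'
  exact ⟨fun z => g z + g' z, hg.add hg', fun z hz => by rw [Complex.exp_add, hgf z hz, hgf' z hz]⟩

lemma inv {U : Set ℂ} {f : ℂ → ℂ} (h : HasLogOn U f) : HasLogOn U (fun z => (f z)⁻¹) := by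
  obtain ⟨g, hg, hgf⟩ := h
  exact ⟨fun z => - g z, hg.neg, fun z hz => by rw [Complex.exp_neg, hgf z hz]⟩

lemma const (U : Set ℂ) {c : ℂ} (hc : c ≠ 0) : HasLogOn U (fun _ => c) :=
  ⟨fun _ => Complex.log c, continuousOn_const, fun _ _ => Complex.exp_log hc⟩

/-- The homotopy lifting property for logarithms. -/
lemma of_homotopy {Z : Set ℂ} {H : ℝ × ℂ → ℂ} (hH : ContinuousOn H (Icc 0 1 ×ˢ Z))
    (hne : ∀ t ∈ Icc (0 : ℝ) 1, ∀ z ∈ Z, H (t, z) ≠ 0) (h0 : HasLogOn Z (fun z => H (0, z))) :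
    HasLogOn Z (fun z => H (1, z)) := by
  obtain ⟨g, hg, hgf⟩ := h0
  let K : C(unitInterval × Z, {z : ℂ // z ≠ 0}) :=
    ⟨fun q => ⟨H (q.1, q.2), hne _ q.1.2 _ q.2.2⟩, by
      refine Continuous.subtype_mk ?_ _
      refine hH.comp_continuous (by fun_prop) ?_
      intro q
      exact ⟨q.1.2, q.2.2⟩⟩
  let f : C(Z, ℂ) := ⟨fun z => g z, hg.domRestrict⟩
  have hK0 : ∀ a, K (0, a) = (⟨_, (f a).exp_ne_zero⟩ : {z : ℂ // z ≠ 0}) := by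
    intro a
    apply Subtype.ext
    exact (hgf a a.2).symm
  let L := Complex.isCoveringMap_exp.liftHomotopy K f hK0
  have hL : ∀ q, Complex.exp (L q) = H (q.1, q.2) := fun q =>
    congrArg Subtype.val (congrFun (Complex.isCoveringMap_exp.liftHomotopy_lifts K f hK0) q)
  classical
  refine ⟨fun z => if hz : z ∈ Z then L (1, ⟨z, hz⟩) else 0, ?_, ?_⟩
  · rw [continuousOn_iff_continuous_domRestrict]
    have : Continuous (fun z : Z => L (1, z)) := by fun_prop
    refine this.congr fun z => ?_
    simp
  · intro z hz
    simp only [hz, dif_pos]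
    exact hL (1, ⟨z, hz⟩)

/-- A nowhere vanishing continuous function on the plane has a continuous logarithm. -/
lemma univ {f : ℂ → ℂ} (hf : Continuous f) (hne : ∀ z, f z ≠ 0) : HasLogOn Set.univ f := by
  have := of_homotopy (Z := Set.univ) (H := fun q => f ((q.1 : ℂ) * q.2)) (by fun_prop)
    (fun t _ z _ => hne _) (by simpa using const _ (hne 0))
  simpa using this

/-- Logarithms on two open sets with preconnected intersection glue. -/
lemma glue {U V : Set ℂ} {f : ℂ → ℂ} (hU : IsOpen U) (hV : IsOpen V)
    (hUV : IsPreconnected (U ∩ V)) (hfU : HasLogOn U f) (hfV : HasLogOn V f) :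
    HasLogOn (U ∪ V) f := by
  classical
  obtain ⟨g, hg, hgf⟩ := hfU
  obtain ⟨g', hg', hgf'⟩ := hfV
  obtain ⟨c, hc1, hc⟩ : ∃ c : ℂ, Complex.exp c = 1 ∧ ∀ z ∈ U ∩ V, g z = g' z + c := by
    rcases (U ∩ V).eq_empty_or_nonempty with he | ⟨z₀, hz₀⟩
    · exact ⟨0, by simp, by simp [he]⟩
    refine ⟨g z₀ - g' z₀, ?_, ?_⟩
    · rw [Complex.exp_sub, hgf _ hz₀.1, hgf' _ hz₀.2, div_self]
      rw [← hgf _ hz₀.1]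
      exact Complex.exp_ne_zero _
    intro z hz
    have hcont : ContinuousOn (fun z => (g z - g' z) / (2 * Real.pi * Complex.I)) (U ∩ V) :=
      ((hg.mono inter_subset_left).sub (hg'.mono inter_subset_right)).div_const _
    have hnint : ∀ z ∈ U ∩ V, ∃ n : ℤ, (g z - g' z) / (2 * Real.pi * Complex.I) = n := by
      intro z hz
      have : Complex.exp (g z) = Complex.exp (g' z) := by rw [hgf _ hz.1, hgf' _ hz.2]
      obtain ⟨n, hn⟩ := Complex.exp_eq_exp_iff_exists_int.1 this
      refine ⟨n, ?_⟩
      rw [hn]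
      have : (2 * Real.pi * Complex.I : ℂ) ≠ 0 := Complex.two_pi_I_ne_zero
      field_simp
      ring
    choose! n hn using hnint
    have hncont : ContinuousOn n (U ∩ V) := by
      have : ContinuousOn (fun z => (n z : ℝ)) (U ∩ V) := by
        refine (Complex.continuous_re.comp_continuousOn hcont).congr ?_
        intro z hz
        simp [hn z hz]
      exact (Int.isClosedEmbedding_coe_real.isEmbedding.continuousOn_iff).2 this
    have := hUV.constant hncont hz hz₀
    have h2 := hn z hz
    rw [this, ← hn z₀ hz₀, div_left_inj' Complex.two_pi_I_ne_zero] at h2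
    linear_combination h2
  refine ⟨fun z => if z ∈ U then g z else g' z + c, ?_, ?_⟩
  · have hcU : ∀ z ∈ U, ContinuousAt (fun z => if z ∈ U then g z else g' z + c) z := by
      intro z hz
      refine (hg.continuousAt (hU.mem_nhds hz)).congr ?_
      filter_upwards [hU.mem_nhds hz] with w hw
      simp [hw]
    have hcV : ∀ z ∈ V, ContinuousAt (fun z => if z ∈ U then g z else g' z + c) z := by
      intro z hz
      refine ((hg'.continuousAt (hV.mem_nhds hz)).add_const c).congr ?_
      filter_upwards [hV.mem_nhds hz] with w hw
      by_cases h : w ∈ U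
      · simp [h, hc w ⟨h, hw⟩]
      · simp [h]
    rintro z (hz | hz)
    · exact (hcU z hz).continuousWithinAt
    · exact (hcV z hz).continuousWithinAt
  · rintro z hz
    by_cases h : z ∈ U
    · simp [h, hgf z h]
    · have : z ∈ V := hz.resolve_left h
      simp [h, Complex.exp_add, hc1, hgf' z this]

end HasLogOn

/-- The identity has no continuous logarithm on a circle around its zero. -/
lemma not_hasLogOn_sphere (p c : ℂ) {r : ℝ} (hr : 0 < r) :
    ¬ HasLogOn (Metric.sphere p r) (fun z => c * (z - p)) := by
  rintro ⟨g, hg, hgf⟩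
  have hc : c ≠ 0 := by
    rintro rfl
    have := hgf (p + r) (by simp [abs_of_pos hr])
    simp at this
  let w : ℝ → ℂ := fun t => p + r * Complex.exp (t * Complex.I)
  have hw : ∀ t, w t ∈ Metric.sphere p r := by
    intro t
    simp [w, Complex.norm_exp_ofReal_mul_I, abs_of_pos hr]
  have hwc : Continuous w := by fun_prop
  have hcont : Continuous (fun t : ℝ => (g (w t) - Complex.log (c * r) - t * Complex.I) /
      (2 * Real.pi * Complex.I)) := by
    refine Continuous.div_const ?_ _
    exact ((hg.comp_continuous hwc hw).sub continuous_const).sub (by fun_prop)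
  have hnint : ∀ t : ℝ, ∃ n : ℤ, (g (w t) - Complex.log (c * r) - t * Complex.I) /
      (2 * Real.pi * Complex.I) = n := by
    intro t
    have hcr : c * r ≠ 0 := mul_ne_zero hc (by exact_mod_cast hr.ne')
    have : Complex.exp (g (w t)) = Complex.exp (Complex.log (c * r) + t * Complex.I) := by
      rw [hgf _ (hw t), Complex.exp_add, Complex.exp_log hcr]
      simp [w]
      ring
    obtain ⟨n, hn⟩ := Complex.exp_eq_exp_iff_exists_int.1 this
    refine ⟨n, ?_⟩
    rw [hn]
    have : (2 * Real.pi * Complex.I : ℂ) ≠ 0 := Complex.two_pi_I_ne_zero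
    field_simp
    ring
  choose n hn using hnint
  have hncont : Continuous n := by
    have : Continuous (fun z => (n z : ℝ)) := by
      refine (Complex.continuous_re.comp hcont).congr ?_
      intro z
      simp [hn z]
    exact (Int.isClosedEmbedding_coe_real.isEmbedding.continuous_iff).2 this
  have h1 : n 0 = n (2 * Real.pi) := PreconnectedSpace.constant inferInstance hncont
  have h2 : w (2 * Real.pi) = w 0 := by
    simp [w, Complex.exp_two_pi_mul_I]
  have h3 := hn 0
  rw [h1, ← hn, div_left_inj' Complex.two_pi_I_ne_zero, h2] at h3
  have : (2 * Real.pi * Complex.I : ℂ) = 0 := by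
    push_cast at h3
    linear_combination h3
  exact Complex.two_pi_I_ne_zero this

/-- `(z - b) / (z - a)` has a logarithm off any arc from `a` to `b`. -/
lemma hasLogOn_compl_arc {γ : ℝ → ℂ} (hγ : ContinuousOn γ (Icc 0 1)) :
    HasLogOn (γ '' Icc 0 1)ᶜ (fun z => (z - γ 1) / (z - γ 0)) := by
  have h0 : ∀ z ∈ (γ '' Icc 0 1)ᶜ, ∀ t ∈ Icc (0 : ℝ) 1, z - γ t ≠ 0 := by
    intro z hz t ht h
    exact hz ⟨t, ht, (sub_eq_zero.1 h).symm⟩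
  refine HasLogOn.of_homotopy (H := fun q => (q.2 - γ q.1) / (q.2 - γ 0)) ?_ ?_ ?_
  · refine ContinuousOn.div ?_ (by fun_prop) ?_
    · exact continuousOn_snd.sub (hγ.comp continuousOn_fst fun q hq => hq.1)
    · rintro ⟨t, z⟩ ⟨_, hz⟩
      exact h0 z hz 0 (by simp)
  · intro t ht z hz
    exact div_ne_zero (h0 z hz t ht) (h0 z hz 0 (by simp))
  · refine (HasLogOn.const _ one_ne_zero).congr fun z hz => ?_
    exact div_self (h0 z hz 0 (by simp))

lemma not_hasLogOn_two_points {a b : ℂ} (hab : a ≠ b) :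
    ¬ HasLogOn {a, b}ᶜ (fun z => (z - b) / (z - a)) := by
  intro h
  set r := dist a b / 2 with hr
  have hd : 0 < dist a b := dist_pos.2 hab
  have hr0 : 0 < r := by positivity
  have hS : Metric.sphere a r ⊆ {a, b}ᶜ := by
    rintro z hz
    simp only [mem_compl_iff, mem_insert_iff, mem_singleton_iff, not_or]
    rw [Metric.mem_sphere] at hz
    constructor
    · rintro rfl; simp at hz; linarith
    · rintro rfl; rw [dist_comm] at hz; linarith
  have hlog : HasLogOn (Metric.sphere a r) (fun z => (a - b)⁻¹ * (z - b)) := by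
    refine ⟨fun z => Complex.log ((a - b)⁻¹ * (z - b)), ?_, ?_⟩
    · refine ContinuousOn.clog (by fun_prop) ?_
      intro z hz
      have : (a - b)⁻¹ * (z - b) = 1 + (z - a) / (a - b) := by
        have : a - b ≠ 0 := sub_ne_zero.2 hab
        field_simp
        ring
      rw [this]
      apply Complex.mem_slitPlane_of_norm_lt_one
      rw [norm_div, ← dist_eq_norm, ← dist_eq_norm, Metric.mem_sphere.1 hz, div_lt_one hd]
      linarith
    · intro z hz
      apply Complex.exp_log
      have := hS hz
      simp only [mem_compl_iff, mem_insert_iff, mem_singleton_iff, not_or] at this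
      exact mul_ne_zero (inv_ne_zero (sub_ne_zero.2 hab)) (sub_ne_zero.2 this.2)
  apply not_hasLogOn_sphere a ((a - b)⁻¹) hr0
  refine (hlog.mul (h.mono hS).inv).congr ?_
  intro z hz
  have := hS hz
  simp only [mem_compl_iff, mem_insert_iff, mem_singleton_iff, not_or] at this
  have h1 : z - a ≠ 0 := sub_ne_zero.2 this.1
  have h2 : z - b ≠ 0 := sub_ne_zero.2 this.2
  have h3 : a - b ≠ 0 := sub_ne_zero.2 hab
  field_simp

/-- The Jordan separation theorem. -/
theorem not_isPreconnected_compl_range_circle {e : Circle → ℂ} (he : Continuous e)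
    (hinj : Function.Injective e) : ¬ IsPreconnected (range e)ᶜ := by
  intro hpre
  let γ : ℝ → ℂ := fun t => e (Circle.exp (Real.pi * t))
  let δ : ℝ → ℂ := fun t => e (Circle.exp (-(Real.pi * t)))
  have hγ : Continuous γ := by fun_prop
  have hδ : Continuous δ := by fun_prop
  have h0 : γ 0 = δ 0 := by simp [γ, δ]
  have h1 : γ 1 = δ 1 := by
    simp only [γ, δ, mul_one]
    congr 1
    rw [Circle.exp_neg]
    ext
    simp
  have hpi := Real.pi_pos
  have hab : γ 0 ≠ γ 1 := by
    intro h
    have := hinj h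
    have := congrArg (fun z : Circle => (z : ℂ)) this
    simp at this
    norm_num [Complex.ext_iff] at this
  have hunion : γ '' Icc 0 1 ∪ δ '' Icc 0 1 = range e := by
    apply Subset.antisymm
    · rintro _ (⟨t, -, rfl⟩ | ⟨t, -, rfl⟩) <;> exact mem_range_self _
    · rintro _ ⟨x, rfl⟩
      have h2 : x = Circle.exp (Complex.arg x) := (Circle.exp_arg x).symm
      have := Complex.neg_pi_lt_arg x
      have := Complex.arg_le_pi x
      rcases le_total 0 (Complex.arg x) with h | h
      · left
        refine ⟨Complex.arg x / Real.pi, ⟨by positivity, by rw [div_le_one hpi]; assumption⟩, ?_⟩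
        simp only [γ]
        rw [mul_div_cancel₀ _ hpi.ne', ← h2]
      · right
        refine ⟨-Complex.arg x / Real.pi, ⟨div_nonneg (by linarith) hpi.le,
          by rw [div_le_one hpi]; linarith⟩, ?_⟩
        simp only [δ]
        rw [mul_div_cancel₀ _ hpi.ne', neg_neg, ← h2]
  have hinter : γ '' Icc 0 1 ∩ δ '' Icc 0 1 ⊆ {γ 0, γ 1} := by
    rintro _ ⟨⟨t, ht, rfl⟩, ⟨s, hs, hst⟩⟩
    have := hinj hst
    rw [Circle.exp_eq_exp] at this
    obtain ⟨m, hm⟩ := this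
    have h3 : -s = t + 2 * m := by
      have h4 : Real.pi * (-s) = Real.pi * (t + 2 * m) := by linarith
      exact mul_left_cancel₀ hpi.ne' h4
    have h5 : (-1 : ℝ) ≤ m := by linarith [ht.1, ht.2, hs.1, hs.2]
    have h6 : (m : ℝ) ≤ 0 := by linarith [ht.1, ht.2, hs.1, hs.2]
    have h5' : (-1 : ℤ) ≤ m := by exact_mod_cast h5
    have h6' : m ≤ 0 := by exact_mod_cast h6
    have : m = -1 ∨ m = 0 := by omega
    rcases this with rfl | rfl
    · right
      have : t = 1 := by push_cast at h3; linarith [ht.1, ht.2, hs.1, hs.2]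
      simp [this]
    · left
      have : t = 0 := by push_cast at h3; linarith [ht.1, ht.2, hs.1, hs.2]
      simp [this]
  have hclosed : ∀ η : ℝ → ℂ, Continuous η → IsOpen (η '' Icc 0 1)ᶜ := fun η hη =>
    (isCompact_Icc.image hη).isClosed.isOpen_compl
  have hl1 := hasLogOn_compl_arc hγ.continuousOn
  have hl2 := hasLogOn_compl_arc hδ.continuousOn
  rw [← h0, ← h1] at hl2
  have := HasLogOn.glue (hclosed γ hγ) (hclosed δ hδ)
    (by rw [← compl_union, hunion]; exact hpre) hl1 hl2
  rw [← compl_inter] at this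
  exact not_hasLogOn_two_points hab (this.mono (compl_subset_compl.2 hinter))

lemma hasLogOn_compl_ray {γ : ℝ → ℂ} (hγ : ContinuousOn γ (Ici 0))
    (hlim : Filter.Tendsto γ Filter.atTop (Filter.cocompact ℂ)) (hne : ∀ t ∈ Ici (0 : ℝ), γ t ≠ 0) :
    HasLogOn (γ '' Ici 0)ᶜ (fun z => 1 - z * (γ 0)⁻¹) := by
  let φ : ℝ → ℂ := fun u => if u = 0 then 0 else (γ (u⁻¹ - 1))⁻¹
  have hmap : ∀ u ∈ Icc (0 : ℝ) 1, u ≠ 0 → u⁻¹ - 1 ∈ Ici (0 : ℝ) := by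
    intro u hu h
    have : 0 < u := lt_of_le_of_ne hu.1 (Ne.symm h)
    have := (one_le_inv₀ this).2 hu.2
    simp only [mem_Ici]; linarith
  have hφ : ContinuousOn φ (Icc 0 1) := by
    intro u hu
    by_cases h : u = 0
    · subst h
      have h1 : Filter.Tendsto (fun u : ℝ => (γ (u⁻¹ - 1))⁻¹) (𝓝[>] 0) (𝓝 0) := by
        refine Filter.tendsto_inv₀_cobounded.comp ?_
        rw [Metric.cobounded_eq_cocompact]
        refine hlim.comp ?_
        exact Filter.tendsto_atTop_add_const_right _ (-1) tendsto_inv_nhdsGT_zero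
      have h2 : Filter.Tendsto φ (𝓝[>] 0) (𝓝 0) := by
        refine h1.congr' ?_
        filter_upwards [self_mem_nhdsWithin] with v hv
        have : v ≠ 0 := ne_of_gt hv
        simp [φ, this]
      have h3 : ContinuousWithinAt φ (insert 0 (Ioi 0)) 0 := by
        rw [continuousWithinAt_insert_self]
        simpa [ContinuousWithinAt, φ] using h2
      refine h3.mono ?_
      intro v hv
      rcases hv.1.eq_or_lt with h | h
      · left; exact h.symm
      · right; exact h
    · have h1 : ContinuousWithinAt (fun u : ℝ => (γ (u⁻¹ - 1))⁻¹) (Icc 0 1 ∩ {0}ᶜ) u := by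
        refine ContinuousWithinAt.inv₀ ?_ (hne _ (hmap u hu h))
        refine ContinuousWithinAt.comp (g := γ) (f := fun u : ℝ => u⁻¹ - 1) (t := Ici 0)
          (hγ _ (hmap u hu h)) ?_ ?_
        · exact ((continuousAt_inv₀ h).sub continuousAt_const).continuousWithinAt
        · intro v hv
          exact hmap v hv.1 hv.2
      have h2 : ContinuousWithinAt (fun u : ℝ => (γ (u⁻¹ - 1))⁻¹) (Icc 0 1) u := by
        rwa [continuousWithinAt_inter (isOpen_compl_singleton.mem_nhds h)] at h1
      refine h2.congr_of_eventuallyEq ?_ (by simp [φ, h])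
      filter_upwards [mem_nhdsWithin_of_mem_nhds (isOpen_compl_singleton.mem_nhds h)] with v hv
      have : v ≠ 0 := hv
      simp [φ, this]
  have := HasLogOn.of_homotopy (Z := (γ '' Ici 0)ᶜ) (H := fun q => 1 - q.2 * φ q.1) ?_ ?_ ?_
  · simpa [φ] using this
  · exact continuousOn_const.sub (continuousOn_snd.mul (hφ.comp continuousOn_fst fun q hq => hq.1))
  · intro t ht z hz h
    by_cases h0 : t = 0
    · simp [φ, h0] at h
    · simp only [φ, h0, if_false] at h
      apply hz
      refine ⟨_, hmap t ht h0, ?_⟩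
      rw [sub_eq_zero, eq_comm, mul_inv_eq_one₀ (hne _ (hmap t ht h0))] at h
      exact h.symm
  · simpa [φ] using HasLogOn.const _ one_ne_zero

/-- A properly embedded line separates the plane. -/
theorem not_isPreconnected_compl_range_line {γ : ℝ → ℂ} (hγ : IsClosedEmbedding γ)
    (h0 : 0 ∉ range γ) : ¬ IsPreconnected (range γ)ᶜ := by
  intro hpre
  have hne : ∀ t, γ t ≠ 0 := fun t h => h0 ⟨t, h⟩
  have hcoc : Filter.Tendsto γ (Filter.cocompact ℝ) (Filter.cocompact ℂ) := hγ.tendsto_cocompact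
  have h1 := hasLogOn_compl_ray hγ.continuous.continuousOn (hcoc.mono_left atTop_le_cocompact)
    (fun t _ => hne t)
  have h2 := hasLogOn_compl_ray (γ := fun t => γ (-t)) (hγ.continuous.comp continuous_neg).continuousOn
    ((hcoc.mono_left atBot_le_cocompact).comp Filter.tendsto_neg_atTop_atBot) (fun t _ => hne _)
  simp only [neg_zero] at h2
  have hc1 : IsClosed (γ '' Ici 0) := hγ.isClosedMap _ isClosed_Ici
  have himg : (fun t => γ (-t)) '' Ici 0 = γ '' Iic 0 := by
    rw [show (fun t => γ (-t)) = γ ∘ Neg.neg from rfl, image_comp]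
    simp
  have hc2 : IsClosed (γ '' Iic 0) := hγ.isClosedMap _ isClosed_Iic
  rw [himg] at h2
  have := HasLogOn.glue hc1.isOpen_compl hc2.isOpen_compl (by
    rw [← compl_union, ← image_union, Ici_union_Iic, image_univ]; exact hpre) h1 h2
  rw [← compl_inter, ← image_inter hγ.injective, Ici_inter_Iic, Icc_self, image_singleton] at this
  refine not_hasLogOn_sphere (γ 0) (-(γ 0)⁻¹) one_pos ((this.mono ?_).congr ?_)
  · rintro z hz rfl
    simp at hz
  · intro z _
    have := hne 0
    field_simp
    ring

/-- Polar coordinates with logarithmic radius. -/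
noncomputable def pol (q : Circle × ℝ) : ℂ := Real.exp q.2 * q.1

open Classical in
/-- The angular coordinate. -/
noncomputable def angle (z : ℂ) : Circle :=
  if h : z = 0 then 1 else ⟨z / ‖z‖, by
    simp [Submonoid.unitSphere, h]⟩

/-- The inverse of `pol`. -/
noncomputable def polInv (z : ℂ) : Circle × ℝ := (angle z, Real.log ‖z‖)

lemma continuous_pol : Continuous pol := by unfold pol; fun_prop

lemma norm_pol (q : Circle × ℝ) : ‖pol q‖ = Real.exp q.2 := by
  simp [pol, Complex.norm_exp, Circle.norm_coe]

lemma pol_ne_zero (q : Circle × ℝ) : pol q ≠ 0 := by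
  rw [← norm_pos_iff, norm_pol]; exact Real.exp_pos _

lemma coe_angle {z : ℂ} (hz : z ≠ 0) : (angle z : ℂ) = z / ‖z‖ := by simp [angle, hz]

lemma continuousOn_angle : ContinuousOn angle {0}ᶜ := by
  have : IsEmbedding (fun s : Circle => (s : ℂ)) := ⟨⟨rfl⟩, Circle.coe_injective⟩
  rw [this.continuousOn_iff]
  have h : ContinuousOn (fun z : ℂ => z / (‖z‖ : ℂ)) {0}ᶜ := by
    refine ContinuousOn.div (by fun_prop) (by fun_prop) ?_
    intro z hz
    simpa using hz
  exact h.congr fun z hz => coe_angle hz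

lemma continuousOn_polInv : ContinuousOn polInv {0}ᶜ := by
  refine continuousOn_angle.prodMk ?_
  refine ContinuousOn.log (by fun_prop) ?_
  intro z hz
  simpa using hz

lemma polInv_pol (q : Circle × ℝ) : polInv (pol q) = q := by
  refine Prod.ext ?_ ?_
  · apply Circle.ext
    change (angle (pol q) : ℂ) = _
    rw [coe_angle (pol_ne_zero q), norm_pol, pol]
    have : (Real.exp q.2 : ℂ) ≠ 0 := by exact_mod_cast (Real.exp_pos _).ne'
    field_simp
  · change Real.log ‖pol q‖ = _
    rw [norm_pol, Real.log_exp]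

lemma pol_polInv {z : ℂ} (hz : z ≠ 0) : pol (polInv z) = z := by
  have h1 : (‖z‖ : ℂ) ≠ 0 := by simpa using hz
  simp only [pol, polInv, coe_angle hz]
  rw [Real.exp_log (norm_pos_iff.2 hz)]
  field_simp

/-- Polar coordinates as a partial homeomorphism. -/
noncomputable def polH : OpenPartialHomeomorph (Circle × ℝ) ℂ where
  toFun := pol
  invFun := polInv
  source := Set.univ
  target := {0}ᶜ
  map_source' q _ := pol_ne_zero q
  map_target' _ _ := mem_univ _
  left_inv' q _ := polInv_pol q
  right_inv' _ hz := pol_polInv hz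
  open_source := isOpen_univ
  open_target := isOpen_compl_singleton
  continuousOn_toFun := continuous_pol.continuousOn
  continuousOn_invFun := continuousOn_polInv

lemma isPreconnected_compl_closedBall {R : ℝ} (hR : 0 < R) :
    IsPreconnected (Metric.closedBall (0 : ℂ) R)ᶜ := by
  have : (Metric.closedBall (0 : ℂ) R)ᶜ = pol '' (univ ×ˢ Ioi (Real.log R)) := by
    ext z
    simp only [mem_compl_iff, Metric.mem_closedBall, dist_zero_right, not_le, mem_image, mem_prod,
      mem_univ, true_and, mem_Ioi]
    constructor
    · intro h
      have hz : z ≠ 0 := norm_pos_iff.1 (hR.trans h)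
      exact ⟨polInv z, Real.log_lt_log hR h, pol_polInv hz⟩
    · rintro ⟨q, hq, rfl⟩
      rw [norm_pol]
      exact (Real.log_lt_iff_lt_exp hR).1 hq
  rw [this]
  exact (isPreconnected_univ.prod isPreconnected_Ioi).image _ continuous_pol.continuousOn

lemma frontier_connectedComponentIn_subset {X : Type*} [TopologicalSpace X]
    [LocallyConnectedSpace X] {U : Set X} (hU : IsOpen U) (p : X) :
    frontier (connectedComponentIn U p) ⊆ Uᶜ := by
  intro x hx hxU
  have hO : IsOpen (connectedComponentIn U p) := hU.connectedComponentIn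
  have hO' : IsOpen (connectedComponentIn U x) := hU.connectedComponentIn
  obtain ⟨y, hy, hy'⟩ := mem_closure_iff.1 hx.1 _ hO' (mem_connectedComponentIn hxU)
  rw [hO.frontier_eq] at hx
  apply hx.2
  rw [connectedComponentIn_eq hy', ← connectedComponentIn_eq hy]
  exact mem_connectedComponentIn hxU

/-- If `z - p` has a logarithm on the compact set `K`, then `p` lies in an unbounded component
of the complement of `K`. -/
lemma not_isBounded_component_of_hasLogOn {K : Set ℂ} (hK : IsCompact K) {p : ℂ} (hp : p ∉ K)
    (hlog : HasLogOn K (fun z => z - p)) :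
    ¬ Bornology.IsBounded (connectedComponentIn Kᶜ p) := by
  classical
  intro hb
  set O := connectedComponentIn Kᶜ p with hOdef
  have hpO : p ∈ O := mem_connectedComponentIn hp
  obtain ⟨g, hg, hgf⟩ := hlog
  obtain ⟨G, hG⟩ := ContinuousMap.exists_restrict_eq hK.isClosed
    (⟨K.domRestrict g, hg.domRestrict⟩ : C(K, ℂ))
  have hGK : ∀ z ∈ K, G z = g z := fun z hz => congrArg (fun F : C(K, ℂ) => F ⟨z, hz⟩) hG
  have hfr : frontier O ⊆ K := by
    simpa using frontier_connectedComponentIn_subset hK.isClosed.isOpen_compl p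
  let F : ℂ → ℂ := O.piecewise (fun z => Complex.exp (G z)) (fun z => z - p)
  have hF : Continuous F := by
    refine Continuous.piecewise ?_ (by fun_prop) (by fun_prop)
    intro a ha
    rw [hGK a (hfr ha), hgf a (hfr ha)]
  have hF0 : ∀ z, F z ≠ 0 := by
    intro z
    by_cases hz : z ∈ O
    · simp [F, hz]
    · simp only [F, hz, not_false_eq_true, piecewise_eq_of_notMem]
      rw [sub_ne_zero]
      rintro rfl
      exact hz hpO
  obtain ⟨R, hR⟩ := hb.subset_ball p
  have hR0 : 0 < R := by simpa using (hR hpO)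
  refine not_hasLogOn_sphere p 1 hR0 (((HasLogOn.univ hF hF0).mono (subset_univ _)).congr ?_)
  intro z hz
  have : z ∉ O := fun h => by
    have := hR h
    rw [Metric.mem_ball, Metric.mem_sphere.1 hz] at this
    exact lt_irrefl _ this
  simp [F, this]

lemma isPreconnected_compl_of_unbounded {K : Set ℂ} (hK : IsCompact K)
    (h : ∀ p ∉ K, ¬ Bornology.IsBounded (connectedComponentIn Kᶜ p)) : IsPreconnected Kᶜ := by
  obtain ⟨R, hR0, hR⟩ := hK.isBounded.subset_closedBall_lt 0 0
  have hpre := isPreconnected_compl_closedBall hR0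
  have key : ∀ p ∉ K, (Metric.closedBall (0 : ℂ) R)ᶜ ⊆ connectedComponentIn Kᶜ p := by
    intro p hp
    have : ¬ (connectedComponentIn Kᶜ p ⊆ Metric.closedBall 0 R) := fun h' =>
      h p hp (Metric.isBounded_closedBall.subset h')
    obtain ⟨q, hq, hqR⟩ := not_subset.1 this
    rw [connectedComponentIn_eq hq]
    exact hpre.subset_connectedComponentIn hqR (compl_subset_compl.2 hR)
  obtain ⟨w, hw⟩ : ((Metric.closedBall (0 : ℂ) R)ᶜ).Nonempty := by
    refine ⟨(R + 1 : ℝ), ?_⟩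
    simp only [mem_compl_iff, Metric.mem_closedBall, dist_zero_right, Complex.norm_real,
      Real.norm_eq_abs, not_le]
    exact lt_of_lt_of_le (by linarith) (le_abs_self _)
  have : Kᶜ = connectedComponentIn Kᶜ w := by
    refine Subset.antisymm ?_ (connectedComponentIn_subset _ _)
    intro p hp
    rw [← connectedComponentIn_eq (key p hp hw)]
    exact mem_connectedComponentIn hp
  rw [this]
  exact isPreconnected_connectedComponentIn

/-- The inverse of a continuous injection on a compact set is continuous. -/
lemma continuousOn_leftInverse {X Y : Type*} [TopologicalSpace X] [TopologicalSpace Y] [T2Space Y]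
    {K : Set X} (hK : IsCompact K) {f : X → Y} (hf : ContinuousOn f K) {g : Y → X}
    (hg : ∀ x ∈ K, g (f x) = x) : ContinuousOn g (f '' K) := by
  rw [continuousOn_iff_isClosed]
  intro C hC
  refine ⟨f '' (K ∩ C), ((hK.inter_right hC).image_of_continuousOn
    (hf.mono inter_subset_left)).isClosed, ?_⟩
  ext y
  constructor
  · rintro ⟨hy, x, hx, rfl⟩
    refine ⟨⟨x, ⟨hx, ?_⟩, rfl⟩, mem_image_of_mem _ hx⟩
    rwa [mem_preimage, hg x hx] at hy
  · rintro ⟨⟨x, ⟨hx, hxC⟩, rfl⟩, hy⟩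
    refine ⟨?_, hy⟩
    rwa [mem_preimage, hg x hx]

lemma isPreconnected_compl_image_closedBall {f : ℂ → ℂ}
    (hf : ContinuousOn f (Metric.closedBall 0 1)) (hinj : InjOn f (Metric.closedBall 0 1)) :
    IsPreconnected (f '' Metric.closedBall 0 1)ᶜ := by
  have hcB : IsCompact (Metric.closedBall (0 : ℂ) 1) := isCompact_closedBall _ _
  have hK : IsCompact (f '' Metric.closedBall 0 1) := hcB.image_of_continuousOn hf
  refine isPreconnected_compl_of_unbounded hK fun p hp =>
    not_isBounded_component_of_hasLogOn hK hp ?_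
  have hne : ∀ w ∈ Metric.closedBall (0 : ℂ) 1, f w - p ≠ 0 := fun w hw h =>
    hp ⟨w, hw, sub_eq_zero.1 h⟩
  have hscale : ∀ t ∈ Icc (0 : ℝ) 1, ∀ w ∈ Metric.closedBall (0 : ℂ) 1,
      (t : ℂ) * w ∈ Metric.closedBall (0 : ℂ) 1 := by
    intro t ht w hw
    simp only [Metric.mem_closedBall, dist_zero_right, norm_mul, Complex.norm_real,
      Real.norm_eq_abs, abs_of_nonneg ht.1] at *
    exact mul_le_one₀ ht.2 (norm_nonneg _) hw
  have hlogB : HasLogOn (Metric.closedBall 0 1) (fun w => f w - p) := by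
    have := HasLogOn.of_homotopy (Z := Metric.closedBall 0 1)
      (H := fun q => f ((q.1 : ℂ) * q.2) - p) ?_ ?_ ?_
    · simpa using this
    · refine (hf.comp (by fun_prop) ?_).sub continuousOn_const
      rintro ⟨t, w⟩ ⟨ht, hw⟩
      exact hscale t ht w hw
    · intro t ht w hw
      exact hne _ (hscale t ht w hw)
    · simpa using HasLogOn.const _ (hne 0 (by simp))
  obtain ⟨g, hg, hgf⟩ := hlogB
  refine ⟨fun z => g (Function.invFunOn f (Metric.closedBall 0 1) z), ?_, ?_⟩
  · refine hg.comp ?_ ?_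
    · exact continuousOn_leftInverse hcB hf fun x hx => hinj.leftInvOn_invFunOn hx
    · intro z hz
      exact Function.invFunOn_mem hz
  · intro z hz
    rw [hgf _ (Function.invFunOn_mem hz)]
    simp only [Function.invFunOn_eq hz]

lemma isOpen_image_unitBall {f : ℂ → ℂ} (hf : ContinuousOn f (Metric.closedBall 0 1))
    (hinj : InjOn f (Metric.closedBall 0 1)) : IsOpen (f '' Metric.ball 0 1) := by
  set K := f '' Metric.closedBall 0 1 with hKdef
  set J := f '' Metric.sphere 0 1 with hJdef
  have hKpre := isPreconnected_compl_image_closedBall hf hinj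
  have hJcomp : IsCompact J :=
    (isCompact_sphere _ _).image_of_continuousOn (hf.mono Metric.sphere_subset_closedBall)
  have hJrange : J = range (fun s : Circle => f s) := by
    rw [hJdef, show (fun s : Circle => f s) = f ∘ (fun s : Circle => (s : ℂ)) from rfl, range_comp]
    congr 1
    ext z
    constructor
    · intro hz
      exact ⟨⟨z, hz⟩, rfl⟩
    · rintro ⟨s, rfl⟩
      simp [Circle.norm_coe]
  have hJsep : ¬ IsPreconnected Jᶜ := by
    rw [hJrange]
    have hs : ∀ s : Circle, (s : ℂ) ∈ Metric.closedBall (0 : ℂ) 1 := by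
      intro s; simp [Circle.norm_coe]
    refine not_isPreconnected_compl_range_circle (hf.comp_continuous (by fun_prop) hs) ?_
    intro s t hst
    exact Circle.coe_injective (hinj (hs s) (hs t) hst)
  have hU : IsPreconnected (f '' Metric.ball 0 1) :=
    (convex_ball (0 : ℂ) 1).isPreconnected.image _ (hf.mono Metric.ball_subset_closedBall)
  have hdisj : Disjoint (f '' Metric.ball 0 1) J := by
    rw [hJdef]
    rw [disjoint_left]
    rintro _ ⟨z, hz, rfl⟩ ⟨w, hw, hwz⟩
    have := hinj (Metric.sphere_subset_closedBall hw) (Metric.ball_subset_closedBall hz) hwz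
    subst this
    exact disjoint_left.1 Metric.sphere_disjoint_ball hw hz
  have hKun : K = f '' Metric.ball 0 1 ∪ J := by
    rw [hKdef, hJdef, ← image_union, Metric.ball_union_sphere]
  have hUJ : f '' Metric.ball 0 1 ⊆ Jᶜ := hdisj.subset_compl_right
  have h0 : f 0 ∈ f '' Metric.ball 0 1 := mem_image_of_mem _ (by simp)
  have hO : IsOpen (connectedComponentIn Jᶜ (f 0)) :=
    hJcomp.isClosed.isOpen_compl.connectedComponentIn
  have hsub := hU.subset_connectedComponentIn h0 hUJ
  have heq : f '' Metric.ball 0 1 = connectedComponentIn Jᶜ (f 0) := by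
    refine Subset.antisymm hsub ?_
    intro x hx
    by_contra hxU
    have hxJ : x ∈ Jᶜ := connectedComponentIn_subset _ _ hx
    have hxK : x ∈ Kᶜ := by
      rw [hKun]
      rintro (h | h)
      · exact hxU h
      · exact hxJ h
    apply hJsep
    have : Jᶜ = connectedComponentIn Jᶜ (f 0) := by
      refine Subset.antisymm ?_ (connectedComponentIn_subset _ _)
      intro y hy
      by_cases hyU : y ∈ f '' Metric.ball 0 1
      · exact hsub hyU
      · rw [connectedComponentIn_eq hx]
        refine hKpre.subset_connectedComponentIn hxK ?_ ?_
        · rw [← hKdef, hKun]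
          exact compl_subset_compl.2 subset_union_right
        · rw [← hKdef, hKun]
          rintro (h | h)
          · exact hyU h
          · exact hy h
    rw [this]
    exact isPreconnected_connectedComponentIn
  rw [heq]
  exact hO

/-- Invariance of domain in the plane. -/
theorem isOpen_image_of_injOn_complex {f : ℂ → ℂ} {U : Set ℂ} (hU : IsOpen U)
    (hf : ContinuousOn f U) (hinj : InjOn f U) : IsOpen (f '' U) := by
  rw [isOpen_iff_mem_nhds]
  rintro _ ⟨x, hx, rfl⟩
  obtain ⟨r, hr, hrU⟩ := Metric.nhds_basis_closedBall.mem_iff.1 (hU.mem_nhds hx)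
  let a : ℂ → ℂ := fun w => x + r * w
  have ha : ∀ w ∈ Metric.closedBall (0 : ℂ) 1, a w ∈ U := by
    intro w hw
    apply hrU
    simp only [Metric.mem_closedBall, dist_zero_right] at hw
    simp only [a, Metric.mem_closedBall, dist_self_add_left, norm_mul, Complex.norm_real,
      Real.norm_eq_abs, abs_of_pos hr]
    exact mul_le_of_le_one_right hr.le hw
  have hainj : Function.Injective a := by
    intro w w' h
    have hr' : (r : ℂ) ≠ 0 := by exact_mod_cast hr.ne'
    simpa [a, hr'] using h
  have h1 : IsOpen ((f ∘ a) '' Metric.ball 0 1) := by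
    apply isOpen_image_unitBall
    · exact hf.comp (by fun_prop) ha
    · exact hinj.comp hainj.injOn ha
  refine Filter.mem_of_superset (h1.mem_nhds ⟨0, by simp, by simp [a]⟩) ?_
  rintro _ ⟨w, hw, rfl⟩
  exact ⟨a w, ha w (Metric.ball_subset_closedBall hw), rfl⟩

/-- A space locally homeomorphic to the plane. -/
class LocallyPlanar (X : Type*) [TopologicalSpace X] : Prop where
  exists_chart : ∀ x : X, ∃ φ : OpenPartialHomeomorph X ℂ, x ∈ φ.source

instance : LocallyPlanar ℂ := ⟨fun _ => ⟨OpenPartialHomeomorph.refl ℂ, mem_univ _⟩⟩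

instance : LocallyPlanar (Circle × ℝ) := ⟨fun _ => ⟨polH, mem_univ _⟩⟩

lemma locallyPlanar_of_chartedSpace {S : Type*} [TopologicalSpace S]
    [ChartedSpace (EuclideanSpace ℝ (Fin 2)) S] : LocallyPlanar S :=
  ⟨fun x => ⟨(chartAt (EuclideanSpace ℝ (Fin 2)) x).trans
    Complex.orthonormalBasisOneI.repr.symm.toHomeomorph.toOpenPartialHomeomorph, by simp⟩⟩

/-- Invariance of domain for surfaces. -/
theorem isOpen_image_of_injOn {X Y : Type*} [TopologicalSpace X] [TopologicalSpace Y]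
    [LocallyPlanar X] [LocallyPlanar Y] {f : X → Y} {U : Set X} (hU : IsOpen U)
    (hf : ContinuousOn f U) (hinj : InjOn f U) : IsOpen (f '' U) := by
  rw [isOpen_iff_mem_nhds]
  rintro _ ⟨x, hx, rfl⟩
  obtain ⟨φ, hφ⟩ := LocallyPlanar.exists_chart x
  obtain ⟨ψ, hψ⟩ := LocallyPlanar.exists_chart (f x)
  have hV : IsOpen (U ∩ f ⁻¹' ψ.source) := hf.isOpen_inter_preimage hU ψ.open_source
  have hW : IsOpen (φ.target ∩ φ.symm ⁻¹' (U ∩ f ⁻¹' ψ.source)) :=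
    φ.isOpen_inter_preimage_symm hV
  set W := φ.target ∩ φ.symm ⁻¹' (U ∩ f ⁻¹' ψ.source) with hWdef
  have h1 : IsOpen ((fun z => ψ (f (φ.symm z))) '' W) := by
    apply isOpen_image_of_injOn_complex hW
    · refine ψ.continuousOn.comp (hf.comp (φ.continuousOn_symm.mono inter_subset_left) ?_) ?_
      · exact fun z hz => hz.2.1
      · exact fun z hz => hz.2.2
    · intro z hz w hw h
      have := hinj hz.2.1 hw.2.1 (ψ.injOn hz.2.2 hw.2.2 h)
      exact φ.symm.injOn hz.1 hw.1 this
  have h2 := ψ.isOpen_inter_preimage h1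
  refine Filter.mem_of_superset (h2.mem_nhds ⟨hψ, φ x, ⟨φ.map_source hφ, ?_⟩, ?_⟩) ?_
  · simp [hφ, hx, hψ]
  · simp [hφ]
  · rintro y ⟨hy, z, hz, hzy⟩
    exact ⟨φ.symm z, hz.2.1, ψ.injOn hz.2.2 hy hzy⟩

lemma IsCircle.exists_param {X : Type*} [TopologicalSpace X] {J : Set X} (hJ : IsCircle J) :
    ∃ e : Circle → X, Continuous e ∧ Function.Injective e ∧ range e = J := by
  obtain ⟨φ⟩ := hJ
  refine ⟨fun s => φ.symm s, by fun_prop, ?_, ?_⟩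
  · exact Subtype.val_injective.comp φ.symm.injective
  · rw [show (fun s => (φ.symm s : X)) = Subtype.val ∘ φ.symm from rfl, range_comp]
    simp

lemma isCircle_range {X : Type*} [TopologicalSpace X] [T2Space X] {e : Circle → X}
    (he : Continuous e) (hinj : Function.Injective e) : IsCircle (range e) :=
  ⟨(he.isClosedEmbedding hinj).isEmbedding.toHomeomorph.symm⟩

lemma IsCircle.image {X Y : Type*} [TopologicalSpace X] [TopologicalSpace Y] [T2Space Y]
    {J : Set X} (hJ : IsCircle J) {f : X → Y} (hf : ContinuousOn f J) (hinj : InjOn f J) :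
    IsCircle (f '' J) := by
  obtain ⟨e, he, hei, rfl⟩ := hJ.exists_param
  rw [← range_comp]
  refine isCircle_range (hf.comp_continuous he fun s => mem_range_self s) ?_
  intro s t hst
  exact hei (hinj (mem_range_self s) (mem_range_self t) hst)

lemma IsCircle.isCompact {X : Type*} [TopologicalSpace X] {J : Set X} (hJ : IsCircle J) :
    IsCompact J := by
  obtain ⟨e, he, -, rfl⟩ := hJ.exists_param
  exact isCompact_range he

lemma IsCircle.nonempty {X : Type*} [TopologicalSpace X] {J : Set X} (hJ : IsCircle J) :
    J.Nonempty := by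
  obtain ⟨e, he, -, rfl⟩ := hJ.exists_param
  exact range_nonempty e

lemma IsCircle.isPreconnected {X : Type*} [TopologicalSpace X] {J : Set X} (hJ : IsCircle J) :
    IsPreconnected J := by
  obtain ⟨e, he, -, rfl⟩ := hJ.exists_param
  exact isPreconnected_range he

/-- An open bicollar of a two-sided circle in a surface. -/
lemma IsTwoSided.exists_collar {X : Type*} [TopologicalSpace X] [LocallyPlanar X] {C : Set X}
    (hC : IsTwoSided C) : ∃ c : Circle × ℝ → X, IsOpenEmbedding c ∧ c '' (univ ×ˢ {0}) = C := by
  obtain ⟨h, hh, hC⟩ := hC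
  let σ : ℝ → Icc (-1 : ℝ) 1 := fun t => ⟨t / (1 + |t|), by
    have : 0 < 1 + |t| := by positivity
    constructor
    · rw [le_div_iff₀ this]; linarith [neg_abs_le t]
    · rw [div_le_one this]; linarith [le_abs_self t]⟩
  have hσc : Continuous σ := by
    refine Continuous.subtype_mk ?_ _
    refine Continuous.div (by fun_prop) (by fun_prop) ?_
    intro t
    positivity
  have hσi : Function.Injective σ := by
    intro a b hab
    have h1 : a / (1 + |a|) = b / (1 + |b|) := congrArg Subtype.val hab
    have ha : 0 < 1 + |a| := by positivity
    have hb : 0 < 1 + |b| := by positivity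
    rw [div_eq_div_iff ha.ne' hb.ne'] at h1
    rcases abs_cases a with ⟨h2, h3⟩ | ⟨h2, h3⟩ <;> rcases abs_cases b with ⟨h4, h5⟩ | ⟨h4, h5⟩ <;>
      rw [h2, h4] at h1 <;> nlinarith
  have hc : Continuous (fun q : Circle × ℝ => h (q.1, σ q.2)) :=
    hh.continuous.comp (by fun_prop)
  have hi : Function.Injective (fun q : Circle × ℝ => h (q.1, σ q.2)) := by
    intro q q' hq
    have := hh.injective hq
    rw [Prod.mk.injEq] at this
    exact Prod.ext this.1 (hσi this.2)
  refine ⟨_, .of_continuous_injective_isOpenMap hc hi ?_, ?_⟩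
  · intro U hU
    exact isOpen_image_of_injOn hU hc.continuousOn hi.injOn
  · rw [← hC]
    ext x
    constructor
    · rintro ⟨⟨s, t⟩, ⟨-, rfl⟩, rfl⟩
      exact ⟨_, by simp [σ], rfl⟩
    · rintro ⟨⟨s, t⟩, ht, rfl⟩
      refine ⟨(s, 0), by simp, ?_⟩
      have : σ 0 = t := by
        apply Subtype.ext
        simp only [mem_ofPred_eq] at ht
        simp [σ, ht]
      simp only [this]

/-- Every circle in the plane is two-sided. -/
def PlaneTwoSided : Prop := ∀ J : Set ℂ, IsCircle J → IsTwoSided J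

/-- The bounded complementary domain of a closed curve. -/
def inside (J : Set ℂ) : Set ℂ := {z | z ∉ J ∧ Bornology.IsBounded (connectedComponentIn Jᶜ z)}

/-- The unbounded complementary domain of a closed curve. -/
def outside (J : Set ℂ) : Set ℂ := {z | z ∉ J ∧ ¬ Bornology.IsBounded (connectedComponentIn Jᶜ z)}

/-- A closed curve together with its interior domain. -/
def hull (J : Set ℂ) : Set ℂ := J ∪ inside J

lemma inside_union_outside (J : Set ℂ) : inside J ∪ outside J = Jᶜ := by
  ext z; simp only [inside, outside, mem_union, mem_ofPred_eq, mem_compl_iff]; tauto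

lemma disjoint_inside_outside (J : Set ℂ) : Disjoint (inside J) (outside J) :=
  disjoint_left.2 fun _ h h' => h'.2 h.2

lemma hull_compl (J : Set ℂ) : (hull J)ᶜ = outside J := by
  ext z; simp only [hull, inside, outside, mem_union, mem_ofPred_eq, mem_compl_iff]; tauto

lemma subset_hull (J : Set ℂ) : J ⊆ hull J := subset_union_left

lemma inside_subset_hull (J : Set ℂ) : inside J ⊆ hull J := subset_union_right

lemma disjoint_inside (J : Set ℂ) : Disjoint (inside J) J :=
  disjoint_left.2 fun _ h h' => h.1 h'

lemma disjoint_outside (J : Set ℂ) : Disjoint (outside J) J :=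
  disjoint_left.2 fun _ h h' => h.1 h'

lemma IsPreconnected.subset_inside {J U : Set ℂ} (hU : IsPreconnected U) (hUJ : Disjoint U J)
    (h : (U ∩ inside J).Nonempty) : U ⊆ inside J := by
  obtain ⟨x, hxU, hx⟩ := h
  intro y hy
  have := hU.subset_connectedComponentIn hxU hUJ.subset_compl_right hy
  exact ⟨disjoint_left.1 hUJ hy, by rw [← connectedComponentIn_eq this]; exact hx.2⟩

lemma IsPreconnected.subset_outside {J U : Set ℂ} (hU : IsPreconnected U) (hUJ : Disjoint U J)
    (h : (U ∩ outside J).Nonempty) : U ⊆ outside J := by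
  obtain ⟨x, hxU, hx⟩ := h
  intro y hy
  have := hU.subset_connectedComponentIn hxU hUJ.subset_compl_right hy
  exact ⟨disjoint_left.1 hUJ hy, by rw [← connectedComponentIn_eq this]; exact hx.2⟩

lemma IsPreconnected.subset_outside_of_unbounded {J U : Set ℂ} (hU : IsPreconnected U)
    (hUJ : Disjoint U J) (h : ¬ Bornology.IsBounded U) : U ⊆ outside J := fun _ hy =>
  ⟨disjoint_left.1 hUJ hy, fun hb =>
    h (hb.subset (hU.subset_connectedComponentIn hy hUJ.subset_compl_right))⟩

/-- The basic structure provided by the Jordan curve theorem. -/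
structure JordanCollar (J : Set ℂ) (c : Circle × ℝ → ℂ) : Prop where
  emb : IsOpenEmbedding c
  zero : c '' (univ ×ˢ {0}) = J
  neg : c '' (univ ×ˢ Iio 0) ⊆ inside J
  pos : c '' (univ ×ˢ Ioi 0) ⊆ outside J
  conn_inside : IsPreconnected (inside J)
  conn_outside : IsPreconnected (outside J)

lemma not_isBounded_compl_of_isCompact {K : Set ℂ} (hK : IsCompact K) :
    ¬ Bornology.IsBounded Kᶜ := by
  intro h
  have := hK.isBounded.union h
  rw [union_compl_self] at this
  exact NormedSpace.unbounded_univ ℂ ℂ this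

lemma exists_jordanCollar (hT : PlaneTwoSided) {J : Set ℂ} (hJ : IsCircle J) :
    ∃ c, JordanCollar J c := by
  obtain ⟨c, hc, hc0⟩ := (hT J hJ).exists_collar
  have hmemJ : ∀ s t, c (s, t) ∈ J ↔ t = 0 := by
    intro s t
    rw [← hc0, hc.injective.mem_set_image]
    simp
  have hVo : IsOpen Jᶜ := hJ.isCompact.isClosed.isOpen_compl
  have hpos : IsPreconnected (c '' (univ ×ˢ Ioi 0)) :=
    (isPreconnected_univ.prod isPreconnected_Ioi).image _ hc.continuous.continuousOn
  have hneg : IsPreconnected (c '' (univ ×ˢ Iio 0)) :=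
    (isPreconnected_univ.prod isPreconnected_Iio).image _ hc.continuous.continuousOn
  have hposJ : c '' (univ ×ˢ Ioi 0) ⊆ Jᶜ := by
    rintro _ ⟨⟨s, t⟩, ⟨-, ht⟩, rfl⟩ h
    exact (ne_of_gt ht) ((hmemJ s t).1 h)
  have hnegJ : c '' (univ ×ˢ Iio 0) ⊆ Jᶜ := by
    rintro _ ⟨⟨s, t⟩, ⟨-, ht⟩, rfl⟩ h
    exact (ne_of_lt ht) ((hmemJ s t).1 h)
  set P := connectedComponentIn Jᶜ (c (1, 1)) with hP
  set M := connectedComponentIn Jᶜ (c (1, -1)) with hM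
  have h1 : c (1, 1) ∈ c '' (univ ×ˢ Ioi 0) := mem_image_of_mem _ (by simp)
  have h2 : c (1, -1) ∈ c '' (univ ×ˢ Iio 0) := mem_image_of_mem _ (by simp)
  have hPsub : c '' (univ ×ˢ Ioi 0) ⊆ P := hpos.subset_connectedComponentIn h1 hposJ
  have hMsub : c '' (univ ×ˢ Iio 0) ⊆ M := hneg.subset_connectedComponentIn h2 hnegJ
  have hPconn : IsPreconnected P := isPreconnected_connectedComponentIn
  have hMconn : IsPreconnected M := isPreconnected_connectedComponentIn
  have hcover : ∀ x ∈ Jᶜ, x ∈ P ∨ x ∈ M := by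
    intro x hx
    set O := connectedComponentIn Jᶜ x with hO
    have hOo : IsOpen O := hVo.connectedComponentIn
    have hfr : (frontier O).Nonempty := by
      rw [nonempty_iff_ne_empty]
      intro h
      have hcl : IsClopen O := isClopen_iff_frontier_eq_empty.2 h
      rcases isClopen_iff.1 hcl with h | h
      · have : x ∈ O := mem_connectedComponentIn hx
        simp [h] at this
      · obtain ⟨y, hy⟩ := hJ.nonempty
        have : y ∈ O := by simp [h]
        exact connectedComponentIn_subset _ _ this hy
    obtain ⟨y, hy⟩ := hfr
    have hyJ : y ∈ J := by
      simpa using frontier_connectedComponentIn_subset hVo x hy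
    have hyc : y ∈ range c := by rw [← hc0] at hyJ; exact image_subset_range _ _ hyJ
    obtain ⟨_, ⟨⟨s, t⟩, rfl⟩, hq⟩ := mem_closure_iff.1 hy.1 _ hc.isOpen_range hyc
    have hne : t ≠ 0 := fun h => connectedComponentIn_subset _ _ hq ((hmemJ s t).2 h)
    rcases lt_or_gt_of_ne hne with h | h
    · right
      have : c (s, t) ∈ M := hMsub (mem_image_of_mem _ ⟨mem_univ _, h⟩)
      rw [hM, connectedComponentIn_eq this, ← connectedComponentIn_eq hq]
      exact mem_connectedComponentIn hx
    · left
      have : c (s, t) ∈ P := hPsub (mem_image_of_mem _ ⟨mem_univ _, h⟩)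
      rw [hP, connectedComponentIn_eq this, ← connectedComponentIn_eq hq]
      exact mem_connectedComponentIn hx
  have hPJ : P ⊆ Jᶜ := connectedComponentIn_subset _ _
  have hMJ : M ⊆ Jᶜ := connectedComponentIn_subset _ _
  have hcov : Jᶜ = P ∪ M := Subset.antisymm hcover (union_subset hPJ hMJ)
  have hsep : ¬ IsPreconnected Jᶜ := by
    obtain ⟨e, he, hei, rfl⟩ := hJ.exists_param
    exact not_isPreconnected_compl_range_circle he hei
  have hPM : Disjoint P M := by
    rw [disjoint_left]
    intro x hxP hxM
    apply hsep
    rw [hcov]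
    exact hPconn.union x hxP hxM hMconn
  have hub := not_isBounded_compl_of_isCompact hJ.isCompact
  have hnotboth : Bornology.IsBounded P ∨ Bornology.IsBounded M := by
    by_contra! h
    obtain ⟨R, hR0, hR⟩ := hJ.isCompact.isBounded.subset_closedBall_lt 0 0
    have hpre := isPreconnected_compl_closedBall hR0
    have key : ∀ p, ¬ Bornology.IsBounded (connectedComponentIn Jᶜ p) →
        (Metric.closedBall (0 : ℂ) R)ᶜ ⊆ connectedComponentIn Jᶜ p := by
      intro p hp
      have : ¬ (connectedComponentIn Jᶜ p ⊆ Metric.closedBall 0 R) := fun h' =>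
        hp (Metric.isBounded_closedBall.subset h')
      obtain ⟨q, hq, hqR⟩ := not_subset.1 this
      rw [connectedComponentIn_eq hq]
      exact hpre.subset_connectedComponentIn hqR (compl_subset_compl.2 hR)
    have hne : ((Metric.closedBall (0 : ℂ) R)ᶜ).Nonempty := by
      rw [nonempty_iff_ne_empty]
      intro he
      apply not_isBounded_compl_of_isCompact (isCompact_closedBall (0 : ℂ) R)
      rw [he]
      exact Bornology.isBounded_empty
    obtain ⟨w, hw⟩ := hne
    exact disjoint_left.1 hPM (key _ h.1 hw) (key _ h.2 hw)
  have hcompP : ∀ x ∈ P, connectedComponentIn Jᶜ x = P := fun x hx =>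
    (connectedComponentIn_eq hx).symm
  have hcompM : ∀ x ∈ M, connectedComponentIn Jᶜ x = M := fun x hx =>
    (connectedComponentIn_eq hx).symm
  have aux : ∀ A B : Set ℂ, Jᶜ = A ∪ B → (∀ x ∈ A, connectedComponentIn Jᶜ x = A) →
      (∀ x ∈ B, connectedComponentIn Jᶜ x = B) → Bornology.IsBounded A →
      A = inside J ∧ B = outside J := by
    intro A B hAB hA hB hbA
    have hbB : ¬ Bornology.IsBounded B := fun h => hub (hAB ▸ hbA.union h)
    have hAJ : A ⊆ Jᶜ := hAB ▸ subset_union_left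
    have hBJ : B ⊆ Jᶜ := hAB ▸ subset_union_right
    constructor
    · ext x
      refine ⟨fun hx => ⟨hAJ hx, by rw [hA x hx]; exact hbA⟩, fun hx => ?_⟩
      have : x ∈ A ∪ B := hAB ▸ hx.1
      refine this.resolve_right fun hxB => hbB ?_
      rw [← hB x hxB]
      exact hx.2
    · ext x
      refine ⟨fun hx => ⟨hBJ hx, by rw [hB x hx]; exact hbB⟩, fun hx => ?_⟩
      have : x ∈ A ∪ B := hAB ▸ hx.1
      refine this.resolve_left fun hxA => hx.2 ?_
      rw [hA x hxA]
      exact hbA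
  rcases hnotboth with hb | hb
  · obtain ⟨h3, h4⟩ := aux P M hcov hcompP hcompM hb
    have hflip : ∀ A : Set ℝ, (fun q : Circle × ℝ => c (q.1, -q.2)) '' (univ ×ˢ A) =
        c '' (univ ×ˢ (-A)) := by
      intro A
      ext x
      constructor
      · rintro ⟨⟨s, t⟩, ⟨-, ht⟩, rfl⟩
        exact ⟨(s, -t), ⟨mem_univ _, by simpa using ht⟩, rfl⟩
      · rintro ⟨⟨s, t⟩, ⟨-, ht⟩, rfl⟩
        exact ⟨(s, -t), ⟨mem_univ _, ht⟩, by simp⟩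
    refine ⟨fun q => c (q.1, -q.2), ⟨?_, ?_, ?_, ?_, h3 ▸ hPconn, h4 ▸ hMconn⟩⟩
    · exact hc.comp ((Homeomorph.refl Circle).prodCongr (Homeomorph.neg ℝ)).isOpenEmbedding
    · rw [hflip]; simpa using hc0
    · rw [hflip, ← h3]; simpa using hPsub
    · rw [hflip, ← h4]; simpa using hMsub
  · obtain ⟨h3, h4⟩ := aux M P (by rw [hcov, union_comm]) hcompM hcompP hb
    exact ⟨c, hc, hc0, h3 ▸ hMsub, h4 ▸ hPsub, h3 ▸ hMconn, h4 ▸ hPconn⟩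

lemma IsPreconnected.subset_of_disjoint_frontier {X : Type*} [TopologicalSpace X] {P O : Set X}
    (hP : IsPreconnected P) (hO : IsOpen O) (hd : Disjoint P (frontier O))
    (hne : (P ∩ O).Nonempty) : P ⊆ O := by
  refine hP.subset_left_of_subset_union hO isClosed_closure.isOpen_compl
    (disjoint_left.2 fun x hx hx' => hx' (subset_closure hx)) ?_ hne
  intro x hx
  by_cases h : x ∈ O
  · exact Or.inl h
  · right
    intro hxc
    exact disjoint_left.1 hd hx (by rw [hO.frontier_eq]; exact ⟨hxc, h⟩)

lemma isOpen_inside {J : Set ℂ} (hJ : IsCompact J) : IsOpen (inside J) := by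
  rw [isOpen_iff_forall_mem_open]
  intro x hx
  have hx' : x ∈ connectedComponentIn Jᶜ x := mem_connectedComponentIn hx.1
  exact ⟨connectedComponentIn Jᶜ x, isPreconnected_connectedComponentIn.subset_inside
    (disjoint_left.2 fun y hy => connectedComponentIn_subset _ _ hy) ⟨x, hx', hx⟩,
    hJ.isClosed.isOpen_compl.connectedComponentIn, hx'⟩

lemma isOpen_outside {J : Set ℂ} (hJ : IsCompact J) : IsOpen (outside J) := by
  rw [isOpen_iff_forall_mem_open]
  intro x hx
  have hx' : x ∈ connectedComponentIn Jᶜ x := mem_connectedComponentIn hx.1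
  exact ⟨connectedComponentIn Jᶜ x, isPreconnected_connectedComponentIn.subset_outside
    (disjoint_left.2 fun y hy => connectedComponentIn_subset _ _ hy) ⟨x, hx', hx⟩,
    hJ.isClosed.isOpen_compl.connectedComponentIn, hx'⟩

lemma isClosed_hull {J : Set ℂ} (hJ : IsCompact J) : IsClosed (hull J) := by
  rw [← isOpen_compl_iff, hull_compl]
  exact isOpen_outside hJ

lemma isBounded_inside {J : Set ℂ} (hJ : IsCompact J) : Bornology.IsBounded (inside J) := by
  obtain ⟨R, hR0, hR⟩ := hJ.isBounded.subset_closedBall_lt 0 0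
  refine (Metric.isBounded_closedBall (x := (0 : ℂ)) (r := R)).subset ?_
  intro x hx
  by_contra hxR
  have := (isPreconnected_compl_closedBall hR0).subset_outside_of_unbounded
    (J := J) (disjoint_left.2 fun y hy hyJ => hy (hR hyJ))
    (not_isBounded_compl_of_isCompact (isCompact_closedBall _ _)) hxR
  exact disjoint_left.1 (disjoint_inside_outside J) hx this

lemma isCompact_hull {J : Set ℂ} (hJ : IsCompact J) : IsCompact (hull J) :=
  Metric.isCompact_of_isClosed_isBounded (isClosed_hull hJ)
    (hJ.isBounded.union (isBounded_inside hJ))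

lemma not_isBounded_outside {J : Set ℂ} (hJ : IsCompact J) :
    ¬ Bornology.IsBounded (outside J) := by
  rw [← hull_compl]
  exact not_isBounded_compl_of_isCompact (isCompact_hull hJ)

namespace JordanCollar
variable {J : Set ℂ} {c : Circle × ℝ → ℂ}

lemma mem_iff (h : JordanCollar J c) (s : Circle) (t : ℝ) : c (s, t) ∈ J ↔ t = 0 := by
  rw [← h.zero, h.emb.injective.mem_set_image]
  simp

lemma mem_inside_iff (h : JordanCollar J c) (s : Circle) (t : ℝ) :
    c (s, t) ∈ inside J ↔ t < 0 := by
  refine ⟨fun hi => ?_, fun ht => h.neg (mem_image_of_mem _ ⟨mem_univ _, ht⟩)⟩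
  by_contra! ht
  rcases ht.eq_or_lt with ht | ht
  · exact hi.1 ((h.mem_iff s t).2 ht.symm)
  · exact disjoint_left.1 (disjoint_inside_outside J) hi
      (h.pos (mem_image_of_mem _ ⟨mem_univ _, ht⟩))

lemma mem_outside_iff (h : JordanCollar J c) (s : Circle) (t : ℝ) :
    c (s, t) ∈ outside J ↔ 0 < t := by
  refine ⟨fun hi => ?_, fun ht => h.pos (mem_image_of_mem _ ⟨mem_univ _, ht⟩)⟩
  by_contra! ht
  rcases ht.eq_or_lt with ht | ht
  · exact hi.1 ((h.mem_iff s t).2 ht)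
  · exact disjoint_left.1 (disjoint_inside_outside J)
      (h.neg ⟨(s, t), ⟨mem_univ _, ht⟩, rfl⟩) hi

lemma mem_hull_iff (h : JordanCollar J c) (s : Circle) (t : ℝ) :
    c (s, t) ∈ hull J ↔ t ≤ 0 := by
  rw [hull, mem_union, h.mem_iff, h.mem_inside_iff]
  exact ⟨fun h => h.elim le_of_eq le_of_lt, fun h => h.eq_or_lt⟩

lemma eq_param (h : JordanCollar J c) {x : ℂ} (hx : x ∈ J) : ∃ s, c (s, 0) = x := by
  rw [← h.zero] at hx
  obtain ⟨⟨s, t⟩, ⟨-, rfl⟩, rfl⟩ := hx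
  exact ⟨s, rfl⟩

/-- Small neighbourhoods of a point of the curve are cut by the curve into two connected halves. -/
lemma exists_halves (h : JordanCollar J c) {x : ℂ} (hx : x ∈ J) {V : Set ℂ} (hV : V ∈ 𝓝 x) :
    ∃ N, IsOpen N ∧ x ∈ N ∧ N ⊆ V ∧ IsPreconnected (N ∩ inside J) ∧
      IsPreconnected (N ∩ outside J) ∧ (N ∩ inside J).Nonempty ∧ (N ∩ outside J).Nonempty := by
  obtain ⟨s, rfl⟩ := h.eq_param hx
  have hpre : c ⁻¹' V ∈ 𝓝 (s, (0 : ℝ)) := h.emb.continuous.continuousAt.preimage_mem_nhds hV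
  rw [nhds_prod_eq, Filter.mem_prod_iff] at hpre
  obtain ⟨A, hA, B, hB, hAB⟩ := hpre
  obtain ⟨ε, hε, hεB⟩ := Metric.mem_nhds_iff.1 hB
  obtain ⟨W, hWo, hsW, hWc, hWA⟩ : ∃ W, IsOpen W ∧ s ∈ W ∧ IsPreconnected W ∧ W ⊆ A := by
    have hcont : ContinuousAt (fun t : ℝ => s * Circle.exp t) 0 := by fun_prop
    have hA' : A ∈ 𝓝 (s * Circle.exp 0) := by simpa using hA
    obtain ⟨δ, hδ, hδA⟩ := Metric.mem_nhds_iff.1 (hcont.preimage_mem_nhds hA')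
    refine ⟨(fun t : ℝ => s * Circle.exp t) '' Metric.ball 0 δ, ?_, ⟨0, by simpa using hδ, by simp⟩,
      (convex_ball (0 : ℝ) δ).isPreconnected.image _ (by fun_prop), ?_⟩
    · refine ((Homeomorph.mulLeft s).isOpenMap.comp Circle.isCoveringMap_exp.isLocalHomeomorph.isOpenMap) _
        Metric.isOpen_ball
    · rintro _ ⟨t, ht, rfl⟩
      exact hδA ht
  have hball : Metric.ball (0 : ℝ) ε = Ioo (-ε) ε := by rw [Real.ball_eq_Ioo]; simp
  rw [hball] at hεB
  have himg : ∀ P : Set ℂ, ∀ T : Set ℝ, (∀ s t, c (s, t) ∈ P ↔ t ∈ T) →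
      c '' (W ×ˢ Ioo (-ε) ε) ∩ P = c '' (W ×ˢ (Ioo (-ε) ε ∩ T)) := by
    intro P T hPT
    ext y
    constructor
    · rintro ⟨⟨⟨s', t⟩, ⟨h1, h2⟩, rfl⟩, hP⟩
      exact mem_image_of_mem _ ⟨h1, h2, (hPT _ _).1 hP⟩
    · rintro ⟨⟨s', t⟩, ⟨h1, h2, h3⟩, rfl⟩
      exact ⟨mem_image_of_mem _ ⟨h1, h2⟩, (hPT _ _).2 h3⟩
  have hi := himg (inside J) (Iio 0) fun s t => h.mem_inside_iff s t
  have ho := himg (outside J) (Ioi 0) fun s t => h.mem_outside_iff s t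
  refine ⟨c '' (W ×ˢ Ioo (-ε) ε), h.emb.isOpenMap _ (hWo.prod isOpen_Ioo),
    mem_image_of_mem _ ⟨hsW, by simpa using hε⟩, ?_, ?_, ?_, ?_, ?_⟩
  · rintro _ ⟨q, ⟨hq1, hq2⟩, rfl⟩
    exact hAB ⟨hWA hq1, hεB hq2⟩
  · rw [hi]
    exact (hWc.prod (ordConnected_Ioo.inter ordConnected_Iio).isPreconnected).image _
      h.emb.continuous.continuousOn
  · rw [ho]
    exact (hWc.prod (ordConnected_Ioo.inter ordConnected_Ioi).isPreconnected).image _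
      h.emb.continuous.continuousOn
  · rw [hi]
    exact ⟨_, mem_image_of_mem _ (⟨hsW, ⟨by constructor <;> linarith, by simp only [mem_Iio]; linarith⟩⟩ :
      (s, -ε / 2) ∈ W ×ˢ (Ioo (-ε) ε ∩ Iio 0))⟩
  · rw [ho]
    exact ⟨_, mem_image_of_mem _ (⟨hsW, ⟨by constructor <;> linarith, by simpa using hε⟩⟩ :
      (s, ε / 2) ∈ W ×ˢ (Ioo (-ε) ε ∩ Ioi 0))⟩

end JordanCollar

section
variable {J : Set ℂ}

lemma isPreconnected_inside (hT : PlaneTwoSided) (hJ : IsCircle J) : IsPreconnected (inside J) :=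
  (exists_jordanCollar hT hJ).choose_spec.conn_inside

lemma isPreconnected_outside (hT : PlaneTwoSided) (hJ : IsCircle J) : IsPreconnected (outside J) :=
  (exists_jordanCollar hT hJ).choose_spec.conn_outside

lemma subset_closure_inside (hT : PlaneTwoSided) (hJ : IsCircle J) : J ⊆ closure (inside J) := by
  obtain ⟨c, hc⟩ := exists_jordanCollar hT hJ
  intro x hx
  rw [mem_closure_iff_nhds]
  intro V hV
  obtain ⟨N, -, -, hNV, -, -, h, -⟩ := hc.exists_halves hx hV
  exact h.mono (inter_subset_inter_left _ hNV)

lemma subset_closure_outside (hT : PlaneTwoSided) (hJ : IsCircle J) : J ⊆ closure (outside J) := by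
  obtain ⟨c, hc⟩ := exists_jordanCollar hT hJ
  intro x hx
  rw [mem_closure_iff_nhds]
  intro V hV
  obtain ⟨N, -, -, hNV, -, -, -, h⟩ := hc.exists_halves hx hV
  exact h.mono (inter_subset_inter_left _ hNV)

lemma inside_nonempty (hT : PlaneTwoSided) (hJ : IsCircle J) : (inside J).Nonempty := by
  obtain ⟨x, hx⟩ := hJ.nonempty
  exact closure_nonempty_iff.1 ⟨x, subset_closure_inside hT hJ hx⟩

lemma closure_inside (hT : PlaneTwoSided) (hJ : IsCircle J) : closure (inside J) = hull J := by
  refine Subset.antisymm ?_ ?_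
  · exact closure_minimal (inside_subset_hull J) (isClosed_hull hJ.isCompact)
  · exact union_subset (subset_closure_inside hT hJ) subset_closure

/-- A nonempty bounded open set whose frontier lies on the curve is the interior domain. -/
lemma eq_inside_of_frontier_subset (hT : PlaneTwoSided) (hJ : IsCircle J) {O : Set ℂ}
    (hO : IsOpen O) (hb : Bornology.IsBounded O)
    (hne : O.Nonempty) (hOJ : Disjoint O J) (hfr : frontier O ⊆ J) : O = inside J := by
  have h1 : O ⊆ inside J := by
    intro x hx
    have : x ∈ inside J ∪ outside J := by
      rw [inside_union_outside]; exact disjoint_left.1 hOJ hx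
    refine this.resolve_right fun hxo => not_isBounded_outside hJ.isCompact (hb.subset ?_)
    exact (isPreconnected_outside hT hJ).subset_of_disjoint_frontier hO
      ((disjoint_outside J).mono_right hfr) ⟨x, hxo, hx⟩
  refine Subset.antisymm h1 ?_
  obtain ⟨x, hx⟩ := hne
  exact (isPreconnected_inside hT hJ).subset_of_disjoint_frontier hO
      ((disjoint_inside J).mono_right hfr) ⟨x, h1 hx, hx⟩

lemma hull_subset_hull (hT : PlaneTwoSided) (hJ : IsCircle J) {J' : Set ℂ}
    (hJ' : J' ⊆ hull J) : hull J' ⊆ hull J := by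
  rw [← compl_subset_compl, hull_compl, hull_compl]
  refine (isPreconnected_outside hT hJ).subset_outside_of_unbounded ?_
    (not_isBounded_outside hJ.isCompact)
  rw [← hull_compl]
  exact disjoint_left.2 fun x hx hx' => hx (hJ' hx')

lemma inside_subset_inside (hT : PlaneTwoSided) (hJ : IsCircle J) {J' : Set ℂ}
    (hJ'c : IsCompact J') (hJ' : J' ⊆ hull J) :
    inside J' ⊆ inside J := by
  intro x hx
  refine ((hull_subset_hull hT hJ hJ') (inside_subset_hull _ hx)).resolve_left fun hxJ => ?_
  obtain ⟨y, hy, hy'⟩ := mem_closure_iff.1 (subset_closure_outside hT hJ hxJ) _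
    (isOpen_inside hJ'c) hx
  rw [← hull_compl] at hy'
  exact hy' (hull_subset_hull hT hJ hJ' (inside_subset_hull _ hy))

end

/-- The inverse of a continuous injection between surfaces is continuous. -/
lemma continuousOn_leftInverse_of_isOpen {X Y : Type*} [TopologicalSpace X] [TopologicalSpace Y]
    [LocallyPlanar X] [LocallyPlanar Y] {f : X → Y} {g : Y → X} {U : Set X} (hU : IsOpen U)
    (hf : ContinuousOn f U) (hg : ∀ x ∈ U, g (f x) = x) : ContinuousOn g (f '' U) := by
  have hinj : InjOn f U := fun x hx y hy h => by rw [← hg x hx, ← hg y hy, h]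
  rintro _ ⟨x, hx, rfl⟩
  refine ContinuousAt.continuousWithinAt ?_
  rw [ContinuousAt, hg x hx]
  intro V hV
  obtain ⟨V', hV'V, hV'o, hxV'⟩ := mem_nhds_iff.1 hV
  have h1 : IsOpen (f '' (U ∩ V')) := isOpen_image_of_injOn (hU.inter hV'o)
    (hf.mono inter_subset_left) (hinj.mono inter_subset_left)
  rw [Filter.mem_map]
  refine Filter.mem_of_superset (h1.mem_nhds (mem_image_of_mem _ ⟨hx, hxV'⟩)) ?_
  rintro _ ⟨y, ⟨hy, hyV'⟩, rfl⟩
  rw [mem_preimage, hg y hy]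
  exact hV'V hyV'

/-- A continuous injection of the plane into a ball which is the identity near the centre. -/
lemma exists_squeeze (a : ℂ) {δ : ℝ} (hδ : 0 < δ) :
    ∃ θ : ℂ → ℂ, Continuous θ ∧ Function.Injective θ ∧ (∀ v ∈ Metric.closedBall a δ, θ v = v) ∧
      ∀ v, θ v ∈ Metric.ball a (2 * δ) := by
  let m : ℂ → ℝ := fun v => max ‖v - a‖ δ
  let l : ℝ → ℝ := fun m => (2 * δ * m - δ ^ 2) / m ^ 2
  have hm : ∀ v, δ ≤ m v := fun v => le_max_right _ _
  have hl : ∀ x, δ ≤ x → 0 < l x := by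
    intro x hx
    have : 0 < x := hδ.trans_le hx
    have : 0 < 2 * δ * x - δ ^ 2 := by nlinarith
    positivity
  let θ : ℂ → ℂ := fun v => a + (l (m v) : ℝ) * (v - a)
  have hnorm : ∀ v, ‖θ v - a‖ = l (m v) * ‖v - a‖ := by
    intro v
    simp only [θ, add_sub_cancel_left, norm_mul, Complex.norm_real, Real.norm_eq_abs,
      abs_of_pos (hl _ (hm v))]
  have hl1 : l δ = 1 := by
    simp only [l]; field_simp; ring
  have hsmall : ∀ v, ‖v - a‖ ≤ δ → ‖θ v - a‖ = ‖v - a‖ := by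
    intro v hv
    rw [hnorm]
    simp only [m, max_eq_right hv, hl1, one_mul]
  have hlarge : ∀ v, δ ≤ ‖v - a‖ → ‖θ v - a‖ = 2 * δ - δ ^ 2 / ‖v - a‖ := by
    intro v hv
    rw [hnorm]
    simp only [m, max_eq_left hv, l]
    have : ‖v - a‖ ≠ 0 := (hδ.trans_le hv).ne'
    field_simp
  refine ⟨θ, ?_, ?_, ?_, ?_⟩
  · have hmc : Continuous m := by fun_prop
    have : Continuous (fun v => l (m v)) := by
      simp only [l]
      refine Continuous.div (by fun_prop) (by fun_prop) ?_
      intro v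
      have := hδ.trans_le (hm v)
      positivity
    exact continuous_const.add
      ((Complex.continuous_ofReal.comp this).mul (continuous_id.sub continuous_const))
  · intro v w hvw
    have hn : ‖θ v - a‖ = ‖θ w - a‖ := by rw [hvw]
    have key : ∀ v w : ℂ, ‖v - a‖ < ‖w - a‖ → ‖θ v - a‖ < ‖θ w - a‖ := by
      intro v w h
      rcases le_total ‖w - a‖ δ with h1 | h1
      · rw [hsmall v (h.le.trans h1), hsmall w h1]; exact h
      · have hw0 : 0 < ‖w - a‖ := hδ.trans_le h1
        rcases le_total ‖v - a‖ δ with h2 | h2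
        · rw [hsmall v h2, hlarge w h1]
          rcases h2.eq_or_lt with h3 | h3
          · have : δ ^ 2 / ‖w - a‖ < δ := by
              rw [div_lt_iff₀ hw0]; nlinarith
            linarith
          · have : δ ^ 2 / ‖w - a‖ ≤ δ := by
              rw [div_le_iff₀ hw0]; nlinarith
            linarith
        · rw [hlarge v h2, hlarge w h1]
          have : δ ^ 2 / ‖w - a‖ < δ ^ 2 / ‖v - a‖ :=
            div_lt_div_of_pos_left (by positivity) (hδ.trans_le h2) h
          linarith
    have hvw' : ‖v - a‖ = ‖w - a‖ := by
      rcases lt_trichotomy ‖v - a‖ ‖w - a‖ with h | h | h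
      · exact absurd hn (key v w h).ne
      · exact h
      · exact absurd hn (key w v h).ne'
    have hmm : m v = m w := by simp only [m, hvw']
    simp only [θ, hmm, add_right_inj] at hvw
    have := mul_left_cancel₀ (by exact_mod_cast (hl _ (hm w)).ne') hvw
    simpa using this
  · intro v hv
    rw [Metric.mem_closedBall, dist_eq_norm] at hv
    simp only [θ, m, max_eq_right hv, hl1]
    simp
  · intro v
    rw [Metric.mem_ball, dist_eq_norm]
    rcases le_total ‖v - a‖ δ with h | h
    · rw [hsmall v h]; linarith
    · rw [hlarge v h]
      have : 0 < δ ^ 2 / ‖v - a‖ := div_pos (by positivity) (hδ.trans_le h)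
      linarith

/-- If `F` collapses at most the two fibres over `a` and `b` of a closed disc, then there is a
self-map of the disc collapsing only the fibre over `b`, equal to the identity near the fibre over
`a`, and with image close to that fibre. -/
lemma exists_collapse_one {R : ℝ} {F : ℂ → ℂ} {a b : ℂ}
    (hF : ContinuousOn F (Metric.closedBall 0 R)) (hab : a ≠ b)
    (hinj : ∀ z ∈ Metric.closedBall (0 : ℂ) R, ∀ w ∈ Metric.closedBall (0 : ℂ) R,
      F z = F w → z = w ∨ F z = a ∨ F z = b)
    (hXb : ∀ z ∈ Metric.closedBall (0 : ℂ) R, F z = a → z ∈ Metric.ball (0 : ℂ) R)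
    (ha : F '' Metric.ball 0 R ∈ 𝓝 a) {V : Set ℂ} (hV : V ∈ 𝓝 a) :
    ∃ (G : ℂ → ℂ) (q : ℂ), ContinuousOn G (Metric.closedBall 0 R) ∧
      (∀ z ∈ Metric.closedBall (0 : ℂ) R, G z ∈ Metric.ball (0 : ℂ) R) ∧
      (∀ z ∈ Metric.closedBall (0 : ℂ) R, F z = a → G z = z) ∧
      (∀ z ∈ Metric.closedBall (0 : ℂ) R, F (G z) ∈ V) ∧
      (∀ z ∈ Metric.closedBall (0 : ℂ) R, ∀ w ∈ Metric.closedBall (0 : ℂ) R,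
        G z = G w → z = w ∨ G z = q) ∧
      (∀ z ∈ Metric.closedBall (0 : ℂ) R, G z = q ↔ F z = b) ∧
      (F '' Metric.ball 0 R ∈ 𝓝 b → G '' Metric.ball 0 R ∈ 𝓝 q) ∧ F q ≠ a := by
  classical
  have hn : V ∩ F '' Metric.ball 0 R ∩ {b}ᶜ ∈ 𝓝 a :=
    Filter.inter_mem (Filter.inter_mem hV ha) (isOpen_compl_singleton.mem_nhds hab)
  obtain ⟨ε, hε, hεs⟩ := Metric.mem_nhds_iff.1 hn
  obtain ⟨θ, hθc, hθi, hθid, hθb⟩ := exists_squeeze a (half_pos hε)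
  rw [mul_div_cancel₀ ε two_ne_zero] at hθb
  have hsub : Metric.ball (0 : ℂ) R ⊆ Metric.closedBall 0 R := Metric.ball_subset_closedBall
  set inv := Function.invFunOn F (Metric.ball (0 : ℂ) R) with hinv
  have hinvmem : ∀ v ∈ Metric.ball a ε, inv v ∈ Metric.ball (0 : ℂ) R := fun v hv =>
    Function.invFunOn_mem (hεs hv).1.2
  have hFinv : ∀ v ∈ Metric.ball a ε, F (inv v) = v := fun v hv =>
    Function.invFunOn_eq (hεs hv).1.2
  have huniq : ∀ v ∈ Metric.ball a ε, v ≠ a → ∀ z ∈ Metric.closedBall (0 : ℂ) R, F z = v →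
      inv v = z := by
    intro v hv hva z hz hzv
    have := hinj _ (hsub (hinvmem v hv)) z hz (by rw [hFinv v hv, hzv])
    rw [hFinv v hv] at this
    refine this.resolve_right ?_
    rintro (h | h)
    · exact hva h
    · exact (hεs hv).2 h
  have hθa : θ a = a := hθid a (Metric.mem_closedBall_self (half_pos hε).le)
  have hθne : ∀ v, v ≠ a → θ v ≠ a := fun v hv h => hv (hθi (h.trans hθa.symm))
  let G : ℂ → ℂ := fun z => if F z = a then z else inv (θ (F z))
  have hG1 : ∀ z, F z = a → G z = z := fun z h => by simp [G, h]
  have hG2 : ∀ z, F z ≠ a → G z = inv (θ (F z)) := fun z h => by simp [G, h]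
  have hFG : ∀ z, F (G z) = θ (F z) := by
    intro z
    by_cases h : F z = a
    · rw [hG1 z h, h, hθa]
    · rw [hG2 z h, hFinv _ (hθb _)]
  have hGid : ∀ z ∈ Metric.closedBall (0 : ℂ) R, F z ∈ Metric.closedBall a (ε / 2) → G z = z := by
    intro z hz hzF
    by_cases h : F z = a
    · exact hG1 z h
    · rw [hG2 z h]
      exact huniq _ (hθb _) (hθne _ h) z hz (hθid _ hzF).symm
  have hGball : ∀ z ∈ Metric.closedBall (0 : ℂ) R, G z ∈ Metric.ball (0 : ℂ) R := by
    intro z hz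
    by_cases h : F z = a
    · rw [hG1 z h]; exact hXb z hz h
    · rw [hG2 z h]; exact hinvmem _ (hθb _)
  have hGinj : ∀ z ∈ Metric.closedBall (0 : ℂ) R, ∀ w ∈ Metric.closedBall (0 : ℂ) R,
      G z = G w → z = w ∨ F z = b := by
    intro z hz w hw h
    have h1 : F z = F w := hθi (by rw [← hFG, ← hFG, h])
    rcases hinj z hz w hw h1 with h2 | h2 | h2
    · exact Or.inl h2
    · left
      rwa [hG1 z h2, hG1 w (h1 ▸ h2)] at h
    · exact Or.inr h2
  have hinvc : ContinuousOn inv (Metric.ball a ε \ {a}) := by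
    have hU : IsOpen (Metric.ball (0 : ℂ) R ∩ F ⁻¹' (Metric.ball a ε \ {a})) :=
      (hF.mono hsub).isOpen_inter_preimage Metric.isOpen_ball
        (Metric.isOpen_ball.sdiff isClosed_singleton)
    refine (continuousOn_leftInverse_of_isOpen hU
      (hF.mono (inter_subset_left.trans hsub)) ?_).mono ?_
    · rintro z ⟨hz, hzF⟩
      exact huniq _ hzF.1 hzF.2 z (hsub hz) rfl
    · rintro v hv
      exact ⟨inv v, ⟨hinvmem v hv.1, by rw [mem_preimage, hFinv v hv.1]; exact hv⟩, hFinv v hv.1⟩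
  have hθbne : θ b ≠ a := hθne b hab.symm
  have hFq : F (inv (θ b)) = θ b := hFinv _ (hθb _)
  have hGq : ∀ z ∈ Metric.closedBall (0 : ℂ) R, G z = inv (θ b) ↔ F z = b := by
    intro z hz
    constructor
    · intro h
      apply hθi
      rw [← hFG, h, hFq]
    · intro h
      rw [hG2 z (by rw [h]; exact hab.symm), h]
  refine ⟨G, inv (θ b), ?_, hGball, fun z _ => hG1 z, ?_, ?_, hGq, ?_, ?_⟩
  · intro z hz
    by_cases h : F z = a
    · have h1 : ∀ᶠ y in 𝓝[Metric.closedBall 0 R] z, F y ∈ Metric.ball a (ε / 2) := by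
        refine (hF z hz).eventually_mem ?_
        rw [h]
        exact Metric.ball_mem_nhds _ (by positivity)
      refine continuousWithinAt_id.congr_of_eventuallyEq ?_ (hG1 z h)
      filter_upwards [h1, self_mem_nhdsWithin] with y hy hy'
      exact hGid y hy' (Metric.ball_subset_closedBall hy)
    · have h1 : ∀ᶠ y in 𝓝[Metric.closedBall 0 R] z, F y ∈ ({a}ᶜ : Set ℂ) :=
        (hF z hz).eventually_mem (isOpen_compl_singleton.mem_nhds h)
      have h2 : ContinuousAt inv (θ (F z)) := hinvc.continuousAt
        ((Metric.isOpen_ball.sdiff isClosed_singleton).mem_nhds ⟨hθb _, hθne _ h⟩)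
      have h3 : ContinuousWithinAt (fun y => inv (θ (F y))) (Metric.closedBall 0 R) z :=
        h2.comp_continuousWithinAt (f := fun y => θ (F y))
          (hθc.continuousAt.comp_continuousWithinAt (hF z hz))
      refine h3.congr_of_eventuallyEq ?_ (hG2 z h)
      filter_upwards [h1] with y hy
      exact hG2 y hy
  · intro z hz
    rw [hFG]
    exact (hεs (hθb _)).1.1
  · intro z hz w hw h
    rcases hGinj z hz w hw h with h1 | h1
    · exact Or.inl h1
    · exact Or.inr ((hGq z hz).2 h1)
  · intro hb
    have hb' : θ '' (F '' Metric.ball 0 R) ∈ 𝓝 (θ b) := by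
      have : IsOpenMap θ := fun U hU => isOpen_image_of_injOn_complex hU hθc.continuousOn hθi.injOn
      exact this.image_mem_nhds hb
    have hqball := hinvmem (θ b) (hθb _)
    have hFat : ContinuousAt F (inv (θ b)) :=
      (hF.mono hsub).continuousAt (Metric.isOpen_ball.mem_nhds hqball)
    have h1 : ∀ᶠ y in 𝓝 (inv (θ b)), F y ∈ θ '' (F '' Metric.ball 0 R) ∩ {a}ᶜ := by
      refine hFat.eventually_mem ?_
      rw [hFq]
      exact Filter.inter_mem hb' (isOpen_compl_singleton.mem_nhds hθbne)
    filter_upwards [h1, Metric.isOpen_ball.mem_nhds hqball] with y hy hyb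
    obtain ⟨⟨_, ⟨z, hz, rfl⟩, hzy⟩, hya⟩ := hy
    refine ⟨z, hz, ?_⟩
    have hza : F z ≠ a := by
      intro h
      rw [h, hθa] at hzy
      exact hya hzy.symm
    rw [hG2 z hza]
    exact huniq _ (hθb _) (hθne _ hza) y (hsub hyb) hzy.symm
  · rw [hFq]
    exact hθbne

/-- The interior side of an open bicollar, extended by the polar coordinate of the collar. -/
lemma exists_radial_coordinate {A : Set ℂ} {c : Circle × ℝ → ℂ} (hc : IsOpenEmbedding c)
    (hAc : Disjoint A (range c)) (hO : ∀ r : ℝ, IsOpen (A ∪ c '' (univ ×ˢ Iio r))) :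
    ∃ u : ℂ → ℂ, ContinuousOn u (A ∪ range c) ∧ (∀ z ∈ A, u z = 0) ∧ ∀ q, u (c q) = pol q := by
  classical
  let u : ℂ → ℂ := fun z => if z ∈ A then 0 else pol (Function.invFun c z)
  have hu0 : ∀ z ∈ A, u z = 0 := fun z hz => if_pos hz
  have huc : ∀ q, u (c q) = pol q := by
    intro q
    have : c q ∉ A := fun h => hAc.le_bot ⟨h, mem_range_self q⟩
    simp only [u, if_neg this, Function.leftInverse_invFun hc.injective q]
  refine ⟨u, ?_, hu0, huc⟩
  intro z hz
  refine ContinuousAt.continuousWithinAt ?_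
  rcases hz with hz | ⟨q, rfl⟩
  · rw [ContinuousAt, hu0 z hz, tendsto_zero_iff_norm_tendsto_zero, Metric.tendsto_nhds]
    intro ε hε
    have hN := (hO (Real.log ε)).mem_nhds (Or.inl hz)
    filter_upwards [hN] with y hy
    rw [Real.dist_eq, sub_zero, abs_of_nonneg (norm_nonneg _)]
    rcases hy with hy | ⟨⟨s, t⟩, ⟨-, ht⟩, rfl⟩
    · rw [hu0 y hy, norm_zero]; exact hε
    · rw [huc, norm_pol, ← Real.exp_log hε]
      exact Real.exp_lt_exp.2 ht
  · rw [← hc.continuousAt_iff (f := c)]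
    exact continuous_pol.continuousAt.congr (Filter.Eventually.of_forall fun y => (huc y).symm)

/-- **Brown's theorem** for a bicollar in the plane: the bounded side is contained in the image of
an open disc whose closure is contained in the union of that side and the collar. -/
lemma exists_disc {A : Set ℂ} {c : Circle × ℝ → ℂ} (hc : IsOpenEmbedding c)
    (hAc : Disjoint A (range c)) (hA : A.Nonempty)
    (hK : ∀ r : ℝ, IsCompact (A ∪ c '' (univ ×ˢ Iic r)))
    (hO : ∀ r : ℝ, IsOpen (A ∪ c '' (univ ×ˢ Iio r))) :
    ∃ κ : ℂ → ℂ, ContinuousOn κ (Metric.closedBall 0 1) ∧ InjOn κ (Metric.closedBall 0 1) ∧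
      A ⊆ κ '' Metric.ball 0 1 ∧ κ '' Metric.closedBall 0 1 ⊆ A ∪ range c := by
  classical
  obtain ⟨u, huC, hu0, huc⟩ := exists_radial_coordinate hc hAc hO
  set O : Set ℂ := A ∪ range c with hOdef
  have hOo : IsOpen O := by
    have : O = (A ∪ c '' (univ ×ˢ Iio 0)) ∪ range c := by
      rw [hOdef, union_assoc, union_eq_self_of_subset_left (image_subset_range _ _)]
    rw [this]
    exact (hO 0).union hc.isOpen_range
  set p := c (1, 0) with hp
  have hupol : ∀ z ∈ O, u z ≠ 0 → c (polInv (u z)) = z := by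
    rintro z (hz | ⟨q, rfl⟩) h
    · exact absurd (hu0 z hz) h
    · rw [huc, polInv_pol]
  have hu1 : ∀ z ∈ O, u z = 1 → z = p := by
    intro z hz h
    have h1 : pol (1, 0) = 1 := by rw [← huc]; simp [huc, pol]
    have := hupol z hz (by rw [h]; exact one_ne_zero)
    rw [h, ← h1, polInv_pol] at this
    exact this.symm
  have huinj : ∀ z ∈ O, ∀ z' ∈ O, u z = u z' → z = z' ∨ u z = 0 := by
    intro z hz z' hz' h
    by_cases h0 : u z = 0
    · exact Or.inr h0
    · left
      rw [← hupol z hz h0, ← hupol z' hz' (h ▸ h0), h]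
  have huA : ∀ z ∈ O, u z = 0 → z ∈ A := by
    rintro z (hz | ⟨q, rfl⟩) h
    · exact hz
    · exact absurd h (by rw [huc]; exact pol_ne_zero q)
  let Ψ : ℂ → ℂ := fun w => if w ≠ 0 ∧ p + w⁻¹ ∈ O then (u (p + w⁻¹) - 1)⁻¹ else 0
  have hΨ1 : ∀ w, w ≠ 0 → p + w⁻¹ ∈ O → Ψ w = (u (p + w⁻¹) - 1)⁻¹ := fun w h1 h2 =>
    if_pos ⟨h1, h2⟩
  have hΨ2 : ∀ w, ¬ (w ≠ 0 ∧ p + w⁻¹ ∈ O) → Ψ w = 0 := fun w h => if_neg h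
  have hne1 : ∀ w, w ≠ 0 → p + w⁻¹ ∈ O → u (p + w⁻¹) - 1 ≠ 0 := by
    intro w hw hwO h
    have := hu1 _ hwO (sub_eq_zero.1 h)
    exact inv_ne_zero hw (by simpa using this)
  have hΨ0 : ∀ w, Ψ w = 0 ↔ ¬ (w ≠ 0 ∧ p + w⁻¹ ∈ O) := by
    intro w
    refine ⟨fun h hw => ?_, hΨ2 w⟩
    rw [hΨ1 w hw.1 hw.2] at h
    exact inv_ne_zero (hne1 w hw.1 hw.2) h
  have hΨm : ∀ w, Ψ w = -1 ↔ w ≠ 0 ∧ p + w⁻¹ ∈ A := by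
    intro w
    constructor
    · intro h
      by_cases hw : w ≠ 0 ∧ p + w⁻¹ ∈ O
      · refine ⟨hw.1, huA _ hw.2 ?_⟩
        rw [hΨ1 w hw.1 hw.2, inv_eq_iff_eq_inv] at h
        have : u (p + w⁻¹) - 1 = -1 := by rw [h]; norm_num
        linear_combination this
      · rw [hΨ2 w hw] at h
        norm_num at h
    · intro h
      rw [hΨ1 w h.1 (Or.inl h.2), hu0 _ h.2]
      norm_num
  have hinvinj : ∀ w w' : ℂ, p + w⁻¹ = p + w'⁻¹ → w = w' := fun w w' h =>
    inv_injective (add_left_cancel h)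
  have hΨinj : ∀ w w', Ψ w = Ψ w' → w = w' ∨ Ψ w = 0 ∨ Ψ w = -1 := by
    intro w w' h
    by_cases hw : w ≠ 0 ∧ p + w⁻¹ ∈ O
    · by_cases hw' : w' ≠ 0 ∧ p + w'⁻¹ ∈ O
      · have h1 := h
        rw [hΨ1 w hw.1 hw.2, hΨ1 w' hw'.1 hw'.2, inv_inj, sub_left_inj] at h1
        rcases huinj _ hw.2 _ hw'.2 h1 with h2 | h2
        · exact Or.inl (hinvinj _ _ h2)
        · exact Or.inr (Or.inr ((hΨm w).2 ⟨hw.1, huA _ hw.2 h2⟩))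
      · exact Or.inr (Or.inl (h.trans (hΨ2 w' hw')))
    · exact Or.inr (Or.inl (hΨ2 w hw))
  have hZc : ∀ w : ℂ, w ≠ 0 → ContinuousAt (fun w : ℂ => p + w⁻¹) w := fun w hw =>
    continuousAt_const.add (continuousAt_inv₀ hw)
  have hΨc : Continuous Ψ := by
    rw [continuous_iff_continuousAt]
    intro w
    by_cases hw : w ≠ 0 ∧ p + w⁻¹ ∈ O
    · have h1 : ∀ᶠ y in 𝓝 w, y ≠ 0 ∧ p + y⁻¹ ∈ O :=
        Filter.Eventually.and (isOpen_ne.mem_nhds hw.1) ((hZc w hw.1).eventually_mem (hOo.mem_nhds hw.2))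
      have h2 : ContinuousAt (fun y => u (p + y⁻¹)) w :=
        ContinuousAt.comp (g := u) (f := fun y : ℂ => p + y⁻¹)
          (huC.continuousAt (hOo.mem_nhds hw.2)) (hZc w hw.1)
      have h3 : ContinuousAt (fun y => (u (p + y⁻¹) - 1)⁻¹) w :=
        (h2.sub continuousAt_const).inv₀ (hne1 w hw.1 hw.2)
      exact h3.congr (h1.mono fun y hy => (hΨ1 y hy.1 hy.2).symm)
    · rw [ContinuousAt, hΨ2 w hw, Metric.tendsto_nhds]
      intro ε hε
      set r := Real.log (1 + ε⁻¹ + 1) with hr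
      have hexp : Real.exp r = 1 + ε⁻¹ + 1 := Real.exp_log (by positivity)
      have h1 : ∀ᶠ y in 𝓝 w, y ≠ 0 → p + y⁻¹ ∉ A ∪ c '' (univ ×ˢ Iic r) := by
        by_cases hw0 : w = 0
        · obtain ⟨M, hM⟩ := (hK r).isBounded.exists_norm_le
          have h2 : ∀ᶠ y in 𝓝 (0 : ℂ), ‖y‖ * (|M| + ‖p‖ + 1) < 1 := by
            have : ContinuousAt (fun y : ℂ => ‖y‖ * (|M| + ‖p‖ + 1)) 0 := by fun_prop
            exact this.eventually_lt continuousAt_const (by simp)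
          rw [hw0]
          filter_upwards [h2] with y hy hy0 hyA
          have h3 := hM _ hyA
          have h4 : ‖y⁻¹‖ ≤ |M| + ‖p‖ := by
            calc ‖y⁻¹‖ = ‖(p + y⁻¹) - p‖ := by ring_nf
              _ ≤ ‖p + y⁻¹‖ + ‖p‖ := norm_sub_le _ _
              _ ≤ |M| + ‖p‖ := by linarith [le_abs_self M]
          have h5 : 0 < ‖y‖ := norm_pos_iff.2 hy0
          have h6 : ‖y‖ * ‖y⁻¹‖ = 1 := by rw [norm_inv]; field_simp
          nlinarith
        · have h2 : p + w⁻¹ ∉ O := fun h => hw ⟨hw0, h⟩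
          have h3 : (A ∪ c '' (univ ×ˢ Iic r))ᶜ ∈ 𝓝 (p + w⁻¹) := by
            refine (hK r).isClosed.isOpen_compl.mem_nhds fun h => h2 ?_
            exact union_subset_union_right A (image_subset_range _ _) h
          filter_upwards [(hZc w hw0).eventually_mem h3] with y hy _ using hy
      filter_upwards [h1] with y hy
      rw [dist_zero_right]
      by_cases hyO : y ≠ 0 ∧ p + y⁻¹ ∈ O
      · have h2 := hy hyO.1
        rw [hΨ1 y hyO.1 hyO.2]
        rcases hyO.2 with h3 | ⟨⟨s, t⟩, h3⟩
        · exact absurd (Or.inl h3) h2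
        · rw [← h3] at h2 ⊢
          have ht : r < t := by
            by_contra! h
            exact h2 (Or.inr ⟨(s, t), ⟨mem_univ _, h⟩, rfl⟩)
          have h4 : Real.exp r < ‖u (c (s, t))‖ := by
            rw [huc, norm_pol]; exact Real.exp_lt_exp.2 ht
          have h5 : ε⁻¹ < ‖u (c (s, t)) - 1‖ := by
            have := norm_sub_norm_le (u (c (s, t))) 1
            rw [norm_one] at this
            linarith
          rw [norm_inv]
          exact inv_lt_of_inv_lt₀ hε h5
      · rw [hΨ2 y hyO, norm_zero]; exact hε
  have hW : c '' (univ ×ˢ Ioo (-1) 1) ∈ 𝓝 p :=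
    (hc.isOpenMap _ (isOpen_univ.prod isOpen_Ioo)).mem_nhds ⟨(1, 0), by simp, rfl⟩
  obtain ⟨η, hη, hηW⟩ := Metric.mem_nhds_iff.1 hW
  set R : ℝ := 2 / η with hR
  have hRpos : 0 < R := by positivity
  have hball : ∀ w : ℂ, w ≠ 0 → p + w⁻¹ ∉ c '' (univ ×ˢ Ioo (-1) 1) → w ∈ Metric.ball (0 : ℂ) R := by
    intro w hw h
    rw [mem_ball_zero_iff]
    by_contra! hwR
    refine h (hηW ?_)
    rw [Metric.mem_ball, dist_eq_norm, add_sub_cancel_left, norm_inv]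
    refine inv_lt_of_inv_lt₀ hη (lt_of_lt_of_le ?_ hwR)
    rw [hR, div_eq_mul_inv]
    have := inv_pos.2 hη
    linarith
  have hXB : ∀ w, Ψ w = 0 → w ∈ Metric.ball (0 : ℂ) R := by
    intro w hw
    rw [hΨ0] at hw
    by_cases h0 : w = 0
    · rw [h0]; exact Metric.mem_ball_self hRpos
    · exact hball w h0 fun h => hw ⟨h0, Or.inr (image_subset_range _ _ h)⟩
  have hXA : ∀ w, Ψ w = -1 → w ∈ Metric.ball (0 : ℂ) R := by
    intro w hw
    rw [hΨm] at hw
    exact hball w hw.1 fun h => hAc.le_bot ⟨hw.2, image_subset_range _ _ h⟩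
  have hsurj : ∀ v : ℂ, v ≠ 0 → v ≠ -1 →
      (polInv (1 + v⁻¹)).2 ∉ Ioo (-1 : ℝ) 1 → v ∈ Ψ '' Metric.ball 0 R := by
    intro v hv hv1 hvt
    have hu : 1 + v⁻¹ ≠ 0 := by
      intro h
      apply hv1
      have h2 : v⁻¹ = -1 := by linear_combination h
      rw [← inv_inv v, h2]; norm_num
    set q := polInv (1 + v⁻¹) with hq
    have hqp : c q ≠ p := by
      intro h
      have := hc.injective h
      rw [this] at hvt
      exact hvt (by norm_num)
    have h1 : p + ((c q - p)⁻¹)⁻¹ = c q := by rw [inv_inv]; ring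
    have h0 : (c q - p)⁻¹ ≠ 0 := inv_ne_zero (sub_ne_zero.2 hqp)
    refine ⟨(c q - p)⁻¹, hball _ h0 ?_, ?_⟩
    · rw [h1]
      rintro ⟨q', hq', h⟩
      rw [hc.injective h] at hq'
      exact hvt hq'.2
    · rw [hΨ1 _ h0 (by rw [h1]; exact Or.inr ⟨q, rfl⟩), h1, huc, hq, pol_polInv hu]
      simp
  have hpolInv2 : ∀ z : ℂ, z ≠ 0 → Real.exp (polInv z).2 = ‖z‖ := by
    intro z hz
    rw [← norm_pol, pol_polInv hz]
  have hn0 : Ψ '' Metric.ball 0 R ∈ 𝓝 (0 : ℂ) := by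
    filter_upwards [Metric.ball_mem_nhds (0 : ℂ) (show (0 : ℝ) < 1 / 5 by norm_num)] with v hv
    rw [mem_ball_zero_iff] at hv
    by_cases hv0 : v = 0
    · rw [hv0]
      exact ⟨0, Metric.mem_ball_self hRpos, hΨ2 0 (by simp)⟩
    · have h1 : 5 < ‖v⁻¹‖ := by
        rw [norm_inv]
        exact (lt_inv_comm₀ (by norm_num) (norm_pos_iff.2 hv0)).2 (by linarith)
      have h2 : 4 < ‖1 + v⁻¹‖ := by
        have := norm_sub_norm_le v⁻¹ (-1)
        rw [norm_neg, norm_one, sub_neg_eq_add, add_comm v⁻¹] at this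
        linarith
      refine hsurj v hv0 ?_ ?_
      · rintro rfl
        norm_num at hv
      · intro h
        have h3 := hpolInv2 (1 + v⁻¹) (by rw [← norm_pos_iff]; linarith)
        have h4 := Real.exp_lt_exp.2 h.2
        have := Real.exp_one_lt_d9
        linarith
  have hnm : Ψ '' Metric.ball 0 R ∈ 𝓝 (-1 : ℂ) := by
    have h1 : ContinuousAt (fun v : ℂ => ‖1 + v⁻¹‖) (-1) :=
      (continuousAt_const.add (continuousAt_inv₀ (by norm_num))).norm
    have h2 : ∀ᶠ v in 𝓝 (-1 : ℂ), ‖1 + v⁻¹‖ < Real.exp (-1) :=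
      h1.eventually_lt continuousAt_const (by norm_num; positivity)
    have h3 : ∀ᶠ v in 𝓝 (-1 : ℂ), v ≠ 0 := isOpen_ne.mem_nhds (by norm_num)
    filter_upwards [h2, h3] with v hv hv0
    by_cases hvm : v = -1
    · obtain ⟨z, hz⟩ := hA
      have hzp : z - p ≠ 0 := by
        intro h
        rw [sub_eq_zero] at h
        exact hAc.le_bot ⟨hz, h ▸ mem_range_self _⟩
      have : Ψ (z - p)⁻¹ = -1 := by
        rw [hΨm, inv_inv]
        exact ⟨inv_ne_zero hzp, by simpa using hz⟩
      rw [hvm]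
      exact ⟨_, hXA _ this, this⟩
    · refine hsurj v hv0 hvm ?_
      intro h
      have hu : 1 + v⁻¹ ≠ 0 := by
        intro h
        apply hvm
        have h2 : v⁻¹ = -1 := by linear_combination h
        rw [← inv_inv v, h2]; norm_num
      have h3 := hpolInv2 (1 + v⁻¹) hu
      have h4 := Real.exp_lt_exp.2 h.1
      linarith
  obtain ⟨G₁, q₁, hG₁c, hG₁b, hG₁id, hG₁V, hG₁inj, hG₁q, hG₁n, hG₁a⟩ :=
    exists_collapse_one (R := R) (a := 0) (b := -1) (V := {-1}ᶜ) hΨc.continuousOn (by norm_num)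
      (fun z _ w _ h => hΨinj z w h) (fun z _ => hXB z) hn0
      (isOpen_compl_singleton.mem_nhds (by norm_num))
  have hb0 : ∀ z ∈ Metric.closedBall (0 : ℂ) R, G₁ z ≠ R := by
    intro z hz h
    have := hG₁b z hz
    rw [h, mem_ball_zero_iff, Complex.norm_real, Real.norm_eq_abs, abs_of_pos hRpos] at this
    exact lt_irrefl _ this
  have hq₁R : q₁ ≠ R := by
    obtain ⟨w, hw, hwm⟩ : (-1 : ℂ) ∈ Ψ '' Metric.ball 0 R := mem_of_mem_nhds hnm
    have hw' := Metric.ball_subset_closedBall hw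
    rw [← (hG₁q w hw').2 hwm]
    exact hb0 w hw'
  obtain ⟨G₂, q₂, hG₂c, hG₂b, hG₂id, hG₂V, hG₂inj, hG₂q, -, -⟩ :=
    exists_collapse_one (R := R) (F := G₁) (a := q₁) (b := R) (V := {v | Ψ v ≠ 0}) hG₁c hq₁R
      (fun z hz w hw h => (hG₁inj z hz w hw h).imp_right Or.inl)
      (fun z hz h => hXA z ((hG₁q z hz).1 h)) (hG₁n hnm)
      ((isOpen_ne.preimage hΨc).mem_nhds hG₁a)
  have hG₂Ψ : ∀ z ∈ Metric.closedBall (0 : ℂ) R, Ψ (G₂ z) ≠ 0 := by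
    intro z hz h
    have h1 := hG₁id (G₂ z) (Metric.ball_subset_closedBall (hG₂b z hz)) h
    have h2 := hG₂V z hz
    rw [h1] at h2
    exact h2 h
  have hG₂' : ∀ z ∈ Metric.closedBall (0 : ℂ) R, G₂ z ≠ 0 ∧ p + (G₂ z)⁻¹ ∈ O := by
    intro z hz
    by_contra h
    exact hG₂Ψ z hz ((hΨ0 _).2 h)
  have hscale : ∀ w ∈ Metric.closedBall (0 : ℂ) 1, (R : ℂ) * w ∈ Metric.closedBall (0 : ℂ) R := by
    intro w hw
    rw [mem_closedBall_zero_iff] at hw ⊢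
    rw [norm_mul, Complex.norm_real, Real.norm_eq_abs, abs_of_pos hRpos]
    nlinarith
  have hR0 : (R : ℂ) ≠ 0 := by exact_mod_cast hRpos.ne'
  refine ⟨fun w => p + (G₂ (R * w))⁻¹, ?_, ?_, ?_, ?_⟩
  · refine continuousOn_const.add (ContinuousOn.inv₀ ?_ fun w hw => (hG₂' _ (hscale w hw)).1)
    exact hG₂c.comp (by fun_prop) hscale
  · intro w hw w' hw' h
    rcases hG₂inj _ (hscale w hw) _ (hscale w' hw') (hinvinj _ _ h) with h1 | h1
    · exact mul_left_cancel₀ hR0 h1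
    · exact absurd ((hG₂q _ (hscale w hw)).1 h1) (hb0 _ (hscale w hw))
  · intro z hz
    have hzp : z - p ≠ 0 := by
      intro h
      rw [sub_eq_zero] at h
      exact hAc.le_bot ⟨hz, h ▸ mem_range_self _⟩
    have h1 : Ψ (z - p)⁻¹ = -1 := by
      rw [hΨm, inv_inv]
      exact ⟨inv_ne_zero hzp, by simpa using hz⟩
    have h2 := hXA _ h1
    have h3 := Metric.ball_subset_closedBall h2
    refine ⟨(z - p)⁻¹ / R, ?_, ?_⟩
    · rw [mem_ball_zero_iff] at h2 ⊢
      rw [norm_div, Complex.norm_real, Real.norm_eq_abs, abs_of_pos hRpos, div_lt_one hRpos]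
      exact h2
    · simp only [mul_div_cancel₀ _ hR0]
      rw [hG₂id _ h3 ((hG₁q _ h3).2 h1), inv_inv]
      ring
  · rintro _ ⟨w, hw, rfl⟩
    exact (hG₂' _ (hscale w hw)).2

/-- A compact set `A` in the plane, surrounded by the negative part of an open collar `c`. -/
structure CollarNest (A : Set ℂ) (c : Circle × ℝ → ℂ) : Prop where
  emb : IsOpenEmbedding c
  disj : Disjoint A (range c)
  nonempty : A.Nonempty
  compact : ∀ r ≤ 0, IsCompact (A ∪ c '' (univ ×ˢ Iic r))
  isOpen : ∀ r ≤ 0, IsOpen (A ∪ c '' (univ ×ˢ Iio r))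

lemma JordanCollar.collarNest {J : Set ℂ} {c : Circle × ℝ → ℂ} (h : JordanCollar J c)
    (hJ : IsCompact J) : CollarNest (hull J \ range c) c := by
  refine ⟨h.emb, disjoint_sdiff_left, ?_, ?_, ?_⟩
  · by_contra hne
    rw [not_nonempty_iff_eq_empty, sdiff_eq_empty] at hne
    have h1 : c '' (univ ×ˢ Iic 0) = hull J := by
      apply Subset.antisymm
      · rintro _ ⟨⟨s, t⟩, ⟨-, ht⟩, rfl⟩
        exact (h.mem_hull_iff s t).2 ht
      · intro x hx
        obtain ⟨⟨s, t⟩, rfl⟩ := hne hx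
        exact ⟨(s, t), ⟨mem_univ _, (h.mem_hull_iff s t).1 hx⟩, rfl⟩
    have h2 : IsCompact (univ ×ˢ Iic 0 : Set (Circle × ℝ)) := by
      rw [h.emb.isInducing.isCompact_iff, h1]
      exact isCompact_hull hJ
    have h3 := (h2.image continuous_snd).bddBelow
    obtain ⟨m, hm⟩ := h3
    have := hm (mem_image_of_mem Prod.snd
      (show ((1 : Circle), min (m - 1) 0) ∈ univ ×ˢ Iic (0 : ℝ) from ⟨mem_univ _, mem_Iic.2 (min_le_right _ _)⟩))
    have h4 := min_le_left (m - 1) 0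
    simp only at this
    linarith
  · intro r hr
    have : hull J \ range c ∪ c '' (univ ×ˢ Iic r) = hull J \ c '' (univ ×ˢ Ioi r) := by
      ext x
      by_cases hx : x ∈ range c
      · obtain ⟨⟨s, t⟩, rfl⟩ := hx
        simp only [mem_union, mem_sdiff, mem_range_self, not_true_eq_false, and_false, false_or,
          h.emb.injective.mem_set_image, mem_prod, mem_univ, true_and, mem_Iic, mem_Ioi, not_lt,
          h.mem_hull_iff]
        exact ⟨fun h => ⟨h.trans hr, h⟩, fun h => h.2⟩
      · have h1 : x ∉ c '' (univ ×ˢ Iic r) := fun h => hx (image_subset_range _ _ h)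
        have h2 : x ∉ c '' (univ ×ˢ Ioi r) := fun h => hx (image_subset_range _ _ h)
        simp [hx, h1, h2]
    rw [this]
    exact (isCompact_hull hJ).diff (h.emb.isOpenMap _ (isOpen_univ.prod isOpen_Ioi))
  · intro r hr
    have : hull J \ range c ∪ c '' (univ ×ˢ Iio r) = inside J \ c '' (univ ×ˢ Icc r 0) := by
      ext x
      by_cases hx : x ∈ range c
      · obtain ⟨⟨s, t⟩, rfl⟩ := hx
        simp only [mem_union, mem_sdiff, mem_range_self, not_true_eq_false, and_false, false_or,
          h.emb.injective.mem_set_image, mem_prod, mem_univ, true_and, mem_Iio, mem_Icc,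
          h.mem_inside_iff]
        exact ⟨fun h => ⟨h.trans_le hr, fun h' => absurd h'.1 (not_le.2 h)⟩, fun h => by
          by_contra! h'
          exact h.2 ⟨h', h.1.le⟩⟩
      · have h1 : x ∉ c '' (univ ×ˢ Iio r) := fun h => hx (image_subset_range _ _ h)
        have h2 : x ∉ c '' (univ ×ˢ Icc r 0) := fun h => hx (image_subset_range _ _ h)
        have h3 : x ∉ J := by
          rw [← h.zero]
          exact fun h => hx (image_subset_range _ _ h)
        simp [hx, h1, h2, h3, hull]
    rw [this]
    refine (isOpen_inside hJ).sdiff (IsCompact.isClosed ?_)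
    exact (isCompact_univ.prod isCompact_Icc).image h.emb.continuous

namespace CollarNest

variable {A : Set ℂ} {c : Circle × ℝ → ℂ}

lemma mem_iff (h : CollarNest A c) (s : Circle) (t r : ℝ) :
    c (s, t) ∈ A ∪ c '' (univ ×ˢ Iic r) ↔ t ≤ r := by
  have : c (s, t) ∉ A := fun hA => h.disj.le_bot ⟨hA, mem_range_self _⟩
  simp [this, h.emb.injective.mem_set_image, -mem_image]

lemma exists_subset (h : CollarNest A c) {W : Set ℂ} (hW : IsOpen W) (hAW : A ⊆ W) :
    ∃ r : ℝ, A ∪ c '' (univ ×ˢ Iic r) ⊆ W := by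
  have h1 : IsCompact ((A ∪ c '' (univ ×ˢ Iic 0)) \ W) := (h.compact 0 le_rfl).diff hW
  have h2 : (A ∪ c '' (univ ×ˢ Iic 0)) \ W ⊆ range c := by
    rintro x ⟨hx | hx, hxW⟩
    · exact absurd (hAW hx) hxW
    · exact image_subset_range _ _ hx
  have h3 : IsCompact (c ⁻¹' ((A ∪ c '' (univ ×ˢ Iic 0)) \ W)) :=
    h.emb.isInducing.isCompact_preimage_iff h2 |>.2 h1
  obtain ⟨m, hm⟩ := (h3.image continuous_snd).bddBelow
  refine ⟨min (m - 1) 0, union_subset hAW ?_⟩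
  rintro _ ⟨⟨s, t⟩, ⟨-, ht⟩, rfl⟩
  by_contra hW'
  have h4 := hm (mem_image_of_mem Prod.snd (show (s, t) ∈ c ⁻¹' ((A ∪ c '' (univ ×ˢ Iic 0)) \ W) from
    ⟨(h.mem_iff s t 0).2 (le_trans ht (min_le_right _ _)), hW'⟩))
  have h5 : t ≤ m - 1 := le_trans ht (min_le_left _ _)
  simp only at h4
  linarith

lemma exists_disc (h : CollarNest A c) {r : ℝ} (hr : r ≤ 0) :
    ∃ (κ : ℂ → ℂ) (r' : ℝ), ContinuousOn κ (Metric.closedBall 0 1) ∧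
      InjOn κ (Metric.closedBall 0 1) ∧ A ∪ c '' (univ ×ˢ Iic r') ⊆ κ '' Metric.ball 0 1 ∧
      κ '' Metric.closedBall 0 1 ⊆ A ∪ c '' (univ ×ˢ Iio r) := by
  let b : Circle × ℝ → Circle × ℝ := fun q => (q.1, r - Real.exp (-q.2))
  have hbi : Function.Injective b := by
    rintro ⟨s, t⟩ ⟨s', t'⟩ hq
    simp only [b, Prod.mk.injEq, sub_right_inj, Real.exp_eq_exp, neg_inj] at hq
    exact Prod.ext hq.1 hq.2
  have hbc : Continuous b := by fun_prop
  have hbo : IsOpenEmbedding b := .of_continuous_injective_isOpenMap hbc hbi fun U hU =>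
    isOpen_image_of_injOn hU hbc.continuousOn hbi.injOn
  have hb1 : ∀ t : ℝ, b '' (univ ×ˢ Iic t) = univ ×ˢ Iic (r - Real.exp (-t)) := by
    intro t
    ext ⟨s, x⟩
    constructor
    · rintro ⟨⟨s', y⟩, ⟨-, hy⟩, hq⟩
      simp only [b, Prod.mk.injEq] at hq
      refine ⟨mem_univ _, ?_⟩
      rw [mem_Iic] at hy ⊢
      simp only [← hq.2]
      have := Real.exp_le_exp.2 (neg_le_neg hy)
      linarith
    · rintro ⟨-, hx⟩
      rw [mem_Iic] at hx
      simp only at hx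
      have hpos : 0 < r - x := lt_of_lt_of_le (Real.exp_pos (-t)) (by linarith)
      refine ⟨(s, -Real.log (r - x)), ⟨mem_univ _, ?_⟩, ?_⟩
      · rw [mem_Iic]
        have := (Real.le_log_iff_exp_le hpos).2 (show Real.exp (-t) ≤ r - x by linarith)
        simp only
        linarith
      · simp only [b, neg_neg, Real.exp_log hpos, sub_sub_cancel]
  have hb2 : ∀ t : ℝ, b '' (univ ×ˢ Iio t) = univ ×ˢ Iio (r - Real.exp (-t)) := by
    intro t
    ext ⟨s, x⟩
    constructor
    · rintro ⟨⟨s', y⟩, ⟨-, hy⟩, hq⟩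
      simp only [b, Prod.mk.injEq] at hq
      refine ⟨mem_univ _, ?_⟩
      rw [mem_Iio] at hy ⊢
      simp only [← hq.2]
      have := Real.exp_lt_exp.2 (neg_lt_neg hy)
      linarith
    · rintro ⟨-, hx⟩
      rw [mem_Iio] at hx
      simp only at hx
      have hpos : 0 < r - x := (Real.exp_pos (-t)).trans (by linarith)
      refine ⟨(s, -Real.log (r - x)), ⟨mem_univ _, ?_⟩, ?_⟩
      · rw [mem_Iio]
        have := (Real.lt_log_iff_exp_lt hpos).2 (show Real.exp (-t) < r - x by linarith)
        simp only
        linarith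
      · simp only [b, neg_neg, Real.exp_log hpos, sub_sub_cancel]
  have hle : ∀ t, r - Real.exp (-t) ≤ 0 := fun t => by linarith [Real.exp_pos (-t)]
  obtain ⟨κ, hκc, hκi, hκA, hκs⟩ := _root_.exists_disc (A := A) (c := c ∘ b) (h.emb.comp hbo)
    (h.disj.mono_right (range_comp_subset_range _ _)) h.nonempty
    (fun t => by rw [image_comp, hb1]; exact h.compact _ (hle t))
    (fun t => by rw [image_comp, hb2]; exact h.isOpen _ (hle t))
  have hκo : IsOpen (κ '' Metric.ball 0 1) := isOpen_image_of_injOn_complex Metric.isOpen_ball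
    (hκc.mono Metric.ball_subset_closedBall) (hκi.mono Metric.ball_subset_closedBall)
  obtain ⟨r', hr'⟩ := h.exists_subset hκo hκA
  refine ⟨κ, r', hκc, hκi, hr', hκs.trans (union_subset_union_right A ?_)⟩
  rintro _ ⟨⟨s, t⟩, rfl⟩
  exact ⟨b (s, t), ⟨mem_univ _, by simp only [b, mem_Iio]; linarith [Real.exp_pos (-t)]⟩, rfl⟩

end CollarNest

/-- A compact subset of an open disc in the plane may be shrunk into any neighbourhood of the
centre by a map supported in the disc. -/
lemma exists_shrink {κ : ℂ → ℂ} (hκc : ContinuousOn κ (Metric.closedBall 0 1))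
    (hκi : InjOn κ (Metric.closedBall 0 1)) {K N : Set ℂ} (hK : IsCompact K)
    (hKκ : K ⊆ κ '' Metric.ball 0 1) (hN : N ∈ 𝓝 (κ 0)) :
    ∃ σ : ℂ → ℂ, Continuous σ ∧ Function.Injective σ ∧
      (∀ x ∉ κ '' Metric.closedBall 0 1, σ x = x) ∧
      (∀ x ∈ κ '' Metric.closedBall 0 1, σ x ∈ κ '' Metric.closedBall 0 1) ∧ ∀ x ∈ K, σ x ∈ N := by
  classical
  set D : Set ℂ := κ '' Metric.closedBall 0 1 with hD
  have hsub : Metric.ball (0 : ℂ) 1 ⊆ Metric.closedBall 0 1 := Metric.ball_subset_closedBall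
  set inv := Function.invFunOn κ (Metric.closedBall 0 1)
  have hinv : ∀ x ∈ Metric.closedBall (0 : ℂ) 1, inv (κ x) = x := fun x hx =>
    hκi.leftInvOn_invFunOn hx
  have hinvc : ContinuousOn inv D := continuousOn_leftInverse (isCompact_closedBall 0 1) hκc hinv
  have hinvm : MapsTo inv D (Metric.closedBall 0 1) := by
    rintro _ ⟨x, hx, rfl⟩
    rw [hinv x hx]; exact hx
  have hκinv : ∀ x ∈ D, κ (inv x) = x := by
    rintro _ ⟨x, hx, rfl⟩
    rw [hinv x hx]
  have hDc : IsClosed D := ((isCompact_closedBall 0 1).image_of_continuousOn hκc).isClosed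
  have hUo : IsOpen (κ '' Metric.ball 0 1) := isOpen_image_of_injOn_complex Metric.isOpen_ball
    (hκc.mono hsub) (hκi.mono hsub)
  obtain ⟨ρ, hρ0, hρ1, hρ⟩ : ∃ ρ : ℝ, 0 ≤ ρ ∧ ρ < 1 ∧ ∀ x ∈ K, ‖inv x‖ ≤ ρ := by
    have h1 : IsCompact (inv '' K) :=
      hK.image_of_continuousOn (hinvc.mono (hKκ.trans (image_mono hsub)))
    have h2 : ∀ z ∈ inv '' K, ‖z‖ < 1 := by
      rintro _ ⟨x, hx, rfl⟩
      obtain ⟨y, hy, rfl⟩ := hKκ hx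
      rw [hinv y (hsub hy)]
      exact mem_ball_zero_iff.1 hy
    rcases (inv '' K).eq_empty_or_nonempty with he | hne
    · refine ⟨0, le_rfl, one_pos, fun x hx => ?_⟩
      have := mem_image_of_mem inv hx
      rw [he] at this
      exact absurd this (notMem_empty _)
    · obtain ⟨z, hz, hmax⟩ := h1.exists_isMaxOn hne continuous_norm.continuousOn
      exact ⟨‖z‖, norm_nonneg _, h2 z hz, fun x hx => hmax (mem_image_of_mem _ hx)⟩
  have hN' : ∀ᶠ z in 𝓝[Metric.closedBall 0 1] (0 : ℂ), κ z ∈ N :=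
    (hκc 0 (by simp)).eventually_mem hN
  obtain ⟨δ, hδ, hδN⟩ := Metric.mem_nhdsWithin_iff.1 hN'
  obtain ⟨m, hm⟩ := exists_pow_lt_of_lt_one hδ hρ1
  let P : ℂ → ℂ := fun z => (‖z‖ ^ m : ℝ) * z
  have hPn : ∀ z, ‖P z‖ = ‖z‖ ^ (m + 1) := by
    intro z
    simp only [P, norm_mul, Complex.norm_real, norm_pow, norm_norm, pow_succ]
  have hPb : MapsTo P (Metric.closedBall 0 1) (Metric.closedBall 0 1) := by
    intro z hz
    rw [mem_closedBall_zero_iff] at hz ⊢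
    rw [hPn]
    exact pow_le_one₀ (norm_nonneg _) hz
  have hPi : Function.Injective P := by
    intro z w hzw
    have h1 : ‖z‖ = ‖w‖ := by
      have : ‖P z‖ = ‖P w‖ := by rw [hzw]
      rw [hPn, hPn] at this
      exact (pow_left_inj₀ (norm_nonneg _) (norm_nonneg _) (Nat.succ_ne_zero m)).1 this
    by_cases hz : z = 0
    · rw [hz, norm_zero] at h1
      rw [hz, norm_eq_zero.1 h1.symm]
    · simp only [P, h1] at hzw
      refine mul_left_cancel₀ ?_ hzw
      have : ‖w‖ ≠ 0 := h1 ▸ norm_ne_zero_iff.2 hz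
      exact_mod_cast pow_ne_zero m this
  have hPs : ∀ z, ‖z‖ = 1 → P z = z := by
    intro z hz
    simp [P, hz]
  have hPc : Continuous P :=
    (Complex.continuous_ofReal.comp (continuous_norm.pow m)).mul continuous_id
  let σ : ℂ → ℂ := fun x => if x ∈ D then κ (P (inv x)) else x
  have hσD : ∀ x ∈ D, σ x = κ (P (inv x)) := fun x hx => if_pos hx
  have hσD' : ∀ x ∉ D, σ x = x := fun x hx => if_neg hx
  have hσm : ∀ x ∈ D, σ x ∈ D := fun x hx => by
    rw [hσD x hx]
    exact mem_image_of_mem _ (hPb (hinvm hx))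
  refine ⟨σ, ?_, ?_, hσD', hσm, ?_⟩
  · have h1 : ContinuousOn σ D :=
      (hκc.comp (hPc.comp_continuousOn hinvc) fun x hx => hPb (hinvm hx)).congr hσD
    have h2 : ContinuousOn σ (κ '' Metric.ball 0 1)ᶜ := by
      refine continuousOn_id.congr fun x hx => ?_
      by_cases hxD : x ∈ D
      · obtain ⟨y, hy, rfl⟩ := hxD
        rw [hσD _ (mem_image_of_mem _ hy), hinv y hy, hPs, id]
        refine le_antisymm (mem_closedBall_zero_iff.1 hy) ?_
        by_contra! h
        exact hx (mem_image_of_mem _ (mem_ball_zero_iff.2 h))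
      · exact hσD' x hxD
    rw [← continuousOn_univ, ← (show D ∪ (κ '' Metric.ball 0 1)ᶜ = univ from ?_)]
    · exact h1.union_of_isClosed h2 hDc hUo.isClosed_compl
    · rw [eq_univ_iff_forall]
      intro x
      by_cases hx : x ∈ κ '' Metric.ball 0 1
      · exact Or.inl (image_mono hsub hx)
      · exact Or.inr hx
  · intro x y hxy
    by_cases hx : x ∈ D
    · by_cases hy : y ∈ D
      · rw [hσD x hx, hσD y hy] at hxy
        have := hPi (hκi (hPb (hinvm hx)) (hPb (hinvm hy)) hxy)
        rw [← hκinv x hx, ← hκinv y hy, this]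
      · rw [hσD' y hy] at hxy
        exact absurd (hxy ▸ hσm x hx) hy
    · by_cases hy : y ∈ D
      · rw [hσD' x hx] at hxy
        exact absurd (hxy ▸ hσm y hy) hx
      · rwa [hσD' x hx, hσD' y hy] at hxy
  · intro x hx
    rw [hσD x (image_mono hsub (hKκ hx))]
    refine hδN ⟨?_, hPb (hinvm (image_mono hsub (hKκ hx)))⟩
    rw [mem_ball_zero_iff, hPn]
    have h1 := hρ x hx
    calc ‖inv x‖ ^ (m + 1) ≤ ρ ^ (m + 1) := by gcongr
      _ = ρ ^ m * ρ := pow_succ _ _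
      _ ≤ ρ ^ m := mul_le_of_le_one_right (by positivity) hρ1.le
      _ < δ := hm

lemma CollarNest.exists_step {A : Set ℂ} {c : Circle × ℝ → ℂ} (h : CollarNest A c) {g : ℂ → ℂ}
    (hg : Continuous g) {t ε : ℝ} (ht : t ≤ 0) (hε : 0 < ε) :
    ∃ (σ : ℂ → ℂ) (t' : ℝ), t' ≤ t - 1 ∧ Continuous σ ∧ Function.Injective σ ∧
      (∀ x ∉ A ∪ c '' (univ ×ˢ Iic t), σ x = x) ∧
      (∀ x ∈ A ∪ c '' (univ ×ˢ Iic t), σ x ∈ A ∪ c '' (univ ×ˢ Iic t)) ∧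
      ∀ x ∈ A ∪ c '' (univ ×ˢ Iic t'), ∀ y ∈ A ∪ c '' (univ ×ˢ Iic t'),
        dist (g (σ x)) (g (σ y)) < ε := by
  obtain ⟨κ, r', hκc, hκi, hr', hκs⟩ := h.exists_disc ht
  have hmono : ∀ {a b : ℝ}, a ≤ b → A ∪ c '' (univ ×ˢ Iic a) ⊆ A ∪ c '' (univ ×ˢ Iic b) :=
    fun hab => union_subset_union_right A (image_mono (prod_mono_right (Iic_subset_Iic.2 hab)))
  have h1 : A ∪ c '' (univ ×ˢ Iic (min r' (t - 1))) ⊆ κ '' Metric.ball 0 1 :=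
    (hmono (min_le_left _ _)).trans hr'
  have hle : min r' (t - 1) ≤ t - 1 := min_le_right _ _
  have hκs' : κ '' Metric.closedBall 0 1 ⊆ A ∪ c '' (univ ×ˢ Iic t) :=
    hκs.trans (union_subset_union_right A (image_mono (prod_mono_right Iio_subset_Iic_self)))
  obtain ⟨σ, hσc, hσi, hσ1, hσ2, hσ3⟩ := exists_shrink hκc hκi (h.compact _ (by linarith)) h1
    (N := {x | dist (g x) (g (κ 0)) < ε / 2})
    ((hg.continuousAt (x := κ 0)).eventually_mem (Metric.ball_mem_nhds _ (half_pos hε)))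
  refine ⟨σ, min r' (t - 1), hle, hσc, hσi, fun x hx => hσ1 x fun h => hx (hκs' h), ?_, ?_⟩
  · intro x hx
    by_cases hxD : x ∈ κ '' Metric.closedBall 0 1
    · exact hκs' (hσ2 x hxD)
    · rwa [hσ1 x hxD]
  · intro x hx y hy
    have h2 : dist (g (σ x)) (g (κ 0)) < ε / 2 := hσ3 x hx
    have h3 : dist (g (σ y)) (g (κ 0)) < ε / 2 := hσ3 y hy
    have := dist_triangle_right (g (σ x)) (g (σ y)) (g (κ 0))
    linarith

lemma CollarNest.exists_seq {A : Set ℂ} {c : Circle × ℝ → ℂ} (h : CollarNest A c) :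
    ∃ (g : ℕ → ℂ → ℂ) (t : ℕ → ℝ) (σ : ℕ → ℂ → ℂ), (∀ n, Continuous (g n)) ∧
      (∀ n, Function.Injective (g n)) ∧ (∀ n, t n ≤ -1) ∧ (∀ x, g 0 x = x) ∧
      (∀ n x, g (n + 1) x = g n (σ n x)) ∧ (∀ n, t (n + 1) ≤ t n - 1) ∧
      (∀ n, ∀ x ∉ A ∪ c '' (univ ×ˢ Iic (t n)), σ n x = x) ∧
      (∀ n, ∀ x ∈ A ∪ c '' (univ ×ˢ Iic (t n)), σ n x ∈ A ∪ c '' (univ ×ˢ Iic (t n))) ∧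
      ∀ n, ∀ x ∈ A ∪ c '' (univ ×ˢ Iic (t (n + 1))), ∀ y ∈ A ∪ c '' (univ ×ˢ Iic (t (n + 1))),
        dist (g (n + 1) x) (g (n + 1) y) < 1 / ((n : ℝ) + 1) := by
  let State := {s : (ℂ → ℂ) × ℝ // Continuous s.1 ∧ Function.Injective s.1 ∧ s.2 ≤ -1}
  have hstep : ∀ (s : State) (n : ℕ), ∃ (σ : ℂ → ℂ) (t' : ℝ), t' ≤ s.1.2 - 1 ∧ Continuous σ ∧
      Function.Injective σ ∧ (∀ x ∉ A ∪ c '' (univ ×ˢ Iic s.1.2), σ x = x) ∧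
      (∀ x ∈ A ∪ c '' (univ ×ˢ Iic s.1.2), σ x ∈ A ∪ c '' (univ ×ˢ Iic s.1.2)) ∧
      ∀ x ∈ A ∪ c '' (univ ×ˢ Iic t'), ∀ y ∈ A ∪ c '' (univ ×ˢ Iic t'),
        dist (s.1.1 (σ x)) (s.1.1 (σ y)) < 1 / ((n : ℝ) + 1) :=
    fun s n => h.exists_step s.2.1 (by linarith [s.2.2.2]) (by positivity)
  choose σ T hT hσc hσi hσ1 hσ2 hσ3 using hstep
  let next : ℕ → State → State := fun n s => ⟨(s.1.1 ∘ σ s n, T s n), s.2.1.comp (hσc s n),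
    s.2.2.1.comp (hσi s n), by have := hT s n; have := s.2.2.2; simp only; linarith⟩
  let s₀ : State := ⟨(id, -1), continuous_id, Function.injective_id, le_rfl⟩
  let S : ℕ → State := fun n => Nat.rec s₀ next n
  exact ⟨fun n => (S n).1.1, fun n => (S n).1.2, fun n => σ (S n) n, fun n => (S n).2.1,
    fun n => (S n).2.2.1, fun n => (S n).2.2.2, fun x => rfl, fun n x => rfl, fun n => hT (S n) n,
    fun n => hσ1 (S n) n, fun n => hσ2 (S n) n, fun n => hσ3 (S n) n⟩

/-- The closure of the bounded side of a collared circle is a disc, with the collar parametrisation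
on the boundary. -/
lemma CollarNest.exists_param {A : Set ℂ} {c : Circle × ℝ → ℂ} (h : CollarNest A c) :
    ∃ k : ℂ → ℂ, ContinuousOn k (Metric.closedBall 0 1) ∧ InjOn k (Metric.closedBall 0 1) ∧
      MapsTo k (Metric.closedBall 0 1) (A ∪ c '' (univ ×ˢ Iic 0)) ∧
      ∀ s : Circle, k s = c (s, 0) := by
  classical
  obtain ⟨g, t, σ, hgc, hgi, ht1, hg0, hgS, htS, hσ1, hσ2, hσ3⟩ := h.exists_seq
  set P : ℝ → Set ℂ := fun t => A ∪ c '' (univ ×ˢ Iic t) with hP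
  have hmono : ∀ {a b : ℝ}, a ≤ b → P a ⊆ P b :=
    fun hab => union_subset_union_right A (image_mono (prod_mono_right (Iic_subset_Iic.2 hab)))
  have hPne : ∀ t, (P t).Nonempty := fun t => h.nonempty.mono subset_union_left
  have htn : ∀ n : ℕ, t n ≤ -n := by
    intro n
    induction n with
    | zero => exact (ht1 0).trans (by norm_num)
    | succ n ih => have := htS n; push_cast; linarith
  have hta : Antitone t := antitone_nat_of_succ_le fun n => by linarith [htS n]
  have hstab1 : ∀ n x, x ∉ P (t n) → g (n + 1) x = g n x := by
    intro n x hx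
    rw [hgS, hσ1 n x hx]
  have hstab : ∀ n m x, n ≤ m → x ∉ P (t n) → g m x = g n x := by
    intro n m x hnm hx
    induction m, hnm using Nat.le_induction with
    | base => rfl
    | succ m hnm ih => rw [hstab1 m x fun hx' => hx (hmono (hta hnm) hx'), ih]
  have hnest1 : ∀ n, g (n + 1) '' P (t (n + 1)) ⊆ g n '' P (t n) := by
    rintro n _ ⟨x, hx, rfl⟩
    rw [hgS]
    exact mem_image_of_mem _ (hσ2 n x (hmono (by linarith [htS n]) hx))
  have hnest : ∀ n m, n ≤ m → g m '' P (t m) ⊆ g n '' P (t n) := fun n m hnm =>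
    antitone_nat_of_succ_le (f := fun n => g n '' P (t n)) hnest1 hnm
  have hsmall : ∀ n, ∀ x ∈ g (n + 1) '' P (t (n + 1)), ∀ y ∈ g (n + 1) '' P (t (n + 1)),
      dist x y < 1 / ((n : ℝ) + 1) := by
    rintro n _ ⟨x, hx, rfl⟩ _ ⟨y, hy, rfl⟩
    exact hσ3 n x hx y hy
  obtain ⟨o, ho⟩ : (⋂ n, g n '' P (t n)).Nonempty := by
    refine IsCompact.nonempty_iInter_of_sequence_nonempty_isCompact_isClosed _ hnest1
      (fun n => (hPne _).image _) ?_ ?_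
    · exact (h.compact _ (by linarith [ht1 0])).image (hgc 0)
    · exact fun n => ((h.compact _ (by linarith [ht1 n])).image (hgc n)).isClosed
  rw [mem_iInter] at ho
  have hinP0 : ∀ n x, x ∈ P 0 → g n x ∈ P 0 := by
    intro n
    induction n with
    | zero => exact fun x hx => (hg0 x).symm ▸ hx
    | succ n ih =>
      intro x hx
      rw [hgS]
      apply ih
      by_cases hx' : x ∈ P (t n)
      · exact hmono (by linarith [ht1 n]) (hσ2 n x hx')
      · rwa [hσ1 n x hx']
  have hN : ∀ x : ℝ, ∃ n, t n < x := by
    intro x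
    obtain ⟨n, hn⟩ := exists_nat_gt (-x)
    exact ⟨n, by linarith [htn n]⟩
  choose N hN using hN
  let k : ℂ → ℂ := fun z => if z = 0 then o else g (N (polInv z).2) (c (polInv z))
  have hk0 : k 0 = o := if_pos rfl
  have hk : ∀ (n : ℕ) (z : ℂ), z ≠ 0 → t n < (polInv z).2 → k z = g n (c (polInv z)) := by
    intro n z hz hn
    have h1 : ∀ m, t m < (polInv z).2 → c (polInv z) ∉ P (t m) := by
      intro m hm hmem
      exact absurd ((h.mem_iff (polInv z).1 (polInv z).2 (t m)).1 hmem) (not_le.2 hm)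
    have h2 : k z = g (N (polInv z).2) (c (polInv z)) := if_neg hz
    rw [h2]
    rcases le_total n (N (polInv z).2) with hle | hle
    · exact hstab _ _ _ hle (h1 n hn)
    · exact (hstab _ _ _ hle (h1 _ (hN _))).symm
  have hlarge : ∀ (n : ℕ) (z : ℂ), z ≠ 0 → (polInv z).2 ≤ t n → k z ∈ g n '' P (t n) := by
    intro n z hz hn
    have h1 : n ≤ N (polInv z).2 := by
      by_contra! hlt
      have := hta hlt.le
      linarith [hN (polInv z).2]
    rw [hk _ z hz (hN _)]
    set m := N (polInv z).2
    have h2 : ∀ m, n ≤ m → ∀ x ∈ P (t n), g m x ∈ g n '' P (t n) := by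
      intro m hnm
      induction m, hnm using Nat.le_induction with
      | base => exact fun x hx => mem_image_of_mem _ hx
      | succ m hnm ih =>
        intro x hx
        rw [hgS]
        apply ih
        by_cases hx' : x ∈ P (t m)
        · exact hmono (hta hnm) (hσ2 m x hx')
        · rwa [hσ1 m x hx']
    exact h2 m h1 _ ((h.mem_iff (polInv z).1 (polInv z).2 (t n)).2 hn)
  have hpolz : ∀ z : ℂ, z ≠ 0 → Real.exp (polInv z).2 = ‖z‖ := by
    intro z hz
    rw [← norm_pol, pol_polInv hz]
  have hko : ∀ z, z ≠ 0 → k z ≠ o := by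
    intro z hz hzo
    rw [hk _ z hz (hN _)] at hzo
    obtain ⟨x, hx, hxo⟩ := ho (N (polInv z).2)
    rw [← hxo] at hzo
    rw [← hgi _ hzo] at hx
    exact absurd ((h.mem_iff (polInv z).1 (polInv z).2 _).1 hx) (not_le.2 (hN _))
  refine ⟨k, ?_, ?_, ?_, ?_⟩
  · have hkc : Continuous k := by
      rw [continuous_iff_continuousAt]
      intro z
      by_cases hz : z = 0
      · subst hz
        rw [ContinuousAt, hk0, Metric.tendsto_nhds]
        intro ε hε
        obtain ⟨n, hn⟩ := exists_nat_one_div_lt hε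
        filter_upwards [Metric.ball_mem_nhds (0 : ℂ) (Real.exp_pos (t (n + 1)))] with y hy
        by_cases hy0 : y = 0
        · rw [hy0, hk0, dist_self]; exact hε
        · rw [mem_ball_zero_iff, ← hpolz y hy0, Real.exp_lt_exp] at hy
          exact (hsmall n _ (hlarge _ y hy0 hy.le) _ (ho _)).trans hn
      · have h1 : ContinuousAt polInv z :=
          continuousOn_polInv.continuousAt (isOpen_compl_singleton.mem_nhds hz)
        set n := N (polInv z).2
        have h2 : ∀ᶠ y in 𝓝 z, t n < (polInv y).2 :=
          continuousAt_const.eventually_lt (continuous_snd.continuousAt.comp h1) (hN _)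
        have h3 : ∀ᶠ y in 𝓝 z, y ≠ 0 := isOpen_ne.mem_nhds hz
        have h4 : ContinuousAt (fun y => g n (c (polInv y))) z :=
          ((hgc n).comp h.emb.continuous).continuousAt.comp h1
        refine h4.congr ?_
        filter_upwards [h2, h3] with y hy hy0 using (hk n y hy0 hy).symm
    exact hkc.continuousOn
  · intro z _ w _ hzw
    by_cases hz : z = 0
    · by_contra hne
      rw [hz, hk0] at hzw
      exact hko w (fun h => hne (hz.trans h.symm)) hzw.symm
    · by_cases hw : w = 0
      · rw [hw, hk0] at hzw
        exact absurd hzw (hko z hz)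
      · have h1 : ∀ x m, N x ≤ m → t m < x := fun x m hm => (hta hm).trans_lt (hN x)
        rw [hk (max (N (polInv z).2) (N (polInv w).2)) z hz (h1 _ _ (le_max_left _ _)),
          hk (max (N (polInv z).2) (N (polInv w).2)) w hw (h1 _ _ (le_max_right _ _))] at hzw
        have := h.emb.injective (hgi _ hzw)
        rw [← pol_polInv hz, ← pol_polInv hw, this]
  · intro z hz
    by_cases hz0 : z = 0
    · rw [hz0, hk0]
      refine hmono (by linarith [ht1 0]) (show o ∈ P (t 0) from ?_)
      obtain ⟨x, hx, hxo⟩ := ho 0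
      rw [hg0] at hxo
      exact hxo ▸ hx
    · rw [hk _ z hz0 (hN _)]
      apply hinP0
      refine (h.mem_iff (polInv z).1 (polInv z).2 0).2 ?_
      rw [mem_closedBall_zero_iff, ← hpolz z hz0] at hz
      exact Real.exp_le_one_iff.1 hz
  · intro s
    have h1 : pol (s, 0) = s := by simp [pol]
    have h2 : polInv (s : ℂ) = (s, 0) := by rw [← h1, polInv_pol]
    rw [hk 0 s (Circle.coe_ne_zero s) (by rw [h2]; linarith [ht1 0]), h2, hg0]

/-- The **Schoenflies theorem** in the plane, for collared circles. -/
theorem exists_schoenflies (hT : PlaneTwoSided) {J : Set ℂ} (hJ : IsCircle J) :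
    ∃ k : ℂ → ℂ, ContinuousOn k (Metric.closedBall 0 1) ∧ InjOn k (Metric.closedBall 0 1) ∧
      k '' Metric.closedBall 0 1 = hull J ∧ k '' Metric.sphere 0 1 = J := by
  obtain ⟨c, hc⟩ := exists_jordanCollar hT hJ
  obtain ⟨k, hkc, hki, hkm, hks⟩ := (hc.collarNest hJ.isCompact).exists_param
  have hsp : k '' Metric.sphere 0 1 = J := by
    apply Subset.antisymm
    · rintro _ ⟨z, hz, rfl⟩
      have := hks ⟨z, hz⟩
      simp only at this
      rw [this]
      exact (hc.mem_iff _ _).2 rfl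
    · intro x hx
      obtain ⟨s, rfl⟩ := hc.eq_param hx
      exact ⟨s, by rw [mem_sphere_zero_iff_norm, Circle.norm_coe], hks s⟩
  have hmap : MapsTo k (Metric.closedBall 0 1) (hull J) := by
    intro z hz
    rcases hkm hz with h | ⟨⟨s, t⟩, ⟨-, ht⟩, h⟩
    · exact h.1
    · rw [← h]
      exact (hc.mem_hull_iff s t).2 ht
  have hsub : Metric.ball (0 : ℂ) 1 ⊆ Metric.closedBall 0 1 := Metric.ball_subset_closedBall
  have hbo : IsOpen (k '' Metric.ball 0 1) := isOpen_image_of_injOn_complex Metric.isOpen_ball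
    (hkc.mono hsub) (hki.mono hsub)
  have hcl : IsClosed (k '' Metric.closedBall 0 1) :=
    ((isCompact_closedBall 0 1).image_of_continuousOn hkc).isClosed
  have hun : k '' Metric.closedBall 0 1 = k '' Metric.ball 0 1 ∪ J := by
    rw [← hsp, ← image_union, Metric.ball_union_sphere]
  have hdis : Disjoint (k '' Metric.ball 0 1) J := by
    rw [← hsp, disjoint_left]
    rintro _ ⟨z, hz, rfl⟩ ⟨w, hw, h⟩
    have := hki (Metric.sphere_subset_closedBall hw) (hsub hz) h
    rw [this] at hw
    rw [mem_ball_zero_iff] at hz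
    rw [mem_sphere_zero_iff_norm] at hw
    linarith
  have hins : inside J ⊆ k '' Metric.ball 0 1 := by
    refine (isPreconnected_inside hT hJ).subset_of_disjoint_frontier hbo ?_ ?_
    · refine (disjoint_inside J).mono_right ?_
      rw [hbo.frontier_eq]
      rintro x ⟨hx, hx'⟩
      have : x ∈ k '' Metric.closedBall 0 1 := hcl.closure_subset_iff.2 (image_mono hsub) hx
      rw [hun] at this
      exact this.resolve_left hx'
    · refine ⟨k 0, ?_, mem_image_of_mem _ (by simp)⟩
      have h1 : k 0 ∈ k '' Metric.ball 0 1 := mem_image_of_mem _ (by simp)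
      exact (hmap (by simp)).resolve_left fun h => hdis.le_bot ⟨h1, h⟩
  refine ⟨k, hkc, hki, Subset.antisymm (image_subset_iff.2 hmap) ?_, hsp⟩
  rw [hun, hull, union_comm]
  exact union_subset_union_left J hins

/-- The **θ-curve lemma**: a chord of a Jordan domain cuts it into the interiors of the two circles
formed by the chord and the two boundary arcs. -/
theorem theta_curve (hT : PlaneTwoSided) {X₁ X₂ X₃ : Set ℂ} (hJ : IsCircle (X₁ ∪ X₂))
    (hJ₁ : IsCircle (X₁ ∪ X₃)) (hJ₂ : IsCircle (X₂ ∪ X₃)) (hX₃ : X₃ ⊆ hull (X₁ ∪ X₂))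
    (hX₁ : (X₁ \ (X₂ ∪ X₃)).Nonempty) :
    Disjoint (inside (X₁ ∪ X₃)) (inside (X₂ ∪ X₃)) ∧
      inside (X₁ ∪ X₂) = inside (X₁ ∪ X₃) ∪ X₃ \ (X₁ ∪ X₂) ∪ inside (X₂ ∪ X₃) := by
  have hs₁ : X₁ ∪ X₃ ⊆ hull (X₁ ∪ X₂) :=
    union_subset (subset_union_left.trans (subset_hull _)) hX₃
  have hs₂ : X₂ ∪ X₃ ⊆ hull (X₁ ∪ X₂) :=
    union_subset (subset_union_right.trans (subset_hull _)) hX₃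
  have hi₁ := inside_subset_inside hT hJ hJ₁.isCompact hs₁
  have hi₂ := inside_subset_inside hT hJ hJ₂.isCompact hs₂
  have hd₁₂ : Disjoint (inside (X₁ ∪ X₃)) (X₂ ∪ X₃) := by
    rw [disjoint_left]
    rintro x hx (hx2 | hx3)
    · exact (hi₁ hx).1 (Or.inr hx2)
    · exact hx.1 (Or.inr hx3)
  have hdis : Disjoint (inside (X₁ ∪ X₃)) (inside (X₂ ∪ X₃)) := by
    have hpre := isPreconnected_inside hT hJ₁
    by_contra hnd
    obtain ⟨y, hy1, hy2⟩ := not_disjoint_iff.1 hnd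
    have hsub : inside (X₁ ∪ X₃) ⊆ inside (X₂ ∪ X₃) := hpre.subset_inside hd₁₂ ⟨y, hy1, hy2⟩
    have hhull : hull (X₁ ∪ X₃) ⊆ hull (X₂ ∪ X₃) := by
      rw [← closure_inside hT hJ₁, ← closure_inside hT hJ₂]
      exact closure_mono hsub
    obtain ⟨x, hx1, hx⟩ := hX₁
    have hxo : x ∈ inside (X₂ ∪ X₃) := (hhull (Or.inl (Or.inl hx1))).resolve_left hx
    obtain ⟨z, hz, hz'⟩ := mem_closure_iff.1 (subset_closure_outside hT hJ (Or.inl hx1)) _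
      (isOpen_inside hJ₂.isCompact) hxo
    exact (disjoint_inside_outside _).le_bot ⟨hi₂ hz, hz'⟩
  refine ⟨hdis, Subset.antisymm ?_ ?_⟩
  swap
  · refine union_subset (union_subset hi₁ ?_) hi₂
    exact fun x hx => (hX₃ hx.1).resolve_left hx.2
  set G : Set ℂ := inside (X₁ ∪ X₃) ∪ X₃ \ (X₁ ∪ X₂) ∪ inside (X₂ ∪ X₃) with hG
  have hGo : IsOpen G := by
    rw [isOpen_iff_mem_nhds]
    rintro x ((hx | hx) | hx)
    · exact Filter.mem_of_superset ((isOpen_inside hJ₁.isCompact).mem_nhds hx)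
        fun y hy => Or.inl (Or.inl hy)
    · obtain ⟨c, hc⟩ := exists_jordanCollar hT hJ₁
      obtain ⟨N, hNo, hxN, hNV, -, hNout, -, -⟩ := hc.exists_halves (x := x) (Or.inr hx.1)
        (hJ.isCompact.isClosed.isOpen_compl.mem_nhds hx.2)
      have hN1 : ∀ z ∈ N, z ∈ X₁ ∪ X₃ → z ∈ X₃ := fun z hz h =>
        h.resolve_left fun h1 => hNV hz (Or.inl h1)
      have hN2 : ∀ z ∈ N, z ∈ X₂ ∪ X₃ → z ∈ X₃ := fun z hz h =>
        h.resolve_left fun h1 => hNV hz (Or.inr h1)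
      obtain ⟨z, hzN, hz⟩ := mem_closure_iff.1 (subset_closure_inside hT hJ₂ (Or.inr hx.1)) N hNo hxN
      have hz1 : z ∈ outside (X₁ ∪ X₃) := by
        rw [← hull_compl]
        rintro (h | h)
        · exact hz.1 (Or.inr (hN1 z hzN h))
        · exact hdis.le_bot ⟨h, hz⟩
      have hsub : N ∩ outside (X₁ ∪ X₃) ⊆ inside (X₂ ∪ X₃) := by
        refine hNout.subset_inside ?_ ⟨z, ⟨hzN, hz1⟩, hz⟩
        rw [disjoint_left]
        rintro y ⟨hyN, hy⟩ hy2
        exact hy.1 (Or.inr (hN2 y hyN hy2))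
      refine Filter.mem_of_superset (hNo.mem_nhds hxN) fun y hy => ?_
      by_cases hyJ : y ∈ X₁ ∪ X₃
      · exact Or.inl (Or.inr ⟨hN1 y hy hyJ, hNV hy⟩)
      · have : y ∈ inside (X₁ ∪ X₃) ∪ outside (X₁ ∪ X₃) := by
          rw [inside_union_outside]; exact hyJ
        rcases this with h | h
        · exact Or.inl (Or.inl h)
        · exact Or.inr (hsub ⟨hy, h⟩)
    · exact Filter.mem_of_superset ((isOpen_inside hJ₂.isCompact).mem_nhds hx)
        fun y hy => Or.inr hy
  obtain ⟨x₀, hx₀⟩ := inside_nonempty hT hJ₁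
  refine (isPreconnected_inside hT hJ).subset_of_disjoint_frontier hGo ?_
    ⟨x₀, hi₁ hx₀, Or.inl (Or.inl hx₀)⟩
  rw [disjoint_left]
  intro x hx hxf
  rw [hGo.frontier_eq] at hxf
  have hcl : closure G ⊆ hull (X₁ ∪ X₃) ∪ hull (X₂ ∪ X₃) := by
    refine closure_minimal ?_ ((isClosed_hull hJ₁.isCompact).union (isClosed_hull hJ₂.isCompact))
    rintro y ((hy | hy) | hy)
    · exact Or.inl (Or.inr hy)
    · exact Or.inl (Or.inl (Or.inr hy.1))
    · exact Or.inr (Or.inr hy)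
  apply hxf.2
  rcases hcl hxf.1 with (h | h) | (h | h)
  · exact Or.inl (Or.inr ⟨h.resolve_left fun h1 => hx.1 (Or.inl h1), hx.1⟩)
  · exact Or.inl (Or.inl h)
  · exact Or.inl (Or.inr ⟨h.resolve_left fun h1 => hx.1 (Or.inr h1), hx.1⟩)
  · exact Or.inr h

/-- A homeomorphism of the unit circle extends to the unit disc. -/
lemma exists_cone {β : ℂ → ℂ} (hβ : ContinuousOn β (Metric.sphere 0 1))
    (hβi : InjOn β (Metric.sphere 0 1)) (hβm : β '' Metric.sphere 0 1 = Metric.sphere 0 1) :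
    ∃ B : ℂ → ℂ, Continuous B ∧ Function.Injective B ∧ EqOn B β (Metric.sphere 0 1) ∧
      B '' Metric.closedBall 0 1 = Metric.closedBall 0 1 := by
  have hm : MapsTo β (Metric.sphere 0 1) (Metric.sphere 0 1) := image_subset_iff.1 hβm.subset
  have hang : ∀ z, (angle z : ℂ) ∈ Metric.sphere (0 : ℂ) 1 := fun z => by
    rw [mem_sphere_zero_iff_norm, Circle.norm_coe]
  have hdec : ∀ z : ℂ, z ≠ 0 → (‖z‖ : ℂ) * angle z = z := by
    intro z hz
    have := pol_polInv hz
    simp only [pol, polInv] at this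
    rwa [Real.exp_log (norm_pos_iff.2 hz)] at this
  let B : ℂ → ℂ := fun z => ‖z‖ * β (angle z)
  have hBn : ∀ z, ‖B z‖ = ‖z‖ := by
    intro z
    have := mem_sphere_zero_iff_norm.1 (hm (hang z))
    simp only [B, norm_mul, Complex.norm_real, norm_norm, this, mul_one]
  have hs : ∀ z ∈ Metric.sphere (0 : ℂ) 1, (angle z : ℂ) = z := by
    intro z hz
    rw [mem_sphere_zero_iff_norm] at hz
    have := hdec z (by rw [← norm_pos_iff, hz]; exact one_pos)
    rw [hz] at this
    simpa using this
  have hBβ : EqOn B β (Metric.sphere 0 1) := by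
    intro z hz
    simp only [B, hs z hz]
    rw [mem_sphere_zero_iff_norm.1 hz]
    simp
  have hBi : Function.Injective B := by
    intro z w h
    have hn : ‖z‖ = ‖w‖ := by rw [← hBn z, ← hBn w, h]
    by_cases hz : z = 0
    · rw [hz, norm_zero] at hn
      rw [hz, norm_eq_zero.1 hn.symm]
    · have hw : w ≠ 0 := by
        rw [← norm_ne_zero_iff, ← hn]; exact norm_ne_zero_iff.2 hz
      simp only [B, hn] at h
      have h1 := mul_left_cancel₀ (by exact_mod_cast norm_ne_zero_iff.2 hw) h
      have h2 := hβi (hang z) (hang w) h1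
      rw [← hdec z hz, ← hdec w hw, hn, h2]
  refine ⟨B, ?_, hBi, hBβ, ?_⟩
  · rw [continuous_iff_continuousAt]
    intro z
    by_cases hz : z = 0
    · have hB0 : B 0 = 0 := by simp [B]
      rw [hz, ContinuousAt, hB0, tendsto_zero_iff_norm_tendsto_zero]
      simp only [hBn]
      simpa using (continuous_norm (E := ℂ)).tendsto 0
    · have h1 : ContinuousOn (fun z : ℂ => β (angle z)) {0}ᶜ :=
        hβ.comp (continuous_subtype_val.comp_continuousOn continuousOn_angle) fun z _ => hang z
      have h2 : ContinuousAt (fun z : ℂ => β (angle z)) z :=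
        h1.continuousAt (isOpen_compl_singleton.mem_nhds hz)
      exact (Complex.continuous_ofReal.comp continuous_norm).continuousAt.mul h2
  · apply Subset.antisymm
    · rintro _ ⟨z, hz, rfl⟩
      rw [mem_closedBall_zero_iff] at hz ⊢
      rwa [hBn]
    · intro w hw
      by_cases hw0 : w = 0
      · exact ⟨0, by simp, by simp [B, hw0]⟩
      · obtain ⟨a, ha, hab⟩ := hβm.symm.subset (hang w)
        have hwn : (‖w‖ : ℂ) ≠ 0 := by exact_mod_cast norm_ne_zero_iff.2 hw0
        have han : ‖(‖w‖ : ℂ) * a‖ = ‖w‖ := by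
          rw [norm_mul, mem_sphere_zero_iff_norm.1 ha]; simp
        refine ⟨‖w‖ * a, ?_, ?_⟩
        · rwa [mem_closedBall_zero_iff, han, ← mem_closedBall_zero_iff]
        · have h3 := hdec (‖w‖ * a) (by
            rw [← norm_ne_zero_iff, han]; exact norm_ne_zero_iff.2 hw0)
          rw [han] at h3
          have h4 := mul_left_cancel₀ hwn h3
          simp only [B, han, h4, hab, hdec w hw0]

/-- A homeomorphism between circles in the plane extends over the hulls. -/
theorem exists_extension (hT : PlaneTwoSided) {K J : Set ℂ} (hK : IsCircle K) (hJ : IsCircle J)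
    {f : ℂ → ℂ} (hf : ContinuousOn f K) (hfi : InjOn f K) (hfJ : f '' K = J) :
    ∃ F : ℂ → ℂ, ContinuousOn F (hull K) ∧ InjOn F (hull K) ∧ EqOn F f K ∧
      F '' hull K = hull J := by
  obtain ⟨k, hkc, hki, hkh, hkK⟩ := exists_schoenflies hT hK
  obtain ⟨l, hlc, hli, hlh, hlJ⟩ := exists_schoenflies hT hJ
  have hsc : Metric.sphere (0 : ℂ) 1 ⊆ Metric.closedBall 0 1 := Metric.sphere_subset_closedBall
  have hcb := isCompact_closedBall (0 : ℂ) 1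
  set k' := Function.invFunOn k (Metric.closedBall 0 1)
  set l' := Function.invFunOn l (Metric.closedBall 0 1)
  have hk' : ∀ x ∈ Metric.closedBall (0 : ℂ) 1, k' (k x) = x := fun x hx =>
    hki.leftInvOn_invFunOn hx
  have hl' : ∀ x ∈ Metric.closedBall (0 : ℂ) 1, l' (l x) = x := fun x hx =>
    hli.leftInvOn_invFunOn hx
  have hk'c : ContinuousOn k' (hull K) := hkh ▸ continuousOn_leftInverse hcb hkc hk'
  have hl'c : ContinuousOn l' (hull J) := hlh ▸ continuousOn_leftInverse hcb hlc hl'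
  have hk'h : k' '' hull K = Metric.closedBall 0 1 := by
    rw [← hkh, image_image]
    exact (image_congr hk').trans (image_id' _)
  have hl'J : l' '' J = Metric.sphere 0 1 := by
    rw [← hlJ, image_image]
    exact (image_congr fun x hx => hl' x (hsc hx)).trans (image_id' _)
  have hl'i : InjOn l' J := by
    rw [← hlJ]
    rintro _ ⟨x, hx, rfl⟩ _ ⟨y, hy, rfl⟩ h
    rw [hl' x (hsc hx), hl' y (hsc hy)] at h
    rw [h]
  have hfk : MapsTo (f ∘ k) (Metric.sphere 0 1) J := fun x hx =>
    hfJ ▸ mem_image_of_mem f (hkK ▸ mem_image_of_mem k hx)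
  have hkm : MapsTo k (Metric.sphere 0 1) K := fun x hx => hkK ▸ mem_image_of_mem k hx
  obtain ⟨B, hBc, hBi, hBβ, hBim⟩ := exists_cone (β := l' ∘ f ∘ k)
    ((hl'c.mono (subset_hull J)).comp (hf.comp (hkc.mono hsc) hkm) hfk)
    (hl'i.comp (hfi.comp (hki.mono hsc) hkm) hfk)
    (by rw [image_comp, image_comp, hkK, hfJ, hl'J])
  have hm1 : MapsTo k' (hull K) (Metric.closedBall 0 1) := image_subset_iff.1 hk'h.subset
  have hm2 : MapsTo B (Metric.closedBall 0 1) (Metric.closedBall 0 1) :=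
    image_subset_iff.1 hBim.subset
  refine ⟨l ∘ B ∘ k', ?_, ?_, ?_, ?_⟩
  · exact hlc.comp (hBc.comp_continuousOn hk'c) (hm2.comp hm1)
  · refine hli.comp (hBi.injOn.comp ?_ hm1) (hm2.comp hm1)
    rw [← hkh]
    rintro _ ⟨x, hx, rfl⟩ _ ⟨y, hy, rfl⟩ h
    rw [hk' x hx, hk' y hy] at h
    rw [h]
  · rintro x hx
    rw [← hkK] at hx
    obtain ⟨y, hy, rfl⟩ := hx
    have h1 : f (k y) ∈ J := hfk hy
    rw [← hlJ] at h1
    obtain ⟨w, hw, hwe⟩ := h1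
    simp only [Function.comp, hk' y (hsc hy), hBβ hy, ← hwe, hl' w (hsc hw)]
  · rw [image_comp, image_comp, hk'h, hBim, hlh]

/-- Two distinct points cut a circle into two arcs. -/
lemma IsCircle.exists_arcs {X : Type*} [TopologicalSpace X] {T : Set X} (hT : IsCircle T) {p q : X}
    (hp : p ∈ T) (hq : q ∈ T) (hpq : p ≠ q) :
    ∃ β₁ β₂ : ℝ → X, Continuous β₁ ∧ Continuous β₂ ∧ InjOn β₁ (Icc (-1) 1) ∧
      InjOn β₂ (Icc (-1) 1) ∧ β₁ 1 = p ∧ β₂ 1 = p ∧ β₁ (-1) = q ∧ β₂ (-1) = q ∧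
      β₁ '' Icc (-1) 1 ∪ β₂ '' Icc (-1) 1 = T ∧
      ∀ x ∈ Icc (-1 : ℝ) 1, ∀ y ∈ Icc (-1 : ℝ) 1, β₁ x = β₂ y → x = y ∧ (x = 1 ∨ x = -1) := by
  obtain ⟨e, he, hei, rfl⟩ := hT.exists_param
  obtain ⟨a, rfl⟩ := hp
  obtain ⟨b, rfl⟩ := hq
  have hab : a ≠ b := fun h => hpq (by rw [h])
  obtain ⟨τ, hτ, hτb⟩ : ∃ τ ∈ Ioo 0 (2 * Real.pi), a * Circle.exp τ = b := by
    have h1 : Circle.exp (Complex.arg (a⁻¹ * b : Circle)) = a⁻¹ * b := Circle.exp_arg _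
    have h0 : Complex.arg (a⁻¹ * b : Circle) ≠ 0 := by
      intro h
      rw [h, Circle.exp_zero] at h1
      exact hab (by rw [← mul_one a, h1]; group)
    have hlt := Complex.neg_pi_lt_arg (a⁻¹ * b : Circle)
    have hle := Complex.arg_le_pi (a⁻¹ * b : Circle)
    have hpi := Real.pi_pos
    rcases lt_or_gt_of_ne h0 with h | h
    · refine ⟨Complex.arg (a⁻¹ * b : Circle) + 2 * Real.pi, ⟨by linarith, by linarith⟩, ?_⟩
      rw [Circle.exp_add, h1, Circle.exp_two_pi]; group
    · refine ⟨Complex.arg (a⁻¹ * b : Circle), ⟨h, by linarith⟩, ?_⟩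
      rw [h1]; group
  have hpi := Real.pi_pos
  have key : ∀ u v : ℝ, e (a * Circle.exp u) = e (a * Circle.exp v) → |u - v| ≤ 2 * Real.pi →
      u = v ∨ u - v = 2 * Real.pi ∨ v - u = 2 * Real.pi := by
    intro u v h huv
    obtain ⟨m, hm⟩ := Circle.exp_eq_exp.1 (mul_left_cancel (hei h))
    rw [abs_le] at huv
    have h1 : (-1 : ℝ) ≤ m := by
      by_contra hlt
      rw [not_le] at hlt
      nlinarith
    have h2 : (m : ℝ) ≤ 1 := by
      by_contra hlt
      rw [not_le] at hlt
      nlinarith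
    have h1' : (-1 : ℤ) ≤ m := by exact_mod_cast h1
    have h2' : m ≤ 1 := by exact_mod_cast h2
    interval_cases m
    · right; right; push_cast at hm; linarith
    · left; push_cast at hm; linarith
    · right; left; push_cast at hm; linarith
  obtain ⟨hτ0, hτ2⟩ := hτ
  refine ⟨fun x => e (a * Circle.exp (τ * (1 - x) / 2)),
    fun x => e (a * Circle.exp (-((2 * Real.pi - τ) * (1 - x) / 2))), by fun_prop, by fun_prop,
    ?_, ?_, by simp, by simp, ?_, ?_, ?_, ?_⟩
  · intro x hx y hy h
    rcases key _ _ h (abs_le.2 ⟨by nlinarith [hx.1, hx.2, hy.1, hy.2],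
      by nlinarith [hx.1, hx.2, hy.1, hy.2]⟩) with h | h | h
    · nlinarith
    · nlinarith [hx.1, hx.2, hy.1, hy.2]
    · nlinarith [hx.1, hx.2, hy.1, hy.2]
  · intro x hx y hy h
    rcases key _ _ h (abs_le.2 ⟨by nlinarith [hx.1, hx.2, hy.1, hy.2],
      by nlinarith [hx.1, hx.2, hy.1, hy.2]⟩) with h | h | h
    · nlinarith
    · nlinarith [hx.1, hx.2, hy.1, hy.2]
    · nlinarith [hx.1, hx.2, hy.1, hy.2]
  · change e (a * Circle.exp (τ * (1 - -1) / 2)) = _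
    rw [show τ * (1 - -1) / 2 = τ by ring, hτb]
  · change e (a * Circle.exp (-((2 * Real.pi - τ) * (1 - -1) / 2))) = _
    rw [show -((2 * Real.pi - τ) * (1 - -1) / 2) = τ - 2 * Real.pi by ring, ← hτb,
      Circle.exp_sub, Circle.exp_two_pi, div_one]
  · apply Subset.antisymm
    · rintro _ (⟨x, -, rfl⟩ | ⟨x, -, rfl⟩) <;> exact mem_range_self _
    · rintro _ ⟨s, rfl⟩
      have h1 : a * Circle.exp (Complex.arg (a⁻¹ * s : Circle)) = s := by
        rw [Circle.exp_arg]; group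
      have hlt := Complex.neg_pi_lt_arg (a⁻¹ * s : Circle)
      have hle := Complex.arg_le_pi (a⁻¹ * s : Circle)
      obtain ⟨θ, hθ1, hθ2, hθ⟩ : ∃ θ, τ - 2 * Real.pi ≤ θ ∧ θ ≤ τ ∧ a * Circle.exp θ = s := by
        by_cases hc1 : Complex.arg (a⁻¹ * s : Circle) < τ - 2 * Real.pi
        · exact ⟨Complex.arg (a⁻¹ * s : Circle) + 2 * Real.pi, by linarith, by linarith, by
            rw [Circle.exp_add, Circle.exp_two_pi, mul_one, h1]⟩
        · by_cases hc2 : τ < Complex.arg (a⁻¹ * s : Circle)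
          · exact ⟨Complex.arg (a⁻¹ * s : Circle) - 2 * Real.pi, by linarith, by linarith, by
              rw [Circle.exp_sub, Circle.exp_two_pi, div_one, h1]⟩
          · exact ⟨_, not_lt.1 hc1, not_lt.1 hc2, h1⟩
      rcases le_total 0 θ with h0 | h0
      · left
        refine ⟨1 - 2 * (θ / τ), ⟨?_, ?_⟩, ?_⟩
        · have : θ / τ ≤ 1 := (div_le_one hτ0).2 hθ2
          linarith
        · have : 0 ≤ θ / τ := by positivity
          linarith
        · change e (a * Circle.exp (τ * (1 - (1 - 2 * (θ / τ))) / 2)) = _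
          rw [show τ * (1 - (1 - 2 * (θ / τ))) / 2 = θ by field_simp; ring, hθ]
      · right
        have hσ : 0 < 2 * Real.pi - τ := by linarith
        refine ⟨1 - 2 * (-θ / (2 * Real.pi - τ)), ⟨?_, ?_⟩, ?_⟩
        · have : -θ / (2 * Real.pi - τ) ≤ 1 := (div_le_one hσ).2 (by linarith)
          linarith
        · have : 0 ≤ -θ / (2 * Real.pi - τ) := div_nonneg (by linarith) hσ.le
          linarith
        · change e (a * Circle.exp (-((2 * Real.pi - τ) *
            (1 - (1 - 2 * (-θ / (2 * Real.pi - τ)))) / 2))) = _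
          rw [show -((2 * Real.pi - τ) * (1 - (1 - 2 * (-θ / (2 * Real.pi - τ)))) / 2) = θ by
            field_simp; ring, hθ]
  · intro x hx y hy h
    rcases key _ _ h (abs_le.2 ⟨by nlinarith [hx.1, hx.2, hy.1, hy.2],
      by nlinarith [hx.1, hx.2, hy.1, hy.2]⟩) with h | h | h
    · have h1 : 0 ≤ τ * (1 - x) := mul_nonneg hτ0.le (by linarith [hx.2])
      have h2 : 0 ≤ (2 * Real.pi - τ) * (1 - y) := mul_nonneg (by linarith) (by linarith [hy.2])
      have h3 : τ * (1 - x) = 0 := by linarith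
      have h4 : (2 * Real.pi - τ) * (1 - y) = 0 := by linarith
      have hx1 : x = 1 := by
        rcases mul_eq_zero.1 h3 with h | h <;> linarith
      have hy1 : y = 1 := by
        rcases mul_eq_zero.1 h4 with h | h <;> linarith
      exact ⟨by rw [hx1, hy1], Or.inl hx1⟩
    · have h1 : 0 ≤ τ * (1 + x) := mul_nonneg hτ0.le (by linarith [hx.1])
      have h2 : 0 ≤ (2 * Real.pi - τ) * (1 + y) := mul_nonneg (by linarith) (by linarith [hy.1])
      have h3 : τ * (1 + x) = 0 := by nlinarith
      have h4 : (2 * Real.pi - τ) * (1 + y) = 0 := by nlinarith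
      have hx1 : x = -1 := by
        rcases mul_eq_zero.1 h3 with h | h <;> linarith
      have hy1 : y = -1 := by
        rcases mul_eq_zero.1 h4 with h | h <;> linarith
      exact ⟨by rw [hx1, hy1], Or.inr hx1⟩
    · have h1 : 0 ≤ τ * (1 - x) := mul_nonneg hτ0.le (by linarith [hx.2])
      have h2 : 0 ≤ (2 * Real.pi - τ) * (1 - y) := mul_nonneg (by linarith) (by linarith [hy.2])
      linarith

/-- The rectangle `[-1, 1] × [0, 1]`. -/
def rectangle : Set ℂ := Icc (-1) 1 ×ℂ Icc 0 1

lemma mem_frontier_rectangle {z : ℂ} : z ∈ frontier rectangle ↔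
    z ∈ rectangle ∧ (z.im = 0 ∨ z.im = 1 ∨ z.re = 1 ∨ z.re = -1) := by
  rw [rectangle, Complex.frontier_reProdIm, isClosed_Icc.closure_eq, isClosed_Icc.closure_eq,
    frontier_Icc (by norm_num), frontier_Icc (by norm_num)]
  simp only [mem_union, Complex.mem_reProdIm, mem_insert_iff, mem_singleton_iff, mem_Icc]
  constructor
  · rintro (⟨h1, h2 | h2⟩ | ⟨h1 | h1, h2⟩)
    · exact ⟨⟨h1, by rw [h2]; norm_num⟩, Or.inl h2⟩
    · exact ⟨⟨h1, by rw [h2]; norm_num⟩, Or.inr (Or.inl h2)⟩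
    · exact ⟨⟨by rw [h1]; norm_num, h2⟩, Or.inr (Or.inr (Or.inr h1))⟩
    · exact ⟨⟨by rw [h1]; norm_num, h2⟩, Or.inr (Or.inr (Or.inl h1))⟩
  · tauto

lemma isClosed_rectangle : IsClosed rectangle := isClosed_Icc.reProdIm isClosed_Icc

lemma convex_rectangle : Convex ℝ rectangle := by
  intro z hz w hw a b ha hb hab
  have h1 := (convex_Icc (-1 : ℝ) 1) hz.1 hw.1 ha hb hab
  have h2 := (convex_Icc (0 : ℝ) 1) hz.2 hw.2 ha hb hab
  refine ⟨?_, ?_⟩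
  · simpa using h1
  · simpa using h2

lemma nonempty_interior_rectangle : (interior rectangle).Nonempty := by
  rw [rectangle, Complex.interior_reProdIm, interior_Icc, interior_Icc]
  exact ⟨⟨0, 1 / 2⟩, by norm_num [Complex.mem_reProdIm]⟩

lemma isBounded_rectangle : Bornology.IsBounded rectangle :=
  (Metric.isBounded_Icc _ _).reProdIm (Metric.isBounded_Icc _ _)

lemma isCircle_sphere : IsCircle (Metric.sphere (0 : ℂ) 1) := ⟨Homeomorph.refl _⟩

lemma isCircle_frontier_rectangle : IsCircle (frontier rectangle) := by
  obtain ⟨h, -, -, hf⟩ := exists_homeomorph_image_interior_closure_frontier_eq_unitBall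
    convex_rectangle nonempty_interior_rectangle isBounded_rectangle
  have : frontier rectangle = h.symm '' Metric.sphere 0 1 := by
    rw [← hf, image_image]; simp
  rw [this]
  exact isCircle_sphere.image h.symm.continuous.continuousOn h.symm.injective.injOn

lemma hull_frontier_rectangle (hT : PlaneTwoSided) : hull (frontier rectangle) = rectangle := by
  have h1 := eq_inside_of_frontier_subset hT isCircle_frontier_rectangle
    (isOpen_interior (s := rectangle)) (isBounded_rectangle.subset interior_subset)
    nonempty_interior_rectangle disjoint_interior_frontier (by
      rw [isOpen_interior.frontier_eq, isClosed_rectangle.frontier_eq]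
      exact sdiff_subset_sdiff_left
        (closure_minimal interior_subset isClosed_rectangle))
  rw [hull, ← h1, isClosed_rectangle.frontier_eq, sdiff_union_of_subset interior_subset]

/-- The map of the rectangle which is affine on vertical segments, `α` on the bottom side and
`β` on the top side. -/
noncomputable def ruled (α β : ℝ → ℂ) (z : ℂ) : ℂ := (1 - z.im) * α z.re + z.im * β z.re

/-- The two segments on the real axis between the unit circle and the points `p` and `-q`. -/
def chords (p q : ℝ) : Set ℂ :=
  (fun t : ℝ => (t : ℂ)) '' Icc 1 p ∪ (fun t : ℝ => -(t : ℂ)) '' Icc 1 q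

/-- Arcs `α` of the unit circle and `β` of `T`, joined by two real segments which meet `T` only
in `p` and `-q`. -/
structure Spanning (T : Set ℂ) (p q : ℝ) (α β : ℝ → ℂ) : Prop where
  contα : Continuous α
  contβ : Continuous β
  injα : InjOn α (Icc (-1) 1)
  injβ : InjOn β (Icc (-1) 1)
  norm : ∀ x ∈ Icc (-1 : ℝ) 1, ‖α x‖ = 1
  mem : ∀ x ∈ Icc (-1 : ℝ) 1, β x ∈ T
  α_one : α 1 = 1
  α_neg : α (-1) = -1
  β_one : β 1 = p
  β_neg : β (-1) = -q
  one_lt : ∀ z ∈ T, 1 < ‖z‖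
  hp : 1 < p
  hq : 1 < q
  not_mem_p : ∀ t : ℝ, 0 ≤ t → t < p → (t : ℂ) ∉ T
  not_mem_q : ∀ t : ℝ, 0 ≤ t → t < q → -(t : ℂ) ∉ T

namespace Spanning

variable {T : Set ℂ} {p q : ℝ} {α β : ℝ → ℂ}

lemma continuous (h : Spanning T p q α β) : Continuous (ruled α β) := by
  have h1 := h.contα.comp Complex.continuous_re
  have h2 := h.contβ.comp Complex.continuous_re
  have h3 := Complex.continuous_ofReal.comp Complex.continuous_im
  exact ((continuous_const.sub h3).mul h1).add (h3.mul h2)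

lemma ruled_bot {z : ℂ} (hz : z.im = 0) : ruled α β z = α z.re := by simp [ruled, hz]

lemma ruled_top {z : ℂ} (hz : z.im = 1) : ruled α β z = β z.re := by simp [ruled, hz]

lemma ruled_right (h : Spanning T p q α β) {z : ℂ} (hz : z.re = 1) :
    ruled α β z = ((1 + z.im * (p - 1) : ℝ) : ℂ) := by
  rw [ruled, hz, h.α_one, h.β_one]; push_cast; ring

lemma ruled_left (h : Spanning T p q α β) {z : ℂ} (hz : z.re = -1) :
    ruled α β z = -((1 + z.im * (q - 1) : ℝ) : ℂ) := by
  rw [ruled, hz, h.α_neg, h.β_neg]; push_cast; ring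

lemma norm_ruled_iff (h : Spanning T p q α β) {z : ℂ} (hz : z ∈ frontier rectangle) :
    ‖ruled α β z‖ = 1 ↔ z.im = 0 := by
  obtain ⟨⟨hx, hy⟩, hc⟩ := mem_frontier_rectangle.1 hz
  have hp := h.hp
  have hq := h.hq
  constructor
  · intro hn
    rcases hc with hc | hc | hc | hc
    · exact hc
    · rw [ruled_top hc] at hn
      exact absurd hn (h.one_lt _ (h.mem _ hx)).ne'
    · rw [h.ruled_right hc, Complex.norm_real, Real.norm_eq_abs,
        abs_of_nonneg (by nlinarith [hy.1])] at hn
      nlinarith [hy.1]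
    · rw [h.ruled_left hc, norm_neg, Complex.norm_real, Real.norm_eq_abs,
        abs_of_nonneg (by nlinarith [hy.1])] at hn
      nlinarith [hy.1]
  · intro h0
    rw [ruled_bot h0, h.norm _ hx]

lemma ruled_mem_iff (h : Spanning T p q α β) {z : ℂ} (hz : z ∈ frontier rectangle) :
    ruled α β z ∈ T ↔ z.im = 1 := by
  obtain ⟨⟨hx, hy⟩, hc⟩ := mem_frontier_rectangle.1 hz
  have hp := h.hp
  have hq := h.hq
  constructor
  · intro hn
    by_contra h1
    have hlt : z.im < 1 := lt_of_le_of_ne hy.2 h1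
    rcases hc with hc | hc | hc | hc
    · have := h.one_lt _ hn
      rw [ruled_bot hc, h.norm _ hx] at this
      exact lt_irrefl _ this
    · exact h1 hc
    · rw [h.ruled_right hc] at hn
      exact h.not_mem_p _ (by nlinarith [hy.1]) (by nlinarith [hy.1]) hn
    · rw [h.ruled_left hc] at hn
      exact h.not_mem_q _ (by nlinarith [hy.1]) (by nlinarith [hy.1]) hn
  · intro h0
    rw [ruled_top h0]
    exact h.mem _ hx

lemma injOn (h : Spanning T p q α β) : InjOn (ruled α β) (frontier rectangle) := by
  intro z hz w hw e
  obtain ⟨⟨hx, hy⟩, hc⟩ := mem_frontier_rectangle.1 hz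
  obtain ⟨⟨hx', hy'⟩, hc'⟩ := mem_frontier_rectangle.1 hw
  have hp := h.hp
  have hq := h.hq
  have h0 : z.im = 0 ↔ w.im = 0 := by rw [← h.norm_ruled_iff hz, ← h.norm_ruled_iff hw, e]
  have h1 : z.im = 1 ↔ w.im = 1 := by rw [← h.ruled_mem_iff hz, ← h.ruled_mem_iff hw, e]
  by_cases hz0 : z.im = 0
  · have hw0 := h0.1 hz0
    rw [ruled_bot hz0, ruled_bot hw0] at e
    exact Complex.ext (h.injα hx hx' e) (by rw [hz0, hw0])
  by_cases hz1 : z.im = 1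
  · have hw1 := h1.1 hz1
    rw [ruled_top hz1, ruled_top hw1] at e
    exact Complex.ext (h.injβ hx hx' e) (by rw [hz1, hw1])
  have hw0 : w.im ≠ 0 := fun h => hz0 (h0.2 h)
  have hw1 : w.im ≠ 1 := fun h => hz1 (h1.2 h)
  have hc := (hc.resolve_left hz0).resolve_left hz1
  have hc' := (hc'.resolve_left hw0).resolve_left hw1
  rcases hc with hc | hc <;> rcases hc' with hc' | hc'
  · rw [h.ruled_right hc, h.ruled_right hc'] at e
    have e := Complex.ofReal_injective e
    refine Complex.ext (by rw [hc, hc']) (mul_right_cancel₀ (b := p - 1) (by linarith) ?_)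
    linarith
  · rw [h.ruled_right hc, h.ruled_left hc', ← Complex.ofReal_neg] at e
    have e := Complex.ofReal_injective e
    nlinarith [hy.1, hy'.1]
  · rw [h.ruled_left hc, h.ruled_right hc', ← Complex.ofReal_neg] at e
    have e := Complex.ofReal_injective e
    nlinarith [hy.1, hy'.1]
  · rw [h.ruled_left hc, h.ruled_left hc'] at e
    have e := Complex.ofReal_injective (neg_injective e)
    refine Complex.ext (by rw [hc, hc']) (mul_right_cancel₀ (b := q - 1) (by linarith) ?_)
    linarith

lemma image_frontier (h : Spanning T p q α β) : ruled α β '' frontier rectangle =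
    β '' Icc (-1) 1 ∪ (chords p q ∪ α '' Icc (-1) 1) := by
  have hp := h.hp
  have hq := h.hq
  apply Subset.antisymm
  · rintro _ ⟨z, hz, rfl⟩
    obtain ⟨⟨hx, hy⟩, hc⟩ := mem_frontier_rectangle.1 hz
    rcases hc with hc | hc | hc | hc
    · rw [ruled_bot hc]; exact Or.inr (Or.inr (mem_image_of_mem _ hx))
    · rw [ruled_top hc]; exact Or.inl (mem_image_of_mem _ hx)
    · rw [h.ruled_right hc]
      exact Or.inr (Or.inl (Or.inl ⟨_, ⟨by nlinarith [hy.1], by nlinarith [hy.2]⟩, rfl⟩))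
    · rw [h.ruled_left hc]
      exact Or.inr (Or.inl (Or.inr ⟨_, ⟨by nlinarith [hy.1], by nlinarith [hy.2]⟩, rfl⟩))
  · rintro _ (⟨x, hx, rfl⟩ | (⟨t, ht, rfl⟩ | ⟨t, ht, rfl⟩) | ⟨x, hx, rfl⟩)
    · exact ⟨⟨x, 1⟩, mem_frontier_rectangle.2 ⟨⟨hx, by norm_num⟩, Or.inr (Or.inl rfl)⟩,
        ruled_top rfl⟩
    · refine ⟨⟨1, (t - 1) / (p - 1)⟩, mem_frontier_rectangle.2 ⟨⟨by norm_num,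
        div_nonneg (by linarith [ht.1]) (by linarith),
        (div_le_one (by linarith)).2 (by linarith [ht.2])⟩, Or.inr (Or.inr (Or.inl rfl))⟩, ?_⟩
      rw [h.ruled_right rfl]
      dsimp only
      rw [div_mul_cancel₀ _ (by linarith : p - 1 ≠ 0)]
      simp
    · refine ⟨⟨-1, (t - 1) / (q - 1)⟩, mem_frontier_rectangle.2 ⟨⟨by norm_num,
        div_nonneg (by linarith [ht.1]) (by linarith),
        (div_le_one (by linarith)).2 (by linarith [ht.2])⟩, Or.inr (Or.inr (Or.inr rfl))⟩, ?_⟩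
      rw [h.ruled_left rfl]
      dsimp only
      rw [div_mul_cancel₀ _ (by linarith : q - 1 ≠ 0)]
      simp
    · exact ⟨⟨x, 0⟩, mem_frontier_rectangle.2 ⟨⟨hx, by norm_num⟩, Or.inl rfl⟩, ruled_bot rfl⟩

lemma isCircle (h : Spanning T p q α β) :
    IsCircle (β '' Icc (-1) 1 ∪ (chords p q ∪ α '' Icc (-1) 1)) := by
  rw [← h.image_frontier]
  exact isCircle_frontier_rectangle.image h.continuous.continuousOn h.injOn

lemma exists_extension (h : Spanning T p q α β) (hT : PlaneTwoSided) :
    ∃ F : ℂ → ℂ, ContinuousOn F rectangle ∧ InjOn F rectangle ∧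
      EqOn F (ruled α β) (frontier rectangle) ∧
      F '' rectangle = hull (β '' Icc (-1) 1 ∪ (chords p q ∪ α '' Icc (-1) 1)) := by
  have := _root_.exists_extension hT isCircle_frontier_rectangle h.isCircle
    h.continuous.continuousOn h.injOn h.image_frontier
  rwa [hull_frontier_rectangle hT] at this

end Spanning

/-- The upper half of the unit circle. -/
noncomputable def upperArc (x : ℝ) : ℂ := x + Real.sqrt (1 - x ^ 2) * Complex.I

/-- The lower half of the unit circle. -/
noncomputable def lowerArc (x : ℝ) : ℂ := x - Real.sqrt (1 - x ^ 2) * Complex.I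

lemma upperArc_re (x : ℝ) : (upperArc x).re = x := by simp [upperArc]
lemma upperArc_im (x : ℝ) : (upperArc x).im = Real.sqrt (1 - x ^ 2) := by simp [upperArc]
lemma lowerArc_re (x : ℝ) : (lowerArc x).re = x := by simp [lowerArc]
lemma lowerArc_im (x : ℝ) : (lowerArc x).im = -Real.sqrt (1 - x ^ 2) := by simp [lowerArc]

lemma continuous_upperArc : Continuous upperArc := by unfold upperArc; fun_prop
lemma continuous_lowerArc : Continuous lowerArc := by unfold lowerArc; fun_prop

lemma norm_eq_one_iff_sq (z : ℂ) : ‖z‖ = 1 ↔ z.re ^ 2 + z.im ^ 2 = 1 := by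
  rw [← sq_eq_sq₀ (norm_nonneg z) zero_le_one, Complex.sq_norm, Complex.normSq_apply]
  constructor <;> intro h <;> linarith

lemma norm_upperArc {x : ℝ} (hx : x ∈ Icc (-1 : ℝ) 1) : ‖upperArc x‖ = 1 := by
  rw [norm_eq_one_iff_sq, upperArc_re, upperArc_im, Real.sq_sqrt (by nlinarith [hx.1, hx.2])]
  ring

lemma norm_lowerArc {x : ℝ} (hx : x ∈ Icc (-1 : ℝ) 1) : ‖lowerArc x‖ = 1 := by
  rw [norm_eq_one_iff_sq, lowerArc_re, lowerArc_im, neg_sq,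
    Real.sq_sqrt (by nlinarith [hx.1, hx.2])]
  ring

lemma upperArc_of_re {z : ℂ} (hz : ‖z‖ = 1) (h : 0 ≤ z.im) : upperArc z.re = z := by
  rw [norm_eq_one_iff_sq] at hz
  apply Complex.ext
  · rw [upperArc_re]
  · rw [upperArc_im, ← Real.sqrt_sq h]; congr 1; linarith

lemma lowerArc_of_re {z : ℂ} (hz : ‖z‖ = 1) (h : z.im ≤ 0) : lowerArc z.re = z := by
  rw [norm_eq_one_iff_sq] at hz
  apply Complex.ext
  · rw [lowerArc_re]
  · rw [lowerArc_im, neg_eq_iff_eq_neg, ← Real.sqrt_sq (neg_nonneg.2 h)]; congr 1; linarith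

lemma re_mem_Icc_of_norm {z : ℂ} (hz : ‖z‖ = 1) : z.re ∈ Icc (-1 : ℝ) 1 := by
  rw [norm_eq_one_iff_sq] at hz
  exact ⟨by nlinarith [sq_nonneg z.im], by nlinarith [sq_nonneg z.im]⟩

lemma upperArc_union_lowerArc :
    upperArc '' Icc (-1) 1 ∪ lowerArc '' Icc (-1) 1 = Metric.sphere (0 : ℂ) 1 := by
  apply Subset.antisymm
  · rintro _ (⟨x, hx, rfl⟩ | ⟨x, hx, rfl⟩)
    · exact mem_sphere_zero_iff_norm.2 (norm_upperArc hx)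
    · exact mem_sphere_zero_iff_norm.2 (norm_lowerArc hx)
  · intro z hz
    rw [mem_sphere_zero_iff_norm] at hz
    rcases le_total 0 z.im with h | h
    · exact Or.inl ⟨z.re, re_mem_Icc_of_norm hz, upperArc_of_re hz h⟩
    · exact Or.inr ⟨z.re, re_mem_Icc_of_norm hz, lowerArc_of_re hz h⟩

/-- The first point of a surrounding circle on a ray. -/
lemma exists_first_hit {T : Set ℂ} (hTc : IsCircle T)
    (h1 : ∀ z ∈ T, 1 < ‖z‖) (h0 : 0 ∈ inside T) {u : ℂ} (hu : ‖u‖ = 1) :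
    ∃ p : ℝ, 1 < p ∧ p * u ∈ T ∧ ∀ t : ℝ, 0 ≤ t → t < p → t * u ∉ T := by
  have hcont : Continuous fun t : ℝ => (t : ℂ) * u := by fun_prop
  set P : Set ℝ := Ici 0 ∩ (fun t : ℝ => (t : ℂ) * u) ⁻¹' T with hP
  have hPc : IsClosed P := isClosed_Ici.inter (hTc.isCompact.isClosed.preimage hcont)
  have hPb : BddBelow P := ⟨0, fun t ht => ht.1⟩
  have hPn : P.Nonempty := by
    by_contra hne
    rw [not_nonempty_iff_eq_empty] at hne
    have hd : Disjoint ((fun t : ℝ => (t : ℂ) * u) '' Ici 0) T := by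
      rw [disjoint_left]
      rintro _ ⟨t, ht, rfl⟩ h
      exact (hne.subset ⟨ht, h⟩ : t ∈ (∅ : Set ℝ))
    have hsub := (isPreconnected_Ici.image _ hcont.continuousOn).subset_inside hd
      ⟨0, ⟨0, by simp, by simp⟩, h0⟩
    obtain ⟨R, hR⟩ := (isBounded_iff_forall_norm_le.1
      ((isBounded_inside hTc.isCompact).subset hsub))
    have := hR _ ⟨|R| + 1, by simp only [mem_Ici]; positivity, rfl⟩
    rw [norm_mul, hu, mul_one, Complex.norm_real, Real.norm_eq_abs,
      abs_of_nonneg (by positivity)] at this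
    linarith [le_abs_self R]
  have hmem := hPc.csInf_mem hPn hPb
  refine ⟨sInf P, ?_, hmem.2, fun t ht hlt h => not_lt.2 (csInf_le hPb ⟨ht, h⟩) hlt⟩
  have := h1 _ hmem.2
  rwa [norm_mul, hu, mul_one, Complex.norm_real, Real.norm_eq_abs, abs_of_nonneg hmem.1] at this

/-- Two chords and the two halves of the unit circle cut a Jordan domain into a disc and two
half annuli. -/
lemma half_annuli (hT : PlaneTwoSided) {B₁ B₂ G A₁ A₂ : Set ℂ} (hTc : IsCircle (B₁ ∪ B₂))
    (h11 : IsCircle (B₁ ∪ (G ∪ A₁))) (h21 : IsCircle (B₂ ∪ (G ∪ A₁)))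
    (h22 : IsCircle (B₂ ∪ (G ∪ A₂))) (hA : A₁ ∪ A₂ = Metric.sphere 0 1)
    (hGT : G ⊆ hull (B₁ ∪ B₂)) (hG : Disjoint G (Metric.ball 0 1))
    (hD : Metric.closedBall 0 1 ⊆ inside (B₁ ∪ B₂)) (hB : (B₁ \ (B₂ ∪ (G ∪ A₁))).Nonempty)
    (hGA : (G \ Metric.sphere 0 1).Nonempty)
    (hball : Metric.ball 0 1 ⊆ inside (B₂ ∪ (G ∪ A₁))) :
    hull (B₁ ∪ (G ∪ A₁)) ∪ hull (B₂ ∪ (G ∪ A₂)) = hull (B₁ ∪ B₂) \ Metric.ball 0 1 ∧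
      hull (B₁ ∪ (G ∪ A₁)) ∩ hull (B₂ ∪ (G ∪ A₂)) ⊆
        (B₁ ∪ (G ∪ A₁)) ∩ (B₂ ∪ (G ∪ A₂)) := by
  have hA₁ : A₁ ⊆ Metric.sphere 0 1 := hA ▸ subset_union_left
  have hA₂ : A₂ ⊆ Metric.sphere 0 1 := hA ▸ subset_union_right
  have hST : Metric.sphere (0 : ℂ) 1 ⊆ inside (B₁ ∪ B₂) := Metric.sphere_subset_closedBall.trans hD
  have hS : Disjoint (Metric.sphere (0 : ℂ) 1) (Metric.ball 0 1) := Metric.sphere_disjoint_ball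
  obtain ⟨hd1, he1⟩ := theta_curve hT hTc h11 h21
    (union_subset hGT (hA₁.trans (hST.trans (inside_subset_hull _)))) hB
  have hSin : inside (A₁ ∪ A₂) = Metric.ball 0 1 := by
    rw [hA]
    refine (eq_inside_of_frontier_subset hT isCircle_sphere Metric.isOpen_ball
      Metric.isBounded_ball ⟨0, by simp⟩ hS.symm ?_).symm
    rw [frontier_ball _ one_ne_zero]
  have hA₂hull : A₂ ⊆ hull (B₂ ∪ (G ∪ A₁)) := by
    refine hA₂.trans ?_
    have h1 : Metric.closedBall (0 : ℂ) 1 ⊆ hull (B₂ ∪ (G ∪ A₁)) := by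
      rw [← closure_ball _ one_ne_zero]
      exact closure_minimal (hball.trans (inside_subset_hull _)) (isClosed_hull h21.isCompact)
    exact Metric.sphere_subset_closedBall.trans h1
  have hc21 : IsCircle ((B₂ ∪ G) ∪ A₁) := by rwa [union_assoc]
  have hc22 : IsCircle ((B₂ ∪ G) ∪ A₂) := by rwa [union_assoc]
  obtain ⟨hd2, he2⟩ := theta_curve hT hc21 hc22 (hA ▸ isCircle_sphere)
    (by rwa [union_assoc]) (by
      obtain ⟨g, hg, hgs⟩ := hGA
      exact ⟨g, Or.inr hg, by rwa [hA]⟩)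
  rw [union_assoc B₂ G A₁, union_assoc B₂ G A₂] at he2
  rw [union_assoc B₂ G A₂] at hd2
  rw [hSin] at he2 hd2
  have hBT : Disjoint (B₁ ∪ B₂) (Metric.ball 0 1) := by
    rw [disjoint_left]
    intro x hx hx'
    exact (hD (Metric.ball_subset_closedBall hx')).1 hx
  have hW : inside (B₂ ∪ (G ∪ A₂)) ⊆ inside (B₂ ∪ (G ∪ A₁)) := by
    rw [he2]; exact fun x hx => Or.inl (Or.inl hx)
  have hWT : inside (B₂ ∪ (G ∪ A₁)) ⊆ inside (B₁ ∪ B₂) := by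
    rw [he1]; exact fun x hx => Or.inr hx
  have h1T : inside (B₁ ∪ (G ∪ A₁)) ⊆ inside (B₁ ∪ B₂) := by
    rw [he1]; exact fun x hx => Or.inl (Or.inl hx)
  rw [disjoint_left] at hd1 hd2 hS hG hBT
  constructor
  · apply Subset.antisymm
    · rintro x ((h | h) | (h | h))
      · rcases h with h | h | h
        · exact ⟨Or.inl (Or.inl h), hBT (Or.inl h)⟩
        · exact ⟨hGT h, hG h⟩
        · exact ⟨Or.inr (hST (hA₁ h)), hS (hA₁ h)⟩
      · exact ⟨Or.inr (h1T h), fun hb => hd1 h (hball hb)⟩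
      · rcases h with h | h | h
        · exact ⟨Or.inl (Or.inr h), hBT (Or.inr h)⟩
        · exact ⟨hGT h, hG h⟩
        · exact ⟨Or.inr (hST (hA₂ h)), hS (hA₂ h)⟩
      · exact ⟨Or.inr (hWT (hW h)), fun hb => hd2 h hb⟩
    · rintro x ⟨(h | h) | h, hxb⟩
      · exact Or.inl (Or.inl (Or.inl h))
      · exact Or.inr (Or.inl (Or.inl h))
      · rw [he1] at h
        rcases h with (h | h) | h
        · exact Or.inl (Or.inr h)
        · exact Or.inl (Or.inl (Or.inr h.1))
        · rw [he2] at h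
          rcases h with (h | h) | h
          · exact Or.inr (Or.inr h)
          · exact Or.inr (Or.inl (Or.inr (Or.inr h.1)))
          · exact absurd h hxb
  · rintro x ⟨h | h, h' | h'⟩
    · exact ⟨h, h'⟩
    · exfalso
      rcases h with h | h
      · exact (hWT (hW h')).1 (Or.inl h)
      · exact (hW h').1 (Or.inr h)
    · exfalso
      rcases h' with h' | h' | h'
      · exact (h1T h).1 (Or.inr h')
      · exact h.1 (Or.inr (Or.inl h'))
      · rcases hA₂hull h' with h2 | h2
        · rcases h2 with h2 | h2
          · exact (h1T h).1 (Or.inr h2)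
          · exact h.1 (Or.inr h2)
        · exact hd1 h h2
    · exact absurd (hW h') (hd1 h)

/-- Gluing two half annuli to an annulus. -/
lemma exists_annulus_of_halves {F₁ F₂ : ℂ → ℂ} {T : Set ℂ} {p q : ℝ} {β₁ β₂ : ℝ → ℂ}
    (h1 : Spanning T p q upperArc β₁) (h2 : Spanning T p q lowerArc β₂)
    (hβ : β₁ '' Icc (-1) 1 ∪ β₂ '' Icc (-1) 1 = T)
    (hd : ∀ x ∈ Icc (-1 : ℝ) 1, ∀ y ∈ Icc (-1 : ℝ) 1, β₁ x = β₂ y → x = y ∧ (x = 1 ∨ x = -1))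
    (hc1 : ContinuousOn F₁ rectangle) (hc2 : ContinuousOn F₂ rectangle)
    (hi1 : InjOn F₁ rectangle) (hi2 : InjOn F₂ rectangle)
    (he1 : EqOn F₁ (ruled upperArc β₁) (frontier rectangle))
    (he2 : EqOn F₂ (ruled lowerArc β₂) (frontier rectangle))
    (hF : F₁ '' rectangle ∩ F₂ '' rectangle ⊆
      F₁ '' frontier rectangle ∩ F₂ '' frontier rectangle) :
    ∃ k : Circle × ℝ → ℂ, ContinuousOn k (univ ×ˢ Icc 0 1) ∧ InjOn k (univ ×ˢ Icc 0 1) ∧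
      k '' (univ ×ˢ Icc 0 1) = F₁ '' rectangle ∪ F₂ '' rectangle ∧ (∀ s, k (s, 0) = s) ∧
      k '' (univ ×ˢ {1}) = T := by
  classical
  have hre : ∀ s : Circle, (s : ℂ).re ∈ Icc (-1 : ℝ) 1 := fun s =>
    re_mem_Icc_of_norm (Circle.norm_coe s)
  have hfs : frontier rectangle ⊆ rectangle := isClosed_rectangle.frontier_subset
  have hreal : ∀ s : Circle, (s : ℂ).im = 0 → (s : ℂ).re = 1 ∨ (s : ℂ).re = -1 := by
    intro s hs
    have := (norm_eq_one_iff_sq _).1 (Circle.norm_coe s)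
    rw [hs] at this
    exact mul_self_eq_one_iff.1 (by nlinarith)
  let ρ : Circle × ℝ → ℂ := fun x => ⟨(x.1 : ℂ).re, x.2⟩
  have hρ : Continuous ρ := by
    have : ρ = fun x => (((x.1 : ℂ).re : ℝ) : ℂ) + (x.2 : ℂ) * Complex.I := by
      funext x; apply Complex.ext <;> simp [ρ]
    rw [this]
    have h : Continuous fun x : Circle × ℝ => (x.1 : ℂ).re :=
      Complex.continuous_re.comp (continuous_subtype_val.comp continuous_fst)
    fun_prop
  have hρm : MapsTo ρ (univ ×ˢ Icc 0 1) rectangle := fun x hx => ⟨hre _, hx.2⟩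
  have hagree : ∀ x ∈ (univ : Set Circle) ×ˢ Icc (0 : ℝ) 1, (x.1 : ℂ).im = 0 →
      F₁ (ρ x) = F₂ (ρ x) := by
    intro x hx h0
    have hm := hρm hx
    rcases hreal _ h0 with h | h
    · have hf : ρ x ∈ frontier rectangle := mem_frontier_rectangle.2 ⟨hm, Or.inr (Or.inr (Or.inl h))⟩
      rw [he1 hf, he2 hf, h1.ruled_right (z := ρ x) h, h2.ruled_right (z := ρ x) h]
    · have hf : ρ x ∈ frontier rectangle := mem_frontier_rectangle.2 ⟨hm, Or.inr (Or.inr (Or.inr h))⟩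
      rw [he1 hf, he2 hf, h1.ruled_left (z := ρ x) h, h2.ruled_left (z := ρ x) h]
  let k : Circle × ℝ → ℂ := fun x => if 0 ≤ (x.1 : ℂ).im then F₁ (ρ x) else F₂ (ρ x)
  have hkp : ∀ x ∈ (univ : Set Circle) ×ˢ Icc (0 : ℝ) 1, 0 ≤ (x.1 : ℂ).im → k x = F₁ (ρ x) :=
    fun x _ h => if_pos h
  have hkn : ∀ x ∈ (univ : Set Circle) ×ˢ Icc (0 : ℝ) 1, (x.1 : ℂ).im ≤ 0 → k x = F₂ (ρ x) := by
    intro x hx h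
    rcases h.lt_or_eq with h | h
    · exact if_neg (not_le.2 h)
    · rw [hkp x hx h.ge, hagree x hx h]
  have hIm : Continuous fun x : Circle × ℝ => (x.1 : ℂ).im :=
    Complex.continuous_im.comp (continuous_subtype_val.comp continuous_fst)
  have hup : ∀ z ∈ rectangle, ∃ x ∈ (univ : Set Circle) ×ˢ Icc (0 : ℝ) 1,
      0 ≤ (x.1 : ℂ).im ∧ ρ x = z := by
    intro z hz
    refine ⟨(⟨upperArc z.re, mem_sphere_zero_iff_norm.2 (norm_upperArc hz.1)⟩, z.im),
      ⟨mem_univ _, hz.2⟩, ?_, Complex.ext ?_ rfl⟩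
    · change 0 ≤ (upperArc z.re).im
      rw [upperArc_im]; exact Real.sqrt_nonneg _
    · exact upperArc_re _
  have hlo : ∀ z ∈ rectangle, ∃ x ∈ (univ : Set Circle) ×ˢ Icc (0 : ℝ) 1,
      (x.1 : ℂ).im ≤ 0 ∧ ρ x = z := by
    intro z hz
    refine ⟨(⟨lowerArc z.re, mem_sphere_zero_iff_norm.2 (norm_lowerArc hz.1)⟩, z.im),
      ⟨mem_univ _, hz.2⟩, ?_, Complex.ext ?_ rfl⟩
    · change (lowerArc z.re).im ≤ 0
      rw [lowerArc_im]; exact neg_nonpos.2 (Real.sqrt_nonneg _)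
    · exact lowerArc_re _
  have hinj : ∀ x ∈ (univ : Set Circle) ×ˢ Icc (0 : ℝ) 1,
      ∀ y ∈ (univ : Set Circle) ×ˢ Icc (0 : ℝ) 1, ρ x = ρ y →
      (0 ≤ (x.1 : ℂ).im ∧ 0 ≤ (y.1 : ℂ).im ∨ (x.1 : ℂ).im ≤ 0 ∧ (y.1 : ℂ).im ≤ 0) → x = y := by
    intro x _ y _ h hs
    have hr : (ρ x).re = (ρ y).re := by rw [h]
    have hi : (ρ x).im = (ρ y).im := by rw [h]
    change (x.1 : ℂ).re = (y.1 : ℂ).re at hr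
    refine Prod.ext (Circle.ext ?_) hi
    rcases hs with ⟨ha, hb⟩ | ⟨ha, hb⟩
    · rw [← upperArc_of_re (Circle.norm_coe x.1) ha, hr, upperArc_of_re (Circle.norm_coe y.1) hb]
    · rw [← lowerArc_of_re (Circle.norm_coe x.1) ha, hr, lowerArc_of_re (Circle.norm_coe y.1) hb]
  have hcross : ∀ z ∈ rectangle, ∀ w ∈ rectangle, F₁ z = F₂ w → z = w ∧ (z.re = 1 ∨ z.re = -1) := by
    intro z hz w hw h
    obtain ⟨⟨a, ha, haz⟩, ⟨b, hb, hbw⟩⟩ := hF ⟨mem_image_of_mem _ hz, h ▸ mem_image_of_mem _ hw⟩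
    have hz' : z ∈ frontier rectangle := hi1 (hfs ha) hz haz ▸ ha
    have hw' : w ∈ frontier rectangle := hi2 (hfs hb) hw (hbw.trans h) ▸ hb
    rw [he1 hz', he2 hw'] at h
    have hp := h1.hp
    have hq := h1.hq
    have hn : z.im = 0 ↔ w.im = 0 := by
      rw [← h1.norm_ruled_iff hz', ← h2.norm_ruled_iff hw', h]
    have hm : z.im = 1 ↔ w.im = 1 := by
      rw [← h1.ruled_mem_iff hz', ← h2.ruled_mem_iff hw', h]
    by_cases hz0 : z.im = 0
    · have hw0 := hn.1 hz0
      rw [Spanning.ruled_bot hz0, Spanning.ruled_bot hw0] at h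
      have hr := congrArg Complex.re h
      have hi := congrArg Complex.im h
      rw [upperArc_re, lowerArc_re] at hr
      rw [upperArc_im, lowerArc_im, ← hr] at hi
      have hs : Real.sqrt (1 - z.re ^ 2) = 0 := by linarith [Real.sqrt_nonneg (1 - z.re ^ 2)]
      rw [Real.sqrt_eq_zero (by nlinarith [hz.1.1, hz.1.2])] at hs
      exact ⟨Complex.ext hr (by rw [hz0, hw0]), mul_self_eq_one_iff.1 (by nlinarith)⟩
    by_cases hz1 : z.im = 1
    · have hw1 := hm.1 hz1
      rw [Spanning.ruled_top hz1, Spanning.ruled_top hw1] at h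
      obtain ⟨hr, hx⟩ := hd _ hz.1 _ hw.1 h
      exact ⟨Complex.ext hr (by rw [hz1, hw1]), hx⟩
    have hw0 : w.im ≠ 0 := fun h => hz0 (hn.2 h)
    have hw1 : w.im ≠ 1 := fun h => hz1 (hm.2 h)
    have hcz := ((mem_frontier_rectangle.1 hz').2.resolve_left hz0).resolve_left hz1
    have hcw := ((mem_frontier_rectangle.1 hw').2.resolve_left hw0).resolve_left hw1
    refine ⟨?_, hcz⟩
    rcases hcw with hc | hc
    · rw [h2.ruled_right hc, ← h1.ruled_right hc] at h
      exact h1.injOn hz' hw' h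
    · exact h1.injOn hz' hw' (by rw [h1.ruled_left hc, ← h2.ruled_left hc, h])
  refine ⟨k, ?_, ?_, ?_, ?_, ?_⟩
  · have hu : (univ : Set Circle) ×ˢ Icc (0 : ℝ) 1 =
        (univ ×ˢ Icc 0 1 ∩ {x : Circle × ℝ | 0 ≤ (x.1 : ℂ).im}) ∪
          (univ ×ˢ Icc 0 1 ∩ {x : Circle × ℝ | (x.1 : ℂ).im ≤ 0}) := by
      rw [← inter_union_distrib_left]
      refine (inter_eq_left.2 fun x _ => ?_).symm
      exact (le_total 0 (x.1 : ℂ).im).imp id id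
    have hcl : IsClosed ((univ : Set Circle) ×ˢ Icc (0 : ℝ) 1) := isClosed_univ.prod isClosed_Icc
    rw [hu]
    refine ContinuousOn.union_of_isClosed ?_ ?_ (hcl.inter (isClosed_le continuous_const hIm))
      (hcl.inter (isClosed_le hIm continuous_const))
    · exact ((hc1.comp hρ.continuousOn hρm).mono inter_subset_left).congr
        fun x hx => hkp x hx.1 hx.2
    · exact ((hc2.comp hρ.continuousOn hρm).mono inter_subset_left).congr
        fun x hx => hkn x hx.1 hx.2
  · intro x hx y hy h
    rcases le_total 0 (x.1 : ℂ).im with hxi | hxi <;> rcases le_total 0 (y.1 : ℂ).im with hyi | hyi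
    · rw [hkp x hx hxi, hkp y hy hyi] at h
      exact hinj x hx y hy (hi1 (hρm hx) (hρm hy) h) (Or.inl ⟨hxi, hyi⟩)
    · rw [hkp x hx hxi, hkn y hy hyi] at h
      obtain ⟨hxy, hr⟩ := hcross _ (hρm hx) _ (hρm hy) h
      refine hinj x hx y hy hxy (Or.inl ⟨hxi, ?_⟩)
      rw [hxy] at hr
      have hr' : (y.1 : ℂ).re = 1 ∨ (y.1 : ℂ).re = -1 := hr
      have := (norm_eq_one_iff_sq _).1 (Circle.norm_coe y.1)
      rcases hr' with hr' | hr' <;> rw [hr'] at this <;> nlinarith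
    · rw [hkn x hx hxi, hkp y hy hyi] at h
      obtain ⟨hxy, hr⟩ := hcross _ (hρm hy) _ (hρm hx) h.symm
      refine hinj x hx y hy hxy.symm (Or.inl ⟨?_, hyi⟩)
      rw [hxy] at hr
      have hr' : (x.1 : ℂ).re = 1 ∨ (x.1 : ℂ).re = -1 := hr
      have := (norm_eq_one_iff_sq _).1 (Circle.norm_coe x.1)
      rcases hr' with hr' | hr' <;> rw [hr'] at this <;> nlinarith
    · rw [hkn x hx hxi, hkn y hy hyi] at h
      exact hinj x hx y hy (hi2 (hρm hx) (hρm hy) h) (Or.inr ⟨hxi, hyi⟩)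
  · apply Subset.antisymm
    · rintro _ ⟨x, hx, rfl⟩
      rcases le_total 0 (x.1 : ℂ).im with hxi | hxi
      · rw [hkp x hx hxi]; exact Or.inl (mem_image_of_mem _ (hρm hx))
      · rw [hkn x hx hxi]; exact Or.inr (mem_image_of_mem _ (hρm hx))
    · rintro _ (⟨z, hz, rfl⟩ | ⟨z, hz, rfl⟩)
      · obtain ⟨x, hx, hxi, rfl⟩ := hup z hz
        exact ⟨x, hx, hkp x hx hxi⟩
      · obtain ⟨x, hx, hxi, rfl⟩ := hlo z hz
        exact ⟨x, hx, hkn x hx hxi⟩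
  · intro s
    have hx : (s, (0 : ℝ)) ∈ (univ : Set Circle) ×ˢ Icc (0 : ℝ) 1 := ⟨mem_univ _, by simp⟩
    have hf : ρ (s, 0) ∈ frontier rectangle := mem_frontier_rectangle.2 ⟨hρm hx, Or.inl rfl⟩
    rcases le_total 0 (s : ℂ).im with hs | hs
    · rw [hkp _ hx hs, he1 hf, Spanning.ruled_bot rfl]
      exact upperArc_of_re (Circle.norm_coe s) hs
    · rw [hkn _ hx hs, he2 hf, Spanning.ruled_bot rfl]
      exact lowerArc_of_re (Circle.norm_coe s) hs
  · have hfr : ∀ x : ℝ, x ∈ Icc (-1 : ℝ) 1 → (⟨x, 1⟩ : ℂ) ∈ frontier rectangle := fun x hx =>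
      mem_frontier_rectangle.2 ⟨⟨hx, by norm_num⟩, Or.inr (Or.inl rfl)⟩
    rw [← hβ]
    apply Subset.antisymm
    · rintro _ ⟨⟨s, t⟩, ⟨-, ht⟩, rfl⟩
      rw [mem_singleton_iff] at ht
      dsimp only at ht
      subst ht
      have hx : (s, (1 : ℝ)) ∈ (univ : Set Circle) ×ˢ Icc (0 : ℝ) 1 := ⟨mem_univ _, by simp⟩
      rcases le_total 0 (s : ℂ).im with hs | hs
      · left
        rw [hkp _ hx hs, he1 (hfr _ (hre s)), Spanning.ruled_top rfl]
        exact mem_image_of_mem _ (hre s)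
      · right
        rw [hkn _ hx hs, he2 (hfr _ (hre s)), Spanning.ruled_top rfl]
        exact mem_image_of_mem _ (hre s)
    · rintro _ (⟨x, hx, rfl⟩ | ⟨x, hx, rfl⟩)
      · obtain ⟨y, hy, hyi, hyx⟩ := hup ⟨x, 1⟩ (hfs (hfr x hx))
        refine ⟨y, ⟨mem_univ _, congrArg Complex.im hyx⟩, ?_⟩
        rw [hkp y hy hyi, hyx, he1 (hfr x hx), Spanning.ruled_top rfl]
      · obtain ⟨y, hy, hyi, hyx⟩ := hlo ⟨x, 1⟩ (hfs (hfr x hx))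
        refine ⟨y, ⟨mem_univ _, congrArg Complex.im hyx⟩, ?_⟩
        rw [hkn y hy hyi, hyx, he2 (hfr x hx), Spanning.ruled_top rfl]

/-- The **annulus theorem** with a round inner circle. -/
theorem exists_round_annulus (hT : PlaneTwoSided) {T : Set ℂ} (hTc : IsCircle T)
    (h1 : ∀ z ∈ T, 1 < ‖z‖) (h0 : 0 ∈ inside T) :
    ∃ k : Circle × ℝ → ℂ, ContinuousOn k (univ ×ˢ Icc 0 1) ∧ InjOn k (univ ×ˢ Icc 0 1) ∧
      k '' (univ ×ˢ Icc 0 1) = hull T \ Metric.ball 0 1 ∧ (∀ s, k (s, 0) = s) ∧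
      k '' (univ ×ˢ {1}) = T := by
  obtain ⟨p, hp, hpT, hpm⟩ := exists_first_hit hTc h1 h0 (u := 1) (by simp)
  obtain ⟨q, hq, hqT, hqm⟩ := exists_first_hit hTc h1 h0 (u := -1) (by simp)
  simp only [mul_one, mul_neg] at hpT hpm hqT hqm
  have hpq : (p : ℂ) ≠ -(q : ℂ) := by
    rw [← Complex.ofReal_neg]
    intro h
    have := Complex.ofReal_injective h
    linarith
  have hD : Metric.closedBall (0 : ℂ) 1 ⊆ inside T := by
    refine (convex_closedBall (0 : ℂ) 1).isPreconnected.subset_inside ?_ ⟨0, by simp, h0⟩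
    rw [disjoint_left]
    intro z hz hzT
    exact not_lt.2 (mem_closedBall_zero_iff.1 hz) (h1 z hzT)
  have hseg : ∀ u : ℂ, ∀ r : ℝ, 1 < r → (r : ℂ) * u ∈ T →
      (∀ t : ℝ, 0 ≤ t → t < r → (t : ℂ) * u ∉ T) → ∀ t ∈ Icc (0 : ℝ) r, (t : ℂ) * u ∈ hull T := by
    intro u r hr hrT hrm t ht
    rcases ht.2.lt_or_eq with hlt | rfl
    · right
      have hsub : (fun t : ℝ => (t : ℂ) * u) '' Ico 0 r ⊆ inside T := by
        refine ((isPreconnected_Ico).image _ (by fun_prop)).subset_inside ?_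
          ⟨0, ⟨0, ⟨le_rfl, by linarith⟩, by simp⟩, h0⟩
        rw [disjoint_left]
        rintro _ ⟨t, ht, rfl⟩ h
        exact hrm t ht.1 ht.2 h
      exact hsub ⟨t, ⟨ht.1, hlt⟩, rfl⟩
    · exact Or.inl hrT
  have hGT : chords p q ⊆ hull T := by
    rintro _ (⟨t, ht, rfl⟩ | ⟨t, ht, rfl⟩)
    · have := hseg 1 p hp (by simpa using hpT) (by simpa using hpm) t
        ⟨by linarith [ht.1], ht.2⟩
      simpa using this
    · have := hseg (-1) q hq (by simpa using hqT) (by simpa using hqm) t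
        ⟨by linarith [ht.1], ht.2⟩
      simpa using this
  have hGn : ∀ z ∈ chords p q, 1 ≤ ‖z‖ := by
    rintro _ (⟨t, ht, rfl⟩ | ⟨t, ht, rfl⟩)
    · rw [Complex.norm_real, Real.norm_eq_abs, abs_of_nonneg (by linarith [ht.1])]; exact ht.1
    · rw [norm_neg, Complex.norm_real, Real.norm_eq_abs, abs_of_nonneg (by linarith [ht.1])]
      exact ht.1
  have hG : Disjoint (chords p q) (Metric.ball 0 1) := by
    rw [disjoint_left]
    intro z hz hzb
    exact not_lt.2 (hGn z hz) (mem_ball_zero_iff.1 hzb)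
  have hGA : (chords p q \ Metric.sphere 0 1).Nonempty := by
    refine ⟨p, Or.inl ⟨p, ⟨hp.le, le_rfl⟩, rfl⟩, ?_⟩
    rw [mem_sphere_zero_iff_norm, Complex.norm_real, Real.norm_eq_abs, abs_of_pos (by linarith)]
    exact hp.ne'
  have hS : ∀ α β : ℝ → ℂ, (α = upperArc ∨ α = lowerArc) → Continuous β →
      InjOn β (Icc (-1) 1) → (∀ x ∈ Icc (-1 : ℝ) 1, β x ∈ T) → β 1 = p → β (-1) = -q →
      Spanning T p q α β := by
    rintro α β (rfl | rfl) hc hi hm hβ1 hβ2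
    · exact ⟨continuous_upperArc, hc, fun x _ y _ h => by
        simpa [upperArc_re] using congrArg Complex.re h, hi, fun x hx => norm_upperArc hx, hm,
        by simp [upperArc], by simp [upperArc], hβ1, hβ2, h1, hp, hq, hpm, hqm⟩
    · exact ⟨continuous_lowerArc, hc, fun x _ y _ h => by
        simpa [lowerArc_re] using congrArg Complex.re h, hi, fun x hx => norm_lowerArc hx, hm,
        by simp [lowerArc], by simp [lowerArc], hβ1, hβ2, h1, hp, hq, hpm, hqm⟩
  have hB : ∀ β₁ β₂ : ℝ → ℂ, Spanning T p q upperArc β₁ →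
      (∀ x ∈ Icc (-1 : ℝ) 1, ∀ y ∈ Icc (-1 : ℝ) 1, β₁ x = β₂ y → x = y ∧ (x = 1 ∨ x = -1)) →
      (β₁ '' Icc (-1) 1 \
        (β₂ '' Icc (-1) 1 ∪ (chords p q ∪ upperArc '' Icc (-1) 1))).Nonempty := by
    intro β₁ β₂ h11 hd
    refine ⟨β₁ 0, mem_image_of_mem _ (by norm_num), ?_⟩
    rintro (⟨y, hy, h⟩ | h | ⟨y, hy, h⟩)
    · rcases (hd 0 (by norm_num) y hy h.symm).2 with h | h <;> norm_num at h
    · have hT0 := h11.mem 0 (by norm_num)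
      rcases h with ⟨t, ht, h⟩ | ⟨t, ht, h⟩
      · rcases ht.2.lt_or_eq with hlt | rfl
        · exact hpm t (by linarith [ht.1]) hlt (by rw [← h] at hT0; exact hT0)
        · have := h11.injβ (by norm_num) (by norm_num) (h.symm.trans h11.β_one.symm)
          norm_num at this
      · rcases ht.2.lt_or_eq with hlt | rfl
        · exact hqm t (by linarith [ht.1]) hlt (by rw [← h] at hT0; exact hT0)
        · have := h11.injβ (by norm_num) (by norm_num) (h.symm.trans h11.β_neg.symm)
          norm_num at this
    · have := h1 _ (h11.mem 0 (by norm_num))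
      rw [← h, norm_upperArc hy] at this
      exact lt_irrefl _ this
  have main : ∀ β₁ β₂ : ℝ → ℂ, (∀ α, (α = upperArc ∨ α = lowerArc) → Spanning T p q α β₁) →
      (∀ α, (α = upperArc ∨ α = lowerArc) → Spanning T p q α β₂) →
      β₁ '' Icc (-1) 1 ∪ β₂ '' Icc (-1) 1 = T →
      (∀ x ∈ Icc (-1 : ℝ) 1, ∀ y ∈ Icc (-1 : ℝ) 1, β₁ x = β₂ y → x = y ∧ (x = 1 ∨ x = -1)) →
      Metric.ball 0 1 ⊆ inside (β₂ '' Icc (-1) 1 ∪ (chords p q ∪ upperArc '' Icc (-1) 1)) →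
      ∃ k : Circle × ℝ → ℂ, ContinuousOn k (univ ×ˢ Icc 0 1) ∧ InjOn k (univ ×ˢ Icc 0 1) ∧
      k '' (univ ×ˢ Icc 0 1) = hull T \ Metric.ball 0 1 ∧ (∀ s, k (s, 0) = s) ∧
      k '' (univ ×ˢ {1}) = T := by
    intro β₁ β₂ hs1 hs2 hβ hd hball
    have h11 := hs1 _ (Or.inl rfl)
    have h22 := hs2 _ (Or.inr rfl)
    obtain ⟨hu, hi⟩ := half_annuli hT (hβ.symm ▸ hTc) h11.isCircle (hs2 _ (Or.inl rfl)).isCircle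
      h22.isCircle upperArc_union_lowerArc (hβ.symm ▸ hGT) hG (hβ.symm ▸ hD)
      (hB β₁ β₂ h11 hd) hGA hball
    obtain ⟨F₁, hc1, hi1, he1, hm1⟩ := h11.exists_extension hT
    obtain ⟨F₂, hc2, hi2, he2, hm2⟩ := h22.exists_extension hT
    obtain ⟨k, hk1, hk2, hk3, hk4, hk5⟩ := exists_annulus_of_halves h11 h22 hβ hd hc1 hc2 hi1 hi2
      he1 he2 (by
        rw [hm1, hm2, he1.image_eq, he2.image_eq, h11.image_frontier, h22.image_frontier]
        exact hi)
    refine ⟨k, hk1, hk2, ?_, hk4, hk5⟩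
    rw [hk3, hm1, hm2, hu, hβ]
  obtain ⟨β₁, β₂, hc1, hc2, hi1, hi2, h11, h21, h1n, h2n, hβ, hd⟩ := hTc.exists_arcs hpT hqT hpq
  have hs1 := fun α hα => hS α β₁ hα hc1 hi1
    (fun x hx => hβ ▸ Or.inl (mem_image_of_mem _ hx)) h11 h1n
  have hs2 := fun α hα => hS α β₂ hα hc2 hi2
    (fun x hx => hβ ▸ Or.inr (mem_image_of_mem _ hx)) h21 h2n
  have hball : ∀ β : ℝ → ℂ, Spanning T p q upperArc β →
      Disjoint (Metric.ball 0 1) (β '' Icc (-1) 1 ∪ (chords p q ∪ upperArc '' Icc (-1) 1)) := by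
    intro β hβ
    rw [disjoint_left]
    rintro z hz (⟨x, hx, rfl⟩ | h | ⟨x, hx, rfl⟩)
    · exact not_lt.2 (hβ.one_lt _ (hβ.mem x hx)).le (mem_ball_zero_iff.1 hz)
    · exact not_lt.2 (hGn z h) (mem_ball_zero_iff.1 hz)
    · exact not_lt.2 (norm_upperArc hx).ge (mem_ball_zero_iff.1 hz)
  have hpre : IsPreconnected (Metric.ball (0 : ℂ) 1) := (convex_ball (0 : ℂ) 1).isPreconnected
  by_cases hin : (0 : ℂ) ∈ inside (β₂ '' Icc (-1) 1 ∪ (chords p q ∪ upperArc '' Icc (-1) 1))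
  · exact main β₁ β₂ hs1 hs2 hβ hd
      (hpre.subset_inside (hball β₂ (hs2 _ (Or.inl rfl))) ⟨0, by simp, hin⟩)
  · refine main β₂ β₁ hs2 hs1 (by rw [union_comm, hβ]) ?_ (hpre.subset_inside
      (hball β₁ (hs1 _ (Or.inl rfl))) ⟨0, by simp, ?_⟩)
    · intro x hx y hy h
      obtain ⟨h2, h3⟩ := hd y hy x hx h.symm
      exact ⟨h2.symm, h2 ▸ h3⟩
    · have hA : upperArc '' Icc (-1) 1 ⊆ Metric.sphere 0 1 :=
        upperArc_union_lowerArc ▸ subset_union_left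
      have hsub : chords p q ∪ upperArc '' Icc (-1) 1 ⊆ hull T := union_subset hGT
        (hA.trans (Metric.sphere_subset_closedBall.trans (hD.trans (inside_subset_hull _))))
      have he := (theta_curve hT (hβ.symm ▸ hTc) (hs1 _ (Or.inl rfl)).isCircle
        (hs2 _ (Or.inl rfl)).isCircle (hβ.symm ▸ hsub) (hB β₁ β₂ (hs1 _ (Or.inl rfl)) hd)).2
      rw [hβ] at he
      have h0' := h0
      rw [he] at h0'
      rcases h0' with (h | h) | h
      · exact h
      · exact absurd (Or.inr h.1)
          (disjoint_left.1 (hball β₁ (hs1 _ (Or.inl rfl))) (by simp : (0 : ℂ) ∈ Metric.ball 0 1))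
      · exact absurd h hin

lemma exists_isClosed_of_connectedComponentIn_subset {X : Type*} [TopologicalSpace X] [T2Space X]
    {K U : Set X} {x : X} (hK : IsCompact K) (hx : x ∈ K) (hU : IsOpen U)
    (h : connectedComponentIn K x ⊆ U) :
    ∃ P ⊆ K, IsClosed P ∧ IsClosed (K \ P) ∧ x ∈ P ∧ P ⊆ U := by
  have : CompactSpace K := isCompact_iff_compactSpace.1 hK
  let x' : K := ⟨x, hx⟩
  let N := { s : Set K // IsClopen s ∧ x' ∈ s }
  have : Nonempty N := ⟨⟨univ, isClopen_univ, mem_univ _⟩⟩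
  have hdir : Directed GE.ge fun s : N => s.val := by
    rintro ⟨s, hs, hxs⟩ ⟨t, ht, hxt⟩
    exact ⟨⟨s ∩ t, hs.inter ht, ⟨hxs, hxt⟩⟩, inter_subset_left, inter_subset_right⟩
  have h_nhds : ∀ y ∈ ⋂ s : N, s.val, ((↑) : K → X) ⁻¹' U ∈ 𝓝 y := fun y hy => by
    rw [← connectedComponent_eq_iInter_isClopen x'] at hy
    refine (hU.preimage continuous_subtype_val).mem_nhds (h ?_)
    rw [connectedComponentIn_eq_image hx]
    exact mem_image_of_mem _ hy
  obtain ⟨⟨s, hs, hxs⟩, hsU⟩ :=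
    exists_subset_nhds_of_compactSpace hdir (fun s : N => s.property.1.1) h_nhds
  have hval := hK.isClosed.isClosedEmbedding_subtypeVal
  refine ⟨(↑) '' s, Subtype.coe_image_subset K s, hval.isClosedMap _ hs.1, ?_, ⟨x', hxs, rfl⟩, ?_⟩
  · have : K \ (↑) '' s = ((↑) : K → X) '' sᶜ := by
      rw [image_compl_eq_range_sdiff_image Subtype.val_injective, Subtype.range_coe]
    rw [this]
    exact hval.isClosedMap _ hs.compl.1
  · rintro _ ⟨y, hy, rfl⟩
    exact hsU hy

/-- A closed subset of a preconnected set with closed complement is trivial. -/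
lemma IsPreconnected.subset_of_isClosed_sdiff {X : Type*} [TopologicalSpace X] {C P K : Set X}
    (hC : IsPreconnected C) (hP : IsClosed P) (hP' : IsClosed (K \ P)) (hCK : C ⊆ K)
    (hne : (C ∩ P).Nonempty) : C ⊆ P := by
  by_contra hn
  obtain ⟨y, hy, hyP⟩ := not_subset.1 hn
  obtain ⟨z, -, hz⟩ := isPreconnected_closed_iff.1 hC P (K \ P) hP hP'
    (fun z hz => (em (z ∈ P)).imp id fun h => ⟨hCK hz, h⟩) hne ⟨y, hy, hCK hy, hyP⟩
  exact hz.2.2 hz.1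

lemma isClosed_connectedComponentIn {X : Type*} [TopologicalSpace X] {K : Set X} (hK : IsClosed K)
    (x : X) : IsClosed (connectedComponentIn K x) := by
  by_cases hx : x ∈ K
  · refine isClosed_of_closure_subset ?_
    exact isPreconnected_connectedComponentIn.closure.subset_connectedComponentIn
      (subset_closure (mem_connectedComponentIn hx))
      (closure_minimal (connectedComponentIn_subset K x) hK)
  · rw [connectedComponentIn_eq_empty hx]
    exact isClosed_empty

lemma exists_subcontinuum_disjoint {X : Type*} [TopologicalSpace X] [T2Space X] [NormalSpace X]
    {𝒜 : Set (Set X)} (hcl : ∀ A ∈ 𝒜, IsClosed A) (hd : 𝒜.PairwiseDisjoint id)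
    {C F : Set X} (hF : F ∈ 𝒜) (hC : IsCompact C) (hC' : IsPreconnected C) (hCA : C ⊆ ⋃₀ 𝒜)
    (h2 : ∃ A ∈ 𝒜, ∃ B ∈ 𝒜, A ≠ B ∧ (C ∩ A).Nonempty ∧ (C ∩ B).Nonempty) :
    ∃ C' ⊆ C, IsCompact C' ∧ IsPreconnected C' ∧ Disjoint C' F ∧
      ∃ A ∈ 𝒜, ∃ B ∈ 𝒜, A ≠ B ∧ (C' ∩ A).Nonempty ∧ (C' ∩ B).Nonempty := by
  by_cases hCF : Disjoint C F
  · exact ⟨C, Subset.rfl, hC, hC', hCF, h2⟩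
  have hCF : (C ∩ F).Nonempty := not_disjoint_iff_nonempty_inter.1 hCF
  obtain ⟨G, hG, hGF, x, hxC, hxG⟩ : ∃ G ∈ 𝒜, G ≠ F ∧ (C ∩ G).Nonempty := by
    obtain ⟨A, hA, B, hB, hAB, hCA, hCB⟩ := h2
    by_cases h : A = F
    · exact ⟨B, hB, fun h' => hAB (h.trans h'.symm), hCB⟩
    · exact ⟨A, hA, h, hCA⟩
  obtain ⟨V, hV, hGV, hVF⟩ := normal_exists_closure_subset (hcl G hG) (hcl F hF).isOpen_compl
    (hd hG hF hGF).subset_compl_right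
  have hK : IsCompact (C ∩ closure V) := hC.inter_right isClosed_closure
  have hx : x ∈ C ∩ closure V := ⟨hxC, subset_closure (hGV hxG)⟩
  have hsub := connectedComponentIn_subset (C ∩ closure V) x
  refine ⟨connectedComponentIn (C ∩ closure V) x, hsub.trans inter_subset_left,
    hK.of_isClosed_subset (isClosed_connectedComponentIn hK.isClosed x) hsub,
    isPreconnected_connectedComponentIn,
    disjoint_left.2 fun y hy hyF => hVF (hsub hy).2 hyF, G, hG, ?_⟩
  by_cases hCV : connectedComponentIn (C ∩ closure V) x ⊆ V
  · exfalso
    obtain ⟨P, hPK, hP, hKP, hxP, hPV⟩ :=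
      exists_isClosed_of_connectedComponentIn_subset hK hx hV hCV
    have hCP : IsClosed (C \ P) := by
      have : C \ P = (C ∩ closure V) \ P ∪ C ∩ Vᶜ := by
        ext y
        constructor
        · rintro ⟨hy, hyP⟩
          by_cases hyV : y ∈ V
          · exact Or.inl ⟨⟨hy, subset_closure hyV⟩, hyP⟩
          · exact Or.inr ⟨hy, hyV⟩
        · rintro (⟨⟨hy, -⟩, hyP⟩ | ⟨hy, hyV⟩)
          · exact ⟨hy, hyP⟩
          · exact ⟨hy, fun h => hyV (hPV h)⟩
      rw [this]
      exact hKP.union (hC.isClosed.inter hV.isClosed_compl)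
    obtain ⟨y, hyC, hyF⟩ := hCF
    exact hVF (subset_closure (hPV (hC'.subset_of_isClosed_sdiff hP hCP Subset.rfl
      ⟨x, hxC, hxP⟩ hyC))) hyF
  · obtain ⟨y, hy, hyV⟩ := not_subset.1 hCV
    obtain ⟨H, hH, hyH⟩ := hCA (hsub hy).1
    exact ⟨H, hH, fun h => hyV (hGV (h ▸ hyH)), ⟨x, mem_connectedComponentIn hx, hxG⟩, y, hy, hyH⟩

/-- Sierpiński: a continuum is not a countable disjoint union of at least two closed sets. -/
theorem sierpinski {X : Type*} [TopologicalSpace X] [T2Space X] [NormalSpace X]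
    {𝒜 : Set (Set X)} (hcount : 𝒜.Countable) (hcl : ∀ A ∈ 𝒜, IsClosed A)
    (hd : 𝒜.PairwiseDisjoint id) {Z : Set X} (hZ : IsCompact Z) (hZ' : IsPreconnected Z)
    (hZA : Z ⊆ ⋃₀ 𝒜) {A B : Set X} (hA : A ∈ 𝒜) (hB : B ∈ 𝒜) (hZA' : (Z ∩ A).Nonempty)
    (hZB : (Z ∩ B).Nonempty) : A = B := by
  by_contra hAB
  obtain ⟨f, hf⟩ := hcount.exists_eq_range ⟨A, hA⟩
  have hf' : ∀ n, f n ∈ 𝒜 := fun n => hf ▸ mem_range_self n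
  let Good := {C : Set X // C ⊆ Z ∧ IsCompact C ∧ IsPreconnected C ∧
    ∃ A ∈ 𝒜, ∃ B ∈ 𝒜, A ≠ B ∧ (C ∩ A).Nonempty ∧ (C ∩ B).Nonempty}
  have step : ∀ (n : ℕ) (C : Good), ∃ C' : Good, C'.1 ⊆ C.1 ∧ Disjoint C'.1 (f n) := by
    rintro n ⟨C, hCZ, hC, hC', h2⟩
    obtain ⟨C', hsub, h3, h4, h5, h6⟩ :=
      exists_subcontinuum_disjoint hcl hd (hf' n) hC hC' (hCZ.trans hZA) h2
    exact ⟨⟨C', hsub.trans hCZ, h3, h4, h6⟩, hsub, h5⟩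
  choose g hg hgd using step
  let s : ℕ → Good := fun n => Nat.rec ⟨Z, Subset.rfl, hZ, hZ', A, hA, B, hB, hAB, hZA', hZB⟩ g n
  have hs : ∀ n, s (n + 1) = g n (s n) := fun n => rfl
  have hne : ∀ n, (s n).1.Nonempty := fun n => by
    obtain ⟨-, -, -, A, -, B, -, -, ⟨x, hx, -⟩, -⟩ := (s n).2
    exact ⟨x, hx⟩
  obtain ⟨x, hx⟩ := IsCompact.nonempty_iInter_of_sequence_nonempty_isCompact_isClosed
    (fun n => (s n).1) (fun n => by rw [hs]; exact hg n _) hne (s 0).2.2.1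
    (fun n => (s n).2.2.1.isClosed)
  rw [mem_iInter] at hx
  obtain ⟨F, hF, hxF⟩ := hZA (hx 0)
  obtain ⟨n, rfl⟩ := hf ▸ hF
  have := hx (n + 1)
  rw [hs] at this
  exact disjoint_left.1 (hgd n _) this hxF

/-- The part of the complement of `a` not in the component of `0`. -/
def shadow (a : Set ℂ) : Set ℂ := aᶜ \ connectedComponentIn aᶜ 0

lemma isOpen_shadow {a : Set ℂ} (ha : IsClosed a) : IsOpen (shadow a) := by
  rw [isOpen_iff_mem_nhds]
  rintro z ⟨hza, hz⟩
  refine Filter.mem_of_superset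
    (ha.isOpen_compl.connectedComponentIn.mem_nhds (mem_connectedComponentIn hza)) ?_
  intro w hw
  refine ⟨connectedComponentIn_subset _ _ hw, fun h => hz ?_⟩
  have h1 := connectedComponentIn_eq hw
  have h2 := connectedComponentIn_eq h
  rw [h2, ← h1]
  exact mem_connectedComponentIn hza

lemma shadow_nonempty {a : Set ℂ} (h : ¬ IsPreconnected aᶜ) : (shadow a).Nonempty := by
  by_contra hn
  rw [not_nonempty_iff_eq_empty, shadow, sdiff_eq_empty] at hn
  exact h ((hn.antisymm (connectedComponentIn_subset _ _)) ▸ isPreconnected_connectedComponentIn)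

lemma subset_component_or_subset_shadow {a b : Set ℂ} (ha : IsClosed a) (hb : IsPreconnected b)
    (hab : Disjoint b a) : b ⊆ connectedComponentIn aᶜ 0 ∨ b ⊆ shadow a :=
  hb.subset_or_subset ha.isOpen_compl.connectedComponentIn (isOpen_shadow ha)
    disjoint_sdiff_self_right (fun x hx => by
      rw [shadow, union_sdiff_self]
      exact Or.inr (disjoint_left.1 hab hx))

lemma closure_connectedComponentIn_inter_nonempty {a : Set ℂ} (ha : IsClosed a)
    (hne : a.Nonempty) {x : ℂ} (hx : x ∉ a) :
    (closure (connectedComponentIn aᶜ x) ∩ a).Nonempty := by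
  have hf : (frontier (connectedComponentIn aᶜ x)).Nonempty := by
    rw [nonempty_frontier_iff]
    refine ⟨⟨x, mem_connectedComponentIn hx⟩, fun h => ?_⟩
    obtain ⟨y, hy⟩ := hne
    exact connectedComponentIn_subset aᶜ x (h ▸ mem_univ y) hy
  obtain ⟨y, hy⟩ := hf
  exact ⟨y, frontier_subset_closure hy,
    not_not.1 (frontier_connectedComponentIn_subset ha.isOpen_compl x hy)⟩

lemma closure_connectedComponentIn_subset {a : Set ℂ} (ha : IsClosed a) (x : ℂ) :
    closure (connectedComponentIn aᶜ x) ⊆ connectedComponentIn aᶜ x ∪ a := by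
  rw [closure_eq_self_union_frontier]
  exact union_subset_union_right _ fun y hy =>
    not_not.1 (frontier_connectedComponentIn_subset ha.isOpen_compl x hy)

lemma shadow_subset_shadow {a b : Set ℂ} (ha : IsClosed a) (ha' : IsPreconnected a)
    (hne : a.Nonempty) (h0 : (0 : ℂ) ∉ a) (hb : b ⊆ shadow a) : shadow b ⊆ shadow a := by
  obtain ⟨y, hy, hya⟩ := closure_connectedComponentIn_inter_nonempty ha hne h0
  have hp : IsPreconnected (closure (connectedComponentIn aᶜ 0) ∪ a) :=
    isPreconnected_connectedComponentIn.closure.union y hy hya ha'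
  have hsub : closure (connectedComponentIn aᶜ 0) ∪ a ⊆ connectedComponentIn bᶜ 0 := by
    refine hp.subset_connectedComponentIn
      (Or.inl (subset_closure (mem_connectedComponentIn h0))) ?_
    rintro x hx hxb
    have h1 := hb hxb
    rcases hx with hx | hx
    · exact (closure_connectedComponentIn_subset ha 0 hx).elim h1.2 h1.1
    · exact h1.1 hx
  rintro x ⟨-, hx⟩
  exact ⟨fun h => hx (hsub (Or.inr h)), fun h => hx (hsub (Or.inl (subset_closure h)))⟩

lemma disjoint_shadow {a b : Set ℂ} (ha : IsClosed a) (hne : a.Nonempty) (hab : Disjoint a b)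
    (h1 : a ⊆ connectedComponentIn bᶜ 0) (h2 : b ⊆ connectedComponentIn aᶜ 0) :
    Disjoint (shadow a) (shadow b) := by
  refine disjoint_left.2 fun x hxa hxb => hxb.2 ?_
  obtain ⟨y, hy, hya⟩ := closure_connectedComponentIn_inter_nonempty ha hne hxa.1
  have hsub : closure (connectedComponentIn aᶜ x) ⊆ connectedComponentIn bᶜ x := by
    refine isPreconnected_connectedComponentIn.closure.subset_connectedComponentIn
      (subset_closure (mem_connectedComponentIn hxa.1)) ?_
    intro z hz hzb
    rcases closure_connectedComponentIn_subset ha x hz with hz | hz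
    · have h3 := connectedComponentIn_eq hz
      have h4 := connectedComponentIn_eq (h2 hzb)
      refine hxa.2 ?_
      rw [h4, ← h3]
      exact mem_connectedComponentIn hxa.1
    · exact disjoint_left.1 hab hz hzb
  rw [connectedComponentIn_eq (h1 hya), ← connectedComponentIn_eq (hsub hy)]
  exact mem_connectedComponentIn hxb.1

/-- The punctured plane has no partition into closed connected unbounded separating sets. -/
theorem no_partition {𝒬 : Set (Set ℂ)} (hcov : ⋃₀ 𝒬 = {0}ᶜ) (hd : 𝒬.PairwiseDisjoint id)
    (hcl : ∀ a ∈ 𝒬, IsClosed a) (hcon : ∀ a ∈ 𝒬, IsPreconnected a)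
    (hub : ∀ a ∈ 𝒬, ¬ Bornology.IsBounded a) (hsep : ∀ a ∈ 𝒬, ¬ IsPreconnected aᶜ) : False := by
  have h0 : ∀ a ∈ 𝒬, (0 : ℂ) ∉ a := fun a ha h => by
    have : (0 : ℂ) ∈ ⋃₀ 𝒬 := ⟨a, ha, h⟩
    rw [hcov] at this
    exact this rfl
  have hne : ∀ a ∈ 𝒬, a.Nonempty := fun a ha => by
    by_contra h
    rw [not_nonempty_iff_eq_empty] at h
    exact hub a ha (h ▸ Bornology.isBounded_empty)
  have nested : ∀ a ∈ 𝒬, ∀ b ∈ 𝒬, shadow a ⊆ shadow b ∨ shadow b ⊆ shadow a ∨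
      Disjoint (shadow a) (shadow b) := by
    intro a ha b hb
    by_cases hab : a = b
    · exact Or.inl (by rw [hab])
    have hdab : Disjoint a b := hd ha hb hab
    rcases subset_component_or_subset_shadow (hcl a ha) (hcon b hb) hdab.symm with h1 | h1
    · rcases subset_component_or_subset_shadow (hcl b hb) (hcon a ha) hdab with h2 | h2
      · exact Or.inr (Or.inr (disjoint_shadow (hcl a ha) (hne a ha) hdab h2 h1))
      · exact Or.inl (shadow_subset_shadow (hcl b hb) (hcon b hb) (hne b hb) (h0 b hb) h2)
    · exact Or.inr (Or.inl (shadow_subset_shadow (hcl a ha) (hcon a ha) (hne a ha) (h0 a ha) h1))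
  let E : Set (Set ℂ) := {a | a ∈ 𝒬 ∧ ∀ b ∈ 𝒬, ¬ a ⊆ shadow b}
  have hEd : E.PairwiseDisjoint shadow := by
    rintro a ⟨ha, ha'⟩ b ⟨hb, hb'⟩ hab
    have hdab : Disjoint a b := hd ha hb hab
    exact disjoint_shadow (hcl a ha) (hne a ha) hdab
      ((subset_component_or_subset_shadow (hcl b hb) (hcon a ha) hdab).resolve_right (ha' b hb))
      ((subset_component_or_subset_shadow (hcl a ha) (hcon b hb) hdab.symm).resolve_right
        (hb' a ha))
  have hEc : E.Countable := hEd.countable_of_isOpen (fun a ha => isOpen_shadow (hcl a ha.1))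
    fun a ha => shadow_nonempty (hsep a ha.1)
  set K : Set ℂ := (⋃ a ∈ 𝒬, shadow a)ᶜ with hKdef
  have hK : IsClosed K := (isOpen_biUnion fun a ha => isOpen_shadow (hcl a ha)).isClosed_compl
  have hK0 : (0 : ℂ) ∈ K := by
    simp only [hKdef, mem_compl_iff, mem_iUnion, not_exists]
    exact fun a ha h => h.2 (mem_connectedComponentIn (h0 a ha))
  have hKE : K ⊆ ⋃₀ (insert {0} E) := by
    intro x hx
    simp only [hKdef, mem_compl_iff, mem_iUnion, not_exists] at hx
    by_cases hx0 : x = 0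
    · exact ⟨{0}, mem_insert _ _, hx0⟩
    · have : x ∈ ⋃₀ 𝒬 := by rw [hcov]; exact hx0
      obtain ⟨a, ha, hxa⟩ := this
      exact ⟨a, mem_insert_of_mem _ ⟨ha, fun b hb h => hx b hb (h hxa)⟩, hxa⟩
  have hEK : ∀ a ∈ E, a ⊆ K := by
    rintro a ⟨ha, ha'⟩ x hx
    simp only [hKdef, mem_compl_iff, mem_iUnion, not_exists]
    intro b hb hxb
    by_cases hab : a = b
    · exact hxb.1 (hab ▸ hx)
    · exact hxb.2 ((subset_component_or_subset_shadow (hcl b hb) (hcon a ha)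
        (hd ha hb hab)).resolve_right (ha' b hb) hx)
  have hKc : IsCompact (K ∩ Metric.closedBall 0 1) :=
    (isCompact_closedBall 0 1).inter_left hK
  have hK0' : (0 : ℂ) ∈ K ∩ Metric.closedBall 0 1 := ⟨hK0, by simp⟩
  have hZsub := connectedComponentIn_subset (K ∩ Metric.closedBall (0 : ℂ) 1) 0
  have hZ : connectedComponentIn (K ∩ Metric.closedBall 0 1) 0 ⊆ Metric.ball 0 1 := by
    intro z hz
    obtain ⟨B, hB, hzB⟩ := hKE (hZsub hz).1
    have : {0} = B := by
      refine sierpinski (hEc.insert {0}) ?_ ?_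
        (hKc.of_isClosed_subset (isClosed_connectedComponentIn hKc.isClosed 0) hZsub)
        isPreconnected_connectedComponentIn (fun w hw => hKE (hZsub hw).1) (mem_insert _ _) hB
        ⟨0, mem_connectedComponentIn hK0', rfl⟩ ⟨z, hz, hzB⟩
      · rintro A (rfl | hA)
        · exact isClosed_singleton
        · exact hcl A hA.1
      · refine (pairwiseDisjoint_insert).2 ⟨fun a ha b hb => hd ha.1 hb.1, fun a ha _ => ?_⟩
        exact disjoint_singleton_left.2 (h0 a ha.1)
    rw [← this] at hzB
    rw [mem_singleton_iff.1 hzB]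
    simp
  obtain ⟨P, hPK, hP, hKP, h0P, hPU⟩ :=
    exists_isClosed_of_connectedComponentIn_subset hKc hK0' Metric.isOpen_ball hZ
  have hKP' : IsClosed (K \ P) := by
    have : K \ P = (K ∩ Metric.closedBall 0 1) \ P ∪ K ∩ (Metric.ball 0 1)ᶜ := by
      ext y
      constructor
      · rintro ⟨hy, hyP⟩
        by_cases hyV : y ∈ Metric.ball (0 : ℂ) 1
        · exact Or.inl ⟨⟨hy, Metric.ball_subset_closedBall hyV⟩, hyP⟩
        · exact Or.inr ⟨hy, hyV⟩
      · rintro (⟨⟨hy, -⟩, hyP⟩ | ⟨hy, hyV⟩)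
        · exact ⟨hy, hyP⟩
        · exact ⟨hy, fun h => hyV (hPU h)⟩
    rw [this]
    exact hKP.union (hK.inter Metric.isOpen_ball.isClosed_compl)
  have hP0 : ∀ x ∈ P, x = 0 := by
    intro x hx
    obtain ⟨B, hB | hB, hxB⟩ := hKE (hPK hx).1
    · rw [hB] at hxB
      exact hxB
    · exact absurd (Metric.isBounded_ball.subset (((hcon B hB.1).subset_of_isClosed_sdiff hP hKP'
        (hEK B hB) ⟨x, hxB, hx⟩).trans hPU)) (hub B hB.1)
  obtain ⟨r, hr, hball⟩ := Metric.isOpen_iff.1 hKP'.isOpen_compl 0 (fun h => h.2 h0P)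
  have hr2 : 0 < r / 2 := by positivity
  set S : Set ℂ := Metric.sphere 0 (r / 2) with hS
  have hScov : ∀ x ∈ S, ∃ a ∈ 𝒬, x ∈ shadow a := by
    intro x hx
    have hxn : ‖x‖ = r / 2 := by simpa [hS] using hx
    have h1 : x ∉ K := by
      intro hxK
      have hxr : x ∈ Metric.ball (0 : ℂ) r := by rw [mem_ball_zero_iff, hxn]; linarith
      refine hball hxr ⟨hxK, fun hxP => ?_⟩
      rw [hP0 x hxP, norm_zero] at hxn
      linarith
    simpa [hKdef] using h1
  have hScon : IsPreconnected S :=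
    isPreconnected_sphere (by rw [Complex.rank_real_complex]; norm_num) _ _
  have hx0 : ((r / 2 : ℝ) : ℂ) ∈ S := by simp [hS, abs_of_pos hr]
  set x₀ : ℂ := ((r / 2 : ℝ) : ℂ)
  let F := {b : Set ℂ // b ∈ 𝒬 ∧ x₀ ∈ shadow b}
  have hSF : S ⊆ ⋃ b : F, shadow b.1 := by
    have key := hScon.subset_or_subset (u := ⋃ b : F, shadow b.1)
      (v := ⋃ c : {c : Set ℂ // c ∈ 𝒬 ∧ x₀ ∉ shadow c ∧ Disjoint (shadow c) (⋃ b : F, shadow b.1)},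
        shadow c.1)
      (isOpen_iUnion fun b => isOpen_shadow (hcl _ b.2.1))
      (isOpen_iUnion fun c => isOpen_shadow (hcl _ c.2.1))
      (disjoint_iUnion_right.2 fun c => c.2.2.2.symm) ?_
    · refine key.resolve_right fun h => ?_
      obtain ⟨c, hc⟩ := mem_iUnion.1 (h hx0)
      exact c.2.2.1 hc
    · intro y hy
      by_cases hyU : y ∈ ⋃ b : F, shadow b.1
      · exact Or.inl hyU
      obtain ⟨c, hc, hyc⟩ := hScov y hy
      have hx0c : x₀ ∉ shadow c := fun h => hyU (mem_iUnion.2 ⟨⟨c, hc, h⟩, hyc⟩)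
      refine Or.inr (mem_iUnion.2 ⟨⟨c, hc, hx0c, disjoint_iUnion_right.2 fun b => ?_⟩, hyc⟩)
      rcases nested c hc b.1 b.2.1 with h | h | h
      · exact absurd (mem_iUnion.2 ⟨b, h hyc⟩) hyU
      · exact absurd (h b.2.2) hx0c
      · exact h
  obtain ⟨a₀, ha₀, hxa₀⟩ := hScov x₀ hx0
  have : Nonempty F := ⟨⟨a₀, ha₀, hxa₀⟩⟩
  obtain ⟨⟨b, hb, hxb'⟩, hSb⟩ := (isCompact_sphere (0 : ℂ) (r / 2)).elim_directed_cover
    (fun b : F => shadow b.1) (fun b => isOpen_shadow (hcl _ b.2.1)) hSF (by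
      rintro ⟨a, ha, hxa⟩ ⟨b, hb, hxb⟩
      rcases nested a ha b hb with h | h | h
      · exact ⟨⟨b, hb, hxb⟩, h, Subset.rfl⟩
      · exact ⟨⟨a, ha, hxa⟩, Subset.rfl, h⟩
      · exact absurd hxb (disjoint_left.1 h hxa))
  have hfr : frontier (Metric.ball (0 : ℂ) (r / 2)) = S := frontier_ball _ hr2.ne'
  have hW : connectedComponentIn bᶜ 0 ⊆ Metric.ball 0 (r / 2) := by
    refine isPreconnected_connectedComponentIn.subset_of_disjoint_frontier Metric.isOpen_ball ?_
      ⟨0, mem_connectedComponentIn (h0 b hb), by simpa using hr2⟩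
    rw [hfr]
    exact disjoint_left.2 fun x hx hxS => (hSb hxS).2 hx
  have hbS : Disjoint b S := disjoint_left.2 fun x hx hxS => (hSb hxS).1 hx
  have hbB : Disjoint b (Metric.ball 0 (r / 2)) := by
    rw [disjoint_iff_inter_eq_empty, ← not_nonempty_iff_eq_empty]
    intro h
    exact hub b hb (Metric.isBounded_ball.subset
      ((hcon b hb).subset_of_disjoint_frontier Metric.isOpen_ball (hfr ▸ hbS) h))
  obtain ⟨y, hy, hyb⟩ :=
    closure_connectedComponentIn_inter_nonempty (hcl b hb) (hne b hb) (h0 b hb)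
  have hy' := closure_mono hW hy
  rw [closure_ball _ hr2.ne', ← Metric.ball_union_sphere] at hy'
  exact hy'.elim (disjoint_left.1 hbB hyb) (disjoint_left.1 hbS hyb)

lemma isOpen_eq_Ioo {A : Set ℝ} (hA : IsOpen A) (hA' : IsPreconnected A) (hne : A.Nonempty)
    (hb : BddBelow A) (hb' : BddAbove A) : A = Ioo (sInf A) (sSup A) := by
  refine Subset.antisymm (fun x hx => ?_) (IsConnected.Ioo_csInf_csSup_subset ⟨hne, hA'⟩ hb hb')
  obtain ⟨l, u, ⟨hl, hu⟩, hs⟩ := mem_nhds_iff_exists_Ioo_subset.1 (hA.mem_nhds hx)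
  obtain ⟨y, hy, hy'⟩ := exists_between hl
  obtain ⟨w, hw, hw'⟩ := exists_between hu
  exact ⟨(csInf_le hb (hs ⟨hy, hy'.trans hu⟩)).trans_lt hy',
    hw.trans_le (le_csSup hb' (hs ⟨hl.trans hw, hw'⟩))⟩

lemma exists_exp_image_Ioo {V : Set Circle} (hV : IsOpen V) (hV' : IsPreconnected V)
    (hne : V.Nonempty) (h1 : Circle.exp Real.pi ∉ V) :
    ∃ a b : ℝ, a < b ∧ -Real.pi ≤ a ∧ b ≤ Real.pi ∧ Circle.exp '' Ioo a b = V := by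
  have harg : ∀ v ∈ V, Complex.arg v ∈ Ioo (-Real.pi) Real.pi := fun v hv =>
    ⟨Complex.neg_pi_lt_arg _, (Complex.arg_le_pi _).lt_of_ne fun h => h1 (by
      rw [← h, Circle.exp_arg]; exact hv)⟩
  set A : Set ℝ := Circle.exp ⁻¹' V ∩ Ioo (-Real.pi) Real.pi with hAdef
  have hA : IsOpen A := (hV.preimage Circle.exp.continuous).inter isOpen_Ioo
  have himg : (fun v : Circle => Complex.arg v) '' V = A := by
    ext x
    constructor
    · rintro ⟨v, hv, rfl⟩
      exact ⟨by simpa using hv, harg v hv⟩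
    · rintro ⟨hx, hx'⟩
      exact ⟨_, hx, Circle.arg_exp hx'.1 hx'.2.le⟩
  have hA' : IsPreconnected A := by
    rw [← himg]
    refine hV'.image _ fun v hv => ContinuousAt.continuousWithinAt ?_
    exact (Complex.continuousAt_arg (Complex.mem_slitPlane_iff_arg.2
      ⟨(harg v hv).2.ne, Circle.coe_ne_zero v⟩)).comp continuous_subtype_val.continuousAt
  have hAne : A.Nonempty := himg ▸ hne.image _
  have hb : BddBelow A := ⟨-Real.pi, fun x hx => hx.2.1.le⟩
  have hb' : BddAbove A := ⟨Real.pi, fun x hx => hx.2.2.le⟩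
  have key := isOpen_eq_Ioo hA hA' hAne hb hb'
  refine ⟨sInf A, sSup A, ?_, le_csInf hAne fun x hx => hx.2.1.le,
    csSup_le hAne fun x hx => hx.2.2.le, ?_⟩
  · rw [key] at hAne
    exact nonempty_Ioo.1 hAne
  · rw [← key]
    ext v
    constructor
    · rintro ⟨x, hx, rfl⟩
      exact hx.1
    · intro hv
      exact ⟨_, himg ▸ mem_image_of_mem _ hv, Circle.exp_arg v⟩

/-- A component of an open part of a circle that is not the whole circle, seen through a closed
chart, is a properly embedded line. -/
lemma exists_closed_line {S : Type*} [TopologicalSpace S] [T2Space S] {e : Circle → S}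
    (he : Continuous e) (hinj : Function.Injective e) {U : Set S} (hU : IsOpen U)
    (h1 : e (Circle.exp Real.pi) ∉ U) {s₀ : Circle} (hs₀ : e s₀ ∈ U) {η : ℂ → S} {ηi : S → ℂ}
    (hη : ContinuousOn η {0}ᶜ) (hηi : ContinuousOn ηi U) (hηU : ∀ z ≠ 0, η z ∈ U)
    (hr : ∀ z ≠ 0, ηi (η z) = z) (hl : ∀ x ∈ U, ηi x ≠ 0 ∧ η (ηi x) = x)
    {N : Set ℂ} (hN : N ∈ 𝓝 (0 : ℂ)) (hN' : ∀ z ∈ N, z ≠ 0 → η z ∉ range e) :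
    ∃ γ : ℝ → ℂ, IsClosedEmbedding γ ∧
      range γ = {z | z ≠ 0 ∧ η z ∈ e '' connectedComponentIn (e ⁻¹' U) s₀} := by
  have hUe : IsOpen (e ⁻¹' U) := hU.preimage he
  have : LocallyConnectedSpace Circle :=
    ChartedSpace.locallyConnectedSpace (EuclideanSpace ℝ (Fin 1)) Circle
  obtain ⟨a, b, hab, ha, hb, hV⟩ := exists_exp_image_Ioo
    (V := connectedComponentIn (e ⁻¹' U) s₀) hUe.connectedComponentIn
    isPreconnected_connectedComponentIn ⟨s₀, mem_connectedComponentIn hs₀⟩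
    (fun h => h1 (connectedComponentIn_subset (e ⁻¹' U) s₀ h))
  set V := connectedComponentIn (e ⁻¹' U) s₀ with hVdef
  have hVU : ∀ v ∈ V, e v ∈ U := fun v hv => connectedComponentIn_subset (e ⁻¹' U) s₀ hv
  have hIcc : ∀ t ∈ Icc a b, e (Circle.exp t) ∈ U → t ∈ Ioo a b := by
    intro t ht htU
    have htV : Circle.exp t ∈ V := by
      have hcl : Circle.exp t ∈ closure V := by
        rw [← hV]
        refine image_closure_subset_closure_image Circle.exp.continuous ⟨t, ?_, rfl⟩
        rwa [closure_Ioo hab.ne]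
      have hp : IsPreconnected (insert (Circle.exp t) V) :=
        isPreconnected_connectedComponentIn.subset_closure (subset_insert _ _)
          (insert_subset hcl subset_closure)
      exact hp.subset_connectedComponentIn (mem_insert_of_mem _ (mem_connectedComponentIn hs₀))
        (insert_subset htU hVU) (mem_insert _ _)
    rw [← hV] at htV
    obtain ⟨u, hu, hut⟩ := htV
    obtain rfl | hlt := ht.1.eq_or_lt
    · have : u = a := Circle.exp_injOn_Ico (a := a) (b := b) (by linarith) ⟨hu.1.le, hu.2⟩
        ⟨le_rfl, hab⟩ hut
      exact absurd hu.1 (by rw [this]; exact lt_irrefl _)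
    · have : u = t := Circle.exp_injOn_Ioc (a := a) (b := b) (by linarith) ⟨hu.1, hu.2.le⟩
        ⟨hlt, ht.2⟩ hut
      exact this ▸ hu
  have hπ := Real.pi_pos
  let g : ℝ → ℝ := fun x => (a + b) / 2 + (b - a) / Real.pi * Real.arctan x
  have hg : Continuous g := by fun_prop
  have hba : 0 < (b - a) / Real.pi := div_pos (by linarith) hπ
  have hgmono : StrictMono g := fun x y hxy =>
    add_lt_add_right (mul_lt_mul_of_pos_left (Real.arctan_strictMono hxy) hba) _
  have hginj : Function.Injective g := hgmono.injective
  have hgr : range g = Ioo a b := by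
    ext t
    constructor
    · rintro ⟨x, rfl⟩
      have h1 := Real.arctan_lt_pi_div_two x
      have h2 := Real.neg_pi_div_two_lt_arctan x
      have e1 := mul_lt_mul_of_pos_left h1 hba
      have e2 := mul_lt_mul_of_pos_left h2 hba
      have e3 : (b - a) / Real.pi * (Real.pi / 2) = (b - a) / 2 := by field_simp
      have e4 : (b - a) / Real.pi * (-(Real.pi / 2)) = -((b - a) / 2) := by field_simp
      rw [e3] at e1
      rw [e4] at e2
      constructor <;> simp only [g] <;> linarith
    · rintro ⟨h1, h2⟩
      refine ⟨Real.tan (Real.pi / (b - a) * (t - (a + b) / 2)), ?_⟩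
      have hba' : 0 < b - a := by linarith
      simp only [g]
      rw [Real.arctan_tan]
      · field_simp
        ring
      · rw [div_mul_eq_mul_div, lt_div_iff₀ hba']
        nlinarith
      · rw [div_mul_eq_mul_div, div_lt_iff₀ hba']
        nlinarith
  have hgm : ∀ x, g x ∈ Ioo a b := fun x => hgr ▸ mem_range_self x
  have hgV : ∀ x, Circle.exp (g x) ∈ V := fun x => hV ▸ mem_image_of_mem _ (hgm x)
  have hδ : ∀ x, e (Circle.exp (g x)) ∈ U := fun x => hVU _ (hgV x)
  let γ : ℝ → ℂ := fun x => ηi (e (Circle.exp (g x)))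
  have hηγ : ∀ x, η (γ x) = e (Circle.exp (g x)) := fun x => (hl _ (hδ x)).2
  have hγ : Continuous γ := hηi.comp_continuous (by fun_prop) hδ
  have hγinj : Function.Injective γ := fun x y hxy => by
    have h2 := congrArg η hxy
    rw [hηγ, hηγ] at h2
    exact hginj (Circle.exp_injOn_Ioc (a := a) (b := b) (by linarith) (Ioo_subset_Ioc_self (hgm x))
      (Ioo_subset_Ioc_self (hgm y)) (hinj h2))
  refine ⟨γ, .of_continuous_injective_isClosedMap hγ hγinj fun F hF => ?_, ?_⟩
  · refine isClosed_of_closure_subset fun z hz => ?_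
    have hz0 : z ≠ 0 := by
      rintro rfl
      obtain ⟨w, hwN, x, -, rfl⟩ := mem_closure_iff_nhds.1 hz N hN
      exact hN' _ hwN (hl _ (hδ x)).1 ⟨_, (hηγ x).symm⟩
    have hcl : η z ∈ closure (η '' (γ '' F)) :=
      ((hη z hz0).continuousAt (isOpen_compl_singleton.mem_nhds hz0)).continuousWithinAt
        |>.mem_closure_image hz
    have hcomp : IsCompact ((fun t => e (Circle.exp t)) '' closure (g '' F)) := by
      refine IsCompact.image ?_ (by fun_prop)
      refine isCompact_Icc.of_isClosed_subset isClosed_closure (s := Icc a b) ?_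
      refine closure_minimal ?_ isClosed_Icc
      rintro _ ⟨x, -, rfl⟩
      exact Ioo_subset_Icc_self (hgm x)
    have hsub : closure (η '' (γ '' F)) ⊆ (fun t => e (Circle.exp t)) '' closure (g '' F) := by
      refine closure_minimal ?_ hcomp.isClosed
      rintro _ ⟨_, ⟨x, hx, rfl⟩, rfl⟩
      exact ⟨g x, subset_closure (mem_image_of_mem _ hx), (hηγ x).symm⟩
    obtain ⟨t, ht, htz⟩ := hsub hcl
    have htI : t ∈ Ioo a b := by
      refine hIcc t ?_ ?_
      · have : closure (g '' F) ⊆ Icc a b := by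
          refine closure_minimal ?_ isClosed_Icc
          rintro _ ⟨x, -, rfl⟩
          exact Ioo_subset_Icc_self (hgm x)
        exact this ht
      · have := hηU z hz0
        rwa [← htz] at this
    rw [← hgr] at htI
    obtain ⟨x, rfl⟩ := htI
    have hord : (range g).OrdConnected := by rw [hgr]; exact ordConnected_Ioo
    have hgo : IsEmbedding g := hgmono.isEmbedding_of_ordConnected hord
    have hxF : x ∈ F := by
      have : x ∈ closure F := by
        rw [hgo.isInducing.closure_eq_preimage_closure_image]
        exact ht
      rwa [hF.closure_eq] at this
    refine ⟨x, hxF, ?_⟩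
    simp only at htz
    simp only [γ]
    rw [htz, hr z hz0]
  · ext z
    constructor
    · rintro ⟨x, rfl⟩
      exact ⟨(hl _ (hδ x)).1, _, hgV x, (hηγ x).symm⟩
    · rintro ⟨hz0, v, hv, hvz⟩
      rw [← hV, ← hgr] at hv
      obtain ⟨_, ⟨x, rfl⟩, rfl⟩ := hv
      exact ⟨x, by simp only [γ]; rw [hvz, hr z hz0]⟩

lemma exists_tube {S : Type*} [TopologicalSpace S] {c : Circle × ℝ → S} (hc : Continuous c)
    {Z : Set S} (hZ : IsClosed Z) (h : ∀ s, c (s, 0) ∉ Z) :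
    ∃ δ > 0, ∀ s t, |t| ≤ δ → c (s, t) ∉ Z := by
  obtain ⟨u, v, -, hv, hu, h0, huv⟩ := generalized_tube_lemma (isCompact_univ (X := Circle))
    (isCompact_singleton (x := (0 : ℝ))) (hZ.isOpen_compl.preimage hc) (by
      rintro ⟨s, t⟩ ⟨-, rfl⟩
      exact h s)
  obtain ⟨δ, hδ, hball⟩ := Metric.isOpen_iff.1 hv 0 (h0 rfl)
  refine ⟨δ / 2, by positivity, fun s t ht => ?_⟩
  have : (s, t) ∈ u ×ˢ v := ⟨hu (mem_univ s), hball (by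
    rw [Metric.mem_ball, dist_zero_right, Real.norm_eq_abs]; linarith)⟩
  exact huv this

/-- The half-open collar `Circle × (0, ε)` as a punctured plane. -/
lemma exists_punctured_chart {S : Type*} [TopologicalSpace S] {c : Circle × ℝ → S}
    (hc : IsOpenEmbedding c) {ε : ℝ} (hε : 0 < ε) :
    ∃ ηi : S → ℂ, ContinuousOn ηi (c '' (univ ×ˢ Ioo 0 ε)) ∧
      ContinuousOn (fun z : ℂ => c (angle z, ε * ‖z‖ / (1 + ‖z‖))) {0}ᶜ ∧
      (∀ z : ℂ, z ≠ 0 → c (angle z, ε * ‖z‖ / (1 + ‖z‖)) ∈ c '' (univ ×ˢ Ioo 0 ε)) ∧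
      (∀ z : ℂ, z ≠ 0 → ηi (c (angle z, ε * ‖z‖ / (1 + ‖z‖))) = z) ∧
      ∀ x ∈ c '' (univ ×ˢ Ioo 0 ε), ηi x ≠ 0 ∧
        c (angle (ηi x), ε * ‖ηi x‖ / (1 + ‖ηi x‖)) = x := by
  let ci := (hc.toOpenPartialHomeomorph c).symm
  have hci : ContinuousOn ci (range c) := by
    simpa using (hc.toOpenPartialHomeomorph c).continuousOn_symm
  have hcl : ∀ q, ci (c q) = q := fun q =>
    (hc.toOpenPartialHomeomorph c).left_inv (x := q) (by simp)
  have hpos : ∀ z : ℂ, 0 < 1 + ‖z‖ := fun z => by positivity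
  have hmem : ∀ z : ℂ, z ≠ 0 → ε * ‖z‖ / (1 + ‖z‖) ∈ Ioo 0 ε := fun z hz => by
    have hn := norm_pos_iff.2 hz
    refine ⟨by positivity, ?_⟩
    rw [div_lt_iff₀ (hpos z)]
    nlinarith
  have hval : ∀ z : ℂ, z ≠ 0 → ε * ‖z‖ / (1 + ‖z‖) / (ε - ε * ‖z‖ / (1 + ‖z‖)) = ‖z‖ :=
    fun z hz => by
      have := hpos z
      have e1 : ε - ε * ‖z‖ / (1 + ‖z‖) = ε / (1 + ‖z‖) := by field_simp; ring
      rw [e1]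
      field_simp
  let ηi : S → ℂ := fun x => (((ci x).2 / (ε - (ci x).2) : ℝ) : ℂ) * ((ci x).1 : ℂ)
  refine ⟨ηi, ?_, ?_, ?_, ?_, ?_⟩
  · have h1 : ContinuousOn ci (c '' (univ ×ˢ Ioo 0 ε)) := hci.mono (image_subset_range _ _)
    have h2 : ContinuousOn (fun x => (ci x).2) (c '' (univ ×ˢ Ioo 0 ε)) :=
      continuous_snd.comp_continuousOn h1
    have h3 : ContinuousOn (fun x => ((ci x).1 : ℂ)) (c '' (univ ×ˢ Ioo 0 ε)) :=
      (continuous_subtype_val.comp continuous_fst).comp_continuousOn h1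
    refine (Complex.continuous_ofReal.comp_continuousOn
      (h2.div (continuousOn_const.sub h2) ?_)).mul h3
    rintro _ ⟨⟨s, t⟩, ⟨-, ht⟩, rfl⟩
    change ε - (ci (c (s, t))).2 ≠ 0
    rw [hcl]
    exact (sub_pos.2 ht.2).ne'
  · refine hc.continuous.comp_continuousOn (continuousOn_angle.prodMk ?_)
    exact (Continuous.div (by fun_prop) (by fun_prop) fun z => (hpos z).ne').continuousOn
  · exact fun z hz => ⟨_, ⟨mem_univ _, hmem z hz⟩, rfl⟩
  · intro z hz
    simp only [ηi, hcl, hval z hz, coe_angle hz]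
    have : (‖z‖ : ℂ) ≠ 0 := by simpa using hz
    field_simp
  · rintro _ ⟨⟨s, t⟩, ⟨-, ht⟩, rfl⟩
    have h0 : 0 < t := ht.1
    have h1 : 0 < ε - t := sub_pos.2 ht.2
    have hη : ηi (c (s, t)) = ((t / (ε - t) : ℝ) : ℂ) * (s : ℂ) := by simp only [ηi, hcl]
    have hr : 0 < t / (ε - t) := by positivity
    have hn : ‖ηi (c (s, t))‖ = t / (ε - t) := by
      rw [hη, norm_mul, Circle.norm_coe, mul_one, Complex.norm_real, Real.norm_of_nonneg hr.le]
    have hne : ηi (c (s, t)) ≠ 0 := norm_pos_iff.1 (by rw [hn]; exact hr)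
    refine ⟨hne, ?_⟩
    have ha : angle (ηi (c (s, t))) = s := by
      apply Circle.coe_injective
      rw [coe_angle hne, hn, hη]
      have : ((t / (ε - t) : ℝ) : ℂ) ≠ 0 := by exact_mod_cast hr.ne'
      field_simp
    rw [ha, hn]
    congr 2
    field_simp
    ring

theorem exists_member_in_collar {S : Type*} [TopologicalSpace S] [T2Space S] {𝒞 : Set (Set S)}
    (h𝒞 : IsCircleDecomposition 𝒞) {C : Set S} (hC : C ∈ 𝒞) {c : Circle × ℝ → S}
    (hc : IsOpenEmbedding c) (hcC : c '' (univ ×ˢ {0}) = C) {ε : ℝ} (hε : 0 < ε) :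
    ∃ D ∈ 𝒞, D ⊆ c '' (univ ×ˢ Ioo 0 ε) := by
  by_contra hno
  push Not at hno
  obtain ⟨hcirc, hdisj, hcov⟩ := h𝒞
  set U := c '' (univ ×ˢ Ioo 0 ε) with hUdef
  have hU : IsOpen U := hc.isOpenMap _ (isOpen_univ.prod isOpen_Ioo)
  obtain ⟨ηi, hηi, hη, hηU, hr, hl⟩ := exists_punctured_chart hc hε
  rw [← hUdef] at hηi hηU hl
  set η : ℂ → S := fun z => c (angle z, ε * ‖z‖ / (1 + ‖z‖)) with hηdef
  have hUC : ∀ x ∈ U, x ∉ C := by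
    rintro _ ⟨⟨s, t⟩, ⟨-, ht⟩, rfl⟩ hx
    rw [← hcC] at hx
    obtain ⟨⟨s', t'⟩, ⟨-, rfl⟩, h⟩ := hx
    have := congrArg Prod.snd (hc.injective h)
    exact ht.1.ne this
  have line : ∀ D ∈ 𝒞, ∀ x ∈ D ∩ U, ∃ γ : ℝ → ℂ, IsClosedEmbedding γ ∧
      range γ = {z | z ≠ 0 ∧ η z ∈ connectedComponentIn (D ∩ U) x} := by
    rintro D hD x ⟨hxD, hxU⟩
    have hDC : Disjoint D C := hdisj D hD C hC fun h => hUC x hxU (h ▸ hxD)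
    obtain ⟨e₀, he₀, hinj₀, hr₀⟩ := (hcirc D hD).exists_param
    obtain ⟨y, hyD, hyU⟩ := not_subset.1 (hno D hD)
    obtain ⟨w, rfl⟩ := hr₀ ▸ hyD
    let R : Circle ≃ₜ Circle := Homeomorph.mulRight ((Circle.exp Real.pi)⁻¹ * w)
    have hR : R (Circle.exp Real.pi) = w := by simp [R]
    have hinj : Function.Injective (e₀ ∘ R) := hinj₀.comp R.injective
    have hre : range (e₀ ∘ R) = D := by rw [R.surjective.range_comp, hr₀]
    have he : Continuous (e₀ ∘ R) := he₀.comp R.continuous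
    obtain ⟨s₀, hs₀⟩ := hre.symm ▸ hxD
    obtain ⟨δ, hδ, htube⟩ := exists_tube hc.continuous (hcirc D hD).isCompact.isClosed
      (fun s h => disjoint_left.1 hDC h (hcC ▸ ⟨(s, 0), ⟨mem_univ _, rfl⟩, rfl⟩))
    obtain ⟨γ, hγ, hrγ⟩ := exists_closed_line he hinj hU (by rw [Function.comp_apply, hR]; exact hyU)
      (s₀ := s₀) (by rw [hs₀]; exact hxU) hη hηi hηU hr hl
      (N := {z | ε * ‖z‖ / (1 + ‖z‖) < δ}) (by
        refine IsOpen.mem_nhds ?_ (by simpa using hδ)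
        exact isOpen_lt (Continuous.div (by fun_prop) (by fun_prop) fun z => by positivity)
          continuous_const) (by
        intro z hz hz0
        rw [hre]
        refine htube _ _ ?_
        rw [abs_of_nonneg (by positivity)]
        exact (show ε * ‖z‖ / (1 + ‖z‖) < δ from hz).le)
    refine ⟨γ, hγ, ?_⟩
    rw [hrγ]
    have hemb : IsEmbedding (e₀ ∘ R) := (he.isClosedEmbedding hinj).isEmbedding
    have himg : (e₀ ∘ R) '' connectedComponentIn ((e₀ ∘ R) ⁻¹' U) s₀ =
        connectedComponentIn (D ∩ U) x := by
      refine Subset.antisymm ?_ ?_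
      · refine (isPreconnected_connectedComponentIn.image _ he.continuousOn
          ).subset_connectedComponentIn ?_ ?_
        · exact ⟨s₀, mem_connectedComponentIn (by
            change (e₀ ∘ R) s₀ ∈ U; rw [hs₀]; exact hxU), hs₀⟩
        · rintro _ ⟨v, hv, rfl⟩
          exact ⟨hre ▸ mem_range_self v, connectedComponentIn_subset ((e₀ ∘ R) ⁻¹' U) s₀ hv⟩
      · have hp : IsPreconnected ((e₀ ∘ R) ⁻¹' connectedComponentIn (D ∩ U) x) := by
          rw [← hemb.isInducing.isPreconnected_image, image_preimage_eq_of_subset]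
          · exact isPreconnected_connectedComponentIn
          · rw [hre]
            exact (connectedComponentIn_subset _ _).trans inter_subset_left
        intro y hy
        obtain ⟨v, rfl⟩ := hre.symm ▸ (connectedComponentIn_subset _ _ hy).1
        refine ⟨v, hp.subset_connectedComponentIn ?_ ?_ hy, rfl⟩
        · change (e₀ ∘ R) s₀ ∈ connectedComponentIn (D ∩ U) x
          rw [hs₀]
          exact mem_connectedComponentIn ⟨hxD, hxU⟩
        · intro v' hv'
          exact (connectedComponentIn_subset _ _ hv').2
    rw [himg]
  let 𝒬 : Set (Set ℂ) := {a | ∃ D ∈ 𝒞, ∃ x ∈ D ∩ U,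
    a = {z | z ≠ 0 ∧ η z ∈ connectedComponentIn (D ∩ U) x}}
  have hline : ∀ a ∈ 𝒬, ∃ γ : ℝ → ℂ, IsClosedEmbedding γ ∧ range γ = a ∧ 0 ∉ a := by
    rintro _ ⟨D, hD, x, hx, rfl⟩
    obtain ⟨γ, hγ, hγr⟩ := line D hD x hx
    exact ⟨γ, hγ, hγr, fun h => h.1 rfl⟩
  refine no_partition (𝒬 := 𝒬) ?_ ?_ ?_ ?_ ?_ ?_
  · ext z
    constructor
    · rintro ⟨_, ⟨D, hD, x, hx, rfl⟩, hz⟩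
      exact hz.1
    · intro hz
      have : η z ∈ ⋃₀ 𝒞 := hcov ▸ mem_univ _
      obtain ⟨D, hD, hzD⟩ := this
      have hm : η z ∈ D ∩ U := ⟨hzD, hηU z hz⟩
      exact ⟨_, ⟨D, hD, η z, hm, rfl⟩, hz, mem_connectedComponentIn hm⟩
  · rintro _ ⟨D, hD, x, hx, rfl⟩ _ ⟨D', hD', x', hx', rfl⟩ hne
    refine disjoint_left.2 ?_
    rintro z ⟨hz, hzx⟩ ⟨-, hzx'⟩
    apply hne
    have hDD : D = D' := by
      by_contra h
      exact disjoint_left.1 (hdisj D hD D' hD' h) (connectedComponentIn_subset _ _ hzx).1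
        (connectedComponentIn_subset _ _ hzx').1
    subst hDD
    rw [connectedComponentIn_eq hzx, connectedComponentIn_eq hzx']
  · intro a ha
    obtain ⟨γ, hγ, rfl, h0⟩ := hline a ha
    exact hγ.isClosed_range
  · intro a ha
    obtain ⟨γ, hγ, rfl, h0⟩ := hline a ha
    exact isPreconnected_range hγ.continuous
  · intro a ha hb
    obtain ⟨γ, hγ, rfl, h0⟩ := hline a ha
    have hcp : IsCompact (range γ) := Metric.isCompact_of_isClosed_isBounded hγ.isClosed_range hb
    have h2 := hγ.isCompact_preimage hcp
    rw [preimage_range] at h2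
    exact noncompact_univ ℝ h2
  · intro a ha
    obtain ⟨γ, hγ, rfl, h0⟩ := hline a ha
    exact not_isPreconnected_compl_range_line hγ h0

section
variable {S : Type*} [TopologicalSpace S] {𝒞 : Set (Set S)}

lemma IsCircleDecomposition.eq_of_mem (h𝒞 : IsCircleDecomposition 𝒞) {C D : Set S} (hC : C ∈ 𝒞)
    (hD : D ∈ 𝒞) {x : S} (hxC : x ∈ C) (hxD : x ∈ D) : C = D := by
  by_contra h
  exact disjoint_left.1 (h𝒞.2.1 C hC D hD h) hxC hxD

lemma IsCircleDecomposition.exists_mem (h𝒞 : IsCircleDecomposition 𝒞) (x : S) :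
    ∃ D ∈ 𝒞, x ∈ D := by
  have h : x ∈ ⋃₀ 𝒞 := by rw [h𝒞.2.2]; exact mem_univ x
  exact h

lemma subset_image_inside [T2Space S] [LocallyPlanar S] (h𝒞 : IsCircleDecomposition 𝒞) {O J : Set ℂ} {l : ℂ → S}
    (hl : ContinuousOn l O) (hinj : InjOn l O) (hJ : IsCircle J)
    (hO : hull J ⊆ O) (hJ𝒞 : l '' J ∈ 𝒞) {x : ℂ} (hx : x ∈ inside J) {D : Set S} (hD : D ∈ 𝒞)
    (hxD : l x ∈ D) : D ⊆ l '' inside J := by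
  have hne : Disjoint D (l '' J) := by
    refine h𝒞.2.1 D hD _ hJ𝒞 ?_
    rintro rfl
    obtain ⟨y, hy, hxy⟩ := hxD
    have := hinj (hO (subset_hull J hy)) (hO (inside_subset_hull J hx)) hxy
    exact disjoint_left.1 (disjoint_inside J) hx (this ▸ hy)
  have hio := isOpen_inside hJ.isCompact
  have hsub : inside J ⊆ O := (inside_subset_hull J).trans hO
  have hop : IsOpen (l '' inside J) := isOpen_image_of_injOn hio (hl.mono hsub) (hinj.mono hsub)
  refine (h𝒞.1 D hD).isPreconnected.subset_of_disjoint_frontier hop ?_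
    ⟨l x, hxD, mem_image_of_mem _ hx⟩
  refine hne.mono_right ?_
  have hcl : closure (l '' inside J) ⊆ l '' hull J :=
    closure_minimal (image_mono (inside_subset_hull J))
      ((isCompact_hull hJ.isCompact).image_of_continuousOn (hl.mono hO)).isClosed
  rw [hop.frontier_eq]
  rintro y ⟨hy, hy'⟩
  obtain ⟨z, hz | hz, rfl⟩ := hcl hy
  · exact mem_image_of_mem _ hz
  · exact absurd (mem_image_of_mem _ hz) hy'

lemma exists_circle_preimage [T2Space S] {D : Set S} (hD : IsCircle D) {K : Set ℂ} (hK : IsCompact K)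
    {l : ℂ → S} (hl : ContinuousOn l K) (hinj : InjOn l K) (hDK : D ⊆ l '' K) :
    ∃ J ⊆ K, IsCircle J ∧ l '' J = D := by
  have hli : ∀ x ∈ K, Function.invFunOn l K (l x) = x := fun x hx => hinj.leftInvOn_invFunOn hx
  have hinv : ∀ y ∈ D, l (Function.invFunOn l K y) = y := fun y hy =>
    Function.invFunOn_eq (hDK hy)
  have hcont := continuousOn_leftInverse hK hl hli
  refine ⟨Function.invFunOn l K '' D, ?_, hD.image (hcont.mono hDK) ?_, ?_⟩
  · rintro _ ⟨y, hy, rfl⟩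
    exact Function.invFunOn_mem (hDK hy)
  · intro x hx y hy h
    rw [← hinv x hx, h, hinv y hy]
  · rw [image_image]
    exact (image_congr hinv).trans (image_id' D)

/-- No member of a circle decomposition bounds a disc. -/
theorem not_mem_of_hull_subset [T2Space S] [LocallyPlanar S] (hT : PlaneTwoSided) (h𝒞 : IsCircleDecomposition 𝒞) {O J : Set ℂ}
    {l : ℂ → S} (hl : ContinuousOn l O) (hinj : InjOn l O) (hJ : IsCircle J)
    (hO : hull J ⊆ O) : l '' J ∉ 𝒞 := by
  intro hJ𝒞
  let 𝓗 : Set (Set ℂ) := {H | ∃ J' ⊆ hull J, IsCircle J' ∧ l '' J' ∈ 𝒞 ∧ H = hull J'}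
  have hzorn : ∀ c ⊆ 𝓗, IsChain (· ⊆ ·) c → c.Nonempty → ∃ lb ∈ 𝓗, ∀ s ∈ c, lb ⊆ s := by
    intro c hc hchain hcne
    have hcJ : ∀ H ∈ c, IsCompact H ∧ H.Nonempty ∧ H ⊆ O := by
      rintro H hH
      obtain ⟨J', hJ', hJ'c, -, rfl⟩ := hc hH
      exact ⟨isCompact_hull hJ'c.isCompact, hJ'c.nonempty.mono (subset_hull J'),
        (hull_subset_hull hT hJ hJ').trans hO⟩
    have : Nonempty c := hcne.to_subtype
    obtain ⟨x, hx⟩ := IsCompact.nonempty_iInter_of_directed_nonempty_isCompact_isClosed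
      (fun H : c => H.1) (fun H₁ H₂ => by
        rcases hchain.total H₁.2 H₂.2 with h | h
        · exact ⟨H₁, Subset.rfl, h⟩
        · exact ⟨H₂, h, Subset.rfl⟩)
      (fun H => (hcJ _ H.2).2.1) (fun H => (hcJ _ H.2).1) (fun H => (hcJ _ H.2).1.isClosed)
    rw [mem_iInter] at hx
    obtain ⟨D, hD, hxD⟩ := h𝒞.exists_mem (l x)
    have hDH : ∀ H ∈ c, D ⊆ l '' H := by
      intro H hH
      have hxH := hx ⟨H, hH⟩
      have hHO := (hcJ H hH).2.2
      obtain ⟨J', hJ', hJ'c, hJ'𝒞, rfl⟩ := hc hH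
      rcases hxH with h | h
      · rw [h𝒞.eq_of_mem hD hJ'𝒞 hxD (mem_image_of_mem _ h)]
        exact image_mono (subset_hull J')
      · exact (subset_image_inside h𝒞 hl hinj hJ'c hHO hJ'𝒞 h hD hxD).trans
          (image_mono (inside_subset_hull J'))
    obtain ⟨H₀, hH₀⟩ := hcne
    obtain ⟨J', hJ', hJ'c, rfl⟩ := exists_circle_preimage (h𝒞.1 D hD) (hcJ H₀ hH₀).1
      (hl.mono (hcJ H₀ hH₀).2.2) (hinj.mono (hcJ H₀ hH₀).2.2) (hDH H₀ hH₀)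
    have hJ'H : ∀ H ∈ c, J' ⊆ H := by
      intro H hH y hy
      obtain ⟨z, hz, hzy⟩ := hDH H hH (mem_image_of_mem _ hy)
      rwa [← hinj ((hcJ H hH).2.2 hz) ((hcJ H₀ hH₀).2.2 (hJ' hy)) hzy]
    have hsub : ∀ H ∈ c, hull J' ⊆ H := by
      intro H hH
      have h1 := hJ'H H hH
      obtain ⟨J₂, hJ₂, hJ₂c, -, rfl⟩ := hc hH
      exact hull_subset_hull hT hJ₂c h1
    refine ⟨hull J', ⟨J', ?_, hJ'c, hD, rfl⟩, hsub⟩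
    obtain ⟨J₂, hJ₂, hJ₂c, -, rfl⟩ := hc hH₀
    exact hJ'.trans (hull_subset_hull hT hJ hJ₂)
  obtain ⟨H, -, ⟨J₁, hJ₁, hJ₁c, hJ₁𝒞, rfl⟩, hmin⟩ := zorn_superset_nonempty 𝓗 hzorn (hull J)
    ⟨J, subset_hull J, hJ, hJ𝒞, rfl⟩
  have hO₁ : hull J₁ ⊆ O := (hull_subset_hull hT hJ hJ₁).trans hO
  obtain ⟨x, hx⟩ := inside_nonempty hT hJ₁c
  obtain ⟨D, hD, hxD⟩ := h𝒞.exists_mem (l x)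
  have hDsub := subset_image_inside h𝒞 hl hinj hJ₁c hO₁ hJ₁𝒞 hx hD hxD
  obtain ⟨J₂, hJ₂, hJ₂c, rfl⟩ := exists_circle_preimage (h𝒞.1 D hD)
    (isCompact_hull hJ₁c.isCompact) (hl.mono hO₁) (hinj.mono hO₁)
    (hDsub.trans (image_mono (inside_subset_hull J₁)))
  have hJ₂i : J₂ ⊆ inside J₁ := by
    intro y hy
    obtain ⟨z, hz, hzy⟩ := hDsub (mem_image_of_mem _ hy)
    rwa [← hinj (hO₁ (inside_subset_hull J₁ hz)) (hO₁ (hJ₂ hy)) hzy]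
  have h21 := hull_subset_hull hT hJ₁c hJ₂
  have h12 := hmin ⟨J₂, hJ₂.trans (hull_subset_hull hT hJ hJ₁), hJ₂c, hD, rfl⟩ h21
  obtain ⟨y, hy⟩ := hJ₁c.nonempty
  have hyi : y ∈ inside J₁ := by
    rcases h12 (subset_hull J₁ hy) with h | h
    · exact hJ₂i h
    · exact inside_subset_inside hT hJ₁c hJ₂c.isCompact hJ₂ h
  exact disjoint_left.1 (disjoint_inside J₁) hyi hy

end

/-- `X` is a closed annulus with end circles `E` and `F`. -/
def IsAnnulus {S : Type*} [TopologicalSpace S] (X E F : Set S) : Prop :=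
  ∃ k : Circle × ℝ → S, ContinuousOn k (univ ×ˢ Icc 0 1) ∧ InjOn k (univ ×ˢ Icc 0 1) ∧
    k '' (univ ×ˢ Icc 0 1) = X ∧ k '' (univ ×ˢ {0}) = E ∧ k '' (univ ×ˢ {1}) = F

namespace IsAnnulus

section
variable {S : Type*} [TopologicalSpace S] {X E F : Set S}

lemma symm (h : IsAnnulus X E F) : IsAnnulus X F E := by
  obtain ⟨k, hk, hinj, rfl, rfl, rfl⟩ := h
  let r : Circle × ℝ → Circle × ℝ := fun q => (q.1, 1 - q.2)
  have hr : Continuous r := by fun_prop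
  have hri : Function.Involutive r := fun q => by simp [r]
  have hrI : r '' (univ ×ˢ Icc 0 1) = univ ×ˢ Icc (0 : ℝ) 1 := by
    rw [image_eq_preimage_of_inverse hri hri]
    ext q
    simp [r, and_comm]
  have hr0 : r '' (univ ×ˢ {0}) = univ ×ˢ {(1 : ℝ)} := by
    rw [image_eq_preimage_of_inverse hri hri]
    ext q
    simp only [r, mem_preimage, mem_prod, mem_univ, true_and, mem_singleton_iff]
    constructor <;> intro h <;> linarith
  have hr1 : r '' (univ ×ˢ {1}) = univ ×ˢ {(0 : ℝ)} := by
    rw [image_eq_preimage_of_inverse hri hri]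
    ext q
    simp only [r, mem_preimage, mem_prod, mem_univ, true_and, mem_singleton_iff]
    constructor <;> intro h <;> linarith
  have hm : MapsTo r (univ ×ˢ Icc (0 : ℝ) 1) (univ ×ˢ Icc (0 : ℝ) 1) := by
    intro q hq
    exact hrI ▸ mem_image_of_mem _ hq
  refine ⟨k ∘ r, hk.comp hr.continuousOn hm, hinj.comp hri.injective.injOn hm, ?_, ?_, ?_⟩
  · rw [image_comp, hrI]
  · rw [image_comp, hr0]
  · rw [image_comp, hr1]

lemma left_subset (h : IsAnnulus X E F) : E ⊆ X := by
  obtain ⟨k, -, -, rfl, rfl, -⟩ := h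
  exact image_mono (prod_mono_right (by simp))

lemma right_subset (h : IsAnnulus X E F) : F ⊆ X := h.symm.left_subset

lemma disjoint (h : IsAnnulus X E F) : Disjoint E F := by
  obtain ⟨k, -, hinj, -, rfl, rfl⟩ := h
  rw [disjoint_iff_inter_eq_empty, ← hinj.image_inter (prod_mono_right (by simp))
    (prod_mono_right (by simp))]
  simp [prod_inter_prod]

lemma exists_interior_param (h : IsAnnulus X E F) : ∃ k : Circle × ℝ → S,
    ContinuousOn k (univ ×ˢ Icc 0 1) ∧ InjOn k (univ ×ˢ Icc 0 1) ∧
    k '' (univ ×ˢ Icc 0 1) = X ∧ k '' (univ ×ˢ {0}) = E ∧ k '' (univ ×ˢ {1}) = F ∧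
    k '' (univ ×ˢ Ioo 0 1) = X \ (E ∪ F) := by
  obtain ⟨k, hk, hinj, rfl, rfl, rfl⟩ := h
  refine ⟨k, hk, hinj, rfl, rfl, rfl, ?_⟩
  rw [← image_union, ← hinj.image_sdiff_subset]
  · congr 1
    ext ⟨s, t⟩
    simp only [mem_prod, mem_univ, true_and, mem_Ioo, mem_sdiff, mem_Icc, mem_union,
      mem_singleton_iff, not_or]
    constructor
    · rintro ⟨h1, h2⟩
      exact ⟨⟨h1.le, h2.le⟩, h1.ne', h2.ne⟩
    · rintro ⟨⟨h1, h2⟩, h3, h4⟩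
      exact ⟨h1.lt_of_ne' h3, h2.lt_of_ne h4⟩
  · exact union_subset (prod_mono_right (by simp)) (prod_mono_right (by simp))

lemma isPreconnected_interior (h : IsAnnulus X E F) : IsPreconnected (X \ (E ∪ F)) := by
  obtain ⟨k, hk, -, -, -, -, hi⟩ := h.exists_interior_param
  rw [← hi]
  exact (isPreconnected_univ.prod isPreconnected_Ioo).image _
    (hk.mono (prod_mono_right Ioo_subset_Icc_self))

lemma subset_closure_interior (h : IsAnnulus X E F) : X ⊆ closure (X \ (E ∪ F)) := by
  obtain ⟨k, hk, -, hX, -, -, hi⟩ := h.exists_interior_param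
  rw [← hi, ← hX]
  have : (univ ×ˢ Icc 0 1 : Set (Circle × ℝ)) = closure (univ ×ˢ Ioo 0 1) := by
    rw [closure_prod_eq, closure_univ, closure_Ioo zero_ne_one]
  rw [this] at hk ⊢
  exact hk.image_closure

lemma isCompact (h : IsAnnulus X E F) : IsCompact X := by
  obtain ⟨k, hk, -, rfl, -, -⟩ := h
  exact (isCompact_univ.prod isCompact_Icc).image_of_continuousOn hk

lemma isPreconnected_sdiff_left (h : IsAnnulus X E F) : IsPreconnected (X \ E) := by
  refine h.isPreconnected_interior.subset_closure (sdiff_subset_sdiff_right subset_union_left)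
    (sdiff_subset.trans h.subset_closure_interior)

variable [T2Space S]

lemma isClosed (h : IsAnnulus X E F) : IsClosed X := h.isCompact.isClosed

lemma exists_left_param (h : IsAnnulus X E F) : ∃ e : Circle → S, Continuous e ∧
    Function.Injective e ∧ range e = E := by
  obtain ⟨k, hk, hinj, -, rfl, -⟩ := h
  refine ⟨fun s => k (s, 0), hk.comp_continuous (by fun_prop) (by simp), fun s s' hs => ?_, ?_⟩
  · exact congrArg Prod.fst (hinj (by simp) (by simp) hs)
  · ext x
    constructor
    · rintro ⟨s, rfl⟩
      exact ⟨(s, 0), ⟨mem_univ _, rfl⟩, rfl⟩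
    · rintro ⟨⟨s, t⟩, ⟨-, rfl⟩, rfl⟩
      exact ⟨s, rfl⟩

lemma isCircle_left (h : IsAnnulus X E F) : IsCircle E := by
  obtain ⟨e, he, hinj, rfl⟩ := h.exists_left_param
  exact isCircle_range he hinj

lemma isCircle_right (h : IsAnnulus X E F) : IsCircle F := h.symm.isCircle_left

/-- An annulus has a parametrization extending any given one of its first end. -/
lemma exists_param_extending (h : IsAnnulus X E F) {e : Circle → S} (he : Continuous e)
    (heinj : Function.Injective e) (her : range e = E) : ∃ k : Circle × ℝ → S,
    ContinuousOn k (univ ×ˢ Icc 0 1) ∧ InjOn k (univ ×ˢ Icc 0 1) ∧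
    k '' (univ ×ˢ Icc 0 1) = X ∧ (∀ s, k (s, 0) = e s) ∧ k '' (univ ×ˢ {1}) = F := by
  obtain ⟨k, hk, hinj, hX, hE, hF⟩ := h
  have hk0 : Continuous fun s => k (s, 0) := hk.comp_continuous (by fun_prop) (by simp)
  have hk0i : Function.Injective fun s => k (s, 0) := fun s s' hs =>
    congrArg Prod.fst (hinj (by simp) (by simp) hs)
  have hk0r : range (fun s => k (s, 0)) = E := by
    rw [← hE]
    ext x
    constructor
    · rintro ⟨s, rfl⟩
      exact ⟨(s, 0), ⟨mem_univ _, rfl⟩, rfl⟩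
    · rintro ⟨⟨s, t⟩, ⟨-, rfl⟩, rfl⟩
      exact ⟨s, rfl⟩
  have hex : ∀ s, ∃ s', k (s', 0) = e s := fun s => by
    have : e s ∈ range fun s => k (s, 0) := by rw [hk0r, ← her]; exact mem_range_self s
    exact this
  choose β hβ using hex
  have hβc : Continuous β := by
    rw [(hk0.isClosedEmbedding hk0i).isInducing.continuous_iff]
    exact he.congr fun s => (hβ s).symm
  have hβi : Function.Injective β := fun s s' hs => heinj (by rw [← hβ, ← hβ, hs])
  have hβs : Function.Surjective β := fun s => by
    have : k (s, 0) ∈ range e := by rw [her, ← hk0r]; exact ⟨s, rfl⟩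
    obtain ⟨s', hs'⟩ := this
    exact ⟨s', hk0i ((hβ s').trans hs')⟩
  let r : Circle × ℝ → Circle × ℝ := Prod.map β id
  have hr : Continuous r := hβc.prodMap continuous_id
  have hrI : ∀ I : Set ℝ, r '' (univ ×ˢ I) = univ ×ˢ I := fun I => by
    rw [prodMap_image_prod, image_univ, hβs.range_eq, image_id]
  have hm : MapsTo r (univ ×ˢ Icc (0 : ℝ) 1) (univ ×ˢ Icc (0 : ℝ) 1) := by
    intro q hq
    rw [← hrI]
    exact mem_image_of_mem _ hq
  refine ⟨k ∘ r, hk.comp hr.continuousOn hm,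
    hinj.comp (hβi.prodMap Function.injective_id).injOn hm, ?_, hβ, ?_⟩
  · rw [image_comp, hrI, hX]
  · rw [image_comp, hrI, hF]

variable [LocallyPlanar S]

lemma isOpen_interior (h : IsAnnulus X E F) : IsOpen (X \ (E ∪ F)) := by
  obtain ⟨k, hk, hinj, -, -, -, hi⟩ := h.exists_interior_param
  have hsub : (univ ×ˢ Ioo 0 1 : Set (Circle × ℝ)) ⊆ univ ×ˢ Icc 0 1 :=
    prod_mono_right Ioo_subset_Icc_self
  rw [← hi]
  exact isOpen_image_of_injOn (isOpen_univ.prod isOpen_Ioo) (hk.mono hsub) (hinj.mono hsub)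

lemma frontier_interior_subset (h : IsAnnulus X E F) : frontier (X \ (E ∪ F)) ⊆ E ∪ F := by
  rw [h.isOpen_interior.frontier_eq]
  rintro x ⟨hx, hx'⟩
  have hxX : x ∈ X := closure_minimal sdiff_subset h.isClosed hx
  by_contra hn
  exact hx' ⟨hxX, hn⟩

/-- The end circles are not in the interior of the annulus. -/
lemma notMem_nhds_of_mem_left (h : IsAnnulus X E F) {x : S} (hx : x ∈ E) : X ∉ 𝓝 x := by
  intro hX
  obtain ⟨k, hk, hinj, rfl, rfl, rfl⟩ := h
  obtain ⟨⟨s, t⟩, ⟨-, rfl⟩, rfl⟩ := hx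
  set A : Set (Circle × ℝ) := univ ×ˢ Icc 0 1
  let g := Function.invFunOn k A
  have hg : ∀ q ∈ A, g (k q) = q := fun q hq => hinj.leftInvOn_invFunOn hq
  have hgc : ContinuousOn g (k '' A) :=
    continuousOn_leftInverse (isCompact_univ.prod isCompact_Icc) hk hg
  have hgA : ∀ x ∈ k '' A, g x ∈ A := fun x hx => Function.invFunOn_mem hx
  have hgi : InjOn g (k '' A) := by
    rintro _ ⟨p, hp, rfl⟩ _ ⟨q, hq, rfl⟩ hpq
    rw [hg p hp, hg q hq] at hpq
    rw [hpq]
  have hopen : IsOpen (g '' interior (k '' A)) := isOpen_image_of_injOn _root_.isOpen_interior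
    (hgc.mono interior_subset) (hgi.mono interior_subset)
  have hmem : ((s, 0) : Circle × ℝ) ∈ g '' interior (k '' A) :=
    ⟨k (s, 0), mem_interior_iff_mem_nhds.2 hX, hg _ ⟨mem_univ _, by simp⟩⟩
  have hopen' := isOpenMap_snd _ hopen
  have hmem' : (0 : ℝ) ∈ Prod.snd '' (g '' interior (k '' A)) := ⟨_, hmem, rfl⟩
  have hsub : Prod.snd '' (g '' interior (k '' A)) ⊆ Icc 0 1 := by
    rintro _ ⟨_, ⟨x, hx, rfl⟩, rfl⟩
    exact (hgA x (interior_subset hx)).2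
  have h0 := interior_mono hsub (hopen'.interior_eq.symm ▸ hmem')
  rw [interior_Icc] at h0
  exact lt_irrefl _ h0.1

lemma notMem_nhds_of_mem_right (h : IsAnnulus X E F) {x : S} (hx : x ∈ F) : X ∉ 𝓝 x :=
  h.symm.notMem_nhds_of_mem_left hx

/-- A connected set missing the ends is either inside or outside. -/
lemma subset_interior (h : IsAnnulus X E F) {P : Set S} (hP : IsPreconnected P)
    (hE : Disjoint P (E ∪ F)) (hne : (P ∩ (X \ (E ∪ F))).Nonempty) : P ⊆ X \ (E ∪ F) :=
  hP.subset_of_disjoint_frontier h.isOpen_interior (hE.mono_right h.frontier_interior_subset) hne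

end

end IsAnnulus

namespace IsAnnulus

variable {S : Type*} [TopologicalSpace S] {X E F : Set S}

lemma exists_plane_param (h : IsAnnulus X E F) : ∃ (r : ℝ) (l : ℂ → S), 1 < r ∧
    ContinuousOn l (Metric.closedBall 0 r \ Metric.ball 0 1) ∧
    InjOn l (Metric.closedBall 0 r \ Metric.ball 0 1) ∧
    l '' (Metric.closedBall 0 r \ Metric.ball 0 1) = X ∧
    (∀ z, ‖z‖ = 1 → l z ∈ E) ∧ E ⊆ l '' Metric.sphere 0 1 ∧ 
    (∀ z, ‖z‖ = r → l z ∈ F) ∧ F ⊆ l '' Metric.sphere 0 r := by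
  obtain ⟨k, hk, hinj, rfl, rfl, rfl⟩ := h
  have hr : (1 : ℝ) < Real.exp 1 := by simp
  have hm : ∀ z ∈ Metric.closedBall (0 : ℂ) (Real.exp 1) \ Metric.ball 0 1,
      z ≠ 0 ∧ polInv z ∈ (univ ×ˢ Icc 0 1 : Set (Circle × ℝ)) := by
    rintro z ⟨hz, hz1⟩
    rw [mem_closedBall_zero_iff] at hz
    rw [mem_ball_zero_iff, not_lt] at hz1
    have hz0 : 0 < ‖z‖ := by linarith
    exact ⟨norm_pos_iff.1 hz0, mem_univ _, Real.log_nonneg hz1, (Real.log_le_iff_le_exp hz0).2 hz⟩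
  have hm' : ∀ q ∈ (univ ×ˢ Icc 0 1 : Set (Circle × ℝ)),
      pol q ∈ Metric.closedBall (0 : ℂ) (Real.exp 1) \ Metric.ball 0 1 := by
    rintro q ⟨-, h0, h1⟩
    rw [mem_sdiff, mem_closedBall_zero_iff, mem_ball_zero_iff, norm_pol, not_lt]
    exact ⟨Real.exp_le_exp.2 h1, Real.one_le_exp h0⟩
  refine ⟨Real.exp 1, k ∘ polInv, hr, ?_, ?_, ?_, ?_, ?_, ?_, ?_⟩
  · exact hk.comp (continuousOn_polInv.mono fun z hz => (hm z hz).1) fun z hz => (hm z hz).2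
  · intro z hz w hw hzw
    have := hinj (hm z hz).2 (hm w hw).2 hzw
    rw [← pol_polInv (hm z hz).1, this, pol_polInv (hm w hw).1]
  · ext x
    constructor
    · rintro ⟨z, hz, rfl⟩
      exact ⟨_, (hm z hz).2, rfl⟩
    · rintro ⟨q, hq, rfl⟩
      exact ⟨_, hm' q hq, by simp [polInv_pol]⟩
  · intro z hz
    exact ⟨_, ⟨mem_univ _, by simp [polInv, hz]⟩, rfl⟩
  · rintro _ ⟨q, ⟨-, hq⟩, rfl⟩
    exact ⟨pol q, by simp [norm_pol, mem_singleton_iff.1 hq], by simp [polInv_pol]⟩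
  · intro z hz
    exact ⟨_, ⟨mem_univ _, by simp [polInv, hz]⟩, rfl⟩
  · rintro _ ⟨q, ⟨-, hq⟩, rfl⟩
    exact ⟨pol q, by simp [norm_pol, mem_singleton_iff.1 hq], by simp [polInv_pol]⟩

variable [T2Space S] [LocallyPlanar S] {𝒞 : Set (Set S)} {D : Set S}

lemma exists_half_split (hT : PlaneTwoSided) (h𝒞 : IsCircleDecomposition 𝒞)
    (h : IsAnnulus X E F) (hD : D ∈ 𝒞) (hDX : D ⊆ X \ (E ∪ F)) :
    ∃ X₁ K, IsAnnulus X₁ E D ∧ IsClosed K ∧ X₁ ∪ K = X ∧ X₁ ∩ K = D ∧ F ⊆ K ∧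
      ∀ R, IsOpen R → R ⊆ X \ (E ∪ F) → frontier R ⊆ D → Disjoint R D → R = ∅ := by
  obtain ⟨r, l, hr, hl, hinj, hX, hE, hE', hF, hF'⟩ := h.exists_plane_param
  set Ω : Set ℂ := Metric.closedBall 0 r \ Metric.ball 0 1 with hΩ
  have hmΩ : ∀ z, z ∈ Ω ↔ 1 ≤ ‖z‖ ∧ ‖z‖ ≤ r := fun z => by
    rw [hΩ, mem_sdiff, mem_closedBall_zero_iff, mem_ball_zero_iff, not_lt, and_comm]
  have hΩc : IsCompact Ω := (isCompact_closedBall 0 r).diff Metric.isOpen_ball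
  set U : Set ℂ := {z | 1 < ‖z‖ ∧ ‖z‖ < r} with hU
  have hUo : IsOpen U :=
    (isOpen_lt continuous_const continuous_norm).inter (isOpen_lt continuous_norm continuous_const)
  have hUΩ : U ⊆ Ω := fun z hz => (hmΩ z).2 ⟨hz.1.le, hz.2.le⟩
  have hUi : ∀ z ∈ Ω, l z ∈ X \ (E ∪ F) → z ∈ U := by
    intro z hz hlz
    have := (hmΩ z).1 hz
    refine ⟨lt_of_le_of_ne this.1 fun h1 => hlz.2 (Or.inl (hE z h1.symm)),
      lt_of_le_of_ne this.2 fun h1 => hlz.2 (Or.inr (hF z h1))⟩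
  obtain ⟨J, hJΩ, hJ, hJD⟩ := exists_circle_preimage (h𝒞.1 D hD) hΩc hl hinj
    (by rw [hX]; exact hDX.trans sdiff_subset)
  have hJU : J ⊆ U := fun z hz => hUi z (hJΩ hz) (hDX (hJD ▸ mem_image_of_mem l hz))
  -- the circle surrounds the hole
  have hbig : {z : ℂ | r ≤ ‖z‖} ⊆ outside J := by
    have heq : {z : ℂ | r ≤ ‖z‖} = pol '' (univ ×ˢ Ici (Real.log r)) := by
      have hr0 : 0 < r := by linarith
      ext z
      simp only [mem_ofPred_eq, mem_image, mem_prod, mem_univ, true_and, mem_Ici]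
      constructor
      · intro h
        have hz : z ≠ 0 := norm_pos_iff.1 (hr0.trans_le h)
        exact ⟨polInv z, Real.log_le_log hr0 h, pol_polInv hz⟩
      · rintro ⟨q, hq, rfl⟩
        rw [norm_pol]
        exact (Real.log_le_iff_le_exp hr0).1 hq
    have hpre : IsPreconnected {z : ℂ | r ≤ ‖z‖} := by
      rw [heq]
      exact (isPreconnected_univ.prod isPreconnected_Ici).image _ continuous_pol.continuousOn
    refine hpre.subset_outside_of_unbounded (disjoint_left.2 fun z hz hzJ => ?_) fun hb => ?_
    · exact absurd (hJU hzJ).2 (not_lt.2 hz)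
    · obtain ⟨B, hB⟩ := hb.exists_norm_le
      have := hB ((max r (B + 1) : ℝ) : ℂ) (by simp [le_abs])
      rw [Complex.norm_real, Real.norm_eq_abs] at this
      have h2 := le_abs_self (max r (B + 1))
      have h3 := le_max_right r (B + 1)
      linarith
  have hball : Disjoint (Metric.closedBall (0 : ℂ) 1) J := by
    refine disjoint_left.2 fun z hz hzJ => ?_
    rw [mem_closedBall_zero_iff] at hz
    exact absurd (hJU hzJ).1 (not_lt.2 hz)
  have h0 : (0 : ℂ) ∈ inside J := by
    by_contra h0
    have h0' : (0 : ℂ) ∈ outside J := by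
      have : (0 : ℂ) ∈ inside J ∪ outside J := by
        rw [inside_union_outside]
        exact disjoint_left.1 hball (by simp)
      exact this.resolve_left h0
    have hbo : Metric.closedBall (0 : ℂ) 1 ⊆ outside J :=
      (convex_closedBall (0 : ℂ) 1).isPreconnected.subset_outside hball ⟨0, by simp, h0'⟩
    refine not_mem_of_hull_subset hT h𝒞 hl hinj hJ (fun z hz => ?_) (hJD ▸ hD)
    rw [hmΩ]
    have hzo : z ∉ outside J := by rwa [← hull_compl, mem_compl_iff, not_not]
    constructor
    · by_contra hlt
      exact hzo (hbo (by rw [mem_closedBall_zero_iff]; linarith))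
    · by_contra hlt
      exact hzo (hbig (le_of_not_ge hlt))
  have hbi : Metric.closedBall (0 : ℂ) 1 ⊆ inside J :=
    (convex_closedBall (0 : ℂ) 1).isPreconnected.subset_inside hball ⟨0, by simp, h0⟩
  have hhr : ∀ z ∈ hull J, ‖z‖ < r := fun z hz => by
    by_contra hlt
    have := hbig (not_lt.1 hlt)
    rw [← hull_compl] at this
    exact this hz
  obtain ⟨κ, hκ, hκi, hκh, hκ0, hκ1⟩ := exists_round_annulus hT hJ (fun z hz => (hJU hz).1) h0
  have hsub : hull J \ Metric.ball 0 1 ⊆ Ω := fun z hz =>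
    ⟨by rw [mem_closedBall_zero_iff]; exact (hhr z hz.1).le, hz.2⟩
  have hκm : MapsTo κ (univ ×ˢ Icc 0 1) Ω := fun q hq => hsub (hκh ▸ mem_image_of_mem κ hq)
  have hino : IsOpen (inside J) := isOpen_inside hJ.isCompact
  have hKc : IsCompact (Ω \ inside J) := hΩc.diff hino
  refine ⟨l '' (hull J \ Metric.ball 0 1), l '' (Ω \ inside J), ?_,
    (hKc.image_of_continuousOn (hl.mono sdiff_subset)).isClosed, ?_, ?_, ?_, ?_⟩
  · refine ⟨l ∘ κ, hl.comp hκ hκm, hinj.comp hκi hκm, ?_, ?_, ?_⟩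
    · rw [image_comp, hκh]
    · apply Subset.antisymm
      · rintro _ ⟨⟨s, t⟩, ⟨-, ht⟩, rfl⟩
        obtain rfl : t = 0 := ht
        exact hE _ (by rw [hκ0]; exact Circle.norm_coe s)
      · intro x hx
        obtain ⟨z, hz, rfl⟩ := hE' hx
        rw [mem_sphere_zero_iff_norm] at hz
        refine ⟨(⟨z, mem_sphere_zero_iff_norm.2 hz⟩, 0), ⟨mem_univ _, rfl⟩, ?_⟩
        exact congrArg l (hκ0 _)
    · rw [image_comp, hκ1, hJD]
  · rw [← image_union, ← hX]
    congr 1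
    apply Subset.antisymm (union_subset hsub sdiff_subset)
    intro z hz
    by_cases hzi : z ∈ inside J
    · exact Or.inl ⟨inside_subset_hull _ hzi, hz.2⟩
    · exact Or.inr ⟨hz, hzi⟩
  · rw [← hinj.image_inter hsub sdiff_subset, ← hJD]
    congr 1
    ext z
    constructor
    · rintro ⟨⟨hz, -⟩, -, hzi⟩
      exact hz.resolve_right hzi
    · intro hz
      exact ⟨⟨subset_hull J hz, (hJΩ hz).2⟩, hJΩ hz, fun hi => disjoint_left.1 (disjoint_inside J) hi hz⟩
  · intro x hx
    obtain ⟨z, hz, rfl⟩ := hF' hx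
    rw [mem_sphere_zero_iff_norm] at hz
    refine ⟨z, ⟨(hmΩ z).2 ⟨by linarith, hz.le⟩, fun hi => ?_⟩, rfl⟩
    exact absurd (hhr z (inside_subset_hull _ hi)) (not_lt.2 hz.ge)
  · intro R hR hRX hRD hRd
    have hR'o : IsOpen (U ∩ l ⁻¹' R) := (hl.mono hUΩ).isOpen_inter_preimage hUo hR
    have hcl : closure (U ∩ l ⁻¹' R) ⊆ Ω :=
      closure_minimal (inter_subset_left.trans hUΩ) hΩc.isClosed
    have hfr : frontier (U ∩ l ⁻¹' R) ⊆ J := by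
      rw [hR'o.frontier_eq]
      rintro z ⟨hz, hz'⟩
      have hzΩ := hcl hz
      have h1 : l z ∈ closure R :=
        ((hl z hzΩ).mono (inter_subset_left.trans hUΩ)).mem_closure hz fun w hw => hw.2
      have h2 : l z ∉ R := fun h2 => hz' ⟨hUi z hzΩ (hRX h2), h2⟩
      have h3 : l z ∈ l '' J := by
        rw [hJD]
        apply hRD
        rw [hR.frontier_eq]
        exact ⟨h1, h2⟩
      obtain ⟨w, hw, hwz⟩ := h3
      rwa [← hinj (hJΩ hw) hzΩ hwz]
    have hdj : Disjoint (U ∩ l ⁻¹' R) J := disjoint_left.2 fun z hz hzJ =>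
      disjoint_left.1 hRd hz.2 (hJD ▸ mem_image_of_mem l hzJ)
    by_contra hne
    obtain ⟨x, hx⟩ := nonempty_iff_ne_empty.2 hne
    obtain ⟨z, hz, rfl⟩ : x ∈ l '' Ω := by rw [hX]; exact (hRX hx).1
    have := eq_inside_of_frontier_subset hT hJ hR'o
      (hΩc.isBounded.subset (inter_subset_left.trans hUΩ)) ⟨z, hUi z hz (hRX hx), hx⟩ hdj hfr
    rw [← this] at h0
    have := h0.1.1
    simp at this
    linarith

/-- A member of the decomposition inside an annulus splits it into two annuli. -/
theorem exists_split (hT : PlaneTwoSided) (h𝒞 : IsCircleDecomposition 𝒞)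
    (h : IsAnnulus X E F) (hD : D ∈ 𝒞) (hDX : D ⊆ X \ (E ∪ F)) :
    ∃ X₁ X₂, IsAnnulus X₁ E D ∧ IsAnnulus X₂ D F ∧ X₁ ∪ X₂ = X ∧ X₁ ∩ X₂ = D := by
  obtain ⟨X₁, K₁, h1, hK1, hu1, hi1, hF1, hR⟩ := h.exists_half_split hT h𝒞 hD hDX
  obtain ⟨X₂, K₂, h2, hK2, hu2, hi2, hE2, -⟩ :=
    h.symm.exists_half_split hT h𝒞 hD (by rwa [union_comm])
  have hD1 : D ⊆ X₁ := h1.right_subset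
  have hD2 : D ⊆ X₂ := h2.right_subset
  have hX1 : X₁ ⊆ X := hu1 ▸ subset_union_left
  have hX2 : X₂ ⊆ X := hu2 ▸ subset_union_left
  have hd2 : X₂ \ D ⊆ K₁ := by
    have hcov : X₂ \ D ⊆ X₁ ∪ K₁ := sdiff_subset.trans (hX2.trans hu1.ge)
    refine (isPreconnected_iff_subset_of_disjoint_closed.1 h2.symm.isPreconnected_sdiff_left
      X₁ K₁ h1.isClosed hK1 hcov (by rw [hi1, sdiff_inter_self])).resolve_left fun hsub => ?_
    obtain ⟨x, hx⟩ := h.isCircle_right.nonempty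
    have hxD : x ∉ D := fun hxD => (hDX hxD).2 (Or.inr hx)
    have : x ∈ X₁ ∩ K₁ := ⟨hsub ⟨h2.left_subset hx, hxD⟩, hF1 hx⟩
    exact hxD (hi1 ▸ this)
  have hRe : (X \ (E ∪ F)) \ (X₁ ∪ X₂) = ∅ := by
    have ho : IsOpen ((X \ (E ∪ F)) \ (X₁ ∪ X₂)) :=
      h.isOpen_interior.sdiff (h1.isClosed.union h2.isClosed)
    refine hR _ ho sdiff_subset ?_ (disjoint_left.2 fun x hx hxD => hx.2 (Or.inl (hD1 hxD)))
    have hcl : closure ((X \ (E ∪ F)) \ (X₁ ∪ X₂)) ⊆ K₁ ∩ K₂ := by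
      refine closure_minimal ?_ (hK1.inter hK2)
      rintro x ⟨⟨hxX, -⟩, hx⟩
      rw [mem_union, not_or] at hx
      exact ⟨(hu1.ge hxX).resolve_left hx.1, (hu2.ge hxX).resolve_left hx.2⟩
    rw [ho.frontier_eq]
    rintro x ⟨hx, hx'⟩
    have hxK := hcl hx
    have hxX : x ∈ X := hu1 ▸ Or.inr hxK.1
    by_cases hx1 : x ∈ X₁
    · exact hi1 ▸ ⟨hx1, hxK.1⟩
    by_cases hx2 : x ∈ X₂
    · exact hi2 ▸ ⟨hx2, hxK.2⟩
    refine absurd ⟨⟨hxX, ?_⟩, ?_⟩ hx'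
    · rintro (hxE | hxF)
      · exact hx1 (h1.left_subset hxE)
      · exact hx2 (h2.left_subset hxF)
    · rintro (h | h)
      · exact hx1 h
      · exact hx2 h
  refine ⟨X₁, X₂, h1, h2.symm, Subset.antisymm (union_subset hX1 hX2) fun x hx => ?_,
    Subset.antisymm ?_ (subset_inter hD1 hD2)⟩
  · by_contra hx'
    have : x ∈ (X \ (E ∪ F)) \ (X₁ ∪ X₂) := by
      refine ⟨⟨hx, ?_⟩, hx'⟩
      rintro (hxE | hxF)
      · exact hx' (Or.inl (h1.left_subset hxE))
      · exact hx' (Or.inr (h2.left_subset hxF))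
    rw [hRe] at this
    exact this
  · rintro x ⟨hx1, hx2⟩
    by_contra hxD
    exact hxD (hi1 ▸ ⟨hx1, hd2 ⟨hx2, hxD⟩⟩)

end IsAnnulus

namespace IsCircleDecomposition

variable {S : Type*} [TopologicalSpace S] [T2Space S] [LocallyPlanar S] {𝒞 : Set (Set S)} {C : Set S}

lemma exists_annulus_in_collar (hT : PlaneTwoSided) (h𝒞 : IsCircleDecomposition 𝒞) (hC : C ∈ 𝒞)
    {c : Circle × ℝ → S} (hc : IsOpenEmbedding c) (hcC : c '' (univ ×ˢ {0}) = C) {δ : ℝ}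
    (hδ : 0 < δ) : ∃ D X Y, D ∈ 𝒞 ∧ IsAnnulus X C D ∧ X ∪ Y = c '' (univ ×ˢ Icc 0 δ) ∧
      IsClosed Y ∧ Disjoint Y C := by
  obtain ⟨D, hD, hDc⟩ := exists_member_in_collar h𝒞 hC hc hcC hδ
  have hA : IsAnnulus (c '' (univ ×ˢ Icc 0 δ)) C (c '' (univ ×ˢ {δ})) := by
    refine ⟨fun q => c (q.1, δ * q.2), (hc.continuous.comp (by fun_prop)).continuousOn, ?_, ?_, ?_, ?_⟩
    · rintro ⟨s, t⟩ - ⟨s', t'⟩ - h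
      have := hc.injective h
      simpa [hδ.ne'] using this
    · apply Subset.antisymm
      · rintro _ ⟨⟨s, t⟩, ⟨-, ht0, ht1⟩, rfl⟩
        exact ⟨(s, δ * t), ⟨mem_univ _, by positivity, by simpa using mul_le_mul_of_nonneg_left ht1 hδ.le⟩, rfl⟩
      · rintro _ ⟨⟨s, t⟩, ⟨-, ht0, ht1⟩, rfl⟩
        refine ⟨(s, t / δ), ⟨mem_univ _, by positivity, (div_le_one hδ).2 ht1⟩, ?_⟩
        simp [mul_div_cancel₀ _ hδ.ne']
    · rw [← hcC]
      apply Subset.antisymm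
      · rintro _ ⟨⟨s, t⟩, ⟨-, ht⟩, rfl⟩
        exact ⟨(s, 0), ⟨mem_univ _, rfl⟩, by simp [show t = _ from ht]⟩
      · rintro _ ⟨⟨s, t⟩, ⟨-, ht⟩, rfl⟩
        exact ⟨(s, 0), ⟨mem_univ _, rfl⟩, by simp [show t = _ from ht]⟩
    · apply Subset.antisymm
      · rintro _ ⟨⟨s, t⟩, ⟨-, ht⟩, rfl⟩
        exact ⟨(s, δ), ⟨mem_univ _, rfl⟩, by simp [show t = _ from ht]⟩
      · rintro _ ⟨⟨s, t⟩, ⟨-, ht⟩, rfl⟩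
        exact ⟨(s, 1), ⟨mem_univ _, rfl⟩, by simp [show t = _ from ht]⟩
  obtain ⟨X, Y, hX, hY, hu, hi⟩ := hA.exists_split hT h𝒞 hD (by
    rw [← hcC, ← image_union, ← image_sdiff hc.injective]
    refine hDc.trans (image_mono ?_)
    rintro ⟨s, t⟩ ⟨-, h0, h1⟩
    exact ⟨⟨mem_univ _, h0.le, h1.le⟩, by simp [h0.ne', h1.ne]⟩)
  refine ⟨D, X, Y, hD, hX, hu, hY.isClosed, disjoint_left.2 fun x hx hxC => ?_⟩
  have : x ∈ D := hi ▸ ⟨hX.left_subset hxC, hx⟩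
  exact disjoint_left.1 hX.disjoint hxC this

/-- A member of the decomposition has small annular neighbourhoods bounded by members. -/
theorem exists_annuli_nhds (hT : PlaneTwoSided) (h𝒞 : IsCircleDecomposition 𝒞) (hC : C ∈ 𝒞)
    (hts : IsTwoSided C) {Z : Set S} (hZ : IsClosed Z) (hd : Disjoint C Z) :
    ∃ D₁ D₂ X₁ X₂, D₁ ∈ 𝒞 ∧ D₂ ∈ 𝒞 ∧ IsAnnulus X₁ C D₁ ∧ IsAnnulus X₂ C D₂ ∧ X₁ ∩ X₂ = C ∧
      (∀ x ∈ C, X₁ ∪ X₂ ∈ 𝓝 x) ∧ Disjoint (X₁ ∪ X₂) Z := by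
  obtain ⟨c, hc, hcC⟩ := hts.exists_collar
  obtain ⟨δ, hδ, hδZ⟩ := exists_tube hc.continuous hZ fun s =>
    disjoint_left.1 hd (hcC ▸ ⟨(s, 0), ⟨mem_univ _, rfl⟩, rfl⟩)
  let r : Circle × ℝ ≃ₜ Circle × ℝ := (Homeomorph.refl Circle).prodCongr (Homeomorph.neg ℝ)
  have hr : ∀ q, r q = (q.1, -q.2) := fun q => rfl
  have hcC' : (c ∘ r) '' (univ ×ˢ {0}) = C := by
    rw [← hcC]
    apply Subset.antisymm
    · rintro _ ⟨⟨s, t⟩, ⟨-, ht⟩, rfl⟩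
      exact ⟨(s, 0), ⟨mem_univ _, rfl⟩, by simp [show t = _ from ht, hr]⟩
    · rintro _ ⟨⟨s, t⟩, ⟨-, ht⟩, rfl⟩
      exact ⟨(s, 0), ⟨mem_univ _, rfl⟩, by simp [show t = _ from ht, hr]⟩
  obtain ⟨D₁, X₁, Y₁, hD1, hX1, hu1, hY1, hYC1⟩ := h𝒞.exists_annulus_in_collar hT hC hc hcC hδ
  obtain ⟨D₂, X₂, Y₂, hD2, hX2, hu2, hY2, hYC2⟩ :=
    h𝒞.exists_annulus_in_collar hT hC (hc.comp r.isOpenEmbedding) hcC' hδ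
  have hm1 : ∀ x ∈ X₁, ∃ s, ∃ t ∈ Icc 0 δ, c (s, t) = x := fun x hx => by
    have : x ∈ c '' (univ ×ˢ Icc 0 δ) := hu1 ▸ Or.inl hx
    obtain ⟨⟨s, t⟩, ⟨-, ht⟩, rfl⟩ := this
    exact ⟨s, t, ht, rfl⟩
  have hm2 : ∀ x ∈ X₂, ∃ s, ∃ t ∈ Icc 0 δ, c (s, -t) = x := fun x hx => by
    have : x ∈ (c ∘ r) '' (univ ×ˢ Icc 0 δ) := hu2 ▸ Or.inl hx
    obtain ⟨⟨s, t⟩, ⟨-, ht⟩, rfl⟩ := this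
    exact ⟨s, t, ht, rfl⟩
  refine ⟨D₁, D₂, X₁, X₂, hD1, hD2, hX1, hX2,
    Subset.antisymm ?_ (subset_inter hX1.left_subset hX2.left_subset), fun x hx => ?_, ?_⟩
  · rintro x ⟨hx1, hx2⟩
    obtain ⟨s, t, ht, rfl⟩ := hm1 x hx1
    obtain ⟨s', t', ht', heq⟩ := hm2 _ hx2
    have := congrArg Prod.snd (hc.injective heq)
    simp only at this
    obtain rfl : t = 0 := by linarith [ht.1, ht'.1]
    rw [← hcC]
    exact ⟨(s, 0), ⟨mem_univ _, rfl⟩, rfl⟩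
  · have ho : IsOpen (c '' (univ ×ˢ Ioo (-δ) δ) \ (Y₁ ∪ Y₂)) :=
      (hc.isOpenMap _ (isOpen_univ.prod isOpen_Ioo)).sdiff (hY1.union hY2)
    refine Filter.mem_of_superset (ho.mem_nhds ⟨?_, ?_⟩) ?_
    · rw [← hcC] at hx
      exact image_mono (prod_mono_right (by simpa using hδ)) hx
    · rintro (h | h)
      · exact disjoint_left.1 hYC1 h hx
      · exact disjoint_left.1 hYC2 h hx
    · rintro _ ⟨⟨⟨s, t⟩, ⟨-, ht⟩, rfl⟩, hY⟩
      rw [mem_union, not_or] at hY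
      rcases le_total 0 t with h0 | h0
      · have : c (s, t) ∈ X₁ ∪ Y₁ := hu1 ▸ ⟨(s, t), ⟨mem_univ _, h0, ht.2.le⟩, rfl⟩
        exact Or.inl (this.resolve_right hY.1)
      · have : c (s, t) ∈ X₂ ∪ Y₂ :=
          hu2 ▸ ⟨(s, -t), ⟨mem_univ _, by simpa using h0, by linarith [ht.1]⟩, by simp [hr]⟩
        exact Or.inr (this.resolve_right hY.2)
  · refine disjoint_left.2 ?_
    rintro x (hx | hx)
    · obtain ⟨s, t, ht, rfl⟩ := hm1 x hx
      exact hδZ s t (abs_le.2 ⟨by linarith [ht.1], ht.2⟩)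
    · obtain ⟨s, t, ht, rfl⟩ := hm2 x hx
      exact hδZ s (-t) (by rw [abs_neg]; exact abs_le.2 ⟨by linarith [ht.1], ht.2⟩)

end IsCircleDecomposition

lemma exists_isOpenEmbedding_complex (S : Type*) [TopologicalSpace S] [Nonempty S]
    [LocallyPlanar S] : ∃ ι : ℂ → S, IsOpenEmbedding ι := by
  obtain ⟨x⟩ := ‹Nonempty S›
  obtain ⟨φ, hφ⟩ := LocallyPlanar.exists_chart x
  obtain ⟨r, hr, hrt⟩ := Metric.isOpen_iff.1 φ.open_target (φ x) (φ.map_source hφ)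
  let u := OpenPartialHomeomorph.univBall (φ x) r
  have hut : ∀ z, u z ∈ φ.target := fun z => hrt (by
    rw [← OpenPartialHomeomorph.univBall_target (φ x) hr]
    exact u.map_source (by simp [u]))
  have hc : Continuous fun z => φ.symm (u z) :=
    φ.continuousOn_symm.comp_continuous (OpenPartialHomeomorph.continuous_univBall _ _) hut
  have hi : Function.Injective fun z => φ.symm (u z) := fun z w h =>
    u.injOn (by simp [u]) (by simp [u]) (φ.symm.injOn (hut z) (hut w) h)
  exact ⟨_, .of_continuous_injective_isOpenMap hc hi fun U hU =>
    isOpen_image_of_injOn hU hc.continuousOn hi.injOn⟩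

lemma planeTwoSided_of_forall_isTwoSided {S : Type*} [TopologicalSpace S] [T2Space S] [Nonempty S]
    [LocallyPlanar S] (hts : ∀ C : Set S, IsCircle C → IsTwoSided C) : PlaneTwoSided := by
  intro J hJ
  obtain ⟨ι, hι⟩ := exists_isOpenEmbedding_complex S
  obtain ⟨c, hc, hcJ⟩ := (hts _ (hJ.image hι.continuous.continuousOn hι.injective.injOn)).exists_collar
  obtain ⟨δ, hδ, hδι⟩ := exists_tube hc.continuous hι.isOpen_range.isClosed_compl fun s => by
    have : c (s, 0) ∈ ι '' J := hcJ ▸ ⟨(s, 0), ⟨mem_univ _, rfl⟩, rfl⟩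
    rw [mem_compl_iff, not_not]
    exact image_subset_range _ _ this
  have hex : ∀ p : Circle × Icc (-1 : ℝ) 1, ∃ z, ι z = c (p.1, δ * p.2) := fun p => by
    have := hδι p.1 (δ * p.2) (by
      rw [abs_mul, abs_of_pos hδ]
      exact mul_le_of_le_one_right hδ.le (abs_le.2 p.2.2))
    rwa [mem_compl_iff, not_not] at this
  choose g hg using hex
  have hgc : Continuous g := by
    rw [hι.isInducing.continuous_iff]
    exact (hc.continuous.comp (by fun_prop)).congr fun p => (hg p).symm
  have hgi : Function.Injective g := by
    rintro ⟨s, t⟩ ⟨s', t'⟩ h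
    have := hc.injective ((hg _).symm.trans ((congrArg ι h).trans (hg _)))
    simp only [Prod.mk.injEq, mul_eq_mul_left_iff, hδ.ne', or_false] at this
    exact Prod.ext this.1 (Subtype.ext this.2)
  refine ⟨g, (hgc.isClosedEmbedding hgi).isEmbedding, ?_⟩
  apply hι.injective.image_injective
  rw [← hcJ]
  apply Subset.antisymm
  · rintro _ ⟨_, ⟨p, hp, rfl⟩, rfl⟩
    exact ⟨(p.1, 0), ⟨mem_univ _, rfl⟩, by rw [hg, show (p.2 : ℝ) = 0 from hp, mul_zero]⟩
  · rintro _ ⟨⟨s, t⟩, ⟨-, ht⟩, rfl⟩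
    obtain rfl : t = 0 := ht
    exact ⟨g (s, ⟨0, by simp⟩), ⟨_, rfl, rfl⟩, by rw [hg, mul_zero]⟩

namespace IsAnnulus

variable {S : Type*} [TopologicalSpace S] {𝒞 : Set (Set S)} {X Y C D E F : Set S}

lemma mem_interior (_ : IsAnnulus X E F) {x : S} (hx : x ∈ X) (hE : x ∉ E) (hF : x ∉ F) :
    x ∈ X \ (E ∪ F) :=
  ⟨hx, fun h => h.elim hE hF⟩

lemma disjoint_interior_left : Disjoint (X \ (E ∪ F)) E :=
  disjoint_left.2 fun _ hx hE => hx.2 (Or.inl hE)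

lemma disjoint_interior_right : Disjoint (X \ (E ∪ F)) F :=
  disjoint_left.2 fun _ hx hF => hx.2 (Or.inr hF)

lemma subset_of_interior_subset (h : IsAnnulus X E F) {K : Set S} (hK : IsClosed K)
    (hX : X \ (E ∪ F) ⊆ K) : X ⊆ K :=
  h.subset_closure_interior.trans (closure_minimal hX hK)

/-- An open set meeting the annulus meets its interior. -/
lemma inter_interior_nonempty (h : IsAnnulus X E F) {U : Set S} (hU : IsOpen U)
    (hne : (X ∩ U).Nonempty) : ((X \ (E ∪ F)) ∩ U).Nonempty := by
  obtain ⟨x, hx, hxU⟩ := hne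
  obtain ⟨y, hy, hy'⟩ := mem_closure_iff.1 (h.subset_closure_interior hx) U hU hxU
  exact ⟨y, hy', hy⟩

variable [T2Space S] [LocallyPlanar S]

/-- An annulus whose interior meets another one, but misses its ends, is contained in it. -/
lemma subset_of_interior_inter (h : IsAnnulus X E F) {A B : Set S} (h' : IsAnnulus Y A B)
    (hA : Disjoint (Y \ (A ∪ B)) E) (hB : Disjoint (Y \ (A ∪ B)) F)
    (hne : ((Y \ (A ∪ B)) ∩ (X \ (E ∪ F))).Nonempty) : Y ⊆ X :=
  h'.subset_of_interior_subset h.isClosed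
    ((h.subset_interior h'.isPreconnected_interior (hA.union_right hB) hne).trans sdiff_subset)

lemma eq_of_interior_inter (h : IsAnnulus X E F) (h' : IsAnnulus Y E F)
    (hne : ((Y \ (E ∪ F)) ∩ (X \ (E ∪ F))).Nonempty) : X = Y :=
  Subset.antisymm
    (h'.subset_of_interior_inter h disjoint_interior_left disjoint_interior_right
      (by rwa [inter_comm]))
    (h.subset_of_interior_inter h' disjoint_interior_left disjoint_interior_right hne)

/-- Members of a decomposition meeting the interior of an annulus lie in it. -/
lemma member_subset_interior (h𝒞 : IsCircleDecomposition 𝒞) (h : IsAnnulus X E F) (hE : E ∈ 𝒞)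
    (hF : F ∈ 𝒞) (hD : D ∈ 𝒞) (hne : ¬ Disjoint D (X \ (E ∪ F))) : D ⊆ X \ (E ∪ F) := by
  obtain ⟨x, hxD, hx⟩ := not_disjoint_iff.1 hne
  refine h.subset_interior (h𝒞.1 D hD).isPreconnected (disjoint_left.2 ?_) ⟨x, hxD, hx⟩
  rintro y hy (hyE | hyF)
  · exact hx.2 (Or.inl (h𝒞.eq_of_mem hE hD hyE hy ▸ hxD))
  · exact hx.2 (Or.inr (h𝒞.eq_of_mem hF hD hyF hy ▸ hxD))

lemma exists_mem_interior_notMem (h : IsAnnulus X C D) {K : Set S} (hK : IsClosed K)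
    (hd : Disjoint C K) : ∃ x ∈ X \ (C ∪ D), x ∉ K := by
  obtain ⟨x, hx⟩ := h.isCircle_left.nonempty
  obtain ⟨y, hy, hy'⟩ := h.inter_interior_nonempty hK.isOpen_compl
    ⟨x, h.left_subset hx, disjoint_left.1 hd hx⟩
  exact ⟨y, hy, hy'⟩

/-- Conditions under which two consecutive annuli only meet along their common end. -/
lemma inter_eq_of_interior_disjoint (h : IsAnnulus X C E) (h' : IsAnnulus Y E D)
    (hYC : Disjoint Y C) (hd : Disjoint (Y \ (E ∪ D)) (X \ (C ∪ E))) :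
    X ∩ Y = E ∧ Disjoint X D := by
  have hXD : Disjoint X D := by
    refine disjoint_left.2 fun x hx hxD => ?_
    have hxY := h'.right_subset hxD
    obtain ⟨y, hy, hy'⟩ := h'.inter_interior_nonempty h.isOpen_interior
      ⟨x, hxY, h.mem_interior hx (disjoint_left.1 hYC hxY)
        fun hxE => disjoint_left.1 h'.disjoint hxE hxD⟩
    exact disjoint_left.1 hd hy hy'
  refine ⟨Subset.antisymm ?_ (subset_inter h.right_subset h'.left_subset), hXD⟩
  rintro x ⟨hx, hxY⟩
  by_contra hxE
  exact disjoint_left.1 hd (h'.mem_interior hxY hxE (disjoint_left.1 hXD hx))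
    (h.mem_interior hx (disjoint_left.1 hYC hxY) hxE)

lemma exists_collar_beyond (hT : PlaneTwoSided) (h𝒞 : IsCircleDecomposition 𝒞)
    (hts : ∀ C : Set S, IsCircle C → IsTwoSided C) (h : IsAnnulus X C E) (hE : E ∈ 𝒞) :
    ∃ P D, D ∈ 𝒞 ∧ IsAnnulus P E D ∧ Disjoint P C ∧ Disjoint (P \ (E ∪ D)) (X \ (C ∪ E)) := by
  obtain ⟨D₁, D₂, X₁, X₂, hD1, hD2, h1, h2, -, hn, hd⟩ := h𝒞.exists_annuli_nhds hT hE
    (hts E (h𝒞.1 E hE)) h.isCircle_left.isCompact.isClosed h.disjoint.symm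
  rw [disjoint_union_left] at hd
  have key : ∀ Y D, IsAnnulus Y E D → Disjoint Y C →
      ¬ Disjoint (Y \ (E ∪ D)) (X \ (C ∪ E)) → Y ⊆ X := fun Y D hY hYC hne =>
    h.subset_of_interior_inter hY (hYC.mono_left sdiff_subset) disjoint_interior_left
      (not_disjoint_iff_nonempty_inter.1 hne)
  by_cases hd1 : Disjoint (X₁ \ (E ∪ D₁)) (X \ (C ∪ E))
  · exact ⟨X₁, D₁, hD1, h1, hd.1, hd1⟩
  by_cases hd2 : Disjoint (X₂ \ (E ∪ D₂)) (X \ (C ∪ E))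
  · exact ⟨X₂, D₂, hD2, h2, hd.2, hd2⟩
  obtain ⟨x, hx⟩ := h.isCircle_right.nonempty
  exact absurd (Filter.mem_of_superset (hn x hx)
    (union_subset (key _ _ h1 hd.1 hd1) (key _ _ h2 hd.2 hd2))) (h.notMem_nhds_of_mem_right hx)

end IsAnnulus

section
variable {S : Type*} [TopologicalSpace S]

/-- Extending a parametrized annulus by another annulus. -/
lemma exists_glued_param [T2Space S] {f : Circle × ℝ → S} {a : ℝ} (ha : 0 ≤ a)
    (hf : ContinuousOn f (univ ×ˢ Icc 0 a)) (hfi : InjOn f (univ ×ˢ Icc 0 a)) {E D P : Set S}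
    (hE : f '' (univ ×ˢ {a}) = E) (hP : IsAnnulus P E D) :
    ∃ g : Circle × ℝ → S, ContinuousOn g (univ ×ˢ Icc 0 (a + 1)) ∧
      (∀ s, ∀ t ≤ a, g (s, t) = f (s, t)) ∧ InjOn g (univ ×ˢ Icc a (a + 1)) ∧
      g '' (univ ×ˢ Icc a (a + 1)) = P ∧ g '' (univ ×ˢ {a + 1}) = D := by
  have haI : a ∈ Icc 0 a := right_mem_Icc.2 ha
  have hec : Continuous fun s => f (s, a) :=
    hf.comp_continuous (by fun_prop) fun s => ⟨mem_univ _, haI⟩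
  have hei : Function.Injective fun s => f (s, a) := fun s s' hs =>
    congrArg Prod.fst (hfi ⟨mem_univ _, haI⟩ ⟨mem_univ _, haI⟩ hs)
  obtain ⟨k, hk, hki, hkP, hk0, hk1⟩ := hP.exists_param_extending hec hei (by
    rw [← hE]
    apply Subset.antisymm
    · rintro _ ⟨s, rfl⟩
      exact ⟨(s, a), ⟨mem_univ _, rfl⟩, rfl⟩
    · rintro _ ⟨⟨s, t⟩, ⟨-, ht⟩, rfl⟩
      exact ⟨s, by rw [show t = a from ht]⟩)
  let g : Circle × ℝ → S := fun q => if q.2 ≤ a then f q else k (q.1, q.2 - a)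
  have hg1 : ∀ s, ∀ t ≤ a, g (s, t) = f (s, t) := fun s t ht => if_pos ht
  have hg2 : ∀ s t, a ≤ t → g (s, t) = k (s, t - a) := by
    intro s t ht
    rcases ht.eq_or_lt with rfl | h
    · rw [hg1 s _ le_rfl, sub_self, hk0]
    · exact if_neg (not_le.2 h)
  refine ⟨g, ?_, hg1, ?_, ?_, ?_⟩
  · have hu : (univ ×ˢ Icc 0 (a + 1) : Set (Circle × ℝ)) =
        univ ×ˢ Icc 0 a ∪ univ ×ˢ Icc a (a + 1) := by
      rw [← prod_union, Icc_union_Icc_eq_Icc ha (by linarith)]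
    rw [hu]
    refine ContinuousOn.union_of_isClosed ?_ ?_ (isClosed_univ.prod isClosed_Icc)
      (isClosed_univ.prod isClosed_Icc)
    · exact hf.congr fun q hq => hg1 _ _ hq.2.2
    · refine (hk.comp (f := fun q : Circle × ℝ => (q.1, q.2 - a)) (by fun_prop) ?_).congr
        fun q hq => hg2 _ _ hq.2.1
      rintro q ⟨-, h1, h2⟩
      exact ⟨mem_univ _, by linarith, by linarith⟩
  · rintro ⟨s, t⟩ ⟨-, h1, h2⟩ ⟨s', t'⟩ ⟨-, h1', h2'⟩ h
    simp only at h1 h2 h1' h2'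
    rw [hg2 s t h1, hg2 s' t' h1'] at h
    have := hki ⟨mem_univ _, by simpa using h1, by simp; linarith⟩
      ⟨mem_univ _, by simpa using h1', by simp; linarith⟩ h
    simpa using this
  · rw [← hkP]
    apply Subset.antisymm
    · rintro _ ⟨⟨s, t⟩, ⟨-, h1, h2⟩, rfl⟩
      simp only at h1 h2
      exact ⟨(s, t - a), ⟨mem_univ _, by simpa using h1, by simp; linarith⟩, (hg2 s t h1).symm⟩
    · rintro _ ⟨⟨s, t⟩, ⟨-, h1, h2⟩, rfl⟩
      simp only at h1 h2
      exact ⟨(s, t + a), ⟨mem_univ _, by simpa using h1, by simp; linarith⟩, by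
        rw [hg2 s (t + a) (by linarith)]; simp⟩
  · rw [← hk1]
    apply Subset.antisymm
    · rintro _ ⟨⟨s, t⟩, ⟨-, ht⟩, rfl⟩
      obtain rfl : t = a + 1 := ht
      exact ⟨(s, 1), ⟨mem_univ _, rfl⟩, by rw [hg2 s _ (by linarith)]; simp⟩
    · rintro _ ⟨⟨s, t⟩, ⟨-, ht⟩, rfl⟩
      obtain rfl : t = 1 := ht
      exact ⟨(s, a + 1), ⟨mem_univ _, rfl⟩, by rw [hg2 s _ (by linarith)]; simp⟩

end

/-- A map on `T` which is injective below and above level `a` is injective if no point above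
level `a` is sent into the lower part. -/
lemma injOn_of_levels {S : Type*} {g : Circle × ℝ → S} {a b : ℝ} {T : Set ℝ} (hT : T ⊆ Icc 0 b)
    (h1 : InjOn g (univ ×ˢ Icc 0 a)) (h2 : InjOn g (univ ×ˢ Icc a b))
    (h : ∀ s, ∀ t ∈ T, a < t → g (s, t) ∉ g '' (univ ×ˢ Icc 0 a)) : InjOn g (univ ×ˢ T) := by
  rintro ⟨s, t⟩ ⟨-, ht⟩ ⟨s', t'⟩ ⟨-, ht'⟩ heq
  rcases le_or_gt t a with hta | hta <;> rcases le_or_gt t' a with hta' | hta'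
  · exact h1 ⟨mem_univ _, (hT ht).1, hta⟩ ⟨mem_univ _, (hT ht').1, hta'⟩ heq
  · exact absurd ⟨(s, t), ⟨mem_univ _, (hT ht).1, hta⟩, heq⟩ (h s' t' ht' hta')
  · exact absurd ⟨(s', t'), ⟨mem_univ _, (hT ht').1, hta'⟩, heq.symm⟩ (h s t ht hta)
  · exact h2 ⟨mem_univ _, hta.le, (hT ht).2⟩ ⟨mem_univ _, hta'.le, (hT ht').2⟩ heq

namespace IsAnnulus

variable {S : Type*} [TopologicalSpace S] [T2Space S] {X P C D E : Set S}

lemma union (h : IsAnnulus X C E) (h' : IsAnnulus P E D) (hi : X ∩ P ⊆ E) :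
    IsAnnulus (X ∪ P) C D := by
  obtain ⟨f, hf, hfi, hfX, hf0, hf1⟩ := h
  obtain ⟨g, hg, hgf, hgi, hgP, hg1⟩ := exists_glued_param zero_le_one hf hfi hf1 h'
  have hgX : g '' (univ ×ˢ Icc 0 1) = X := by
    rw [← hfX]
    exact image_congr fun q hq => hgf _ _ hq.2.2
  have hg0 : g '' (univ ×ˢ {0}) = C := by
    rw [← hf0]
    refine image_congr fun q hq => hgf _ _ ?_
    rw [show q.2 = 0 from hq.2]
    exact zero_le_one
  have hgE : g '' (univ ×ˢ {1}) = E := by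
    rw [← hf1]
    exact image_congr fun q hq => hgf _ _ (show q.2 = 1 from hq.2).le
  have hgi' : InjOn g (univ ×ˢ Icc 0 (1 + 1)) := by
    refine injOn_of_levels subset_rfl (a := 1) (b := 1 + 1) (fun q hq q' hq' h => ?_) hgi
      fun s t ht h1 hX => ?_
    · rw [← Prod.mk.eta (p := q), ← Prod.mk.eta (p := q'), hgf _ _ hq.2.2, hgf _ _ hq'.2.2] at h
      exact hfi hq hq' h
    · rw [hgX] at hX
      have hm : (s, t) ∈ (univ ×ˢ Icc 1 (1 + 1) : Set (Circle × ℝ)) := ⟨mem_univ _, h1.le, ht.2⟩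
      have : g (s, t) ∈ g '' (univ ×ˢ {1}) := by
        rw [hgE]
        exact hi ⟨hX, hgP ▸ mem_image_of_mem g hm⟩
      obtain ⟨⟨s', t'⟩, ⟨-, ht'⟩, heq⟩ := this
      obtain rfl : t' = 1 := ht'
      have := congrArg Prod.snd (hgi ⟨mem_univ _, by simp⟩ hm heq)
      exact h1.ne this
  let r : Circle × ℝ → Circle × ℝ := fun q => (q.1, 2 * q.2)
  have hr : Continuous r := by fun_prop
  have hm : MapsTo r (univ ×ˢ Icc 0 1) (univ ×ˢ Icc 0 (1 + 1)) := by
    rintro q ⟨-, h0, h1⟩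
    exact ⟨mem_univ _, by simpa [r] using h0, by simp only [r]; linarith⟩
  refine ⟨g ∘ r, hg.comp hr.continuousOn hm, hgi'.comp ?_ hm, ?_, ?_, ?_⟩
  · rintro ⟨s, t⟩ - ⟨s', t'⟩ - h
    simpa [r] using h
  · have : r '' (univ ×ˢ Icc 0 1) = univ ×ˢ Icc 0 1 ∪ univ ×ˢ Icc 1 (1 + 1) := by
      rw [← prod_union, Icc_union_Icc_eq_Icc zero_le_one (by norm_num)]
      apply Subset.antisymm (image_subset_iff.2 hm)
      rintro ⟨s, t⟩ ⟨-, h0, h1⟩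
      simp only at h0 h1
      exact ⟨(s, t / 2), ⟨mem_univ _, by simp; linarith, by simp; linarith⟩, by simp [r]; ring⟩
    rw [image_comp, this, image_union, hgX, hgP]
  · have : r '' (univ ×ˢ {0}) = univ ×ˢ {0} := by
      ext ⟨s, t⟩
      simp [r, eq_comm]
    rw [image_comp, this, hg0]
  · have : r '' (univ ×ˢ {1}) = univ ×ˢ {1 + 1} := by
      ext ⟨s, t⟩
      simp [r, eq_comm]
      norm_num
    rw [image_comp, this, hg1]

end IsAnnulus

/-- `X` is an annulus between `C` and a member `E` of `𝒞`, containing `B`. -/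
def IsExtension {S : Type*} [TopologicalSpace S] (𝒞 : Set (Set S)) (C B X E : Set S) : Prop :=
  E ∈ 𝒞 ∧ IsAnnulus X C E ∧ B ⊆ X

/-- The side of `C` filled by annuli extending `B`. -/
def extensionSide {S : Type*} [TopologicalSpace S] (𝒞 : Set (Set S)) (C B : Set S) : Set S :=
  {x | x ∉ C ∧ ∃ X E, IsExtension 𝒞 C B X E ∧ x ∈ X}

namespace IsExtension

variable {S : Type*} [TopologicalSpace S] [T2Space S] [LocallyPlanar S] {𝒞 : Set (Set S)}
  {X X' B C D E E' : Set S}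

lemma exists_mem_inter (hB : IsAnnulus B C D) (h : IsExtension 𝒞 C B X E)
    (h' : IsExtension 𝒞 C B X' E') : ((X \ (C ∪ E)) ∩ (X' \ (C ∪ E'))).Nonempty := by
  obtain ⟨y, hy, hy'⟩ := hB.exists_mem_interior_notMem
    (h.2.1.isCircle_right.isCompact.isClosed.union h'.2.1.isCircle_right.isCompact.isClosed)
    (h.2.1.disjoint.union_right h'.2.1.disjoint)
  rw [mem_union, not_or] at hy'
  have hyC : y ∉ C := fun hC => hy.2 (Or.inl hC)
  exact ⟨y, h.2.1.mem_interior (h.2.2 hy.1) hyC hy'.1, h'.2.1.mem_interior (h'.2.2 hy.1) hyC hy'.2⟩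

lemma exists_difference (hT : PlaneTwoSided) (h𝒞 : IsCircleDecomposition 𝒞)
    (hB : IsAnnulus B C D) (h : IsExtension 𝒞 C B X E)
    (h' : IsExtension 𝒞 C B X' E') (hE : E ⊆ X' \ (C ∪ E')) :
    ∃ P, IsAnnulus P E E' ∧ X ∪ P = X' ∧ X ∩ P = E := by
  obtain ⟨A, P, hA, hP, hu, hi⟩ := h'.2.1.exists_split hT h𝒞 h.1 hE
  have hCP : Disjoint C P := disjoint_left.2 fun x hx hxP => by
    have : x ∈ E := hi ▸ ⟨hA.left_subset hx, hxP⟩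
    exact disjoint_left.1 hA.disjoint hx this
  obtain ⟨y, hy, hyP⟩ := hB.exists_mem_interior_notMem hP.isClosed hCP
  have hyC : y ∉ C := fun hC => hy.2 (Or.inl hC)
  have hyE : y ∉ E := fun hE => hyP (hP.left_subset hE)
  have hyA : y ∈ A := (hu.ge (h'.2.2 hy.1)).resolve_right hyP
  obtain rfl : X = A := h.2.1.eq_of_interior_inter hA
    ⟨y, hA.mem_interior hyA hyC hyE, h.2.1.mem_interior (h.2.2 hy.1) hyC hyE⟩
  exact ⟨P, hP, hu, hi⟩

lemma subset_or_subset (hT : PlaneTwoSided) (h𝒞 : IsCircleDecomposition 𝒞) (hC : C ∈ 𝒞)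
    (hB : IsAnnulus B C D) (h : IsExtension 𝒞 C B X E) (h' : IsExtension 𝒞 C B X' E') :
    X ⊆ X' ∨ X' ⊆ X := by
  by_cases hd : Disjoint E (X' \ (C ∪ E'))
  · exact Or.inr (h.2.1.subset_of_interior_inter h'.2.1 IsAnnulus.disjoint_interior_left hd.symm
      (h'.exists_mem_inter hB h))
  · obtain ⟨P, -, hu, -⟩ := exists_difference hT h𝒞 hB h h'
      (h'.2.1.member_subset_interior h𝒞 hC h'.1 h.1 hd)
    exact Or.inl (hu ▸ subset_union_left)

lemma union {P : Set S} (h : IsExtension 𝒞 C B X E) (hP : IsAnnulus P E E') (hE' : E' ∈ 𝒞)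
    (hPC : Disjoint P C) (hd : Disjoint (P \ (E ∪ E')) (X \ (C ∪ E))) :
    IsExtension 𝒞 C B (X ∪ P) E' ∧ Disjoint X E' := by
  obtain ⟨h1, h2⟩ := h.2.1.inter_eq_of_interior_disjoint hP hPC hd
  exact ⟨⟨hE', h.2.1.union hP h1.le, h.2.2.trans subset_union_left⟩, h2⟩

lemma exists_larger (hT : PlaneTwoSided) (h𝒞 : IsCircleDecomposition 𝒞)
    (hts : ∀ C : Set S, IsCircle C → IsTwoSided C) (h : IsExtension 𝒞 C B X E) :
    ∃ X' E', IsExtension 𝒞 C B X' E' ∧ X ⊆ X' ∧ Disjoint X E' := by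
  obtain ⟨P, E', hE', hP, hPC, hd⟩ := h.2.1.exists_collar_beyond hT h𝒞 hts h.1
  obtain ⟨h1, h2⟩ := h.union hP hE' hPC hd
  exact ⟨_, _, h1, subset_union_left, h2⟩

lemma right_subset_interior (h : IsExtension 𝒞 C B X E) (hX : IsAnnulus X' C E') (hs : X ⊆ X')
    (hd : Disjoint X E') : E ⊆ X' \ (C ∪ E') := fun _ hx =>
  hX.mem_interior (hs (h.2.1.right_subset hx)) (fun hC => disjoint_left.1 h.2.1.disjoint hC hx)
    (disjoint_left.1 hd (h.2.1.right_subset hx))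

lemma exists_larger₂ (hT : PlaneTwoSided) (h𝒞 : IsCircleDecomposition 𝒞)
    (hts : ∀ C : Set S, IsCircle C → IsTwoSided C) (hC : C ∈ 𝒞) (hB : IsAnnulus B C D)
    (h : IsExtension 𝒞 C B X E) (h' : IsExtension 𝒞 C B X' E') :
    ∃ Y F P, IsExtension 𝒞 C B Y F ∧ IsAnnulus P E F ∧ X ∪ P = Y ∧ X ∩ P = E ∧ X' ⊆ Y := by
  have key : ∃ Y F, IsExtension 𝒞 C B Y F ∧ X ⊆ Y ∧ Disjoint X F ∧ X' ⊆ Y := by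
    rcases subset_or_subset hT h𝒞 hC hB h h' with hs | hs
    · obtain ⟨Y, F, hY, hs', hd⟩ := h'.exists_larger hT h𝒞 hts
      exact ⟨Y, F, hY, hs.trans hs', hd.mono_left hs, hs'⟩
    · obtain ⟨Y, F, hY, hs', hd⟩ := h.exists_larger hT h𝒞 hts
      exact ⟨Y, F, hY, hs', hd, hs.trans hs'⟩
  obtain ⟨Y, F, hY, hs, hd, hs'⟩ := key
  obtain ⟨P, hP, hu, hi⟩ :=
    exists_difference hT h𝒞 hB h hY (h.right_subset_interior hY.2.1 hs hd)
  exact ⟨Y, F, P, hY, hP, hu, hi, hs'⟩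

lemma interior_subset_extensionSide (h : IsExtension 𝒞 C B X E) :
    X \ (C ∪ E) ⊆ extensionSide 𝒞 C B :=
  fun _ hx => ⟨fun hC => hx.2 (Or.inl hC), X, E, h, hx.1⟩

end IsExtension

section
variable {S : Type*} [TopologicalSpace S] [T2Space S] [LocallyPlanar S] {𝒞 : Set (Set S)}
  {B C D : Set S}

lemma exists_interior_of_mem_extensionSide (hT : PlaneTwoSided) (h𝒞 : IsCircleDecomposition 𝒞)
    (hts : ∀ C : Set S, IsCircle C → IsTwoSided C) {x : S} (hx : x ∈ extensionSide 𝒞 C B) :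
    ∃ X E, IsExtension 𝒞 C B X E ∧ x ∈ X \ (C ∪ E) := by
  obtain ⟨hxC, X, E, h, hxX⟩ := hx
  obtain ⟨X', E', h', hs, hd⟩ := h.exists_larger hT h𝒞 hts
  exact ⟨X', E', h', h'.2.1.mem_interior (hs hxX) hxC (disjoint_left.1 hd hxX)⟩

lemma isOpen_extensionSide (hT : PlaneTwoSided) (h𝒞 : IsCircleDecomposition 𝒞)
    (hts : ∀ C : Set S, IsCircle C → IsTwoSided C) : IsOpen (extensionSide 𝒞 C B) := by
  refine isOpen_iff_forall_mem_open.2 fun x hx => ?_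
  obtain ⟨X, E, h, hxX⟩ := exists_interior_of_mem_extensionSide hT h𝒞 hts hx
  exact ⟨_, h.interior_subset_extensionSide, h.2.1.isOpen_interior, hxX⟩

lemma closure_extensionSide_subset (hT : PlaneTwoSided) (h𝒞 : IsCircleDecomposition 𝒞)
    (hts : ∀ C : Set S, IsCircle C → IsTwoSided C) (hC : C ∈ 𝒞) :
    closure (extensionSide 𝒞 C B) ⊆ extensionSide 𝒞 C B ∪ C := by
  intro x hx
  by_contra hxn
  rw [mem_union, not_or] at hxn
  obtain ⟨D, hD, hxD⟩ := h𝒞.exists_mem x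
  have hDC : Disjoint D C := h𝒞.2.1 D hD C hC fun h => hxn.2 (h ▸ hxD)
  obtain ⟨D₁, D₂, X₁, X₂, hD1, hD2, h1, h2, -, hn, hd⟩ := h𝒞.exists_annuli_nhds hT hD
    (hts D (h𝒞.1 D hD)) (h𝒞.1 C hC).isCompact.isClosed hDC
  rw [disjoint_union_left] at hd
  have key : ∀ Q D', D' ∈ 𝒞 → IsAnnulus Q D D' → Disjoint Q C →
      Disjoint (extensionSide 𝒞 C B) Q := by
    intro Q D' hD' hQ hQC
    by_contra hne
    obtain ⟨y, hyV, hyQ⟩ := not_disjoint_iff.1 hne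
    obtain ⟨X, E, h, hyX⟩ := exists_interior_of_mem_extensionSide hT h𝒞 hts hyV
    have hxX : x ∉ X := fun hxX => hxn.1 ⟨hxn.2, X, E, h, hxX⟩
    have hne := hQ.inter_interior_nonempty h.2.1.isOpen_interior ⟨y, hyQ, hyX⟩
    have hEQ : ¬ Disjoint E (Q \ (D ∪ D')) := fun hd => hxX
      (h.2.1.subset_of_interior_inter hQ (hQC.mono_left sdiff_subset) hd.symm hne
        (hQ.left_subset hxD))
    obtain ⟨Q₁, Q₂, hQ1, hQ2, hu, hi⟩ := hQ.symm.exists_split hT h𝒞 h.1 (by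
      rw [union_comm]
      exact hQ.member_subset_interior h𝒞 hD hD' h.1 hEQ)
    have hQ2C : Disjoint Q₂ C := hQC.mono_left (hu ▸ subset_union_right)
    have hdj : Disjoint (Q₂ \ (E ∪ D)) (X \ (C ∪ E)) := by
      by_contra hne
      exact hxX (h.2.1.subset_of_interior_inter hQ2 (hQ2C.mono_left sdiff_subset)
        IsAnnulus.disjoint_interior_left (not_disjoint_iff_nonempty_inter.1 hne)
        (hQ2.right_subset hxD))
    exact hxn.1 ⟨hxn.2, _, _, (h.union hQ2 hD hQ2C hdj).1, Or.inr (hQ2.right_subset hxD)⟩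
  obtain ⟨y, hy, hyV⟩ := mem_closure_iff_nhds.1 hx _ (hn x hxD)
  rcases hy with hy | hy
  · exact disjoint_left.1 (key _ _ hD1 h1 hd.1) hyV hy
  · exact disjoint_left.1 (key _ _ hD2 h2 hd.2) hyV hy

end

section
variable {S : Type*} [TopologicalSpace S] [T2Space S] [LocallyPlanar S] {𝒞 : Set (Set S)}
  {B C D : Set S}

lemma exists_cofinal_extensions [SecondCountableTopology S] (hT : PlaneTwoSided)
    (h𝒞 : IsCircleDecomposition 𝒞) (hts : ∀ C : Set S, IsCircle C → IsTwoSided C) (hD : D ∈ 𝒞)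
    (hB : IsAnnulus B C D) : ∃ Z F : ℕ → Set S, (∀ n, IsExtension 𝒞 C B (Z n) (F n)) ∧
      extensionSide 𝒞 C B ⊆ ⋃ n, Z n := by
  let I := {p : Set S × Set S // IsExtension 𝒞 C B p.1 p.2}
  obtain ⟨T, hTc, hTu⟩ := TopologicalSpace.isOpen_iUnion_countable
    (fun i : I => i.1.1 \ (C ∪ i.1.2)) fun i => i.2.2.1.isOpen_interior
  let i₀ : I := ⟨(B, D), hD, hB, subset_rfl⟩
  obtain ⟨z, hz⟩ := (hTc.insert i₀).exists_eq_range (insert_nonempty _ _)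
  refine ⟨fun n => (z n).1.1, fun n => (z n).1.2, fun n => (z n).2, fun x hx => ?_⟩
  obtain ⟨X, E, h, hxX⟩ := exists_interior_of_mem_extensionSide hT h𝒞 hts hx
  have : x ∈ ⋃ i ∈ T, i.1.1 \ (C ∪ i.1.2) := by
    rw [hTu]
    exact mem_iUnion.2 ⟨(⟨(X, E), h⟩ : I), hxX⟩
  obtain ⟨i, hi, hxi⟩ := mem_iUnion₂.1 this
  obtain ⟨n, rfl⟩ : i ∈ range z := hz ▸ mem_insert_of_mem _ hi
  exact mem_iUnion.2 ⟨n, hxi.1⟩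

theorem exists_ray_param [SecondCountableTopology S] (hT : PlaneTwoSided)
    (h𝒞 : IsCircleDecomposition 𝒞) (hts : ∀ C : Set S, IsCircle C → IsTwoSided C) (hC : C ∈ 𝒞)
    (hD : D ∈ 𝒞) (hB : IsAnnulus B C D) {e : Circle → S} (he : Continuous e)
    (hei : Function.Injective e) (her : range e = C) :
    ∃ φ : Circle × ℝ → S, ContinuousOn φ (univ ×ˢ Ici 0) ∧ InjOn φ (univ ×ˢ Ici 0) ∧
      (∀ s, φ (s, 0) = e s) ∧ φ '' (univ ×ˢ Ioi 0) = extensionSide 𝒞 C B := by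
  obtain ⟨Z, F, hZ, hZu⟩ := exists_cofinal_extensions hT h𝒞 hts hD hB
  let Good : ℕ → (Set S × Set S) × (Circle × ℝ → S) → Prop := fun n p =>
    IsExtension 𝒞 C B p.1.1 p.1.2 ∧ ContinuousOn p.2 (univ ×ˢ Icc 0 (n + 1 : ℝ)) ∧
      InjOn p.2 (univ ×ˢ Icc 0 (n + 1 : ℝ)) ∧ p.2 '' (univ ×ˢ Icc 0 (n + 1 : ℝ)) = p.1.1 ∧
      p.2 '' (univ ×ˢ {(n + 1 : ℝ)}) = p.1.2 ∧ ∀ s, p.2 (s, 0) = e s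
  have hstart : ∃ p, Good 0 p := by
    obtain ⟨k, hk, hki, hkB, hk0, hk1⟩ := hB.exists_param_extending he hei her
    refine ⟨((B, D), k), ⟨hD, hB, subset_rfl⟩, ?_⟩
    simp only [Nat.cast_zero, zero_add]
    exact ⟨hk, hki, hkB, hk1, hk0⟩
  have hstep : ∀ n p, Good n p → ∃ q, Good (n + 1) q ∧
      (∀ s, ∀ t ≤ (n + 1 : ℝ), q.2 (s, t) = p.2 (s, t)) ∧ Z n ⊆ q.1.1 := by
    rintro n ⟨⟨X, E⟩, f⟩ ⟨hX, hf, hfi, hfX, hfE, hf0⟩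
    simp only at hX hf hfi hfX hfE hf0
    obtain ⟨Y, G, P, hY, hP, hu, hi, hZY⟩ := hX.exists_larger₂ hT h𝒞 hts hC hB (hZ n)
    have hn : (0 : ℝ) ≤ n + 1 := by positivity
    obtain ⟨g, hg, hgf, hgi, hgP, hg1⟩ := exists_glued_param hn hf hfi hfE hP
    have hgX : g '' (univ ×ˢ Icc 0 (n + 1 : ℝ)) = X := by
      rw [← hfX]
      exact image_congr fun q hq => hgf _ _ hq.2.2
    have hgE : g '' (univ ×ˢ {(n + 1 : ℝ)}) = E := by
      rw [← hfE]
      exact image_congr fun q hq => hgf _ _ (show q.2 = n + 1 from hq.2).le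
    refine ⟨((Y, G), g), ⟨hY, ?_, ?_, ?_, ?_, fun s => ?_⟩, hgf, hZY⟩
    · simpa using hg
    · simp only [Nat.cast_add, Nat.cast_one]
      refine injOn_of_levels subset_rfl (a := n + 1) (fun q hq q' hq' h => ?_) hgi
        fun s t ht h1 hX => ?_
      · rw [← Prod.mk.eta (p := q), ← Prod.mk.eta (p := q'), hgf _ _ hq.2.2, hgf _ _ hq'.2.2] at h
        exact hfi hq hq' h
      · rw [hgX] at hX
        have hm : ((s, t) : Circle × ℝ) ∈ (univ ×ˢ Icc ((n : ℝ) + 1) ((n : ℝ) + 1 + 1) : Set (Circle × ℝ)) :=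
          ⟨mem_univ _, h1.le, ht.2⟩
        have : g (s, t) ∈ g '' (univ ×ˢ {(n + 1 : ℝ)}) := by
          rw [hgE, ← hi]
          exact ⟨hX, hgP ▸ mem_image_of_mem g hm⟩
        obtain ⟨⟨s', t'⟩, ⟨-, ht'⟩, heq⟩ := this
        obtain rfl : t' = n + 1 := ht'
        have := congrArg Prod.snd (hgi ⟨mem_univ _, by simp⟩ hm heq)
        exact h1.ne this
    · simp only [Nat.cast_add, Nat.cast_one]
      rw [← hu, ← hgX, ← hgP, ← image_union, ← prod_union,
        Icc_union_Icc_eq_Icc hn (by linarith)]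
    · simpa using hg1
    · change g (s, 0) = e s
      rw [hgf _ _ hn, hf0]
  obtain ⟨p₀, hp₀⟩ := hstart
  choose! next hnext using hstep
  let p : ℕ → (Set S × Set S) × (Circle × ℝ → S) := fun n => Nat.rec p₀ next n
  have hp : ∀ n, Good n (p n) := by
    intro n
    induction n with
    | zero => exact hp₀
    | succ n ih => exact (hnext n (p n) ih).1
  let f : ℕ → Circle × ℝ → S := fun n => (p n).2
  have hf1 : ∀ n : ℕ, ∀ s, ∀ t ≤ (n : ℝ) + 1, f (n + 1) (s, t) = f n (s, t) := fun n =>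
    (hnext n (p n) (hp n)).2.1
  have hZp : ∀ n, Z n ⊆ (p (n + 1)).1.1 := fun n => (hnext n (p n) (hp n)).2.2
  have hfm : ∀ n m : ℕ, n ≤ m → ∀ s, ∀ t ≤ (n : ℝ) + 1, f m (s, t) = f n (s, t) := by
    intro n m hnm s t ht
    induction m, hnm using Nat.le_induction with
    | base => rfl
    | succ m hm ih =>
      rw [hf1 m s t (ht.trans (by gcongr)), ih]
  let φ : Circle × ℝ → S := fun q => f ⌊q.2⌋₊ q
  have hφ : ∀ n : ℕ, ∀ s, ∀ t ≤ (n + 1 : ℝ), φ (s, t) = f n (s, t) := by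
    intro n s t ht
    change f ⌊t⌋₊ (s, t) = f n (s, t)
    rw [← hfm _ (max ⌊t⌋₊ n) (le_max_left _ _) s t (Nat.lt_floor_add_one t).le,
      ← hfm n (max ⌊t⌋₊ n) (le_max_right _ _) s t ht]
  have hφ0 : ∀ s, φ (s, 0) = e s := fun s => by
    rw [hφ 0 s 0 (by simp)]
    exact (hp 0).2.2.2.2.2 s
  have hinj : InjOn φ (univ ×ˢ Ici 0) := by
    rintro ⟨s, t⟩ ⟨-, ht⟩ ⟨s', t'⟩ ⟨-, ht'⟩ h
    obtain ⟨n, hn⟩ := exists_nat_ge (max t t')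
    have h1 : t ≤ n + 1 := (le_max_left _ _).trans (hn.trans (by simp))
    have h2 : t' ≤ n + 1 := (le_max_right _ _).trans (hn.trans (by simp))
    rw [hφ n s t h1, hφ n s' t' h2] at h
    exact (hp n).2.2.1 ⟨mem_univ _, ht, h1⟩ ⟨mem_univ _, ht', h2⟩ h
  refine ⟨φ, ?_, hinj, hφ0, Subset.antisymm ?_ ?_⟩
  · rintro ⟨s, t⟩ ⟨-, ht⟩
    obtain ⟨n, hn⟩ := exists_nat_ge t
    have hc : ContinuousOn φ (univ ×ˢ Icc 0 (n + 1 : ℝ)) :=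
      (hp n).2.1.congr fun q hq => hφ n _ _ hq.2.2
    refine (hc (s, t) ⟨mem_univ _, ht, hn.trans (by simp)⟩).mono_of_mem_nhdsWithin ?_
    have : (univ ×ˢ Iio (n + 1 : ℝ) : Set (Circle × ℝ)) ∈ 𝓝 (s, t) :=
      (isOpen_univ.prod isOpen_Iio).mem_nhds ⟨mem_univ _, hn.trans_lt (by simp)⟩
    refine Filter.mem_of_superset (inter_mem_nhdsWithin _ this) ?_
    rintro q ⟨⟨-, h0⟩, -, h1⟩
    exact ⟨mem_univ _, h0, le_of_lt h1⟩
  · rintro _ ⟨⟨s, t⟩, ⟨-, ht⟩, rfl⟩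
    refine ⟨fun hC => ?_, ?_⟩
    · rw [← her] at hC
      obtain ⟨s', hs'⟩ := hC
      rw [← hφ0] at hs'
      have := congrArg Prod.snd (hinj ⟨mem_univ _, mem_Ici.2 le_rfl⟩ ⟨mem_univ _, mem_Ici.2 (le_of_lt ht)⟩ hs')
      exact ne_of_lt ht this
    · obtain ⟨n, hn⟩ := exists_nat_ge t
      have hn' : t ≤ n + 1 := hn.trans (by simp)
      refine ⟨_, _, (hp n).1, ?_⟩
      rw [hφ n s t hn', ← (hp n).2.2.2.1]
      exact mem_image_of_mem _ ⟨mem_univ _, le_of_lt ht, hn'⟩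
  · intro x hx
    obtain ⟨n, hn⟩ := mem_iUnion.1 (hZu hx)
    have := hZp n hn
    rw [← (hp (n + 1)).2.2.2.1] at this
    obtain ⟨⟨s, t⟩, ⟨-, h0, h1⟩, rfl⟩ := this
    refine ⟨(s, t), ⟨mem_univ _, lt_of_le_of_ne h0 ?_⟩, hφ _ s t h1⟩
    intro h
    obtain rfl : 0 = t := h
    refine hx.1 ?_
    rw [← her]
    exact ⟨s, ((hp (n + 1)).2.2.2.2.2 s).symm⟩

end

section
variable {S : Type*} [TopologicalSpace S] [T2Space S] [LocallyPlanar S] {𝒞 : Set (Set S)}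
  {B B' C D D' : Set S}

lemma disjoint_extensionSide (hT : PlaneTwoSided) (h𝒞 : IsCircleDecomposition 𝒞)
    (hts : ∀ C : Set S, IsCircle C → IsTwoSided C) (hC : C ∈ 𝒞) (hD' : D' ∈ 𝒞)
    (hB' : IsAnnulus B' C D')
    (hw : ∀ X E, IsExtension 𝒞 C B X E → Disjoint (X \ (C ∪ E)) (B' \ (C ∪ D'))) :
    Disjoint (extensionSide 𝒞 C B) (extensionSide 𝒞 C B') := by
  rw [Set.disjoint_left]
  intro y hy hy'
  obtain ⟨Y, F, hY, hyY⟩ := exists_interior_of_mem_extensionSide hT h𝒞 hts hy'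
  have hopen := isOpen_extensionSide (B := B) hT h𝒞 hts (C := C)
  have hfr : Disjoint (Y \ (C ∪ F)) (frontier (extensionSide 𝒞 C B)) := by
    rw [Set.disjoint_left]
    intro z hz hzf
    rw [hopen.frontier_eq] at hzf
    rcases closure_extensionSide_subset hT h𝒞 hts hC hzf.1 with h | h
    · exact hzf.2 h
    · exact hz.2 (Or.inl h)
  have hsub := hY.2.1.isPreconnected_interior.subset_of_disjoint_frontier hopen hfr ⟨y, hyY, hy⟩
  obtain ⟨z, hz, hz'⟩ := hY.exists_mem_inter hB' ⟨hD', hB', subset_rfl⟩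
  obtain ⟨X, E, hX, hzX⟩ := exists_interior_of_mem_extensionSide hT h𝒞 hts (hsub hz)
  exact Set.disjoint_left.1 (hw X E hX) hzX hz'

lemma extensionSide_union_eq_univ [ConnectedSpace S] (hT : PlaneTwoSided)
    (h𝒞 : IsCircleDecomposition 𝒞) (hts : ∀ C : Set S, IsCircle C → IsTwoSided C) (hC : C ∈ 𝒞)
    (hD : D ∈ 𝒞) (hD' : D' ∈ 𝒞) (hB : IsAnnulus B C D) (hB' : IsAnnulus B' C D')
    (hn : ∀ x ∈ C, B ∪ B' ∈ 𝓝 x) :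
    extensionSide 𝒞 C B ∪ extensionSide 𝒞 C B' ∪ C = univ := by
  have hsub : B ∪ B' ⊆ extensionSide 𝒞 C B ∪ extensionSide 𝒞 C B' ∪ C := by
    intro x hx
    by_cases hxC : x ∈ C
    · exact Or.inr hxC
    · rcases hx with hx | hx
      · exact Or.inl (Or.inl ⟨hxC, B, D, ⟨hD, hB, subset_rfl⟩, hx⟩)
      · exact Or.inl (Or.inr ⟨hxC, B', D', ⟨hD', hB', subset_rfl⟩, hx⟩)
  have h1 := isOpen_extensionSide (B := B) hT h𝒞 hts (C := C)
  have h2 := isOpen_extensionSide (B := B') hT h𝒞 hts (C := C)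
  refine IsClopen.eq_univ ⟨?_, ?_⟩ ?_
  · have h3 := (h𝒞.1 C hC).isCompact.isClosed
    rw [← closure_subset_iff_isClosed, closure_union, closure_union, h3.closure_eq]
    have h4 := closure_extensionSide_subset hT h𝒞 hts hC (B := B)
    have h5 := closure_extensionSide_subset hT h𝒞 hts hC (B := B')
    rintro x ((h | h) | h)
    · rcases h4 h with h | h
      · exact Or.inl (Or.inl h)
      · exact Or.inr h
    · rcases h5 h with h | h
      · exact Or.inl (Or.inr h)
      · exact Or.inr h
    · exact Or.inr h
  · rw [isOpen_iff_mem_nhds]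
    rintro x (h | h)
    · exact Filter.mem_of_superset ((h1.union h2).mem_nhds h) subset_union_left
    · exact Filter.mem_of_superset (hn x h) hsub
  · exact (h𝒞.1 C hC).nonempty.mono subset_union_right

theorem nonempty_homeomorph_open_annulus [SecondCountableTopology S] [ConnectedSpace S]
    (hT : PlaneTwoSided)
    (h𝒞 : IsCircleDecomposition 𝒞) (hts : ∀ C : Set S, IsCircle C → IsTwoSided C) (hC : C ∈ 𝒞)
    (hD : D ∈ 𝒞) (hD' : D' ∈ 𝒞) (hB : IsAnnulus B C D) (hB' : IsAnnulus B' C D')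
    (hn : ∀ x ∈ C, B ∪ B' ∈ 𝓝 x)
    (hw : ∀ X E, IsExtension 𝒞 C B X E → Disjoint (X \ (C ∪ E)) (B' \ (C ∪ D'))) :
    Nonempty (S ≃ₜ Circle × ℝ) := by
  have hdisj := disjoint_extensionSide hT h𝒞 hts hC hD' hB' hw
  have huniv := extensionSide_union_eq_univ hT h𝒞 hts hC hD hD' hB hB' hn
  obtain ⟨e, he, hei, her⟩ := (h𝒞.1 C hC).exists_param
  obtain ⟨φ, hφ, hφi, hφ0, hφr⟩ := exists_ray_param hT h𝒞 hts hC hD hB he hei her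
  obtain ⟨ψ, hψ, hψi, hψ0, hψr⟩ := exists_ray_param hT h𝒞 hts hC hD' hB' he hei her
  have hφV : ∀ s t, 0 < t → φ (s, t) ∈ extensionSide 𝒞 C B := fun s t ht =>
    hφr ▸ mem_image_of_mem φ ⟨mem_univ s, mem_Ioi.2 ht⟩
  have hψV : ∀ s t, 0 < t → ψ (s, t) ∈ extensionSide 𝒞 C B' := fun s t ht =>
    hψr ▸ mem_image_of_mem ψ ⟨mem_univ s, mem_Ioi.2 ht⟩
  let F : Circle × ℝ → S := fun q => if 0 ≤ q.2 then φ q else ψ (q.1, -q.2)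
  have hFc : Continuous F := by
    refine continuous_if_le continuous_const continuous_snd ?_ ?_ ?_
    · exact hφ.mono fun q hq => ⟨mem_univ _, hq⟩
    · refine hψ.comp (by fun_prop) fun q hq => ⟨mem_univ _, ?_⟩
      have : q.2 ≤ 0 := hq
      exact mem_Ici.2 (by linarith)
    · rintro ⟨s, t⟩ h
      obtain rfl : 0 = t := h
      simp [hφ0, hψ0]
  have hmix : ∀ s t s' t', 0 ≤ t → 0 < t' → φ (s, t) ≠ ψ (s', t') := by
    intro s t s' t' ht ht' h
    have h1 := hψV s' t' ht'
    rcases ht.eq_or_lt with rfl | ht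
    · exact h1.1 (h ▸ hφ0 s ▸ her ▸ mem_range_self s)
    · exact Set.disjoint_left.1 hdisj (hφV s t ht) (h ▸ h1)
  have hFi : Function.Injective F := by
    rintro ⟨s, t⟩ ⟨s', t'⟩ h
    simp only [F] at h
    split_ifs at h with h1 h2 h2
    · exact hφi ⟨mem_univ _, mem_Ici.2 h1⟩ ⟨mem_univ _, mem_Ici.2 h2⟩ h
    · exact (hmix _ _ _ _ h1 (by linarith) h).elim
    · exact (hmix _ _ _ _ h2 (by linarith) h.symm).elim
    · have := hψi ⟨mem_univ _, mem_Ici.2 (by linarith)⟩ ⟨mem_univ _, mem_Ici.2 (by linarith)⟩ h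
      simp only [Prod.mk.injEq, neg_inj] at this ⊢
      exact this
  have hFs : Function.Surjective F := by
    intro x
    rcases huniv.symm ▸ mem_univ x with (h | h) | h
    · rw [← hφr] at h
      obtain ⟨⟨s, t⟩, ⟨-, ht⟩, rfl⟩ := h
      exact ⟨(s, t), if_pos (le_of_lt ht)⟩
    · rw [← hψr] at h
      obtain ⟨⟨s, t⟩, ⟨-, ht⟩, rfl⟩ := h
      have ht : 0 < t := ht
      refine ⟨(s, -t), ?_⟩
      simp only [F]
      rw [if_neg (by linarith), neg_neg]
    · rw [← her] at h
      obtain ⟨s, rfl⟩ := h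
      refine ⟨(s, 0), ?_⟩
      simp only [F, le_refl, if_true, hφ0]
  have hFo : IsOpenMap F := fun U hU => isOpen_image_of_injOn hU hFc.continuousOn hFi.injOn
  exact ⟨(IsHomeomorph.mk hFc hFo ⟨hFi, hFs⟩).homeomorph.symm⟩

end

section
variable {S : Type*} [TopologicalSpace S] [T2Space S] [LocallyPlanar S] {𝒞 : Set (Set S)}
  {B B' C D D' E X : Set S}

theorem exists_wrapped_param [ConnectedSpace S] (hT : PlaneTwoSided)
    (h𝒞 : IsCircleDecomposition 𝒞) (hC : C ∈ 𝒞) (hD' : D' ∈ 𝒞) (hB' : IsAnnulus B' C D')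
    (hn : ∀ x ∈ C, B ∪ B' ∈ 𝓝 x) (hX : IsExtension 𝒞 C B X E)
    (hw : ¬ Disjoint (X \ (C ∪ E)) (B' \ (C ∪ D'))) :
    ∃ g : Circle × ℝ → S, ContinuousOn g (univ ×ˢ Icc 0 2) ∧ InjOn g (univ ×ˢ Ico 0 2) ∧
      InjOn g (univ ×ˢ {2}) ∧ g '' (univ ×ˢ Icc 0 2) = univ ∧
      g '' (univ ×ˢ {2}) = g '' (univ ×ˢ {0}) := by
  obtain ⟨x₀, hx₀⟩ := (h𝒞.1 C hC).nonempty
  have hXn : ∀ x ∈ C, X ∉ 𝓝 x := fun x hx => hX.2.1.notMem_nhds_of_mem_left hx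
  have hEB : E ⊆ B' \ (C ∪ D') := by
    refine hB'.member_subset_interior h𝒞 hC hD' hX.1 fun hd => ?_
    obtain ⟨y, hy, hy'⟩ := not_disjoint_iff.1 hw
    have := hX.2.1.subset_of_interior_inter hB' IsAnnulus.disjoint_interior_left hd.symm
      ⟨y, hy', hy⟩
    exact hXn x₀ hx₀ (Filter.mem_of_superset (hn x₀ hx₀) (union_subset hX.2.2 this))
  obtain ⟨Q, P, hQ, hP, hu, hi⟩ := hB'.exists_split hT h𝒞 hX.1 hEB
  have hPC : Disjoint P C := disjoint_left.2 fun x hx hxC =>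
    disjoint_left.1 hQ.disjoint hxC (hi ▸ ⟨hQ.left_subset hxC, hx⟩)
  have hnear : ∀ x ∈ C, X ∪ Q ∈ 𝓝 x := fun x hx => by
    have : Pᶜ ∈ 𝓝 x := hP.isClosed.isOpen_compl.mem_nhds fun h => disjoint_left.1 hPC h hx
    refine Filter.mem_of_superset (Filter.inter_mem (hn x hx) this) ?_
    rintro y ⟨hy | hy, hyP⟩
    · exact Or.inl (hX.2.2 hy)
    · exact Or.inr ((hu.ge hy).resolve_right hyP)
  have hdisj : ∀ x ∈ Q, x ∉ C → x ∉ E → x ∉ X := by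
    intro x hx hxC hxE hxX
    have := hX.2.1.subset_of_interior_inter hQ IsAnnulus.disjoint_interior_left
      IsAnnulus.disjoint_interior_right
      ⟨x, hQ.mem_interior hx hxC hxE, hX.2.1.mem_interior hxX hxC hxE⟩
    exact hXn x₀ hx₀ (Filter.mem_of_superset (hnear x₀ hx₀) (union_subset subset_rfl this))
  obtain ⟨f, hf, hfi, hfX, hf0, hf1⟩ := hX.2.1
  obtain ⟨g, hg, hgf, hgi, hgQ, hg2⟩ := exists_glued_param zero_le_one hf hfi hf1 hQ.symm
  rw [one_add_one_eq_two] at hg hgi hgQ hg2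
  have hgX : g '' (univ ×ˢ Icc 0 1) = X := by
    rw [← hfX]
    exact image_congr fun q hq => hgf _ _ hq.2.2
  have hg0 : g '' (univ ×ˢ {0}) = C := by
    rw [← hf0]
    exact image_congr fun q hq => hgf _ _ ((show q.2 = 0 from hq.2).le.trans zero_le_one)
  have hg1 : g '' (univ ×ˢ {1}) = E := by
    rw [← hf1]
    exact image_congr fun q hq => hgf _ _ (show q.2 = 1 from hq.2).le
  have hall : g '' (univ ×ˢ Icc 0 2) = X ∪ Q := by
    rw [← hgX, ← hgQ, ← image_union, ← prod_union,
      Icc_union_Icc_eq_Icc zero_le_one one_le_two]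
  have hgi1 : InjOn g (univ ×ˢ Icc 0 1) := by
    intro q hq q' hq' h
    rw [← Prod.mk.eta (p := q), ← Prod.mk.eta (p := q'), hgf _ _ hq.2.2, hgf _ _ hq'.2.2] at h
    exact hfi hq hq' h
  have hinj : InjOn g (univ ×ˢ Ico 0 2) := by
    refine injOn_of_levels Ico_subset_Icc_self hgi1 hgi fun s t ht h1 => ?_
    rw [hgX]
    have hm : ((s, t) : Circle × ℝ) ∈ (univ ×ˢ Icc 1 2 : Set (Circle × ℝ)) :=
      ⟨mem_univ _, h1.le, ht.2.le⟩
    refine hdisj _ (hgQ ▸ mem_image_of_mem g hm) ?_ ?_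
    · rw [← hg2]
      rintro ⟨⟨s', t'⟩, ⟨-, ht'⟩, heq⟩
      obtain rfl : t' = 2 := ht'
      exact ht.2.ne' (congrArg Prod.snd (hgi ⟨mem_univ _, by norm_num⟩ hm heq))
    · rw [← hg1]
      rintro ⟨⟨s', t'⟩, ⟨-, ht'⟩, heq⟩
      obtain rfl : t' = 1 := ht'
      exact h1.ne (congrArg Prod.snd (hgi ⟨mem_univ _, by norm_num⟩ hm heq))
  refine ⟨g, hg, hinj, hgi.mono (prod_mono_right (by simp)), ?_, hg2.trans hg0.symm⟩
  rw [hall]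
  refine IsClopen.eq_univ ⟨hX.2.1.isClosed.union hQ.isClosed, ?_⟩ ⟨x₀, Or.inr (hQ.left_subset hx₀)⟩
  have hopen : IsOpen (g '' (univ ×ˢ Ioo 0 2)) :=
    isOpen_image_of_injOn (isOpen_univ.prod isOpen_Ioo)
      (hg.mono (prod_mono_right Ioo_subset_Icc_self))
      (hinj.mono (prod_mono_right Ioo_subset_Ico_self))
  rw [isOpen_iff_mem_nhds]
  intro x hx
  by_cases hxC : x ∈ C
  · exact hnear x hxC
  · rw [← hall] at hx ⊢
    refine Filter.mem_of_superset (hopen.mem_nhds ?_)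
      (image_mono (prod_mono_right Ioo_subset_Icc_self))
    obtain ⟨⟨s, t⟩, ⟨-, h0, h2⟩, rfl⟩ := hx
    refine mem_image_of_mem g ⟨mem_univ _, lt_of_le_of_ne h0 ?_, lt_of_le_of_ne h2 ?_⟩
    · rintro h
      exact hxC (hg0 ▸ mem_image_of_mem g ⟨mem_univ _, h.symm⟩)
    · rintro h
      exact hxC (hg2 ▸ mem_image_of_mem g ⟨mem_univ _, h⟩)

end

namespace Circle

lemma exists_lift {σ : Circle → Circle} (hσ : Continuous σ) :
    ∃ G : ℝ → ℝ, Continuous G ∧ ∀ x, exp (G x) = σ (exp x) := by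
  let f : C(ℝ, Circle) := ⟨fun x => σ (exp x), hσ.comp exp.continuous⟩
  obtain ⟨G, ⟨-, hG⟩, -⟩ := isCoveringMap_exp.existsUnique_continuousMap_lifts f
    (a₀ := 0) (e₀ := Complex.arg (f 0)) (exp_arg _)
  exact ⟨G, G.continuous, fun x => congrFun hG x⟩

lemma exists_int_shift {f g : ℝ → ℝ} (hf : Continuous f) (hg : Continuous g)
    (h : ∀ x, exp (f x) = exp (g x)) : ∃ m : ℤ, ∀ x, f x = g x + m * (2 * Real.pi) := by
  obtain ⟨m, hm⟩ := exp_eq_exp.1 (h 0)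
  refine ⟨m, fun x => congrFun (isCoveringMap_exp.eq_of_comp_eq hf
    (hg.add continuous_const) (funext fun y => ?_) 0 hm) x⟩
  simp only [Function.comp_apply]
  rw [h y]
  exact (exp_eq_exp.2 ⟨m, rfl⟩).symm

/-- An equivariant function with integral degree. -/
lemma map_add_int_mul {K : ℝ → ℝ} {d : ℝ} (h : ∀ x, K (x + 2 * Real.pi) = K x + d * (2 * Real.pi))
    (x : ℝ) (n : ℤ) : K (x + n * (2 * Real.pi)) = K x + n * d * (2 * Real.pi) := by
  have : Function.Periodic (fun x => K x - d * x) (2 * Real.pi) := fun x => by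
    simp only [h]
    ring
  have := this.int_mul n x
  linarith

theorem exists_signed_lift {σ : Circle → Circle} (hσ : Continuous σ) (hb : Function.Bijective σ) :
    ∃ ε : ℝ, (ε = 1 ∨ ε = -1) ∧ ∃ H : ℝ → ℝ, Continuous H ∧ StrictMono H ∧
      (∀ x, H (x + 2 * Real.pi) = H x + 2 * Real.pi) ∧ ∀ x, exp (H x) = σ (exp (ε * x)) := by
  have hpi := Real.pi_pos
  let τ : Circle ≃ₜ Circle := hσ.homeoOfEquivCompactToT2 (f := Equiv.ofBijective σ hb)
  have hτ : ∀ z, τ.symm (σ z) = z := fun z => τ.symm_apply_apply z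
  obtain ⟨G, hG, hGσ⟩ := exists_lift hσ
  obtain ⟨K, hK, hKτ⟩ := exists_lift τ.symm.continuous
  obtain ⟨m, hm⟩ := exists_int_shift (hK.comp hG) continuous_id fun x => by
    simp only [Function.comp_apply, id, hKτ, hGσ, hτ]
  simp only [Function.comp_apply, id] at hm
  have hGi : Function.Injective G := fun x y h => by
    have := hm x
    rw [h, hm y] at this
    linarith
  obtain ⟨d, hd⟩ := exists_int_shift (hG.comp (continuous_add_const (2 * Real.pi))) hG fun x => by
    simp only [Function.comp_apply, hGσ, exp_add_two_pi]
  obtain ⟨d', hd'⟩ := exists_int_shift (hK.comp (continuous_add_const (2 * Real.pi))) hK fun x => by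
    simp only [Function.comp_apply, hKτ, exp_add_two_pi]
  simp only [Function.comp_apply] at hd hd'
  have hdd : d * d' = 1 := by
    have h1 := hm (0 + 2 * Real.pi)
    rw [hd, map_add_int_mul hd', hm] at h1
    have h2 : ((d : ℝ) * d' - 1) * (2 * Real.pi) = 0 := by linarith
    have h3 : (d : ℝ) * d' - 1 = 0 := (mul_eq_zero.1 h2).resolve_right (by positivity)
    exact_mod_cast sub_eq_zero.1 h3
  have h0 := hd 0
  rcases Int.eq_one_or_neg_one_of_mul_eq_one hdd with rfl | rfl
  · refine ⟨1, Or.inl rfl, G, hG, ?_, fun x => by simpa using hd x, fun x => by simp [hGσ]⟩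
    refine (hG.strictMono_of_inj hGi).resolve_right fun h => ?_
    have := h (show (0 : ℝ) < 0 + 2 * Real.pi by linarith)
    push_cast at h0
    linarith
  · refine ⟨-1, Or.inr rfl, fun x => G (-1 * x), by fun_prop, ?_, fun x => ?_, fun x => hGσ _⟩
    · have hanti : StrictAnti G := (hG.strictMono_of_inj hGi).resolve_left fun h => by
        have := h (show (0 : ℝ) < 0 + 2 * Real.pi by linarith)
        push_cast at h0
        linarith
      exact fun x y hxy => hanti (by linarith)
    · have := hd (-1 * (x + 2 * Real.pi))
      rw [show -1 * (x + 2 * Real.pi) + 2 * Real.pi = -1 * x by ring] at this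
      push_cast at this
      linarith

end Circle

lemma surjective_of_map_add_two_pi {f : ℝ → ℝ} (hf : Continuous f)
    (h : ∀ x, f (x + 2 * Real.pi) = f x + 2 * Real.pi) : Function.Surjective f := by
  intro c
  have hn : ∀ n : ℤ, f (0 + n * (2 * Real.pi)) = f 0 + n * (2 * Real.pi) := fun n => by
    rw [Circle.map_add_int_mul (K := f) (d := 1) (by simpa using h), mul_one]
  obtain ⟨n, hn1⟩ := exists_int_gt ((c - f 0) / (2 * Real.pi))
  obtain ⟨m, hm1⟩ := exists_int_lt ((c - f 0) / (2 * Real.pi))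
  rw [div_lt_iff₀ Real.two_pi_pos] at hn1
  rw [lt_div_iff₀ Real.two_pi_pos] at hm1
  refine mem_range_of_exists_le_of_exists_ge hf ⟨0 + m * (2 * Real.pi), ?_⟩
    ⟨0 + n * (2 * Real.pi), ?_⟩
  · rw [hn]; linarith
  · rw [hn]; linarith

section
variable {S : Type*} [TopologicalSpace S] [T2Space S]

lemma exists_monodromy {φ : Circle × ℝ → S} (hφ : ContinuousOn φ (univ ×ˢ Icc 0 2))
    (hi : InjOn φ (univ ×ˢ Ico 0 2)) (hi2 : InjOn φ (univ ×ˢ {2}))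
    (he : φ '' (univ ×ˢ {2}) = φ '' (univ ×ˢ {0})) :
    ∃ σ : Circle → Circle, Continuous σ ∧ Function.Bijective σ ∧
      ∀ s, φ (s, 2) = φ (σ s, 0) := by
  have hc : ∀ t ∈ Icc (0 : ℝ) 2, Continuous fun s => φ (s, t) := fun t ht =>
    hφ.comp_continuous (by fun_prop) fun s => ⟨mem_univ _, ht⟩
  have h0 : Function.Injective fun s => φ (s, 0) := fun s s' h =>
    congrArg Prod.fst (hi ⟨mem_univ _, by simp⟩ ⟨mem_univ _, by simp⟩ h)
  have h2 : Function.Injective fun s => φ (s, 2) := fun s s' h =>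
    congrArg Prod.fst (hi2 ⟨mem_univ _, mem_singleton _⟩ ⟨mem_univ _, mem_singleton _⟩ h)
  have hex : ∀ s, ∃ s', φ (s, 2) = φ (s', 0) := fun s => by
    obtain ⟨⟨s', t⟩, ⟨-, ht⟩, h⟩ := he.le (mem_image_of_mem φ (show (s, 2) ∈ univ ×ˢ {2} by simp))
    obtain rfl : t = 0 := ht
    exact ⟨s', h.symm⟩
  choose σ hσ using hex
  have hemb : IsEmbedding fun s => φ (s, 0) :=
    ((hc 0 (by simp)).isClosedEmbedding h0).isEmbedding
  refine ⟨σ, ?_, ⟨fun s s' h => h2 ?_, fun s => ?_⟩, hσ⟩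
  · rw [hemb.continuous_iff]
    convert hc 2 (by simp) using 1
    exact funext fun s => (hσ s).symm
  · simp only [hσ, h]
  · obtain ⟨⟨s', t⟩, ⟨-, ht⟩, h⟩ := he.ge (mem_image_of_mem φ (show (s, 0) ∈ univ ×ˢ {0} by simp))
    obtain rfl : t = 2 := ht
    exact ⟨s', h0 ((hσ s').symm.trans h)⟩

/-- A closed-up annulus has a parametrization in which the ends are glued by `x ↦ ± x`. -/
theorem exists_periodic_param {φ : Circle × ℝ → S} (hφ : ContinuousOn φ (univ ×ˢ Icc 0 2))
    (hi : InjOn φ (univ ×ˢ Ico 0 2)) (hi2 : InjOn φ (univ ×ˢ {2}))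
    (hs : φ '' (univ ×ˢ Icc 0 2) = univ) (he : φ '' (univ ×ˢ {2}) = φ '' (univ ×ˢ {0})) :
    ∃ ε : ℝ, (ε = 1 ∨ ε = -1) ∧ ∃ P : ℝ × ℝ → S, ContinuousOn P (univ ×ˢ Icc 0 2) ∧
      (∀ x t, P (x + 2 * Real.pi, t) = P (x, t)) ∧ (∀ x, P (x, 2) = P (ε * x, 0)) ∧
      (∀ x t x' t', t ∈ Ico (0 : ℝ) 2 → t' ∈ Ico (0 : ℝ) 2 → P (x, t) = P (x', t') →
        Circle.exp x = Circle.exp x' ∧ t = t') ∧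
      P '' (univ ×ˢ Icc 0 2) = univ := by
  obtain ⟨σ, hσ, hσb, hσφ⟩ := exists_monodromy hφ hi hi2 he
  obtain ⟨ε, hε, H, hH, hHm, hHp, hHσ⟩ := Circle.exists_signed_lift hσ hσb
  let M : ℝ → ℝ → ℝ := fun t x => t / 2 * x + (1 - t / 2) * H x
  have hMp : ∀ t x, M t (x + 2 * Real.pi) = M t x + 2 * Real.pi := fun t x => by
    simp only [M, hHp]
    ring
  have hMm : ∀ t ∈ Ico (0 : ℝ) 2, StrictMono (M t) := fun t ht x y hxy => by
    have h1 := mul_le_mul_of_nonneg_left hxy.le (by linarith [ht.1] : 0 ≤ t / 2)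
    have h2 := mul_lt_mul_of_pos_left (hHm hxy) (by linarith [ht.2] : 0 < 1 - t / 2)
    simp only [M]
    linarith
  have hMc : Continuous fun q : ℝ × ℝ => M q.2 q.1 := by fun_prop
  refine ⟨ε, hε, fun q => φ (Circle.exp (M q.2 q.1), q.2), ?_, fun x t => ?_, fun x => ?_,
    fun x t x' t' ht ht' h => ?_, eq_univ_of_forall fun y => ?_⟩
  · refine hφ.comp ?_ fun q hq => ⟨mem_univ _, hq.2⟩
    exact ((Circle.exp.continuous.comp hMc).prodMk continuous_snd).continuousOn
  · simp only [hMp, Circle.exp_add_two_pi]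
  · have h1 : ε * (ε * x) = x := by rcases hε with rfl | rfl <;> ring
    have h2 : M 0 (ε * x) = H (ε * x) := by simp [M]
    have h3 : M 2 x = x := by simp [M]
    simp only [h2, h3, hHσ, h1, hσφ]
  · have := hi ⟨mem_univ _, ht⟩ ⟨mem_univ _, ht'⟩ h
    obtain rfl : t = t' := congrArg Prod.snd this
    refine ⟨?_, rfl⟩
    obtain ⟨m, hm⟩ := Circle.exp_eq_exp.1 (congrArg Prod.fst this)
    refine Circle.exp_eq_exp.2 ⟨m, (hMm t ht).injective ?_⟩
    rw [Circle.map_add_int_mul (K := M t) (d := 1) (by simpa using hMp t), mul_one]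
    exact hm
  · obtain ⟨⟨s, t⟩, ht, rfl⟩ := hs.ge (mem_univ y)
    obtain ⟨x, hx⟩ := surjective_of_map_add_two_pi (f := M t) (by fun_prop) (hMp t)
      (Complex.arg s)
    refine ⟨(x, t), ⟨mem_univ _, ht.2⟩, ?_⟩
    simp only [hx, Circle.exp_arg]

end

/-- Two continuous surjections from a compact space to Hausdorff spaces with the same fibres have
homeomorphic targets. -/
lemma nonempty_homeomorph_of_fibers {K A B : Type*} [TopologicalSpace K] [CompactSpace K]
    [TopologicalSpace A] [T2Space A] [TopologicalSpace B] [T2Space B] {p : K → A} {q : K → B}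
    (hp : Continuous p) (hps : Function.Surjective p) (hq : Continuous q)
    (hqs : Function.Surjective q) (h : ∀ x y, p x = p y ↔ q x = q y) : Nonempty (A ≃ₜ B) := by
  have hP := IsQuotientMap.of_surjective_continuous hps hp
  have hQ := IsQuotientMap.of_surjective_continuous hqs hq
  let f : A → B := fun a => q (Function.surjInv hps a)
  let g : B → A := fun b => p (Function.surjInv hqs b)
  have hf : ∀ x, f (p x) = q x := fun x => (h _ _).1 (Function.surjInv_eq hps _)
  have hg : ∀ x, g (q x) = p x := fun x => (h _ _).2 (Function.surjInv_eq hqs _)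
  exact ⟨{ toFun := f
           invFun := g
           left_inv := hps.forall.2 fun x => by rw [hf, hg]
           right_inv := hqs.forall.2 fun x => by rw [hg, hf]
           continuous_toFun := hP.continuous_iff.2 (hq.congr fun x => (hf x).symm)
           continuous_invFun := hQ.continuous_iff.2 (hp.congr fun x => (hg x).symm) }⟩

lemma Circle.exp_pi_mul_eq_iff {t t' : ℝ} (ht : t ∈ Ico (0 : ℝ) 2) (ht' : t' ∈ Ico (0 : ℝ) 2) :
    exp (Real.pi * t) = exp (Real.pi * t') ↔ t = t' := by
  have hpi := Real.pi_pos
  refine ⟨fun h => ?_, fun h => h ▸ rfl⟩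
  have := exp_injOn_Ico (a := 0) (b := 2 * Real.pi) (by simp)
    (⟨by have := ht.1; positivity, by nlinarith [ht.2]⟩ : Real.pi * t ∈ Ico 0 (2 * Real.pi))
    (⟨by have := ht'.1; positivity, by nlinarith [ht'.2]⟩ : Real.pi * t' ∈ Ico 0 (2 * Real.pi)) h
  exact mul_left_cancel₀ hpi.ne' this

lemma Circle.exists_exp_pi_mul (z : Circle) : ∃ t ∈ Ico (0 : ℝ) 2, exp (Real.pi * t) = z := by
  have hpi := Real.pi_pos
  obtain ⟨y, hy, hyz⟩ := periodic_exp.exists_mem_Ico₀ Real.two_pi_pos (Complex.arg z)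
  refine ⟨y / Real.pi, ⟨div_nonneg hy.1 hpi.le, (div_lt_iff₀ hpi).2 hy.2⟩, ?_⟩
  rw [mul_div_cancel₀ _ hpi.ne', ← hyz, exp_arg]

lemma Circle.exists_mem_Ico_exp_pi_mul_eq {t : ℝ} (ht : t ∈ Icc (0 : ℝ) 2) :
    ∃ r ∈ Ico (0 : ℝ) 2, exp (Real.pi * t) = exp (Real.pi * r) ∧ (t = r ∨ t = 2 ∧ r = 0) := by
  rcases ht.2.eq_or_lt with rfl | hlt
  · refine ⟨0, by simp, ?_, Or.inr ⟨rfl, rfl⟩⟩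
    rw [mul_comm, exp_two_pi, mul_zero, exp_zero]
  · exact ⟨t, ⟨ht.1, hlt⟩, rfl, Or.inl rfl⟩

section
variable {S : Type*} [TopologicalSpace S] [T2Space S] {P : ℝ × ℝ → S}

/-- A closed interval with ends identified gives a circle. -/
lemma isCircle_image_Icc {γ : ℝ → S} (hγ : ContinuousOn γ (Icc 0 2)) (hi : InjOn γ (Ico 0 2))
    (h2 : γ 2 = γ 0) : IsCircle (γ '' Icc 0 2) := by
  refine nonempty_homeomorph_of_fibers (K := Icc (0 : ℝ) 2)
    (A := γ '' Icc 0 2)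
    (p := fun t => ⟨γ t, mem_image_of_mem γ t.2⟩) (q := fun t => Circle.exp (Real.pi * t))
    (hγ.domRestrict.subtype_mk _) ?_ (by fun_prop) ?_ ?_
  · rintro ⟨_, t, ht, rfl⟩
    exact ⟨⟨t, ht⟩, rfl⟩
  · intro z
    obtain ⟨t, ht, rfl⟩ := Circle.exists_exp_pi_mul z
    exact ⟨⟨t, Ico_subset_Icc_self ht⟩, rfl⟩
  · have key : ∀ t : Icc (0 : ℝ) 2, ∃ r ∈ Ico (0 : ℝ) 2, γ t = γ r ∧
        Circle.exp (Real.pi * t) = Circle.exp (Real.pi * r) := by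
      rintro ⟨t, ht⟩
      obtain ⟨r, hr, he, rfl | ⟨rfl, rfl⟩⟩ := Circle.exists_mem_Ico_exp_pi_mul_eq ht
      · exact ⟨t, hr, rfl, rfl⟩
      · exact ⟨0, hr, h2, he⟩
    intro t t'
    obtain ⟨r, hr, h1, h1'⟩ := key t
    obtain ⟨r', hr', h3, h3'⟩ := key t'
    rw [Subtype.mk_eq_mk, h1, h3, h1', h3', Circle.exp_pi_mul_eq_iff hr hr', hi.eq_iff hr hr']

lemma nonempty_homeomorph_torus (hP : ContinuousOn P (univ ×ˢ Icc 0 2))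
    (hper : ∀ x t, P (x + 2 * Real.pi, t) = P (x, t)) (h2 : ∀ x, P (x, 2) = P (x, 0))
    (hi : ∀ x t x' t', t ∈ Ico (0 : ℝ) 2 → t' ∈ Ico (0 : ℝ) 2 → P (x, t) = P (x', t') →
      Circle.exp x = Circle.exp x' ∧ t = t')
    (hs : P '' (univ ×ˢ Icc 0 2) = univ) : Nonempty (S ≃ₜ Circle × Circle) := by
  have hper' : ∀ x x' t, Circle.exp x = Circle.exp x' → P (x, t) = P (x', t) := by
    intro x x' t h
    obtain ⟨m, rfl⟩ := Circle.exp_eq_exp.1 h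
    exact (show Function.Periodic (fun x => P (x, t)) (2 * Real.pi) from
      fun x => hper x t).int_mul m x'
  refine nonempty_homeomorph_of_fibers (K := Icc (0 : ℝ) (2 * Real.pi) × Icc (0 : ℝ) 2)
    (p := fun q => P (q.1, q.2)) (q := fun q => (Circle.exp q.1, Circle.exp (Real.pi * q.2)))
    (hP.comp_continuous (by fun_prop) fun q => ⟨mem_univ _, q.2.2⟩) ?_ (by fun_prop) ?_ ?_
  · intro y
    obtain ⟨⟨x, t⟩, ⟨-, ht⟩, rfl⟩ := hs.ge (mem_univ y)
    obtain ⟨x', hx', h⟩ := Circle.periodic_exp.exists_mem_Ico₀ Real.two_pi_pos x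
    exact ⟨(⟨x', Ico_subset_Icc_self hx'⟩, ⟨t, ht⟩), hper' _ _ _ h.symm⟩
  · rintro ⟨z, w⟩
    obtain ⟨t, ht, rfl⟩ := Circle.exists_exp_pi_mul w
    obtain ⟨x', hx', h⟩ := Circle.periodic_exp.exists_mem_Ico₀ Real.two_pi_pos (Complex.arg z)
    refine ⟨(⟨x', Ico_subset_Icc_self hx'⟩, ⟨t, Ico_subset_Icc_self ht⟩), ?_⟩
    simp only [← h, Circle.exp_arg]
  · have key : ∀ t : Icc (0 : ℝ) 2, ∃ r ∈ Ico (0 : ℝ) 2, (∀ x, P (x, t) = P (x, r)) ∧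
        Circle.exp (Real.pi * t) = Circle.exp (Real.pi * r) := by
      rintro ⟨t, ht⟩
      obtain ⟨r, hr, he, rfl | ⟨rfl, rfl⟩⟩ := Circle.exists_mem_Ico_exp_pi_mul_eq ht
      · exact ⟨t, hr, fun _ => rfl, rfl⟩
      · exact ⟨0, hr, h2, he⟩
    rintro ⟨⟨x, hx⟩, t⟩ ⟨⟨x', hx'⟩, t'⟩
    obtain ⟨r, hr, h1, h1'⟩ := key t
    obtain ⟨r', hr', h3, h3'⟩ := key t'
    simp only [h1, h3, h1', h3', Prod.mk.injEq]
    rw [Circle.exp_pi_mul_eq_iff hr hr']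
    refine ⟨hi _ _ _ _ hr hr', ?_⟩
    rintro ⟨h, rfl⟩
    exact hper' _ _ _ h

end

lemma Circle.eq_zero_of_exp_eq_one {x : ℝ} (h : exp x = 1) (h1 : -(2 * Real.pi) < x)
    (h2 : x < 2 * Real.pi) : x = 0 := by
  obtain ⟨n, rfl⟩ := exp_eq_one.1 h
  have hpi := Real.two_pi_pos
  have h3 : (-1 : ℝ) < n := by nlinarith
  have h4 : (n : ℝ) < 1 := by nlinarith
  have h5 : -1 < n := by exact_mod_cast h3
  have h6 : n < 1 := by exact_mod_cast h4
  obtain rfl : n = 0 := by omega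
  simp

section
variable {S : Type*} [TopologicalSpace S] {P : ℝ × ℝ → S}

lemma exists_thin_strip (hP : ContinuousOn P (univ ×ˢ Icc 0 2)) {R : Set S} (hR : IsOpen R)
    (h : ∀ t ∈ Icc (0 : ℝ) 2, P (0, t) ∈ R) :
    ∃ δ > 0, ∀ x, |x| < δ → ∀ t ∈ Icc (0 : ℝ) 2, P (x, t) ∈ R := by
  have hQ : Continuous fun q : ℝ × Icc (0 : ℝ) 2 => P (q.1, q.2) :=
    hP.comp_continuous (by fun_prop) fun q => ⟨mem_univ _, q.2.2⟩
  obtain ⟨u, v, hu, -, h0u, hv, huv⟩ := generalized_tube_lemma (isCompact_singleton (x := (0 : ℝ)))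
    (isCompact_univ (X := Icc (0 : ℝ) 2)) (hR.preimage hQ) fun q hq => by
      obtain ⟨x, t⟩ := q
      obtain rfl : x = 0 := hq.1
      exact h t t.2
  obtain ⟨δ, hδ, hδu⟩ := Metric.isOpen_iff.1 hu 0 (h0u rfl)
  refine ⟨δ, hδ, fun x hx t ht => ?_⟩
  exact huv (show (x, (⟨t, ht⟩ : Icc (0 : ℝ) 2)) ∈ u ×ˢ v from
    ⟨hδu (by simpa using hx), hv (mem_univ _)⟩)

/-- The Klein bottle contains a one-sided circle. -/
theorem false_of_reversed_ends [T2Space S] [LocallyPlanar S]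
    (hts : ∀ C : Set S, IsCircle C → IsTwoSided C) (hP : ContinuousOn P (univ ×ˢ Icc 0 2))
    (hper : ∀ x t, P (x + 2 * Real.pi, t) = P (x, t)) (h2 : ∀ x, P (x, 2) = P (-x, 0))
    (hi : ∀ x t x' t', t ∈ Ico (0 : ℝ) 2 → t' ∈ Ico (0 : ℝ) 2 → P (x, t) = P (x', t') →
      Circle.exp x = Circle.exp x' ∧ t = t')
    (hs : P '' (univ ×ˢ Icc 0 2) = univ) : False := by
  have hpi := Real.pi_gt_three
  have hred : ∀ x, ∀ t ∈ Icc (0 : ℝ) 2, ∃ r ∈ Ico (0 : ℝ) 2, ∃ x', (x' = x ∨ x' = -x) ∧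
      P (x, t) = P (x', r) := by
    intro x t ht
    rcases ht.2.eq_or_lt with rfl | hlt
    · exact ⟨0, by simp, -x, Or.inr rfl, h2 x⟩
    · exact ⟨t, ⟨ht.1, hlt⟩, x, Or.inl rfl, rfl⟩
  set γ : ℝ → S := fun t => P (0, t)
  set M := γ '' Icc 0 2
  have hM : ∀ x, ∀ t ∈ Icc (0 : ℝ) 2, P (x, t) ∈ M → Circle.exp x = 1 := by
    rintro x t ht ⟨t', ht', h⟩
    obtain ⟨r, hr, x', hx', h1⟩ := hred x t ht
    obtain ⟨r', hr', y, hy, h1'⟩ := hred 0 t' ht'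
    have hy0 : y = 0 := by rcases hy with rfl | rfl <;> simp
    have h3 : P (0, t') = P (x, t) := h
    rw [h1, h1', hy0] at h3
    have h4 := (hi _ _ _ _ hr' hr h3).1
    rw [Circle.exp_zero] at h4
    rcases hx' with rfl | rfl
    · exact h4.symm
    · rwa [Circle.exp_neg, eq_comm, inv_eq_one] at h4
  have hMc : IsCircle M := isCircle_image_Icc
    (hP.comp (by fun_prop) fun t ht => ⟨mem_univ _, ht⟩)
    (fun t ht t' ht' h => (hi _ _ _ _ ht ht' h).2) ((h2 0).trans (by simp [γ]))
  obtain ⟨c, hc, hcM⟩ := (hts M hMc).exists_collar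
  obtain ⟨δ₀, hδ₀, hδR⟩ := exists_thin_strip hP hc.isOpen_range fun t ht => by
    have : P (0, t) ∈ M := mem_image_of_mem γ ht
    rw [← hcM] at this
    exact image_subset_range _ _ this
  obtain ⟨δ, hδ, hδ1, hδδ⟩ : ∃ δ > 0, δ ≤ 1 ∧ δ ≤ δ₀ :=
    ⟨min 1 δ₀, lt_min one_pos hδ₀, min_le_left _ _, min_le_right _ _⟩
  set W := P '' (Ioo 0 δ ×ˢ Icc 0 2) ∪ P '' (Ioo (-δ) 0 ×ˢ Icc 0 2)
  have hWmem : ∀ x, x ∈ Ioo (-δ) δ → x ≠ 0 → ∀ t ∈ Icc (0 : ℝ) 2, P (x, t) ∈ W := by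
    intro x hx hx0 t ht
    rcases hx0.lt_or_gt with h | h
    · exact Or.inr ⟨(x, t), ⟨⟨hx.1, h⟩, ht⟩, rfl⟩
    · exact Or.inl ⟨(x, t), ⟨⟨h, hx.2⟩, ht⟩, rfl⟩
  have hWpre : IsPreconnected W := by
    refine IsPreconnected.union (P (δ / 2, 2)) ?_ ?_ ?_ ?_
    · exact ⟨(δ / 2, 2), ⟨⟨by linarith, by linarith⟩, by simp⟩, rfl⟩
    · rw [h2]
      exact ⟨(-(δ / 2), 0), ⟨⟨by linarith, by linarith⟩, by simp⟩, rfl⟩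
    · exact (isPreconnected_Ioo.prod isPreconnected_Icc).image _
        (hP.mono (prod_mono_left (subset_univ _)))
    · exact (isPreconnected_Ioo.prod isPreconnected_Icc).image _
        (hP.mono (prod_mono_left (subset_univ _)))
  have hWc : W ⊆ c '' (univ ×ˢ Ioi 0) ∪ c '' (univ ×ˢ Iio 0) := by
    have hx : ∀ x, x ∈ Ioo (-δ) δ → x ≠ 0 → ∀ t ∈ Icc (0 : ℝ) 2,
        P (x, t) ∈ c '' (univ ×ˢ Ioi 0) ∪ c '' (univ ×ˢ Iio 0) := by
      intro x hx hx0 t ht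
      obtain ⟨⟨s, r⟩, hsr⟩ := hδR x ((abs_lt.2 hx).trans_le hδδ) t ht
      rcases lt_trichotomy r 0 with hr | rfl | hr
      · exact Or.inr ⟨(s, r), ⟨mem_univ _, hr⟩, hsr⟩
      · have : P (x, t) ∈ M := by
          rw [← hcM]
          exact ⟨(s, 0), ⟨mem_univ _, rfl⟩, hsr⟩
        exact (hx0 (Circle.eq_zero_of_exp_eq_one (hM x t ht this) (by linarith [hx.1])
          (by linarith [hx.2]))).elim
      · exact Or.inl ⟨(s, r), ⟨mem_univ _, hr⟩, hsr⟩
    rintro _ (⟨⟨x, t⟩, ⟨h, ht⟩, rfl⟩ | ⟨⟨x, t⟩, ⟨h, ht⟩, rfl⟩)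
    · exact hx x ⟨by linarith [h.1], h.2⟩ h.1.ne' t ht
    · exact hx x ⟨h.1, by linarith [h.2]⟩ h.2.ne t ht
  set K := P '' (Icc δ (2 * Real.pi - δ) ×ˢ Icc 0 2)
  have hK : IsClosed K := ((isCompact_Icc.prod isCompact_Icc).image_of_continuousOn
    (hP.mono (prod_mono_left (subset_univ _)))).isClosed
  obtain ⟨η, hη, hηK⟩ := exists_tube hc.continuous hK fun s hsK => by
    have hsM : c (s, 0) ∈ M := hcM ▸ mem_image_of_mem c ⟨mem_univ _, rfl⟩
    obtain ⟨⟨x, t⟩, ⟨hx, ht⟩, h⟩ := hsK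
    have := Circle.eq_zero_of_exp_eq_one (hM x t ht (h ▸ hsM)) (by linarith [hx.1])
      (by linarith [hx.2])
    linarith [hx.1]
  have hnear : ∀ r, |r| ≤ η → r ≠ 0 → c (1, r) ∈ W := by
    intro r hr hr0
    have hnM : c (1, r) ∉ M := by
      rw [← hcM]
      rintro ⟨⟨s, r'⟩, ⟨-, hr'⟩, h⟩
      obtain rfl : r' = 0 := hr'
      exact hr0 (congrArg Prod.snd (hc.injective h)).symm
    have hnK := hηK 1 r hr
    obtain ⟨⟨x₀, t⟩, ⟨-, ht⟩, h⟩ := hs.ge (mem_univ (c (1, r)))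
    have hpt : Function.Periodic (fun x => P (x, t)) (2 * Real.pi) := fun x => hper x t
    obtain ⟨x, hx, hxx⟩ := hpt.exists_mem_Ico Real.two_pi_pos x₀ (-δ)
    simp only [h] at hxx
    rw [hxx] at hnM hnK ⊢
    refine hWmem x ⟨hx.1.lt_of_ne ?_, ?_⟩ ?_ t ht
    · rintro rfl
      refine hnK ⟨(-δ + 2 * Real.pi, t), ⟨⟨by linarith, by linarith⟩, ht⟩, hper _ _⟩
    · by_contra! hle
      exact hnK ⟨(x, t), ⟨⟨hle, by linarith [hx.2]⟩, ht⟩, rfl⟩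
    · rintro rfl
      exact hnM (mem_image_of_mem γ ht)
  obtain ⟨y, -, ⟨⟨s, r⟩, ⟨-, hr⟩, hy⟩, ⟨s', r'⟩, ⟨-, hr'⟩, hy'⟩ := hWpre _ _
    (hc.isOpenMap _ (isOpen_univ.prod isOpen_Ioi)) (hc.isOpenMap _ (isOpen_univ.prod isOpen_Iio))
    hWc ⟨_, hnear η (abs_of_pos hη).le hη.ne', (1, η), ⟨mem_univ _, hη⟩, rfl⟩
    ⟨_, hnear (-η) (by rw [abs_neg, abs_of_pos hη]) (by linarith), (1, -η),
      ⟨mem_univ _, mem_Iio.2 (by linarith)⟩, rfl⟩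
  have : r = r' := congrArg Prod.snd (hc.injective (hy.trans hy'.symm))
  exact lt_asymm (show 0 < r from hr) (this ▸ show r' < 0 from hr')

end

/-- Let `S` be a boundaryless surface in which every circle is two-sided. If `S` admits a
circle decomposition, then `S` is homeomorphic to the torus or to the open annulus. -/
theorem torus_or_open_annulus
    {S : Type*} [TopologicalSpace S] [T2Space S] [SecondCountableTopology S]
    [ConnectedSpace S] [Nonempty S] [ChartedSpace (EuclideanSpace ℝ (Fin 2)) S]
    (hts : ∀ C : Set S, IsCircle C → IsTwoSided C)
    (h : ∃ 𝒞 : Set (Set S), IsCircleDecomposition 𝒞) :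
    Nonempty (S ≃ₜ Circle × Circle) ∨ Nonempty (S ≃ₜ Circle × ℝ) := by
  have : LocallyPlanar S := locallyPlanar_of_chartedSpace
  have hT := planeTwoSided_of_forall_isTwoSided hts
  obtain ⟨𝒞, h𝒞⟩ := h
  obtain ⟨C, hC, -⟩ := h𝒞.exists_mem (Classical.arbitrary S)
  obtain ⟨D, D', B, B', hD, hD', hB, hB', -, hn, -⟩ := h𝒞.exists_annuli_nhds hT hC
    (hts C (h𝒞.1 C hC)) isClosed_empty (disjoint_empty C)
  by_cases hw : ∀ X E, IsExtension 𝒞 C B X E → Disjoint (X \ (C ∪ E)) (B' \ (C ∪ D'))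
  · exact Or.inr (nonempty_homeomorph_open_annulus hT h𝒞 hts hC hD hD' hB hB' hn hw)
  · push Not at hw
    obtain ⟨X, E, hX, hXw⟩ := hw
    obtain ⟨g, hg, hgi, hg2, hgs, hge⟩ := exists_wrapped_param hT h𝒞 hC hD' hB' hn hX hXw
    obtain ⟨ε, rfl | rfl, P, hP, hper, h2, hi, hs⟩ := exists_periodic_param hg hgi hg2 hgs hge
    · exact Or.inl (nonempty_homeomorph_torus hP hper (by simpa using h2) hi hs)
    · exact (false_of_reversed_ends hts hP hper (by simpa using h2) hi hs).elim
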